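/- Let K be a field of characteristic 0 and let R = K[x_1, …, x_N] be a symmetric nilpotent semi-quadratic Poisson algebra satisfying the Poisson analog of condition (B). Then R has a canonical structure of cluster algebra for which no frozen variables are inverted and for which the Poisson bracket {·,·} is compatible in the sense of Gekhtman–Shapiro–Vainshtein. Its initial cluster consists, up to scalar multiples, of those Poisson prime elements of the chain of Poisson subalgebras K[x_1] ⊂ K[x_1, x_2] ⊂ ⋯ ⊂ K[x_1, …, x_N] that are H-eigenvectors; each generator x_k, 1 ≤ k ≤ N, is a cluster variable of this cluster algebra; and this cluster algebra coincides with the corresponding upper cluster algebra. -/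

import Mathlib

open scoped BigOperators

noncomputable section

universe u v

/-- The group of `K`-points of a split torus of rank `r`. -/
abbrev Torus (K : Type u) [Field K] (r : ℕ) : Type u := Fin r → Kˣ

section Core

variable (K : Type u) [Field K] {R : Type v} [Ring R] [Algebra K R] {r N : ℕ}

/-- `a` is an eigenvector of the torus action `act` with (integral) character `f`. -/
def IsEigenWith (act : Torus K r →* (R ≃ₐ[K] R)) (f : Fin r → ℤ) (a : R) : Prop :=
  ∀ ξ : Torus K r, act ξ a = ((∏ i, ξ i ^ f i : Kˣ) : K) • a

/-- The torus action `act` is rational: every element is a finite sum of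
eigenvectors whose eigenvalues are given by integral characters of the torus. -/
def IsRationalAction (act : Torus K r →* (R ≃ₐ[K] R)) : Prop :=
  ∀ a : R, ∃ (s : Finset (Fin r → ℤ)) (c : (Fin r → ℤ) → R),
    a = ∑ f ∈ s, c f ∧ ∀ f ∈ s, IsEigenWith K act f (c f)

/-- The ordered monomial `x 0 ^ m 0 * x 1 ^ m 1 * ⋯ * x (N-1) ^ m (N-1)`. -/
def ordMonomial (x : Fin N → R) (m : Fin N → ℕ) : R :=
  ((List.finRange N).map fun k => x k ^ m k).prod

/-- The ordered monomial in the reversed order of the generators. -/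
def revOrdMonomial (x : Fin N → R) (m : Fin N → ℕ) : R :=
  ((List.finRange N).reverse.map fun k => x k ^ m k).prod

/-- The subalgebra generated by the first `m` of the elements `x 0, …, x (N-1)`. -/
def Rsub (x : Fin N → R) (m : ℕ) : Subalgebra K R :=
  Algebra.adjoin K (x '' {l : Fin N | (l : ℕ) < m})

/-- The subalgebra generated by the elements `x l` with `m < l` (for the reversed order). -/
def RsubRev (x : Fin N → R) (m : ℕ) : Subalgebra K R :=
  Algebra.adjoin K (x '' {l : Fin N | m < (l : ℕ)})

/-- The skew derivation `δ_k : a ↦ x_k a − (h_k · a) x_k` attached to the `k`-th generator. -/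
def skewDelta (act : Torus K r →* (R ≃ₐ[K] R)) (x : Fin N → R) (h : Fin N → Torus K r)
    (k : Fin N) : R → R :=
  fun a => x k * a - act (h k) a * x k

end Core

/-- A quantum nilpotent algebra (CGL extension) of dimension `N`:  an iterated skew
polynomial extension `R = K[x_1][x_2; σ_2, δ_2]⋯[x_N; σ_N, δ_N]` equipped with a rational
action of a torus `H = (Kˣ)^r` by `K`-algebra automorphisms such that the `x_k` are
`H`-eigenvectors, each `δ_k` is a locally nilpotent `σ_k`-derivation of the subalgebra
generated by `x_1, …, x_{k-1}`, and each `σ_k` is given by the action of a torus element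
`h_k` whose eigenvalue `λ_k` on `x_k` is not a root of unity.  The iterated skew polynomial
presentation is encoded by the generation, linear independence of ordered monomials
(PBW basis) and the skew commutation conditions. -/
structure QNA (K : Type u) [Field K] (R : Type v) [Ring R] [Algebra K R] (N r : ℕ) where
  x : Fin N → R
  act : Torus K r →* (R ≃ₐ[K] R)
  h : Fin N → Torus K r
  lam : Fin N → K
  rational : IsRationalAction K act
  gen : Algebra.adjoin K (Set.range x) = ⊤
  pbw : LinearIndependent K (ordMonomial (R := R) x)
  eigenvec : ∀ k : Fin N, ∃ f : Fin r → ℤ, IsEigenWith K act f (x k)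
  stable : ∀ k : Fin N, ∀ a ∈ Rsub K x (k : ℕ), skewDelta K act x h k a ∈ Rsub K x (k : ℕ)
  locnil : ∀ k : Fin N, ∀ a ∈ Rsub K x (k : ℕ), ∃ n : ℕ, (skewDelta K act x h k)^[n] a = 0
  hx : ∀ k, act (h k) (x k) = lam k • x k
  lam_not_root : ∀ k, ∀ n : ℕ, n ≠ 0 → lam k ^ n ≠ 1

/-- A symmetric quantum nilpotent algebra: a quantum nilpotent algebra which admits an
iterated skew polynomial presentation, satisfying the same axioms, also for the reversed
order `x_N, x_{N-1}, …, x_1` of the generators, with respect to torus elements `h*_k`. -/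
structure SymQNA (K : Type u) [Field K] (R : Type v) [Ring R] [Algebra K R] (N r : ℕ)
    extends QNA K R N r where
  hstar : Fin N → Torus K r
  lamstar : Fin N → K
  pbwRev : LinearIndependent K (revOrdMonomial (R := R) x)
  stableRev : ∀ k : Fin N, ∀ a ∈ RsubRev K x (k : ℕ),
    skewDelta K act x hstar k a ∈ RsubRev K x (k : ℕ)
  locnilRev : ∀ k : Fin N, ∀ a ∈ RsubRev K x (k : ℕ),
    ∃ n : ℕ, (skewDelta K act x hstar k)^[n] a = 0
  hxstar : ∀ k, act (hstar k) (x k) = lamstar k • x k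
  lamstar_not_root : ∀ k, ∀ n : ℕ, n ≠ 0 → lamstar k ^ n ≠ 1

section Prime

variable (K : Type u) [Field K] {R : Type v} [Ring R] [Algebra K R] {r N : ℕ}

/-- The skew derivation `δ_k` of the `k`-th step of the presentation vanishes. -/
def deltaZero (Q : QNA K R N r) (k : Fin N) : Prop :=
  ∀ a ∈ Rsub K Q.x (k : ℕ), skewDelta K Q.act Q.x Q.h k a = 0

/-- `p` is a prime element of the subalgebra `A`:  `p` is a nonzero noninvertible normal
element of `A` (`pA = Ap`) such that `A/Ap` is a domain. -/
def IsPrimeIn (A : Subalgebra K R) (p : R) : Prop :=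
  p ∈ A ∧ p ≠ 0 ∧ (¬ ∃ u ∈ A, p * u = 1 ∧ u * p = 1) ∧
  (∀ a ∈ A, ∃ b ∈ A, a * p = p * b) ∧
  (∀ a ∈ A, ∃ b ∈ A, p * a = b * p) ∧
  (∀ a ∈ A, ∀ b ∈ A, (∃ d ∈ A, a * b = p * d) → (∃ d ∈ A, a = p * d) ∨ (∃ d ∈ A, b = p * d))

/-- The predecessor function of the level sets of `η`:  `p(k)` is the largest `l < k`
with `η l = η k`, and `⊥` (i.e. `−∞`) if there is no such `l`. -/
def predIdx {α : Type*} [DecidableEq α] (η : Fin N → α) (k : Fin N) : WithBot (Fin N) :=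
  (Finset.univ.filter fun l => l < k ∧ η l = η k).max

/-- The successor function of the level sets of `η`:  `s(k)` is the smallest `l > k`
with `η l = η k`, and `⊤` (i.e. `+∞`) if there is no such `l`. -/
def succIdx {α : Type*} [DecidableEq α] (η : Fin N → α) (k : Fin N) : WithTop (Fin N) :=
  (Finset.univ.filter fun l => k < l ∧ η l = η k).min

/-- `(η, c, y)` is a sequence of homogeneous prime elements for the quantum nilpotent
algebra `Q` in the sense of the prime element theorem:  `y` is defined by the recursion
`y_k = y_{p(k)} x_k − c_k` (if `δ_k ≠ 0`; `y_k = x_k` if `δ_k = 0`), the `y_k` are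
`H`-eigenvectors, and for every `k` the homogeneous prime elements of the subalgebra
`R_k` generated by `x_1, …, x_k` are precisely the nonzero scalar multiples of the
`y_l` with `l ≤ k` and `s(l) > k`. -/
structure IsPrimeSeq (Q : QNA K R N r) (η : Fin N → ℤ) (c : Fin N → R) (y : Fin N → R) :
    Prop where
  c_mem : ∀ k : Fin N, ¬ deltaZero K Q k → c k ∈ Rsub K Q.x (k : ℕ)
  rec_delta_zero : ∀ k : Fin N, deltaZero K Q k → y k = Q.x k
  rec_delta_ne : ∀ k : Fin N, ¬ deltaZero K Q k →
    y k = (WithBot.recBotCoe (1 : R) (fun l => y l) (predIdx η k)) * Q.x k - c k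
  homog : ∀ k : Fin N, ∃ f : Fin r → ℤ, IsEigenWith K Q.act f (y k)
  prime_iff : ∀ k : Fin N, ∀ u : R,
    (IsPrimeIn K (Rsub K Q.x ((k : ℕ) + 1)) u ∧ ∃ f : Fin r → ℤ, IsEigenWith K Q.act f u) ↔
    (∃ l : Fin N, l ≤ k ∧ (∀ l' : Fin N, l < l' → l' ≤ k → η l' ≠ η l) ∧
      ∃ t : Kˣ, u = (t : K) • y l)

/-- The vector `ē_k = e_k + e_{p(k)} + e_{p²(k)} + ⋯ ∈ ℤ^N`. -/
def ebar (η : Fin N → ℤ) (k : Fin N) : Fin N → ℤ :=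
  fun l => if l ≤ k ∧ η l = η k then 1 else 0

/-- The multiplicatively skewsymmetric matrix of eigenvalues:  `1` on the diagonal,
`λ_{kl}` below it and `λ_{lk}⁻¹` above it. -/
def omegaEntry (lam2 : Fin N → Fin N → Kˣ) (k l : Fin N) : Kˣ :=
  if k = l then 1 else if l < k then lam2 k l else (lam2 l k)⁻¹

/-- The unique group bicharacter `Ω : ℤ^N × ℤ^N → Kˣ` with `Ω(e_k, e_l)` equal to `1`,
`λ_{kl}`, `λ_{lk}⁻¹` according as `k = l`, `k > l`, `k < l`. -/
def Omega (lam2 : Fin N → Fin N → Kˣ) (f g : Fin N → ℤ) : Kˣ :=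
  ∏ k, ∏ l, (omegaEntry K lam2 k l) ^ (f k * g l)

/-- The set of exchangeable indices: those `k` with `s(k) ≠ +∞`. -/
def exSet (η : Fin N → ℤ) : Finset (Fin N) :=
  Finset.univ.filter fun k => ∃ l, k < l ∧ η l = η k

/-- Condition (A): `K` contains square roots of the scalars `λ_{kl}` such that the
subgroup of `Kˣ` generated by all of them contains no elements of order 2. -/
def CondA (lam2 : Fin N → Fin N → Kˣ) : Prop :=
  ∃ sq : Fin N → Fin N → Kˣ, (∀ k l : Fin N, l < k → sq k l ^ 2 = lam2 k l) ∧
    ∀ g ∈ Subgroup.closure {u : Kˣ | ∃ k l : Fin N, l < k ∧ u = sq k l}, g ^ 2 = 1 → g = 1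

/-- Condition (B): there exist positive integers `d_n`, `n ∈ range η`, such that
`(λ*_k)^{d_{η(l)}} = (λ*_l)^{d_{η(k)}}` for all exchangeable `k, l`. -/
def CondB (η : Fin N → ℤ) (lamstar : Fin N → K) : Prop :=
  ∃ d : ℤ → ℕ, (∀ n ∈ Set.range η, 0 < d n) ∧
    ∀ k ∈ exSet η, ∀ l ∈ exSet η, lamstar k ^ d (η l) = lamstar l ^ d (η k)

/-- The defining conditions for the exchange matrix `B̃ ∈ M_{N×ex}(ℤ)`:  columns indexed
outside `ex` vanish; `Ω(Σ_l b_{lk} ē_l, ē_n)` equals `λ*_n` for `k = n` and `1` otherwise;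
and the products `y_1^{b_{1k}} ⋯ y_N^{b_{Nk}}` are fixed under `H`, i.e. the characters
`χ_{y_l}` of the `y_l` satisfy `Σ_l b_{lk} χ_{y_l} = 0`. -/
def IsExchangeMatrix (lam2 : Fin N → Fin N → Kˣ) (η : Fin N → ℤ) (lamstar : Fin N → K)
    (chiy : Fin N → Fin r → ℤ) (B : Fin N → Fin N → ℤ) : Prop :=
  (∀ k : Fin N, k ∉ exSet η → ∀ l, B l k = 0) ∧
  (∀ k ∈ exSet η, ∀ n : Fin N,
    ((Omega K lam2 (fun j => ∑ l, B l k * ebar η l j) (ebar η n) : Kˣ) : K) =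
      (if k = n then lamstar n else 1)) ∧
  (∀ k ∈ exSet η, ∀ i : Fin r, (∑ l, B l k * chiy l i) = 0)

/-- `ι : R →ₐ[K] D` realizes the division ring `D` as the division ring of fractions
`Fract R`:  `ι` is injective and every element of `D` is a right fraction `ι(a) ι(b)⁻¹`. -/
def IsFractionEmb {D : Type v} [DivisionRing D] [Algebra K D] (ι : R →ₐ[K] D) : Prop :=
  Function.Injective ι ∧ ∀ d : D, ∃ a b : R, b ≠ 0 ∧ d * ι b = ι a

end Prime
section CCA

variable (K : Type u) [Field K] (F : Type v) [Field F] [Algebra K F] {N : ℕ}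

/-- A (commutative) seed inside a field `F` over `K`:  a cluster `z_1, …, z_N` together
with an exchange matrix `B` (meaningful columns indexed by the exchangeable indices). -/
structure CSeed (F : Type v) [Field F] (N : ℕ) where
  z : Fin N → F
  B : Fin N → Fin N → ℤ

/-- The Laurent monomial `z^f = z_1^{f_1} ⋯ z_N^{f_N}` of a seed. -/
def cLaurent (S : CSeed F N) (f : Fin N → ℤ) : F :=
  ∏ k, S.z k ^ f k

/-- Validity of a seed with exchangeable indices `ex`: the Laurent monomials in the
cluster are linearly independent over `K`, the columns of `B` outside `ex` vanish, and
the principal part of `B` is skew-symmetrizable. -/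
structure CSeedIsValid (ex : Finset (Fin N)) (S : CSeed F N) : Prop where
  indep : LinearIndependent K (cLaurent F S)
  colzero : ∀ k : Fin N, k ∉ ex → ∀ l, S.B l k = 0
  skewsym : ∃ dd : Fin N → ℕ, (∀ k, 0 < dd k) ∧
    ∀ k ∈ ex, ∀ l ∈ ex, (dd k : ℤ) * S.B k l = - ((dd l : ℤ) * S.B l k)

/-- Matrix mutation in direction `k` (Fomin–Zelevinsky). -/
def cMutB (B : Fin N → Fin N → ℤ) (k : Fin N) : Fin N → Fin N → ℤ :=
  fun i j =>
    if i = k ∨ j = k then - B i j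
    else B i j + max (B i k) 0 * max (B k j) 0 - max (- B i k) 0 * max (- B k j) 0

/-- `S'` is the mutation of the seed `S` in direction `k ∈ ex`:  the cluster variables
other than the `k`-th are unchanged and the new one satisfies the exchange relation
`z'_k z_k = ∏ z_l^{[b_{lk}]_+} + ∏ z_l^{[−b_{lk}]_+}`. -/
def CSeedMutRel (ex : Finset (Fin N)) (S S' : CSeed F N) (k : Fin N) : Prop :=
  k ∈ ex ∧ S'.B = cMutB S.B k ∧
  (∀ l : Fin N, l ≠ k → S'.z l = S.z l) ∧
  S'.z k * S.z k =
    (∏ l, S.z l ^ (max (S.B l k) 0).toNat) + ∏ l, S.z l ^ (max (- S.B l k) 0).toNat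

/-- Mutation equivalence of seeds. -/
def CMutEquiv (ex : Finset (Fin N)) : CSeed F N → CSeed F N → Prop :=
  Relation.ReflTransGen (fun S S' => CSeedIsValid K F ex S ∧ CSeedIsValid K F ex S' ∧
    ∃ k : Fin N, CSeedMutRel F ex S S' k ∨ CSeedMutRel F ex S' S k)

/-- The set of all cluster variables (including the frozen ones) of all seeds
mutation-equivalent to `S0`. -/
def cClusterVars (ex : Finset (Fin N)) (S0 : CSeed F N) : Set F :=
  {v | ∃ S' : CSeed F N, CMutEquiv K F ex S0 S' ∧ ∃ l : Fin N, v = S'.z l}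

/-- The cluster algebra of the seed `S0`, with no frozen variables inverted. -/
def cClusterAlg (ex : Finset (Fin N)) (S0 : CSeed F N) : Subalgebra K F :=
  Algebra.adjoin K (cClusterVars K F ex S0)

/-- The cluster algebra of the seed `S0`, with all frozen variables inverted. -/
def cClusterAlgInv (ex : Finset (Fin N)) (S0 : CSeed F N) : Subalgebra K F :=
  Algebra.adjoin K (cClusterVars K F ex S0 ∪
    {v | ∃ l : Fin N, l ∉ ex ∧ v = (S0.z l)⁻¹})

/-- The mixed Laurent polynomial algebra of a seed:  Laurent in the exchangeable
variables, polynomial in the frozen ones. -/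
def cMixed (ex : Finset (Fin N)) (S' : CSeed F N) : Subalgebra K F :=
  Algebra.adjoin K {v | ∃ f : Fin N → ℤ, (∀ l : Fin N, l ∉ ex → 0 ≤ f l) ∧
    v = cLaurent F S' f}

/-- The Laurent polynomial algebra of a seed (all variables inverted). -/
def cTorusOf (S' : CSeed F N) : Subalgebra K F :=
  Algebra.adjoin K (Set.range (cLaurent F S'))

/-- The upper cluster algebra of `S0` (frozen variables not inverted). -/
def cUpper (ex : Finset (Fin N)) (S0 : CSeed F N) : Subalgebra K F :=
  ⨅ S' ∈ {S' : CSeed F N | CMutEquiv K F ex S0 S'}, cMixed K F ex S'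

/-- The upper cluster algebra of `S0` with all frozen variables inverted. -/
def cUpperInv (ex : Finset (Fin N)) (S0 : CSeed F N) : Subalgebra K F :=
  ⨅ S' ∈ {S' : CSeed F N | CMutEquiv K F ex S0 S'}, cTorusOf K F S'

end CCA
section Poisson

variable (K : Type u) [Field K] {N r : ℕ}

/-- The chain of Poisson subalgebras `K[x_1] ⊂ K[x_1,x_2] ⊂ ⋯` of the polynomial
algebra `K[x_1, …, x_N]`. -/
def PRsub (N : ℕ) (m : ℕ) : Subalgebra K (MvPolynomial (Fin N) K) :=
  Rsub K (fun k : Fin N => MvPolynomial.X k) m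

/-- `p` is a Poisson prime element of the Poisson subalgebra `A` (with respect to the
Poisson bracket `br`):  `p ∈ A` is a nonzero noninvertible prime element of `A` and
`{A, p} ⊆ Ap`. -/
def IsPoissonPrimeIn {R : Type v} [CommRing R] [Algebra K R]
    (br : R →ₗ[K] R →ₗ[K] R) (A : Subalgebra K R) (p : R) : Prop :=
  p ∈ A ∧ p ≠ 0 ∧ (¬ ∃ u ∈ A, p * u = 1) ∧
  (∀ a ∈ A, ∀ b ∈ A, (∃ e ∈ A, a * b = p * e) →
    (∃ e ∈ A, a = p * e) ∨ (∃ e ∈ A, b = p * e)) ∧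
  (∀ a ∈ A, ∃ e ∈ A, br a p = e * p)

/-- A symmetric nilpotent semi-quadratic Poisson algebra:  the polynomial algebra
`K[x_1, …, x_N]` with a Poisson bracket and a rational action of the torus `H = (Kˣ)^r`
by Poisson automorphisms such that the `x_k` are `H`-eigenvectors (with characters
`χ_k`), and there are elements `h_k` (and, for the reversed order of the variables,
`h*_k`) of the Lie algebra of `H` — with the associated derivations `∂_{h_k}` acting on
an eigenvector of character `f` by `Σ_i (h_k)_i f_i` — such that
`{x_k, −} = ∂_{h_k}(−) x_k + δ_k` on `K[x_1, …, x_{k-1}]` with `δ_k` locally nilpotent,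
the `h_k`-eigenvalue of `x_k` is nonzero, and symmetrically in the reversed order. -/
structure SymPoissonNilpotent (N r : ℕ) where
  br : MvPolynomial (Fin N) K →ₗ[K] MvPolynomial (Fin N) K →ₗ[K] MvPolynomial (Fin N) K
  skew : ∀ a b, br a b = - br b a
  jacobi : ∀ a b c, br a (br b c) = br (br a b) c + br b (br a c)
  leibniz : ∀ a b c, br a (b * c) = br a b * c + b * br a c
  act : Torus K r →* (MvPolynomial (Fin N) K ≃ₐ[K] MvPolynomial (Fin N) K)
  actPoisson : ∀ ξ a b, act ξ (br a b) = br (act ξ a) (act ξ b)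
  rational : IsRationalAction K act
  chi : Fin N → Fin r → ℤ
  hchi : ∀ k : Fin N, IsEigenWith K act (chi k) (MvPolynomial.X k)
  hk : Fin N → Fin r → K
  Dk : Fin N → (MvPolynomial (Fin N) K →ₗ[K] MvPolynomial (Fin N) K)
  hDk : ∀ (k : Fin N) (a : MvPolynomial (Fin N) K) (f : Fin r → ℤ),
    IsEigenWith K act f a → Dk k a = (∑ i, hk k i * (f i : K)) • a
  stable : ∀ k : Fin N, ∀ b ∈ PRsub K N (k : ℕ),
    br (MvPolynomial.X k) b - Dk k b * MvPolynomial.X k ∈ PRsub K N (k : ℕ)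
  locnil : ∀ k : Fin N, ∀ b ∈ PRsub K N (k : ℕ),
    ∃ n : ℕ, (fun a => br (MvPolynomial.X k) a - Dk k a * MvPolynomial.X k)^[n] b = 0
  eig_ne : ∀ k : Fin N, (∑ i, hk k i * (chi k i : K)) ≠ 0
  -- the reversed (symmetric) presentation:
  hkRev : Fin N → Fin r → K
  DkRev : Fin N → (MvPolynomial (Fin N) K →ₗ[K] MvPolynomial (Fin N) K)
  hDkRev : ∀ (k : Fin N) (a : MvPolynomial (Fin N) K) (f : Fin r → ℤ),
    IsEigenWith K act f a → DkRev k a = (∑ i, hkRev k i * (f i : K)) • a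
  stableRev : ∀ k : Fin N, ∀ b ∈ RsubRev K (fun k : Fin N => MvPolynomial.X k) (k : ℕ),
    br (MvPolynomial.X k) b - DkRev k b * MvPolynomial.X k ∈
      RsubRev K (fun k : Fin N => MvPolynomial.X k) (k : ℕ)
  locnilRev : ∀ k : Fin N, ∀ b ∈ RsubRev K (fun k : Fin N => MvPolynomial.X k) (k : ℕ),
    ∃ n : ℕ, (fun a => br (MvPolynomial.X k) a - DkRev k a * MvPolynomial.X k)^[n] b = 0
  eig_ne_rev : ∀ k : Fin N, (∑ i, hkRev k i * (chi k i : K)) ≠ 0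

/-- The `h*_k`-eigenvalue `λ*_k` of `x_k` for the reversed presentation. -/
def SymPoissonNilpotent.lamstar (P : SymPoissonNilpotent K N r) (k : Fin N) : K :=
  ∑ i, P.hkRev k i * (P.chi k i : K)

/-- `(η, y)` is a sequence of homogeneous Poisson prime elements of the chain of Poisson
subalgebras `K[x_1] ⊂ K[x_1,x_2] ⊂ ⋯`:  each `y_k` is an `H`-eigenvector and a Poisson
prime element of `K[x_1, …, x_k]`, and conversely for each `k` the `H`-eigenvector
Poisson prime elements of `K[x_1, …, x_k]` are exactly the nonzero scalar multiples of
the `y_l` with `l ≤ k` and `s(l) > k`. -/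
structure IsPoissonPrimeSeq (P : SymPoissonNilpotent K N r) (η : Fin N → ℤ)
    (y : Fin N → MvPolynomial (Fin N) K) : Prop where
  homog : ∀ k : Fin N, ∃ f : Fin r → ℤ, IsEigenWith K P.act f (y k)
  prime : ∀ k : Fin N, IsPoissonPrimeIn K P.br (PRsub K N ((k : ℕ) + 1)) (y k)
  prime_iff : ∀ (k : Fin N) (u : MvPolynomial (Fin N) K),
    (IsPoissonPrimeIn K P.br (PRsub K N ((k : ℕ) + 1)) u ∧
      ∃ f : Fin r → ℤ, IsEigenWith K P.act f u) ↔
    (∃ l : Fin N, l ≤ k ∧ (∀ l' : Fin N, l < l' → l' ≤ k → η l' ≠ η l) ∧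
      ∃ t : Kˣ, u = (t : K) • y l)

/-- The Poisson analog of condition (B): there exist positive integers `d_n`,
`n ∈ range η`, with `d_{η(l)} λ*_k = d_{η(k)} λ*_l` for all exchangeable `k, l`. -/
def PoissonCondB (P : SymPoissonNilpotent K N r) (η : Fin N → ℤ) : Prop :=
  ∃ d : ℤ → ℕ, (∀ n ∈ Set.range η, 0 < d n) ∧
    ∀ k ∈ exSet η, ∀ l ∈ exSet η,
      (d (η l) : K) * SymPoissonNilpotent.lamstar K P k = (d (η k) : K) * SymPoissonNilpotent.lamstar K P l

end Poisson

section Mod1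
open MvPolynomial

namespace PN

/-! ### Nilpotency of derivations on domains -/
section LND

variable {K : Type u} [Field K] [CharZero K] {A : Type v} [CommRing A] [IsDomain A] [Algebra K A]

theorem der_iter_mul (D : Derivation K A A) : ∀ (s m n : ℕ) (a b : A), m + n = s →
    D^[m+1] a = 0 → D^[n+1] b = 0 →
    D^[m+n+1] (a * b) = 0 ∧ D^[m+n] (a*b) = ((m+n).choose m : A) * (D^[m] a * D^[n] b) := by
  have h0 : ∀ n, D^[n] (0:A) = 0 := fun n => by
    induction n with
    | zero => rfl
    | succ n ih => rw [Function.iterate_succ_apply, map_zero, ih]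
  have hadd : ∀ n (x y : A), D^[n] (x + y) = D^[n] x + D^[n] y := fun n => by
    induction n with
    | zero => intro x y; rfl
    | succ n ih => intro x y; rw [Function.iterate_succ_apply, map_add, ih]; rfl
  intro s
  induction s with
  | zero =>
    intro m n a b h ha hb
    obtain ⟨rfl, rfl⟩ : m = 0 ∧ n = 0 := by omega
    simp only [zero_add, Function.iterate_one, Function.iterate_zero, id] at *
    simp [ha, hb]
  | succ s ih =>
    intro m n a b h ha hb
    have key : ∀ t, D^[t+1] (a*b) = D^[t] (a * D b) + D^[t] (D a * b) := by
      intro t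
      rw [Function.iterate_succ_apply, D.leibniz, hadd, smul_eq_mul, smul_eq_mul, mul_comm b]
    have A1 : D^[m+n+1] (a*b) = 0 ∧ D^[m+n] (a * b) =
        ((m+n).choose m : A) * (D^[m] a * D^[n] b) := by
      rcases m with _ | m
      · rcases n with _ | n
        · omega
        · have hDa : D a = 0 := by simpa using ha
          obtain ⟨h1, h2⟩ := ih 0 n a (D b) (by omega) ha (by
            rw [← Function.iterate_succ_apply]; exact hb)
          refine ⟨?_, ?_⟩
          · rw [show 0 + (n+1) + 1 = (0 + n + 1) + 1 by ring, key, h1, hDa, zero_mul, h0, add_zero]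
          · rw [show 0 + (n+1) = (0 + n) + 1 by ring, key, h2, hDa, zero_mul, h0, add_zero]
            simp [Function.iterate_succ_apply]
      · rcases n with _ | n
        · have hDb : D b = 0 := by simpa using hb
          obtain ⟨h1, h2⟩ := ih m 0 (D a) b (by omega) (by
            rw [← Function.iterate_succ_apply]; exact ha) hb
          refine ⟨?_, ?_⟩
          · rw [show m + 1 + 0 + 1 = (m + 0 + 1) + 1 by ring, key, h1, hDb, mul_zero, h0, add_zero]
          · rw [Nat.add_zero] at h2
            rw [Nat.add_zero, key, h2, hDb, mul_zero, h0, zero_add]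
            simp [Function.iterate_succ_apply]
        · obtain ⟨h1, h2⟩ := ih (m+1) n a (D b) (by omega) ha (by
            rw [← Function.iterate_succ_apply]; exact hb)
          obtain ⟨h3, h4⟩ := ih m (n+1) (D a) b (by omega) (by
            rw [← Function.iterate_succ_apply]; exact ha) hb
          refine ⟨?_, ?_⟩
          · rw [show m + 1 + (n + 1) + 1 = (m + (n+1) + 1) + 1 by ring, key, h3,
              show m + (n+1) + 1 = m+1+n+1 by ring, h1, add_zero]
          · rw [show m + 1 + (n + 1) = (m + (n+1)) + 1 by ring, key, h4,
              show m + (n+1) = m+1+n by ring, h2, Nat.choose_succ_succ (m+1+n) m]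
            simp only [Function.iterate_succ_apply]
            push_cast
            ring
    exact A1

/-- `D`-nilpotent elements. -/
def Nilp (D : Derivation K A A) (a : A) : Prop := ∃ n, D^[n] a = 0

theorem der_iter_zero (D : Derivation K A A) (n : ℕ) : D^[n] (0:A) = 0 := by
  induction n with
  | zero => rfl
  | succ n ih => rw [Function.iterate_succ_apply, map_zero, ih]

theorem nilp_top (D : Derivation K A A) {a : A} (h : Nilp D a) (ha : a ≠ 0) :
    ∃ m, D^[m] a ≠ 0 ∧ D^[m+1] a = 0 := by
  classical
  have hf := Nat.find_spec h
  set n := Nat.find h with hn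
  have hn0 : n ≠ 0 := by
    intro h0; rw [h0] at hf; exact ha hf
  obtain ⟨m, hm⟩ := Nat.exists_eq_succ_of_ne_zero hn0
  refine ⟨m, ?_, by rw [← Nat.succ_eq_add_one, ← hm]; exact hf⟩
  exact Nat.find_min h (by omega : m < Nat.find h)

theorem charZero_of_alg (K : Type u) [Field K] [CharZero K] (A : Type v) [CommRing A] [IsDomain A]
    [Algebra K A] : CharZero A := charZero_of_injective_algebraMap (algebraMap K A).injective

theorem nilp_mul_top (D : Derivation K A A) {a b : A} {m n : ℕ} (ha : D^[m] a ≠ 0)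
    (ha' : D^[m+1] a = 0) (hb : D^[n] b ≠ 0) (hb' : D^[n+1] b = 0) :
    D^[m+n] (a * b) ≠ 0 ∧ D^[m+n+1] (a*b) = 0 := by
  obtain ⟨h1, h2⟩ := der_iter_mul D _ m n a b rfl ha' hb'
  refine ⟨?_, h1⟩
  rw [h2]
  have : CharZero A := charZero_of_alg K A
  refine mul_ne_zero ?_ (mul_ne_zero ha hb)
  exact_mod_cast (Nat.choose_pos (by omega)).ne'

theorem iter_zero_of_le (D : Derivation K A A) {a : A} {m n : ℕ} (h : D^[m] a = 0) (hmn : m ≤ n) :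
    D^[n] a = 0 := by
  obtain ⟨t, rfl⟩ := Nat.exists_eq_add_of_le hmn
  rw [add_comm, Function.iterate_add_apply, h, der_iter_zero]

/-- (a): if `p ∣ D p` with `p` and the quotient nilpotent then `D p = 0`. -/
theorem der_eq_zero_of_dvd (D : Derivation K A A) {p q : A} (hp : Nilp D p) (hq : Nilp D q)
    (h : D p = p * q) : D p = 0 := by
  by_contra hne
  have hp0 : p ≠ 0 := by rintro rfl; simp at hne
  have hq0 : q ≠ 0 := by rintro rfl; simp [h] at hne
  obtain ⟨m, h1, h2⟩ := nilp_top D hp hp0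
  obtain ⟨n, h3, h4⟩ := nilp_top D hq hq0
  have h5 := (nilp_mul_top D h1 h2 h3 h4).1
  rw [← h, ← Function.iterate_succ_apply] at h5
  exact h5 (iter_zero_of_le D h2 (by omega))

/-- (b), (c) -/
theorem der_mul_deg (D : Derivation K A A) {a b : A} (ha : Nilp D a) (hb : Nilp D b) (ha0 : a ≠ 0)
    (hb0 : b ≠ 0) :
    (D (a * b) = 0 → D a = 0 ∧ D b = 0) ∧ (D (D (a*b)) = 0 → D a = 0 ∨ D b = 0) := by
  obtain ⟨m, h1, h2⟩ := nilp_top D ha ha0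
  obtain ⟨n, h3, h4⟩ := nilp_top D hb hb0
  have h5 := (nilp_mul_top D h1 h2 h3 h4).1
  constructor
  · intro h
    have hmn : m + n = 0 := by
      by_contra hc
      exact h5 (iter_zero_of_le D (m := 1) (by simpa using h) (by omega))
    obtain ⟨rfl, rfl⟩ : m = 0 ∧ n = 0 := by omega
    exact ⟨by simpa using h2, by simpa using h4⟩
  · intro h
    have hmn : m + n < 2 := by
      by_contra hc
      exact h5 (iter_zero_of_le D (m := 2) (by simpa using h) (by omega))
    rcases Nat.eq_zero_or_pos m with rfl | hm
    · exact Or.inl (by simpa using h2)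
    · obtain rfl : n = 0 := by omega
      exact Or.inr (by simpa using h4)

end LND

end PN

end Mod1

section Mod2
open MvPolynomial


namespace PN

/-! ### Supported subalgebras -/
section Supp

variable {K : Type u} [Field K] {N : ℕ}

theorem sup_der {S : Set (Fin N)} (D : Derivation K (MvPolynomial (Fin N) K) (MvPolynomial (Fin N) K))
    (h : ∀ m ∈ S, D (X m) ∈ supported K S) {a : MvPolynomial (Fin N) K} (ha : a ∈ supported K S) :
    D a ∈ supported K S := by
  rw [supported_eq_adjoin_X] at ha
  induction ha using Algebra.adjoin_induction with
  | mem x hx => obtain ⟨m, hm, rfl⟩ := hx; exact h m hm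
  | algebraMap c => simp
  | add x y _ _ h1 h2 => rw [map_add]; exact add_mem h1 h2
  | mul x y hx hy h1 h2 =>
    rw [← supported_eq_adjoin_X] at hx hy
    rw [D.leibniz, smul_eq_mul, smul_eq_mul]; exact add_mem (mul_mem hx h2) (mul_mem hy h1)

theorem sup_iff {S : Set (Fin N)} {a : MvPolynomial (Fin N) K} :
    a ∈ supported K S ↔ ∀ m ∉ S, a.degreeOf m = 0 := by
  rw [mem_supported]
  constructor
  · intro h m hm
    by_contra hc
    exact hm (h (mem_vars_iff_degreeOf_ne_zero.2 hc))
  · intro h m hm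
    by_contra hc
    exact (mem_vars_iff_degreeOf_ne_zero.1 hm) (h m hc)

theorem sup_factor {S : Set (Fin N)} {a b : MvPolynomial (Fin N) K} (h : a * b ∈ supported K S)
    (h0 : a * b ≠ 0) : a ∈ supported K S := by
  rw [sup_iff] at h ⊢
  intro m hm
  have := h m hm
  rw [degreeOf_mul_eq (left_ne_zero_of_mul h0) (right_ne_zero_of_mul h0)] at this
  omega

theorem sup_of_dvd {S : Set (Fin N)} {a b : MvPolynomial (Fin N) K} (h : b ∈ supported K S)
    (h0 : b ≠ 0) (hd : a ∣ b) : a ∈ supported K S := by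
  obtain ⟨c, rfl⟩ := hd
  exact sup_factor h h0

theorem sup_of_assoc {S : Set (Fin N)} {a b : MvPolynomial (Fin N) K} (h : b ∈ supported K S)
    (h0 : b ≠ 0) (hd : Associated a b) : a ∈ supported K S := sup_of_dvd h h0 hd.dvd

theorem sup_quot {S : Set (Fin N)} {a b : MvPolynomial (Fin N) K} (h : a * b ∈ supported K S)
    (ha : a ∈ supported K S) (ha0 : a ≠ 0) : b ∈ supported K S := by
  by_cases hb : b = 0
  · rw [hb]; exact zero_mem _
  · rw [mul_comm] at h
    exact sup_factor h (mul_ne_zero hb ha0)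

theorem sup_inter {S T : Set (Fin N)} {a : MvPolynomial (Fin N) K} (h : a ∈ supported K S)
    (h' : a ∈ supported K T) : a ∈ supported K (S ∩ T) := by
  rw [mem_supported] at *; exact Set.subset_inter h h'

theorem isUnit_iff_C {a : MvPolynomial (Fin N) K} : IsUnit a ↔ ∃ c : K, c ≠ 0 ∧ a = C c := by
  rw [MvPolynomial.isUnit_iff_eq_C_of_isReduced]
  constructor
  · rintro ⟨c, h, rfl⟩; exact ⟨c, h.ne_zero, rfl⟩
  · rintro ⟨c, h, rfl⟩; exact ⟨c, h.isUnit, rfl⟩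

theorem assoc_iff {a b : MvPolynomial (Fin N) K} : Associated a b ↔ ∃ c : K, c ≠ 0 ∧ b = C c * a := by
  constructor
  · rintro ⟨u, rfl⟩
    obtain ⟨c, hc, h⟩ := isUnit_iff_C.1 u.isUnit
    exact ⟨c, hc, by rw [h, mul_comm]⟩
  · rintro ⟨c, hc, rfl⟩
    have : IsUnit (C c : MvPolynomial (Fin N) K) := isUnit_iff_C.2 ⟨c, hc, rfl⟩
    exact associated_unit_mul_right _ _ this

/-! expansion in one variable -/

/-- `Phi k a` is `a` seen as a polynomial in `x_k`. -/
def Phi (k : Fin N) : MvPolynomial (Fin N) K →ₐ[K] Polynomial (MvPolynomial (Fin N) K) :=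
  aeval (fun m => if m = k then Polynomial.X else Polynomial.C (X m))

theorem Phi_X_self (k : Fin N) : Phi (K := K) k (X k) = Polynomial.X := by simp [Phi]

theorem Phi_supp {S : Set (Fin N)} {k : Fin N} (hk : k ∉ S) {a : MvPolynomial (Fin N) K}
    (ha : a ∈ supported K S) : Phi k a = Polynomial.C a := by
  rw [supported_eq_adjoin_X] at ha
  induction ha using Algebra.adjoin_induction with
  | mem x hx =>
    obtain ⟨m, hm, rfl⟩ := hx
    have : m ≠ k := by rintro rfl; exact hk hm
    simp [Phi, this]
  | algebraMap c => rw [AlgHom.commutes]; rfl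
  | add x y _ _ h1 h2 => rw [map_add, h1, h2, map_add]
  | mul x y hx hy h1 h2 => rw [map_mul, h1, h2, map_mul]

theorem Phi_eval (k : Fin N) (a : MvPolynomial (Fin N) K) : (Phi k a).eval (X k) = a := by
  induction a using MvPolynomial.induction_on with
  | C c =>
    have : Phi k (C c) = Polynomial.C (C c : MvPolynomial (Fin N) K) :=
      Phi_supp (S := ∅) (by simp) (by
        rw [← MvPolynomial.algebraMap_eq]; exact Subalgebra.algebraMap_mem _ c)
    rw [this, Polynomial.eval_C]
  | add p q h1 h2 => rw [map_add, Polynomial.eval_add, h1, h2]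
  | mul_X p i h =>
    rw [map_mul, Polynomial.eval_mul, h]
    congr 1
    by_cases hi : i = k
    · subst hi; rw [Phi_X_self, Polynomial.eval_X]
    · simp [Phi, hi]

theorem Phi_inj (k : Fin N) : Function.Injective (Phi (K := K) k) := by
  intro a b h
  rw [← Phi_eval k a, h, Phi_eval]

theorem Phi_coeff {S : Set (Fin N)} (k : Fin N) {a : MvPolynomial (Fin N) K}
    (ha : a ∈ supported K S) (i : ℕ) : (Phi k a).coeff i ∈ supported K (S \ {k}) := by
  rw [supported_eq_adjoin_X] at ha
  induction ha using Algebra.adjoin_induction generalizing i with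
  | mem x hx =>
    obtain ⟨m, hm, rfl⟩ := hx
    by_cases h : m = k
    · subst h
      rw [Phi_X_self, Polynomial.coeff_X]
      split_ifs
      · exact one_mem _
      · exact zero_mem _
    · simp only [Phi, aeval_X, h, if_false, Polynomial.coeff_C]
      split_ifs
      · exact X_mem_supported.2 ⟨hm, h⟩
      · exact zero_mem _
  | algebraMap c =>
    rw [AlgHom.commutes, Polynomial.algebraMap_apply, Polynomial.coeff_C]
    split_ifs
    · exact Subalgebra.algebraMap_mem _ c
    · exact zero_mem _
  | add x y _ _ h1 h2 => rw [map_add, Polynomial.coeff_add]; exact add_mem (h1 i) (h2 i)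
  | mul x y hx hy h1 h2 =>
    rw [map_mul, Polynomial.coeff_mul]
    exact Subalgebra.sum_mem _ fun z _ => mul_mem (h1 _) (h2 _)

theorem Phi_coeff' {S : Set (Fin N)} {k : Fin N} {a : MvPolynomial (Fin N) K}
    (ha : a ∈ supported K (insert k S)) (i : ℕ) : (Phi k a).coeff i ∈ supported K S := by
  refine supported_mono ?_ (Phi_coeff k ha i)
  rintro m ⟨hm, hmk⟩
  rcases hm with rfl | hm
  · exact absurd rfl hmk
  · exact hm

theorem sup_of_Phi {S : Set (Fin N)} {k : Fin N} {a : MvPolynomial (Fin N) K}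
    (ha : a ∈ supported K (insert k S)) (h : (Phi k a).natDegree = 0) : a ∈ supported K S := by
  have h1 := Phi_eval k a
  rw [Polynomial.eq_C_of_natDegree_eq_zero h, Polynomial.eval_C] at h1
  rw [← h1]; exact Phi_coeff' ha 0

theorem Phi_lin {S : Set (Fin N)} {k : Fin N} (hk : k ∉ S) {p c : MvPolynomial (Fin N) K}
    (hp : p ∈ supported K S) (hc : c ∈ supported K S) :
    Phi k (p * X k - c) = Polynomial.C p * Polynomial.X - Polynomial.C c := by
  rw [map_sub, map_mul, Phi_X_self, Phi_supp hk hp, Phi_supp hk hc]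

theorem lin_coeff {S : Set (Fin N)} {k : Fin N} (hk : k ∉ S) {p c p' c' : MvPolynomial (Fin N) K}
    (hp : p ∈ supported K S) (hc : c ∈ supported K S) (hp' : p' ∈ supported K S)
    (hc' : c' ∈ supported K S) (h : p * X k - c = p' * X k - c') : p = p' ∧ c = c' := by
  have h1 := congrArg (Phi k) h
  rw [Phi_lin hk hp hc, Phi_lin hk hp' hc'] at h1
  have h2 := congrArg (fun q => Polynomial.coeff q 1) h1
  have h3 := congrArg (fun q => Polynomial.coeff q 0) h1
  simp at h2 h3
  exact ⟨h2, h3⟩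

end Supp

/-! ### Weights -/
section Wt

variable {K : Type u} [Field K] {N r : ℕ}

/-- pairing of an element of the Lie algebra with a character -/
def dot (h : Fin r → K) (w : Fin r → ℤ) : K := ∑ u, h u * (w u : K)

theorem dot_add (h : Fin r → K) (w v : Fin r → ℤ) : dot h (w + v) = dot h w + dot h v := by
  simp [dot, mul_add, Finset.sum_add_distrib]

theorem dot_sub (h : Fin r → K) (w v : Fin r → ℤ) : dot h (w - v) = dot h w - dot h v := by
  simp [dot, mul_sub, Finset.sum_sub_distrib]

theorem dot_neg (h : Fin r → K) (w : Fin r → ℤ) : dot h (-w) = - dot h w := by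
  simp [dot]

theorem dot_zero (h : Fin r → K) : dot h (0 : Fin r → ℤ) = 0 := by simp [dot]

theorem dot_smul (h : Fin r → K) (n : ℤ) (w : Fin r → ℤ) : dot h (n • w) = n * dot h w := by
  simp only [dot, Pi.smul_apply, smul_eq_mul, Int.cast_mul, Finset.mul_sum]
  exact Finset.sum_congr rfl fun _ _ => by ring

theorem dot_sum {ι : Type*} (s : Finset ι) (h : Fin r → K) (w : ι → Fin r → ℤ) :
    dot h (∑ i ∈ s, w i) = ∑ i ∈ s, dot h (w i) := by
  classical
  induction s using Finset.induction_on with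
  | empty => simp [dot_zero]
  | insert a s ha ih => rw [Finset.sum_insert ha, Finset.sum_insert ha, dot_add, ih]

theorem dot_inj [CharZero K] {w v : Fin r → ℤ} (h : ∀ g : Fin r → K, dot g w = dot g v) : w = v := by
  funext u
  have := h (Pi.single u 1)
  simp [dot, Pi.single_apply] at this
  exact_mod_cast this

/-- the derivation `∂_h` -/
def sg (chi : Fin N → Fin r → ℤ) (h : Fin r → K) :
    Derivation K (MvPolynomial (Fin N) K) (MvPolynomial (Fin N) K) :=
  mkDerivation K (fun l => dot h (chi l) • X l)

@[simp] theorem sg_X (chi : Fin N → Fin r → ℤ) (h : Fin r → K) (l : Fin N) :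
    sg chi h (X l) = dot h (chi l) • X l := by simp [sg]

/-- homogeneous of weight `w` -/
def Hom (chi : Fin N → Fin r → ℤ) (w : Fin r → ℤ) (a : MvPolynomial (Fin N) K) : Prop :=
  ∀ h : Fin r → K, sg chi h a = dot h w • a

variable {chi : Fin N → Fin r → ℤ}

theorem Hom.mul {w v : Fin r → ℤ} {a b : MvPolynomial (Fin N) K} (ha : Hom chi w a)
    (hb : Hom chi v b) : Hom chi (w + v) (a * b) := by
  intro h
  rw [Derivation.leibniz, ha h, hb h, dot_add, smul_eq_mul, smul_eq_mul, mul_smul_comm,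
    mul_smul_comm, mul_comm b a, ← add_smul, add_comm]

theorem Hom.C (c : K) : Hom chi 0 (C c : MvPolynomial (Fin N) K) := by
  intro h; rw [dot_zero, zero_smul, derivation_C]

theorem Hom.one : Hom chi 0 (1 : MvPolynomial (Fin N) K) := by
  simpa using Hom.C (chi := chi) (1 : K)

theorem Hom.X (l : Fin N) : Hom chi (chi l) (X l : MvPolynomial (Fin N) K) := by
  intro h; simp

theorem Hom.add {w : Fin r → ℤ} {a b : MvPolynomial (Fin N) K} (ha : Hom chi w a)
    (hb : Hom chi w b) : Hom chi w (a + b) := by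
  intro h; rw [map_add, ha h, hb h, smul_add]

theorem Hom.neg {w : Fin r → ℤ} {a : MvPolynomial (Fin N) K} (ha : Hom chi w a) :
    Hom chi w (-a) := by
  intro h; rw [map_neg, ha h, smul_neg]

theorem Hom.sub {w : Fin r → ℤ} {a b : MvPolynomial (Fin N) K} (ha : Hom chi w a)
    (hb : Hom chi w b) : Hom chi w (a - b) := by
  rw [sub_eq_add_neg]; exact ha.add hb.neg

theorem Hom.smul {w : Fin r → ℤ} {a : MvPolynomial (Fin N) K} (c : K) (ha : Hom chi w a) :
    Hom chi w (c • a) := by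
  intro h; rw [Derivation.map_smul, ha h, smul_comm]

theorem Hom.Cmul {w : Fin r → ℤ} {a : MvPolynomial (Fin N) K} (c : K) (ha : Hom chi w a) :
    Hom chi w (MvPolynomial.C c * a) := by
  rw [← smul_eq_C_mul]; exact ha.smul c

theorem Hom.pow {w : Fin r → ℤ} {a : MvPolynomial (Fin N) K} (ha : Hom chi w a) (n : ℕ) :
    Hom chi (n • w) (a ^ n) := by
  induction n with
  | zero => simpa using Hom.one
  | succ n ih => rw [pow_succ, succ_nsmul]; exact ih.mul ha

theorem Hom.unique [CharZero K] {w v : Fin r → ℤ} {a : MvPolynomial (Fin N) K} (h0 : a ≠ 0)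
    (h1 : Hom chi w a) (h2 : Hom chi v a) : w = v := by
  apply dot_inj (K := K)
  intro g
  have := (h1 g).symm.trans (h2 g)
  exact smul_left_injective K h0 this

/-- weight of a monomial -/
def mw (chi : Fin N → Fin r → ℤ) (m : Fin N →₀ ℕ) : Fin r → ℤ := ∑ l, (m l) • chi l

theorem mw_add (m n : Fin N →₀ ℕ) : mw chi (m + n) = mw chi m + mw chi n := by
  simp [mw, add_smul, Finset.sum_add_distrib]

theorem mw_single (i : Fin N) (n : ℕ) : mw chi (Finsupp.single i n) = n • chi i := by
  classical
  rw [mw, Finset.sum_eq_single i]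
  · simp
  · intro b _ hb; simp [Finsupp.single_apply, Ne.symm hb]
  · simp

theorem Hom.monomial (m : Fin N →₀ ℕ) (c : K) : Hom chi (mw chi m) (monomial m c) := by
  induction m using Finsupp.induction_linear generalizing c with
  | zero => simpa [mw] using Hom.C c
  | add m n h1 h2 =>
    rw [mw_add, show MvPolynomial.monomial (m+n) c = MvPolynomial.monomial m c * MvPolynomial.monomial n 1 by
      rw [monomial_mul, mul_one]]
    exact (h1 c).mul (h2 1)
  | single i n =>
    rw [mw_single, ← C_mul_X_pow_eq_monomial]
    exact (Hom.X i).pow n |>.Cmul c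

theorem coeff_sg (h : Fin r → K) (a : MvPolynomial (Fin N) K) (m : Fin N →₀ ℕ) :
    coeff m (sg chi h a) = dot h (mw chi m) * coeff m a := by
  induction a using MvPolynomial.induction_on' with
  | monomial n c =>
    classical
    rw [Hom.monomial n c h, coeff_smul, coeff_monomial, smul_eq_mul]
    split_ifs with e
    · rw [e]
    · simp
  | add p q h1 h2 => rw [map_add, coeff_add, h1, h2, coeff_add, mul_add]

theorem Hom_iff_coeff [CharZero K] {w : Fin r → ℤ} {a : MvPolynomial (Fin N) K} :
    Hom chi w a ↔ ∀ m, coeff m a ≠ 0 → mw chi m = w := by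
  constructor
  · intro h m hm
    apply dot_inj (K := K)
    intro g
    have := congrArg (coeff m) (h g)
    rw [coeff_sg, coeff_smul, smul_eq_mul] at this
    exact mul_right_cancel₀ hm this
  · intro h g
    ext m
    rw [coeff_sg, coeff_smul, smul_eq_mul]
    by_cases hm : coeff m a = 0
    · rw [hm]; simp
    · rw [h m hm]

/-- if all `∂_h a` are scalar multiples of `a`, then `a` is homogeneous of integral weight -/
theorem Hom_of_scalar [CharZero K] {a : MvPolynomial (Fin N) K} (ha : a ≠ 0)
    (h : ∀ g : Fin r → K, ∃ c : K, sg chi g a = c • a) : ∃ w, Hom chi w a := by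
  obtain ⟨m, hm⟩ : ∃ m, coeff m a ≠ 0 := by
    by_contra hc; push Not at hc
    exact ha (by ext m; simpa using hc m)
  refine ⟨mw chi m, fun g => ?_⟩
  obtain ⟨c, hc⟩ := h g
  have := congrArg (coeff m) hc
  rw [coeff_sg, coeff_smul, smul_eq_mul] at this
  rw [hc, mul_right_cancel₀ hm this]

/-- a divisor relation `a ∣ ∂ a` forces a scalar -/
theorem sg_scalar_of_dvd {a : MvPolynomial (Fin N) K} (ha : a ≠ 0) {g : Fin r → K}
    (h : a ∣ sg chi g a) : ∃ c : K, sg chi g a = c • a := by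
  obtain ⟨b, hb⟩ := h
  by_cases hb0 : b = 0
  · exact ⟨0, by rw [hb, hb0]; simp⟩
  have hdeg : ∀ m, b.degreeOf m = 0 := by
    intro m
    have h1 : (sg chi g a).degreeOf m ≤ a.degreeOf m := by
      rw [degreeOf_le_iff]
      intro s hs
      rw [mem_support_iff, coeff_sg] at hs
      exact (degreeOf_le_iff.1 le_rfl) s (mem_support_iff.2 (right_ne_zero_of_mul hs))
    rw [hb, degreeOf_mul_eq ha hb0] at h1
    omega
  have : b ∈ supported K (∅ : Set (Fin N)) := sup_iff.2 fun m _ => hdeg m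
  rw [supported_empty] at this
  obtain ⟨c, rfl⟩ := Algebra.mem_bot.1 this
  exact ⟨c, by rw [hb, mul_comm, Algebra.smul_def]⟩

end Wt

end PN

end Mod2

section Mod3
open MvPolynomial


namespace PN

/-- `ham`iltonian derivation -/
def hamOf {K : Type u} [Field K] {R : Type v} [CommRing R] [Algebra K R] (br : R →ₗ[K] R →ₗ[K] R)
    (leib : ∀ a b c, br a (b * c) = br a b * c + b * br a c) (a : R) : Derivation K R R :=
  Derivation.mk' (br a) (fun b c => by rw [leib, smul_eq_mul, smul_eq_mul]; ring)

/-- working structure -/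
structure PA (K : Type u) [Field K] (N r : ℕ) where
  br : MvPolynomial (Fin N) K →ₗ[K] MvPolynomial (Fin N) K →ₗ[K] MvPolynomial (Fin N) K
  skew : ∀ a b, br a b = - br b a
  jacobi : ∀ a b c, br a (br b c) = br (br a b) c + br b (br a c)
  leibniz : ∀ a b c, br a (b * c) = br a b * c + b * br a c
  chi : Fin N → Fin r → ℤ
  hk : Fin N → Fin r → K
  hr : Fin N → Fin r → K
  sgp : ∀ h a b, sg chi h (br a b) = br (sg chi h a) b + br a (sg chi h b)
  stab : ∀ j k, j < k → br (X k) (X j) - dot (hk k) (chi j) • (X j * X k) ∈ supported K (Set.Ioo j k)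
  cross : ∀ j k, j < k → dot (hk k) (chi j) = - dot (hr j) (chi k)
  nil : ∀ k, ∀ a ∈ supported K (Set.Iio k), ∃ n, (fun a => br (X k) a - X k * sg chi (hk k) a)^[n] a = 0
  nilr : ∀ k, ∀ a ∈ supported K (Set.Ioi k), ∃ n, (fun a => br (X k) a - X k * sg chi (hr k) a)^[n] a = 0
  lam_ne : ∀ k, dot (hk k) (chi k) ≠ 0
  lamr_ne : ∀ k, dot (hr k) (chi k) ≠ 0

section supX
variable {K : Type u} [Field K] {N : ℕ}

theorem X_mem_sup {S : Set (Fin N)} {l : Fin N} (h : l ∈ S) : (X l : MvPolynomial (Fin N) K) ∈ supported K S := by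
  rw [supported_eq_adjoin_X]; exact Algebra.subset_adjoin ⟨l, h, rfl⟩

theorem coeff_sup_zero {S : Set (Fin N)} {a : MvPolynomial (Fin N) K} (ha : a ∈ supported K S)
    {m : Fin N →₀ ℕ} {l : Fin N} (hl : l ∉ S) (hm : m l ≠ 0) : coeff m a = 0 := by
  by_contra hc
  have h1 := sup_iff.1 ha l hl
  have h2 := monomial_le_degreeOf l (mem_support_iff.2 hc)
  omega

end supX

section ofP

variable {K : Type u} [Field K] [CharZero K] {N r : ℕ} (P : SymPoissonNilpotent K N r)

theorem eigen_mul {w v : Fin r → ℤ} {a b : MvPolynomial (Fin N) K} (ha : IsEigenWith K P.act w a)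
    (hb : IsEigenWith K P.act v b) : IsEigenWith K P.act (w + v) (a * b) := by
  intro ξ
  rw [map_mul, ha ξ, hb ξ]
  simp only [Pi.add_apply, zpow_add, Finset.prod_mul_distrib, Units.val_mul]
  rw [smul_mul_smul_comm]

theorem eigen_br {w v : Fin r → ℤ} {a b : MvPolynomial (Fin N) K} (ha : IsEigenWith K P.act w a)
    (hb : IsEigenWith K P.act v b) : IsEigenWith K P.act (w + v) (P.br a b) := by
  intro ξ
  rw [P.actPoisson, ha ξ, hb ξ]
  simp only [Pi.add_apply, zpow_add, Finset.prod_mul_distrib, Units.val_mul]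
  rw [LinearMap.map_smul₂, map_smul, smul_smul]

theorem eigen_monomial (m : Fin N →₀ ℕ) (c : K) :
    IsEigenWith K P.act (mw P.chi m) (monomial m c) := by
  induction m using Finsupp.induction_linear generalizing c with
  | zero =>
    intro ξ
    have : mw P.chi (0 : Fin N →₀ ℕ) = 0 := by simp [mw]
    rw [this]
    have h2 := (P.act ξ).commutes c
    simp only [algebraMap_eq] at h2
    simp [h2]
  | add m n h1 h2 =>
    rw [mw_add, show MvPolynomial.monomial (m+n) c = MvPolynomial.monomial m c * MvPolynomial.monomial n 1 by
      rw [monomial_mul, mul_one]]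
    exact eigen_mul P (h1 c) (h2 1)
  | single i n =>
    rw [mw_single]
    have h1 : ∀ n : ℕ, IsEigenWith K P.act (n • P.chi i) (X i ^ n : MvPolynomial (Fin N) K) := by
      intro n
      induction n with
      | zero => intro ξ; simp
      | succ n ih => rw [pow_succ, succ_nsmul]; exact eigen_mul P ih (P.hchi i)
    have h2 : MvPolynomial.monomial (Finsupp.single i n) c = c • (X i ^ n : MvPolynomial (Fin N) K) := by
      rw [X_pow_eq_monomial, smul_monomial, smul_eq_mul, mul_one]
    intro ξ
    rw [h2, map_smul, h1 n ξ, smul_comm]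

theorem coeff_act (ξ : Torus K r) (a : MvPolynomial (Fin N) K) (m : Fin N →₀ ℕ) :
    coeff m (P.act ξ a) = ((∏ i, ξ i ^ (mw P.chi m) i : Kˣ) : K) * coeff m a := by
  induction a using MvPolynomial.induction_on' with
  | monomial n c =>
    classical
    rw [eigen_monomial P n c ξ, coeff_smul, coeff_monomial, smul_eq_mul]
    split_ifs with h
    · rw [h]
    · simp
  | add p q h1 h2 => rw [map_add, coeff_add, coeff_add, h1, h2, mul_add]

theorem two_zpow_inj {a b : ℤ} (h : (2 : K) ^ a = 2 ^ b) : a = b := by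
  have h1 : (((2 : ℚ) ^ a : ℚ) : K) = ((2 : ℚ) ^ b : ℚ) := by push_cast; exact h
  have h2 : (2 : ℚ) ^ a = 2 ^ b := by exact_mod_cast h1
  exact zpow_right_injective₀ (by norm_num) (by norm_num) h2

theorem eigen_iff {w : Fin r → ℤ} {a : MvPolynomial (Fin N) K} :
    IsEigenWith K P.act w a ↔ Hom P.chi w a := by
  rw [Hom_iff_coeff]
  constructor
  · intro h m hm
    funext u
    have h1 := congrArg (coeff m) (h (Pi.mulSingle u (Units.mk0 2 two_ne_zero)))
    rw [coeff_act, coeff_smul, smul_eq_mul] at h1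
    have h2 := mul_right_cancel₀ hm h1
    have key : ∀ v : Fin r → ℤ, ((∏ i, (Pi.mulSingle u (Units.mk0 (2 : K) two_ne_zero) : Fin r → Kˣ) i ^ v i : Kˣ) : K) = 2 ^ v u := by
      intro v
      rw [Finset.prod_eq_single u]
      · simp
      · intro b _ hb; simp [Pi.mulSingle_eq_of_ne hb]
      · simp
    rw [key, key] at h2
    exact two_zpow_inj h2
  · intro h ξ
    ext m
    rw [coeff_act, coeff_smul, smul_eq_mul]
    by_cases hm : coeff m a = 0
    · rw [hm]; simp
    · rw [h m hm]

theorem lin_eq_sg {D : MvPolynomial (Fin N) K →ₗ[K] MvPolynomial (Fin N) K} {h : Fin r → K}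
    (hD : ∀ (a : MvPolynomial (Fin N) K) (f : Fin r → ℤ),
    IsEigenWith K P.act f a → D a = (∑ i, h i * (f i : K)) • a) (a : MvPolynomial (Fin N) K) :
    D a = sg P.chi h a := by
  induction a using MvPolynomial.induction_on' with
  | monomial n c =>
    rw [hD _ _ (eigen_monomial P n c), Hom.monomial n c h]; rfl
  | add p q h1 h2 => rw [map_add, map_add, h1, h2]

theorem sgp_of (h : Fin r → K) (a b : MvPolynomial (Fin N) K) :
    sg P.chi h (P.br a b) = P.br (sg P.chi h a) b + P.br a (sg P.chi h b) := by
  induction a using MvPolynomial.induction_on' with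
  | monomial n c =>
    induction b using MvPolynomial.induction_on' with
    | monomial n' c' =>
      have := (eigen_iff P).1 (eigen_br P (eigen_monomial P n c) (eigen_monomial P n' c'))
      rw [this h, Hom.monomial n c h, Hom.monomial n' c' h, dot_add, add_smul, map_smul, map_smul,
        LinearMap.smul_apply]
    | add p q h1 h2 =>
      simp only [map_add, h1, h2]; abel
  | add p q h1 h2 =>
    simp only [map_add, LinearMap.add_apply, h1, h2]; abel

theorem PRsub_eq (m : Fin N) : PRsub K N (m : ℕ) = supported K (Set.Iio m) := by
  rw [supported_eq_adjoin_X]; rfl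

theorem PRsub_succ_eq (m : Fin N) : PRsub K N ((m : ℕ) + 1) = supported K (Set.Iic m) := by
  rw [supported_eq_adjoin_X]
  have : {l : Fin N | (l : ℕ) < (m : ℕ) + 1} = Set.Iic m := by
    refine Set.ext fun l => ?_
    rw [Set.mem_setOf_eq, Set.mem_Iic, Fin.le_def, Nat.lt_succ_iff]
  rw [← this]; rfl

theorem RsubRev_eq (m : Fin N) : RsubRev K (fun k : Fin N => (X k : MvPolynomial (Fin N) K)) (m : ℕ) = supported K (Set.Ioi m) := by
  rw [supported_eq_adjoin_X]; rfl

theorem ofP_stab (j k : Fin N) (hjk : j < k) :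
    P.br (X k) (X j) - dot (P.hk k) (P.chi j) • (X j * X k) ∈ supported K (Set.Ioo j k) ∧
    dot (P.hk k) (P.chi j) = - dot (P.hkRev j) (P.chi k) := by
  have h1 := P.stable k (X j) (by rw [PRsub_eq]; exact X_mem_sup hjk)
  rw [PRsub_eq, lin_eq_sg P (P.hDk k), sg_X, smul_mul_assoc] at h1
  have h2 := P.stableRev j (X k) (by rw [RsubRev_eq]; exact X_mem_sup hjk)
  rw [RsubRev_eq, lin_eq_sg P (P.hDkRev j), sg_X, smul_mul_assoc, P.skew] at h2
  have hc : dot (P.hk k) (P.chi j) = - dot (P.hkRev j) (P.chi k) := by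
    set m : Fin N →₀ ℕ := Finsupp.single j 1 + Finsupp.single k 1 with hm
    have e1 := coeff_sup_zero h1 (m := m) (l := k) (by simp) (by
      simp [hm])
    have e2 := coeff_sup_zero h2 (m := m) (l := j) (by simp) (by
      simp [hm])
    have e3 : coeff m (X j * X k : MvPolynomial (Fin N) K) = 1 := by
      rw [show (X j * X k : MvPolynomial (Fin N) K) = monomial m 1 by
        simp [X, monomial_mul, hm]]
      simp
    rw [mul_comm (X k) (X j)] at e2
    rw [coeff_sub, coeff_smul, e3] at e1 e2
    rw [coeff_neg] at e2
    simp only [smul_eq_mul, mul_one] at e1 e2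
    linear_combination -e1 - e2
  refine ⟨?_, hc⟩
  have h3 : P.br (X k) (X j) - dot (P.hk k) (P.chi j) • (X j * X k) ∈ supported K (Set.Ioi j) := by
    have := neg_mem h2
    rw [hc]
    convert this using 1
    rw [mul_comm (X k) (X j), neg_smul]; ring
  have := sup_inter h3 h1
  rwa [Set.Ioi_inter_Iio] at this

def ofP : PA K N r where
  br := P.br
  skew := P.skew
  jacobi := P.jacobi
  leibniz := P.leibniz
  chi := P.chi
  hk := P.hk
  hr := P.hkRev
  sgp := sgp_of P
  stab := fun j k h => (ofP_stab P j k h).1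
  cross := fun j k h => (ofP_stab P j k h).2
  nil := by
    intro k a ha
    obtain ⟨n, hn⟩ := P.locnil k a (by rw [PRsub_eq]; exact ha)
    refine ⟨n, ?_⟩
    rw [← hn]
    congr 2
    funext a
    rw [lin_eq_sg P (P.hDk k), mul_comm]
  nilr := by
    intro k a ha
    obtain ⟨n, hn⟩ := P.locnilRev k a (by rw [RsubRev_eq]; exact ha)
    refine ⟨n, ?_⟩
    rw [← hn]
    congr 2
    funext a
    rw [lin_eq_sg P (P.hDkRev k), mul_comm]
  lam_ne := P.eig_ne
  lamr_ne := P.eig_ne_rev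

end ofP

end PN

end Mod3

section Mod4
open MvPolynomial


namespace PN

section Ext

variable {K : Type u} [Field K] {N r : ℕ} {F : Type v} [Field F] [Algebra K F]
  [Algebra (MvPolynomial (Fin N) K) F] [IsFractionRing (MvPolynomial (Fin N) K) F]
  [IsScalarTower K (MvPolynomial (Fin N) K) F]

/-- ring hom to dual numbers -/
def dualHom (D : Derivation K (MvPolynomial (Fin N) K) F) :
    MvPolynomial (Fin N) K →+* TrivSqZeroExt F F where
  toFun a := TrivSqZeroExt.inl (algebraMap _ F a) + TrivSqZeroExt.inr (D a)
  map_one' := by ext <;> simp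
  map_zero' := by ext <;> simp
  map_add' a b := by ext <;> simp
  map_mul' a b := by
    ext
    · simp
    · simp only [TrivSqZeroExt.snd_add, TrivSqZeroExt.snd_inl, TrivSqZeroExt.snd_inr, zero_add,
        TrivSqZeroExt.snd_mul, TrivSqZeroExt.fst_add, TrivSqZeroExt.fst_inl, TrivSqZeroExt.fst_inr,
        add_zero, Derivation.leibniz, Algebra.smul_def, MulOpposite.smul_eq_mul_unop,
        MulOpposite.unop_op, smul_eq_mul]
      simp [mul_comm]

theorem dualHom_unit (D : Derivation K (MvPolynomial (Fin N) K) F)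
    (y : nonZeroDivisors (MvPolynomial (Fin N) K)) : IsUnit (dualHom D (y : MvPolynomial (Fin N) K)) := by
  rw [TrivSqZeroExt.isUnit_iff_isUnit_fst]
  simp only [dualHom, RingHom.coe_mk, MonoidHom.coe_mk, OneHom.coe_mk, TrivSqZeroExt.fst_add,
    TrivSqZeroExt.fst_inl, TrivSqZeroExt.fst_inr, add_zero]
  exact IsLocalization.map_units F y

def dualHomF (D : Derivation K (MvPolynomial (Fin N) K) F) : F →+* TrivSqZeroExt F F :=
  IsLocalization.lift (M := nonZeroDivisors (MvPolynomial (Fin N) K)) (dualHom_unit D)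

theorem dualHomF_io (D : Derivation K (MvPolynomial (Fin N) K) F) (a : MvPolynomial (Fin N) K) :
    dualHomF D (algebraMap _ F a) = dualHom D a := IsLocalization.lift_eq _ _

theorem dualHomF_fst (D : Derivation K (MvPolynomial (Fin N) K) F) (f : F) :
    (dualHomF D f).fst = f := by
  have : ((TrivSqZeroExt.fstHom F F F).toRingHom.comp (dualHomF D)) = RingHom.id F := by
    apply IsLocalization.ringHom_ext (nonZeroDivisors (MvPolynomial (Fin N) K))
    apply RingHom.ext
    intro a
    simp only [RingHom.comp_apply, dualHomF_io, RingHom.id_apply]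
    simp [dualHom]
  exact RingHom.congr_fun this f

/-- extension of a derivation to the fraction field -/
def extD (D : Derivation K (MvPolynomial (Fin N) K) F) : Derivation K F F :=
  Derivation.mk'
    { toFun := fun f => (dualHomF D f).snd
      map_add' := by intro a b; simp
      map_smul' := by
        intro c f
        rw [Algebra.smul_def, map_mul, TrivSqZeroExt.snd_mul, dualHomF_fst, dualHomF_fst,
          IsScalarTower.algebraMap_apply K (MvPolynomial (Fin N) K) F, dualHomF_io]
        simp [dualHom, Algebra.smul_def, IsScalarTower.algebraMap_apply K (MvPolynomial (Fin N) K) F] }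
    (by
      intro a b
      simp only [LinearMap.coe_mk, AddHom.coe_mk, map_mul, TrivSqZeroExt.snd_mul, dualHomF_fst]
      simp [mul_comm])

theorem extD_io (D : Derivation K (MvPolynomial (Fin N) K) F) (a : MvPolynomial (Fin N) K) :
    extD D (algebraMap _ F a) = D a := by
  show (dualHomF D (algebraMap _ F a)).snd = D a
  rw [dualHomF_io]; simp [dualHom]

/-- derivation of `F` with prescribed values -/
def derF (v : Fin N → F) : Derivation K F F := extD (mkDerivation K v)

@[simp] theorem derF_X (v : Fin N → F) (m : Fin N) :
    derF (K := K) v (algebraMap (MvPolynomial (Fin N) K) F (X m)) = v m := by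
  rw [derF, extD_io, mkDerivation_X]

theorem io_ne {a : MvPolynomial (Fin N) K} (h : a ≠ 0) : algebraMap _ F a ≠ 0 := by
  rw [Ne, FaithfulSMul.algebraMap_eq_zero_iff]; exact h

theorem io_inj : Function.Injective (algebraMap (MvPolynomial (Fin N) K) F) :=
  FaithfulSMul.algebraMap_injective _ _

theorem io_smul (c : K) (a : MvPolynomial (Fin N) K) :
    algebraMap (MvPolynomial (Fin N) K) F (c • a) = c • algebraMap _ F a :=
by
  rw [Algebra.smul_def, map_mul, Algebra.smul_def, ← IsScalarTower.algebraMap_apply]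

theorem derF_ext {D D' : Derivation K F F}
    (h : ∀ m : Fin N, D (algebraMap (MvPolynomial (Fin N) K) F (X m)) = D' (algebraMap (MvPolynomial (Fin N) K) F (X m))) :
    D = D' := by
  have h1 : ∀ a : MvPolynomial (Fin N) K, D (algebraMap _ F a) = D' (algebraMap _ F a) := by
    intro a
    induction a using MvPolynomial.induction_on with
    | C c =>
      have : algebraMap (MvPolynomial (Fin N) K) F (C c) = algebraMap K F c := by
        rw [← algebraMap_eq, ← IsScalarTower.algebraMap_apply]
      rw [this]; simp
    | add p q h1 h2 => rw [map_add, map_add, map_add, h1, h2]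
    | mul_X p m h1 => rw [map_mul, Derivation.leibniz, Derivation.leibniz, h1, h m]
  ext f
  obtain ⟨a, b, hb, rfl⟩ := IsFractionRing.div_surjective (A := MvPolynomial (Fin N) K) f
  rw [Derivation.leibniz_div, Derivation.leibniz_div, h1, h1]

/-- The subfield generated by the variables in `S`. -/
def FS (K : Type u) [Field K] {N : ℕ} (F : Type v) [Field F] [Algebra K F]
    [Algebra (MvPolynomial (Fin N) K) F] (S : Set (Fin N)) : IntermediateField K F :=
  IntermediateField.adjoin K ((fun m => algebraMap (MvPolynomial (Fin N) K) F (X m)) '' S)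

theorem der_adjoin_mem {s : Set F} {E : IntermediateField K F} (D : Derivation K F F)
    (hs : ∀ x ∈ s, x ∈ E) (h : ∀ x ∈ s, D x ∈ E) {f : F} (hf : f ∈ IntermediateField.adjoin K s) :
    D f ∈ E := by
  have hle : IntermediateField.adjoin K s ≤ E := IntermediateField.adjoin_le_iff.2 hs
  induction hf using IntermediateField.adjoin_induction with
  | mem x hx => exact h x hx
  | algebraMap c => simp
  | add x y hx hy h1 h2 => rw [map_add]; exact add_mem h1 h2
  | inv x hx h1 =>
    rw [D.leibniz_inv, neg_smul, smul_eq_mul]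
    exact neg_mem (mul_mem (pow_mem (inv_mem (hle hx)) 2) h1)
  | mul x y hx hy h1 h2 =>
    rw [D.leibniz, smul_eq_mul, smul_eq_mul]
    exact add_mem (mul_mem (hle hx) h2) (mul_mem (hle hy) h1)

theorem der_adjoin_eq {s : Set F} (D D' : Derivation K F F)
    (h : ∀ x ∈ s, D x = D' x) {f : F} (hf : f ∈ IntermediateField.adjoin K s) :
    D f = D' f := by
  induction hf using IntermediateField.adjoin_induction with
  | mem x hx => exact h x hx
  | algebraMap c => simp
  | add x y hx hy h1 h2 => rw [map_add, map_add, h1, h2]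
  | inv x hx h1 => rw [D.leibniz_inv, D'.leibniz_inv, h1]
  | mul x y hx hy h1 h2 => rw [D.leibniz, D'.leibniz, h1, h2]

theorem io_mem_FS {S : Set (Fin N)} {a : MvPolynomial (Fin N) K} (ha : a ∈ supported K S) :
    algebraMap _ F a ∈ FS K F S := by
  rw [supported_eq_adjoin_X] at ha
  induction ha using Algebra.adjoin_induction with
  | mem x hx => obtain ⟨m, hm, rfl⟩ := hx; exact IntermediateField.subset_adjoin _ _ ⟨m, hm, rfl⟩
  | algebraMap c =>
    rw [← IsScalarTower.algebraMap_apply]; exact (FS K F S).algebraMap_mem c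
  | add x y _ _ h1 h2 => rw [map_add]; exact add_mem h1 h2
  | mul x y hx hy h1 h2 => rw [map_mul]; exact mul_mem h1 h2

theorem FS_frac {S : Set (Fin N)} {f : F} (hf : f ∈ FS K F S) :
    ∃ c p : MvPolynomial (Fin N) K, c ∈ supported K S ∧ p ∈ supported K S ∧ p ≠ 0 ∧
      IsRelPrime p c ∧ algebraMap _ F c = f * algebraMap _ F p := by
  rw [FS, IntermediateField.mem_adjoin_iff_div] at hf
  obtain ⟨a, ha, b, hb, rfl⟩ := hf
  have key : ∀ x ∈ Algebra.adjoin K ((fun m => algebraMap (MvPolynomial (Fin N) K) F (X m)) '' S),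
      ∃ a ∈ supported K S, algebraMap (MvPolynomial (Fin N) K) F a = x := by
    intro x hx
    induction hx using Algebra.adjoin_induction with
    | mem x hx => obtain ⟨m, hm, rfl⟩ := hx; exact ⟨X m, X_mem_sup hm, rfl⟩
    | algebraMap c =>
      exact ⟨algebraMap _ _ c, Subalgebra.algebraMap_mem _ _, by rw [← IsScalarTower.algebraMap_apply]⟩
    | add x y _ _ h1 h2 =>
      obtain ⟨a, ha, rfl⟩ := h1
      obtain ⟨b, hb, rfl⟩ := h2
      exact ⟨a + b, add_mem ha hb, map_add _ _ _⟩
    | mul x y hx hy h1 h2 =>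
      obtain ⟨a, ha, rfl⟩ := h1
      obtain ⟨b, hb, rfl⟩ := h2
      exact ⟨a * b, mul_mem ha hb, map_mul _ _ _⟩
  obtain ⟨a, ha', rfl⟩ := key a ha
  obtain ⟨b, hb', rfl⟩ := key b hb
  by_cases hb0 : b = 0
  · refine ⟨0, 1, zero_mem _, one_mem _, one_ne_zero, isRelPrime_one_left, ?_⟩
    rw [hb0]; simp
  by_cases ha0 : a = 0
  · refine ⟨0, 1, zero_mem _, one_mem _, one_ne_zero, isRelPrime_one_left, ?_⟩
    rw [ha0]; simp
  obtain ⟨p, c, e, hrel, h1, h2⟩ := UniqueFactorizationMonoid.exists_reduced_factors b hb0 a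
  rw [mul_comm] at h1 h2
  refine ⟨c, p, sup_factor (by rw [h2]; exact ha') (by rw [h2]; exact ha0),
    sup_factor (by rw [h1]; exact hb') (by rw [h1]; exact hb0), ?_, hrel, ?_⟩
  · rintro rfl; exact hb0 (by rw [← h1, zero_mul])
  · have he : e ≠ 0 := by rintro rfl; exact hb0 (by rw [← h1, mul_zero])
    have hp : p ≠ 0 := by rintro rfl; exact hb0 (by rw [← h1, zero_mul])
    rw [← h1, ← h2, map_mul, map_mul]
    have := io_ne (F := F) he
    have := io_ne (F := F) hp
    field_simp

end Ext

section Ham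

variable {K : Type u} [Field K] {N r : ℕ} (F : Type v) [Field F] [Algebra K F]
  [Algebra (MvPolynomial (Fin N) K) F] [IsFractionRing (MvPolynomial (Fin N) K) F]
  [IsScalarTower K (MvPolynomial (Fin N) K) F] (A : PA K N r)

/-- `{x_l, ·}` on `F` -/
def hX (l : Fin N) : Derivation K F F :=
  derF (fun m => algebraMap (MvPolynomial (Fin N) K) F (A.br (X l) (X m)))

variable {F}

/-- `{f, ·}` on `F` -/
def hamF (f : F) : Derivation K F F := derF (N := N) (fun l => - hX F A l f)

@[simp] theorem hamF_X (f : F) (l : Fin N) : hamF A f (algebraMap (MvPolynomial (Fin N) K) F (X l)) = - hX F A l f := by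
  rw [hamF, derF_X]

theorem hamF_add (f g : F) : hamF A (f + g) = hamF A f + hamF A g := by
  apply derF_ext (N := N); intro m
  rw [Derivation.add_apply]; simp; ring

theorem hamF_smul (c : K) (f : F) : hamF A (c • f) = c • hamF A f := by
  apply derF_ext (N := N); intro m
  rw [Derivation.smul_apply]; simp

theorem hamF_mul (f g : F) : hamF A (f * g) = f • hamF A g + g • hamF A f := by
  apply derF_ext (N := N); intro m
  rw [Derivation.add_apply, Derivation.smul_apply, Derivation.smul_apply]; simp; ring

theorem hamF_io_X (l : Fin N) : hamF A (algebraMap (MvPolynomial (Fin N) K) F (X l)) = hX F A l := by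
  apply derF_ext (N := N); intro m
  rw [hamF_X, hX, hX, derF_X, derF_X, A.skew, map_neg, neg_neg]

/-- bracket as bilinear map -/
def brF : F →ₗ[K] F →ₗ[K] F :=
  LinearMap.mk₂ K (fun f g => hamF A f g) (fun f g h => by rw [hamF_add]; rfl)
    (fun c f g => by rw [hamF_smul]; rfl) (fun f g h => map_add _ _ _) (fun c f g => Derivation.map_smul _ _ _)

theorem brF_ham (f g : F) : brF A f g = hamF A f g := rfl

theorem brF_lr (f g h : F) : brF A f (g * h) = brF A f g * h + g * brF A f h := by
  rw [brF_ham, brF_ham, brF_ham, Derivation.leibniz, smul_eq_mul, smul_eq_mul]; ring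

theorem brF_ll (f g h : F) : brF A (f * g) h = brF A f h * g + f * brF A g h := by
  simp only [brF_ham]
  rw [hamF_mul, Derivation.add_apply, Derivation.smul_apply, Derivation.smul_apply, smul_eq_mul, smul_eq_mul]; ring

/-- the derivation `f ↦ {f,g}` -/
def rhamF (g : F) : Derivation K F F :=
  Derivation.mk' ((brF A).flip g) (fun a b => by
    rw [LinearMap.flip_apply, LinearMap.flip_apply, LinearMap.flip_apply, brF_ll, smul_eq_mul, smul_eq_mul]; ring)

theorem rhamF_apply (f g : F) : rhamF A g f = brF A f g := rfl

theorem brF_skew (f g : F) : brF A f g = - brF A g f := by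
  have : hamF A f = - rhamF A f := by
    apply derF_ext (N := N); intro m
    rw [Derivation.neg_apply, rhamF_apply, brF_ham, hamF_X, hamF_io_X]
  rw [brF_ham, this, Derivation.neg_apply, rhamF_apply]

theorem brF_io (a b : MvPolynomial (Fin N) K) :
    brF A (algebraMap _ F a) (algebraMap _ F b) = algebraMap _ F (A.br a b) := by
  have hX' : ∀ l (b : MvPolynomial (Fin N) K), hX F A l (algebraMap _ F b) = algebraMap _ F (A.br (X l) b) := by
    intro l b
    induction b using MvPolynomial.induction_on with
    | C c =>
      have : algebraMap (MvPolynomial (Fin N) K) F (C c) = algebraMap K F c := by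
        rw [← algebraMap_eq, ← IsScalarTower.algebraMap_apply]
      have h2 := (hamOf A.br A.leibniz (X l)).map_algebraMap c
      rw [algebraMap_eq] at h2
      change A.br (X l) (C c) = 0 at h2
      rw [this, h2]; simp
    | add p q h1 h2 => rw [map_add, map_add, map_add, map_add, h1, h2]
    | mul_X p m h1 =>
      rw [map_mul, Derivation.leibniz, h1, A.leibniz, map_add, map_mul, map_mul, hX, derF_X,
        smul_eq_mul, smul_eq_mul]; ring
  induction b using MvPolynomial.induction_on with
  | C c =>
    have : algebraMap (MvPolynomial (Fin N) K) F (C c) = algebraMap K F c := by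
      rw [← algebraMap_eq, ← IsScalarTower.algebraMap_apply]
    have h2 := (hamOf A.br A.leibniz a).map_algebraMap c
    rw [algebraMap_eq] at h2
    change A.br a (C c) = 0 at h2
    rw [this, h2, brF_ham]; simp
  | add p q h1 h2 => rw [map_add, map_add, map_add, map_add, h1, h2]
  | mul_X p m h1 =>
    rw [map_mul, brF_lr, h1, A.leibniz, map_add, map_mul, map_mul, brF_ham, hamF_X, hX', A.skew a (X m), map_neg]

variable (F) in
/-- torus derivations on `F` -/
def sgF (h : Fin r → K) : Derivation K F F :=
  derF (fun l => dot h (A.chi l) • algebraMap (MvPolynomial (Fin N) K) F (X l))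

theorem sgF_io (h : Fin r → K) (a : MvPolynomial (Fin N) K) :
    sgF F A h (algebraMap _ F a) = algebraMap _ F (sg A.chi h a) := by
  induction a using MvPolynomial.induction_on with
  | C c =>
    have : algebraMap (MvPolynomial (Fin N) K) F (C c) = algebraMap K F c := by
      rw [← algebraMap_eq, ← IsScalarTower.algebraMap_apply]
    rw [this]; simp
  | add p q h1 h2 => rw [map_add, map_add, map_add, map_add, h1, h2]
  | mul_X p m h1 =>
    rw [map_mul, Derivation.leibniz, h1, Derivation.leibniz, map_add, sg_X, sgF, derF_X]
    simp only [smul_eq_mul, map_mul, io_smul]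

/-- Poisson derivations -/
def PoisDer (D : Derivation K F F) : Prop :=
  ∀ f g, D (brF A f g) = brF A (D f) g + brF A f (D g)

theorem poisDer_of (D : Derivation K F F)
    (h : ∀ l m : Fin N, D (brF A (algebraMap (MvPolynomial (Fin N) K) F (X l)) (algebraMap (MvPolynomial (Fin N) K) F (X m))) =
      brF A (D (algebraMap (MvPolynomial (Fin N) K) F (X l))) (algebraMap (MvPolynomial (Fin N) K) F (X m)) + brF A (algebraMap (MvPolynomial (Fin N) K) F (X l)) (D (algebraMap (MvPolynomial (Fin N) K) F (X m)))) :
    PoisDer A D := by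
  have key : ∀ f : F, (∀ m, D (brF A f (algebraMap (MvPolynomial (Fin N) K) F (X m))) =
      brF A (D f) (algebraMap (MvPolynomial (Fin N) K) F (X m)) + brF A f (D (algebraMap (MvPolynomial (Fin N) K) F (X m)))) →
      ∀ g, D (brF A f g) = brF A (D f) g + brF A f (D g) := by
    intro f hf g
    have : ⁅D, hamF A f⁆ = hamF A (D f) := by
      apply derF_ext (N := N); intro m
      rw [Derivation.commutator_apply]
      have := hf m
      simp only [brF_ham] at this
      rw [this]; ring
    have h2 := congrArg (fun E : Derivation K F F => E g) this
    simp only [Derivation.commutator_apply] at h2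
    simp only [brF_ham]
    linear_combination h2
  intro f g
  refine key f (fun m => ?_) g
  have := key _ (h m) f
  rw [brF_skew, map_neg, this, brF_skew A (D f), brF_skew A f]; ring

theorem poisDer_ham (l : Fin N) : PoisDer (F := F) A (hamF A (algebraMap (MvPolynomial (Fin N) K) F (X l))) := by
  apply poisDer_of
  intro m n
  simp only [← brF_ham, brF_io]
  rw [A.jacobi, map_add]

theorem poisDer_sg (h : Fin r → K) : PoisDer (F := F) A (sgF F A h) := by
  apply poisDer_of
  intro m n
  simp only [sgF_io, brF_io]
  rw [A.sgp, map_add]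

end Ham

end PN

end Mod4

section Mod5
open MvPolynomial


namespace PN

section Step

variable {K : Type u} [Field K] {N r : ℕ} (A : PA K N r)

/-- hamiltonian derivation on `R` -/
def PA.ham (a : MvPolynomial (Fin N) K) : Derivation K (MvPolynomial (Fin N) K) (MvPolynomial (Fin N) K) :=
  hamOf A.br A.leibniz a

@[simp] theorem PA.ham_apply (a b : MvPolynomial (Fin N) K) : A.ham a b = A.br a b := rfl

/-- `δ` -/
def PA.del (k : Fin N) (h : Fin r → K) : Derivation K (MvPolynomial (Fin N) K) (MvPolynomial (Fin N) K) :=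
  A.ham (X k) - (X k : MvPolynomial (Fin N) K) • sg A.chi h

theorem PA.del_apply (k : Fin N) (h : Fin r → K) (a : MvPolynomial (Fin N) K) :
    A.del k h a = A.br (X k) a - X k * sg A.chi h a := rfl

/-- an (abstract) Ore-type step -/
structure PA.Stp (S : Set (Fin N)) (k : Fin N) (h : Fin r → K) : Prop where
  hkS : k ∉ S
  pois : ∀ l ∈ S, ∀ m ∈ S, A.br (X l) (X m) ∈ supported K S
  del : ∀ m ∈ S, A.del k h (X m) ∈ supported K S
  nil : ∀ a ∈ supported K S, Nilp (A.del k h) a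
  lam : dot h (A.chi k) ≠ 0

end Step

section Tor

variable {K : Type u} [Field K] {N r : ℕ} (F : Type v) [Field F] [Algebra K F]
  [Algebra (MvPolynomial (Fin N) K) F] [IsFractionRing (MvPolynomial (Fin N) K) F]
  [IsScalarTower K (MvPolynomial (Fin N) K) F] (A : PA K N r)

/-- torus coordinates on `F_S` -/
structure Tor (S : Set (Fin N)) (Y : Fin N → F) (θ : Fin N → Derivation K F F) (q : Fin N → Fin N → K) :
    Prop where
  ne : ∀ l ∈ S, Y l ≠ 0
  wt : ∀ l ∈ S, ∀ g, sgF F A g (Y l) = dot g (A.chi l) • Y l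
  lc : ∀ l ∈ S, ∀ m ∈ S, brF A (Y l) (Y m) = q l m • (Y l * Y m)
  th : ∀ l ∈ S, ∀ m ∈ S, θ l (Y m) = if l = m then Y m else 0
  adj : IntermediateField.adjoin K (Y '' S) = FS K F S
  out : ∀ l, ∀ m ∉ S, θ l (algebraMap (MvPolynomial (Fin N) K) F (X m)) = 0
  thz : ∀ l ∉ S, θ l = 0

variable {F A}
variable {S : Set (Fin N)} {Y : Fin N → F} {θ : Fin N → Derivation K F F} {q : Fin N → Fin N → K}

theorem Tor.mem (T : Tor F A S Y θ q) {l : Fin N} (hl : l ∈ S) : Y l ∈ FS K F S := by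
  rw [← T.adj]; exact IntermediateField.subset_adjoin _ _ ⟨l, hl, rfl⟩

theorem Tor.dmem (T : Tor F A S Y θ q) (D : Derivation K F F) (h : ∀ l ∈ S, D (Y l) ∈ FS K F S) {f : F}
    (hf : f ∈ FS K F S) : D f ∈ FS K F S := by
  rw [← T.adj] at hf
  refine der_adjoin_mem D ?_ ?_ hf
  · rintro _ ⟨l, hl, rfl⟩; exact T.mem hl
  · rintro _ ⟨l, hl, rfl⟩; exact h l hl

theorem Tor.deq (T : Tor F A S Y θ q) (D D' : Derivation K F F) (h : ∀ l ∈ S, D (Y l) = D' (Y l)) {f : F}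
    (hf : f ∈ FS K F S) : D f = D' f := by
  rw [← T.adj] at hf
  refine der_adjoin_eq D D' ?_ hf
  rintro _ ⟨l, hl, rfl⟩; exact h l hl

theorem Tor.thmem (T : Tor F A S Y θ q) (l : Fin N) {f : F} (hf : f ∈ FS K F S) : θ l f ∈ FS K F S := by
  by_cases hl : l ∈ S
  · refine T.dmem _ (fun m hm => ?_) hf
    rw [T.th l hl m hm]; split_ifs
    · exact T.mem hm
    · exact zero_mem _
  · rw [T.thz l hl]; exact zero_mem _

theorem FS_der (D : Derivation K F F)
    (h : ∀ l ∈ S, D (algebraMap (MvPolynomial (Fin N) K) F (X l)) ∈ FS K F S) {f : F}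
    (hf : f ∈ FS K F S) : D f ∈ FS K F S := by
  refine der_adjoin_mem D ?_ ?_ hf
  · rintro _ ⟨l, hl, rfl⟩; exact io_mem_FS (X_mem_sup hl)
  · rintro _ ⟨l, hl, rfl⟩; exact h l hl

theorem Tor.thY (T : Tor F A S Y θ q) (l : Fin N) {m : Fin N} (hm : m ∈ S) :
    θ l (Y m) = if l = m then Y m else 0 := by
  by_cases hl : l ∈ S
  · exact T.th l hl m hm
  · rw [T.thz l hl, if_neg (by rintro rfl; exact hl hm)]; rfl

theorem Tor.comm (T : Tor F A S Y θ q) (l m : Fin N) {f : F} (hf : f ∈ FS K F S) :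
    θ l (θ m f) = θ m (θ l f) := by
  have : ⁅θ l, θ m⁆ f = (0 : Derivation K F F) f := by
    refine T.deq _ _ (fun n hn => ?_) hf
    rw [Derivation.commutator_apply, T.thY m hn, T.thY l hn, apply_ite (θ l), apply_ite (θ m), map_zero,
      map_zero, T.thY m hn, T.thY l hn]
    split_ifs <;> simp
  rw [Derivation.commutator_apply] at this
  exact sub_eq_zero.1 this

theorem Tor.sgcomm (T : Tor F A S Y θ q) (g : Fin r → K) (m : Fin N) {f : F} (hf : f ∈ FS K F S) :
    sgF F A g (θ m f) = θ m (sgF F A g f) := by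
  have : ⁅sgF F A g, θ m⁆ f = (0 : Derivation K F F) f := by
    refine T.deq _ _ (fun n hn => ?_) hf
    rw [Derivation.commutator_apply, T.thY m hn, T.wt n hn, Derivation.map_smul, T.thY m hn,
      apply_ite (sgF F A g), map_zero, T.wt n hn]
    split_ifs <;> simp
  rw [Derivation.commutator_apply] at this
  exact sub_eq_zero.1 this

theorem Tor.E (T : Tor F A S Y θ q) {l : Fin N} (hl : l ∈ S) {f : F} (hf : f ∈ FS K F S) :
    brF A (Y l) f = Y l * ∑ m, q l m • θ m f := by
  have : hamF A (Y l) f = (Y l • ∑ m, q l m • θ m) f := by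
    refine T.deq _ _ (fun n hn => ?_) hf
    rw [← brF_ham, T.lc l hl n hn, Derivation.smul_apply, ← Derivation.coeFnAddMonoidHom_apply, map_sum,
      Finset.sum_apply, Finset.sum_eq_single n]
    · simp [T.thY n hn]
    · intro m _ hm; simp [T.thY m hn, hm]
    · simp
  rw [brF_ham, this, Derivation.smul_apply, ← Derivation.coeFnAddMonoidHom_apply, map_sum, Finset.sum_apply]
  simp

theorem Tor.sgsum (T : Tor F A S Y θ q) (g : Fin r → K) {f : F} (hf : f ∈ FS K F S) :
    sgF F A g f = ∑ m, dot g (A.chi m) • θ m f := by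
  have : sgF F A g f = (∑ m, dot g (A.chi m) • θ m) f := by
    refine T.deq _ _ (fun n hn => ?_) hf
    rw [T.wt n hn, ← Derivation.coeFnAddMonoidHom_apply, map_sum,
      Finset.sum_apply, Finset.sum_eq_single n]
    · simp [T.thY n hn]
    · intro m _ hm; simp [T.thY m hn, hm]
    · simp
  rw [this, ← Derivation.coeFnAddMonoidHom_apply, map_sum, Finset.sum_apply]
  simp

variable (F A) in
/-- `δ` on `F` -/
def delF (k : Fin N) (h : Fin r → K) : Derivation K F F :=
  hamF A (algebraMap (MvPolynomial (Fin N) K) F (X k)) -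
    (algebraMap (MvPolynomial (Fin N) K) F (X k)) • sgF F A h

theorem delF_apply (k : Fin N) (h : Fin r → K) (f : F) :
    delF F A k h f = brF A (algebraMap (MvPolynomial (Fin N) K) F (X k)) f
      - algebraMap (MvPolynomial (Fin N) K) F (X k) * sgF F A h f := rfl

theorem delF_io (k : Fin N) (h : Fin r → K) (a : MvPolynomial (Fin N) K) :
    delF F A k h (algebraMap _ F a) = algebraMap _ F (A.del k h a) := by
  rw [delF_apply, brF_io, sgF_io, PA.del_apply, map_sub, map_mul]

theorem delF_br (k : Fin N) (h : Fin r → K) (f g : F) :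
    delF F A k h (brF A f g) = brF A (delF F A k h f) g + brF A f (delF F A k h g)
      + sgF F A h f * delF F A k h g - sgF F A h g * delF F A k h f := by
  have h1 := poisDer_ham (F := F) A k f g
  have h2 := poisDer_sg (F := F) A h f g
  simp only [← brF_ham] at h1
  simp only [delF_apply, map_sub, LinearMap.sub_apply, brF_ll, brF_lr, h1, h2]
  rw [brF_skew A f (algebraMap (MvPolynomial (Fin N) K) F (X k))]
  ring

theorem delF_sg (k : Fin N) (h g : Fin r → K) (f : F) :
    sgF F A g (delF F A k h f) = delF F A k h (sgF F A g f) + dot g (A.chi k) • delF F A k h f := by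
  have hc : sgF F A g (sgF F A h f) = sgF F A h (sgF F A g f) := by
    have : ⁅sgF F A g, sgF F A h⁆ = (0 : Derivation K F F) := by
      apply derF_ext (N := N); intro m
      have e : ∀ g h : Fin r → K, sgF F A g (sgF F A h (algebraMap (MvPolynomial (Fin N) K) F (X m))) =
          (dot h (A.chi m) * dot g (A.chi m)) • (algebraMap (MvPolynomial (Fin N) K) F (X m)) := by
        intro g h
        rw [sgF_io, sg_X, io_smul, Derivation.map_smul, sgF_io, sg_X, io_smul, smul_smul]
      rw [Derivation.commutator_apply, e, e, mul_comm, sub_self, Derivation.zero_apply]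
    have h2 := congrArg (fun E : Derivation K F F => E f) this
    simp only [Derivation.commutator_apply] at h2
    exact sub_eq_zero.1 h2
  simp only [delF_apply, map_sub, poisDer_sg A g _ _, Derivation.leibniz, hc]
  rw [sgF_io, sg_X, io_smul]
  rw [map_smul, LinearMap.smul_apply]
  simp only [smul_eq_mul, Algebra.smul_def]
  ring

/-- the key element `d` -/
theorem Tor.exists_d [CharZero K] (T : Tor F A S Y θ q) {k : Fin N} {h : Fin r → K} (st : A.Stp S k h) :
    ∃ d ∈ FS K F S, (∀ f ∈ FS K F S, delF F A k h f = brF A d f - sgF F A h f * d) ∧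
      ∀ g, sgF F A g d = dot g (A.chi k) • d := by
  set lam := dot h (A.chi k) with hlam
  have hdS : ∀ f ∈ FS K F S, delF F A k h f ∈ FS K F S := fun f hf =>
    FS_der _ (fun l hl => by rw [delF_io]; exact io_mem_FS (st.del l hl)) hf
  set D : Fin N → F := fun l => delF F A k h (Y l) / Y l with hD
  have hDm : ∀ l ∈ S, D l ∈ FS K F S := fun l hl => div_mem (hdS _ (T.mem hl)) (T.mem hl)
  have hDY : ∀ l ∈ S, delF F A k h (Y l) = D l * Y l := fun l hl => by
    rw [hD]; field_simp [T.ne l hl]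
  have hDs : ∀ l ∈ S, ∀ g, sgF F A g (D l) = dot g (A.chi k) • D l := by
    intro l hl g
    have h1 := delF_sg (F := F) (A := A) k h g (Y l)
    rw [T.wt l hl, Derivation.map_smul, hDY l hl, Derivation.leibniz, T.wt l hl] at h1
    simp only [smul_eq_mul, Algebra.smul_def] at h1 ⊢
    apply mul_right_cancel₀ (T.ne l hl)
    linear_combination h1
  have qsk : ∀ l ∈ S, ∀ m ∈ S, q l m = - q m l := by
    intro l hl m hm
    have h1 := T.lc l hl m hm
    rw [brF_skew, T.lc m hm l hl, mul_comm (Y m) (Y l), ← neg_smul] at h1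
    exact (smul_left_injective K (mul_ne_zero (T.ne l hl) (T.ne m hm)) h1).symm
  have sym : ∀ l ∈ S, ∀ m ∈ S, (∑ n, q l n • θ n (D m)) + dot h (A.chi l) • D m =
      (∑ n, q m n • θ n (D l)) + dot h (A.chi m) • D l := by
    intro l hl m hm
    have h1 := delF_br (F := F) (A := A) k h (Y l) (Y m)
    rw [T.lc l hl m hm, Derivation.map_smul, Derivation.leibniz, hDY l hl, hDY m hm, brF_ll, brF_lr,
      T.lc l hl m hm, brF_skew A (D l), T.E hl (hDm m hm), T.E hm (hDm l hl), T.wt l hl, T.wt m hm] at h1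
    simp only [smul_eq_mul, Algebra.smul_def] at h1 ⊢
    apply mul_right_cancel₀ (mul_ne_zero (T.ne l hl) (T.ne m hm))
    linear_combination -h1
  -- sum of θ_m E_m vanishes
  have van : ∀ f ∈ FS K F S, ∑ m, θ m (∑ n, q m n • θ n f) = 0 := by
    intro f hf
    have e1 : ∑ m, θ m (∑ n, q m n • θ n f) = ∑ m, ∑ n, q m n • θ m (θ n f) := by
      refine Finset.sum_congr rfl fun m _ => ?_
      rw [map_sum]; simp
    have e2 : ∑ m, ∑ n, q m n • θ m (θ n f) = - ∑ m, ∑ n, q m n • θ m (θ n f) := by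
      conv_lhs => rw [Finset.sum_comm]
      rw [← Finset.sum_neg_distrib]
      refine Finset.sum_congr rfl fun n _ => ?_
      rw [← Finset.sum_neg_distrib]
      refine Finset.sum_congr rfl fun m _ => ?_
      by_cases hn : n ∈ S
      · by_cases hm : m ∈ S
        · rw [qsk m hm n hn, T.comm m n hf, neg_smul]
        · rw [T.thz m hm]; simp
      · rw [T.thz n hn]; simp
    rw [e1]
    haveI := charZero_of_alg K F
    have e3 : (2 : F) * ∑ m, ∑ n, q m n • θ m (θ n f) = 0 := by linear_combination e2
    exact (mul_eq_zero.1 e3).resolve_left two_ne_zero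
  refine ⟨-(lam⁻¹ • ∑ m, θ m (D m)), ?_, ?_, ?_⟩
  · refine neg_mem ((FS K F S).smul_mem (sum_mem fun m _ => ?_))
    by_cases hm : m ∈ S
    · exact T.thmem m (hDm m hm)
    · rw [T.thz m hm]; exact zero_mem _
  · set d := -(lam⁻¹ • ∑ m, θ m (D m)) with hd
    have key : ∀ l ∈ S, (∑ n, q l n • θ n d) + dot h (A.chi l) • d = - D l := by
      intro l hl
      have e0 : (∑ n, q l n • θ n d) + dot h (A.chi l) • d =
          -(lam⁻¹ • ∑ m, ((∑ n, q l n • θ n (θ m (D m))) + dot h (A.chi l) • θ m (D m))) := by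
        rw [Finset.sum_add_distrib, smul_add, neg_add]
        congr 1
        · rw [Finset.sum_comm, Finset.smul_sum, ← Finset.sum_neg_distrib]
          refine Finset.sum_congr rfl fun n _ => ?_
          rw [hd, map_neg, Derivation.map_smul, map_sum, smul_neg, smul_comm, ← Finset.smul_sum]
        · rw [hd, smul_neg, smul_comm, ← Finset.smul_sum]
      rw [e0]
      have e1 : ∀ m, (∑ n, q l n • θ n (θ m (D m))) + dot h (A.chi l) • θ m (D m) =
          θ m (∑ n, q m n • θ n (D l)) + dot h (A.chi m) • θ m (D l) := by
        intro m
        by_cases hm : m ∈ S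
        · rw [← Derivation.map_smul, ← Derivation.map_smul, ← map_add, ← sym l hl m hm, map_add, map_sum]
          congr 1
          refine Finset.sum_congr rfl fun n _ => ?_
          rw [Derivation.map_smul, T.comm n m (hDm m hm)]
        · rw [T.thz m hm]; simp
      rw [Finset.sum_congr rfl fun m _ => e1 m, Finset.sum_add_distrib, van _ (hDm l hl), zero_add,
        ← T.sgsum h (hDm l hl), hDs l hl, smul_smul, inv_mul_cancel₀ st.lam, one_smul]
    have hdm : d ∈ FS K F S := by
      refine neg_mem ((FS K F S).smul_mem (sum_mem fun m _ => ?_))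
      by_cases hm : m ∈ S
      · exact T.thmem m (hDm m hm)
      · rw [T.thz m hm]; exact zero_mem _
    intro f hf
    have : delF F A k h f = (hamF A d - d • sgF F A h) f := by
      refine T.deq _ _ (fun l hl => ?_) hf
      rw [Derivation.sub_apply, Derivation.smul_apply, ← brF_ham, brF_skew, T.E hl hdm, T.wt l hl, hDY l hl]
      have := key l hl
      simp only [smul_eq_mul, Algebra.smul_def] at this ⊢
      linear_combination (Y l) * this
    rw [this, Derivation.sub_apply, Derivation.smul_apply, ← brF_ham, smul_eq_mul, mul_comm d]
  · intro g
    rw [map_neg, Derivation.map_smul, map_sum, smul_neg, smul_comm (dot g (A.chi k)), Finset.smul_sum (r := dot g (A.chi k))]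
    congr 2
    refine Finset.sum_congr rfl fun m _ => ?_
    by_cases hm : m ∈ S
    · rw [T.sgcomm g m (hDm m hm), hDs m hm, Derivation.map_smul]
    · rw [T.thz m hm]; simp

theorem FS_mono {S T : Set (Fin N)} (h : S ⊆ T) : FS K F S ≤ FS K F T :=
  IntermediateField.adjoin.mono _ _ _ (Set.image_mono h)

theorem Tor.insert [CharZero K] (T : Tor F A S Y θ q) {k : Fin N} {h : Fin r → K} (st : A.Stp S k h) :
    ∃ Y' θ' q', Tor F A (Insert.insert k S) Y' θ' q' := by
  classical
  obtain ⟨d, hd, hdel, hwt⟩ := T.exists_d st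
  set xk : F := algebraMap (MvPolynomial (Fin N) K) F (X k) with hxk
  set pk : Derivation K F F := derF (N := N) (Pi.single k 1) with hpk
  have hpS : ∀ f ∈ FS K F S, pk f = 0 := by
    intro f hf
    have : pk f = (0 : Derivation K F F) f := by
      refine der_adjoin_eq _ _ ?_ hf
      rintro _ ⟨l, hl, rfl⟩
      simp only [hpk, derF_X]
      rw [Pi.single_eq_of_ne (by rintro rfl; exact st.hkS hl)]; rfl
    rw [this]; rfl
  have hpk1 : pk xk = 1 := by rw [hpk, hxk, derF_X]; simp
  have hkS := st.hkS
  have hneq : ∀ l ∈ S, l ≠ k := by rintro l hl rfl; exact hkS hl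
  have hYk : pk (xk - d) = 1 := by rw [map_sub, hpk1, hpS d hd, sub_zero]
  have hbr : ∀ m ∈ S, brF A (xk - d) (Y m) = dot h (A.chi m) • ((xk - d) * Y m) := by
    intro m hm
    have h1 := hdel (Y m) (T.mem hm)
    rw [delF_apply, T.wt m hm] at h1
    rw [map_sub, LinearMap.sub_apply]
    simp only [Algebra.smul_def] at h1 ⊢
    linear_combination h1
  refine ⟨fun l => if l = k then xk - d else Y l,
    fun l => if l = k then (xk - d) • pk else if l ∈ S then θ l + (θ l d) • pk else 0,
    fun l m => if l = k then (if m = k then 0 else dot h (A.chi m)) else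
      if m = k then - dot h (A.chi l) else q l m, ?_, ?_, ?_, ?_, ?_, ?_, ?_⟩
  · rintro l (rfl | hl)
    · simp only [if_true]
      intro h0; rw [h0, map_zero] at hYk; exact zero_ne_one hYk
    · simp only [if_neg (hneq l hl)]; exact T.ne l hl
  · rintro l (rfl | hl) g
    · simp only [if_true]
      rw [map_sub, hwt, hxk, sgF_io, sg_X, io_smul, smul_sub]
    · simp only [if_neg (hneq l hl)]; exact T.wt l hl g
  · rintro l (rfl | hl) m (rfl | hm)
    · simp only [if_true, zero_smul]
      have e2 := brF_skew A (xk - d) (xk - d)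
      haveI := charZero_of_alg K F
      have e3 : (2 : F) * brF A (xk - d) (xk - d) = 0 := by linear_combination e2
      exact (mul_eq_zero.1 e3).resolve_left two_ne_zero
    · simp only [if_true, if_neg (hneq m hm)]; exact hbr m hm
    · simp only [if_true, if_neg (hneq l hl)]
      rw [brF_skew, hbr l hl, neg_smul, mul_comm]
    · simp only [if_neg (hneq l hl), if_neg (hneq m hm)]; exact T.lc l hl m hm
  · rintro l (rfl | hl) m (rfl | hm)
    · simp only [if_true, Derivation.smul_apply, hYk]; simp
    · simp only [if_true, if_neg (hneq m hm), if_neg (hneq m hm).symm, Derivation.smul_apply,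
        hpS _ (T.mem hm)]; simp
    · simp only [if_true, if_neg (hneq l hl), if_pos hl, Derivation.add_apply, Derivation.smul_apply, hYk]
      rw [map_sub, hxk, T.out l _ hkS]; simp
    · simp only [if_neg (hneq l hl), if_neg (hneq m hm), if_pos hl, Derivation.add_apply, Derivation.smul_apply,
        hpS _ (T.mem hm)]
      rw [T.th l hl m hm]; simp
  · apply le_antisymm
    · rw [IntermediateField.adjoin_le_iff]
      rintro _ ⟨l, (rfl | hl), rfl⟩
      · simp only [if_true]
        exact sub_mem (io_mem_FS (X_mem_sup (Set.mem_insert _ _))) (FS_mono (Set.subset_insert _ _) hd)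
      · simp only [if_neg (hneq l hl)]; exact FS_mono (Set.subset_insert _ _) (T.mem hl)
    · set E := IntermediateField.adjoin K ((fun l => if l = k then xk - d else Y l) '' Insert.insert k S) with hE
      have hSE : FS K F S ≤ E := by
        rw [← T.adj, IntermediateField.adjoin_le_iff]
        rintro _ ⟨l, hl, rfl⟩
        refine IntermediateField.subset_adjoin _ _ ⟨l, Or.inr hl, ?_⟩
        simp only [if_neg (hneq l hl)]
      rw [FS, IntermediateField.adjoin_le_iff]
      rintro _ ⟨l, (rfl | hl), rfl⟩
      · have h1 : xk - d ∈ E := IntermediateField.subset_adjoin _ _ ⟨l, Or.inl rfl, by simp only [if_true]⟩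
        have := add_mem h1 (hSE hd)
        rwa [sub_add_cancel] at this
      · exact hSE (io_mem_FS (X_mem_sup hl))
  · intro l m hm
    have hmk : m ≠ k := fun e => hm (Or.inl e)
    have hpm : pk (algebraMap (MvPolynomial (Fin N) K) F (X m)) = 0 := by
      rw [hpk, derF_X, Pi.single_eq_of_ne hmk]
    split_ifs
    · rw [Derivation.smul_apply, hpm, smul_zero]
    · rw [Derivation.add_apply, Derivation.smul_apply, hpm, smul_zero, T.out l m (fun e => hm (Or.inr e)), zero_add]
    · rfl
  · intro l hl
    rw [if_neg (fun e => hl (Or.inl e)), if_neg (fun e => hl (Or.inr e))]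

theorem tor_empty : Tor F A ∅ (fun _ => 0) (fun _ => 0) (fun _ _ => 0) where
  ne := by simp
  wt := by simp
  lc := by simp
  th := by simp
  adj := by simp [FS]
  out := by intro l m _; rfl
  thz := by intro l _; rfl

/-- the interface with polynomials -/
theorem Tor.interface [CharZero K] (T : Tor F A S Y θ q) {k : Fin N} {h : Fin r → K} (st : A.Stp S k h) :
    ∃ p ∈ supported K S, ∃ c ∈ supported K S, p ≠ 0 ∧ IsRelPrime p c ∧
      (∀ a ∈ supported K S, p ^ 2 * A.del k h a = p * A.br c a - c * A.br p a - sg A.chi h a * c * p) ∧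
      ∀ g, p * sg A.chi g c - c * sg A.chi g p = dot g (A.chi k) • (c * p) := by
  obtain ⟨d, hd, hdel, hwt⟩ := T.exists_d st
  obtain ⟨c, p, hc, hp, hp0, hrel, hcp⟩ := FS_frac hd
  refine ⟨p, hp, c, hc, hp0, hrel, ?_, ?_⟩
  · intro a ha
    apply io_inj (F := F)
    have h1 := hdel _ (io_mem_FS ha)
    simp only [map_sub, map_mul, map_pow, ← delF_io, ← brF_io, ← sgF_io, hcp, brF_ll]
    rw [h1]; ring
  · intro g
    apply io_inj (F := F)
    have h1 := hwt g
    rw [io_smul]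
    simp only [map_sub, map_mul, ← sgF_io, hcp, Derivation.leibniz, h1, smul_eq_mul]
    simp only [Algebra.smul_def]
    ring

end Tor

end PN

end Mod5

section Mod6
open MvPolynomial


namespace PN

section HPsec

variable {K : Type u} [Field K] {N r : ℕ}

theorem Phi_der_coeff {S : Set (Fin N)} {k : Fin N} (hk : k ∉ S)
    (D : Derivation K (MvPolynomial (Fin N) K) (MvPolynomial (Fin N) K))
    (hD : ∀ a ∈ supported K S, D a ∈ supported K S) {u v : MvPolynomial (Fin N) K}
    (hu : u ∈ supported K S) (hv : v ∈ supported K S) (hX : D (X k) = u * X k + v)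
    {a : MvPolynomial (Fin N) K} (ha : a ∈ supported K (insert k S)) (i : ℕ) :
    (Phi k (D a)).coeff i = D ((Phi k a).coeff i) + i * u * (Phi k a).coeff i +
      (i + 1) * v * (Phi k a).coeff (i + 1) := by
  have h1 : a = ∑ j ∈ Finset.range ((Phi k a).natDegree + 1), (Phi k a).coeff j * X k ^ j := by
    conv_lhs => rw [← Phi_eval k a, Polynomial.eval_eq_sum_range]
  have hc := fun j => Phi_coeff' ha j
  have key : ∀ b ∈ supported K S, ∀ j : ℕ, Phi k (D (b * X k ^ j : MvPolynomial (Fin N) K)) =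
      Polynomial.C (D b + (j : MvPolynomial (Fin N) K) * u * b) * Polynomial.X ^ j +
        Polynomial.C ((j : MvPolynomial (Fin N) K) * v * b) * Polynomial.X ^ (j - 1) := by
    intro b hb j
    have e1 : D (b * X k ^ j) = (D b + (j : MvPolynomial (Fin N) K) * u * b) * X k ^ j +
        ((j : MvPolynomial (Fin N) K) * v * b) * X k ^ (j - 1) := by
      rw [Derivation.leibniz, Derivation.leibniz_pow, hX]
      simp only [smul_eq_mul, nsmul_eq_mul]
      rcases j with _ | j
      · simp
      · simp only [Nat.add_sub_cancel, pow_succ]; ring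
    rw [e1, map_add, map_mul, map_mul, map_pow, map_pow, Phi_X_self,
      Phi_supp hk (add_mem (hD b hb) (mul_mem (mul_mem (natCast_mem _ _) hu) hb)),
      Phi_supp hk (mul_mem (mul_mem (natCast_mem _ _) hv) hb)]
  conv_lhs => rw [h1]
  rw [map_sum, map_sum, Polynomial.finset_sum_coeff]
  simp only [key _ (hc _), Polynomial.coeff_add, Polynomial.coeff_C_mul, Polynomial.coeff_X_pow]
  rw [Finset.sum_add_distrib]
  have e2 : ∑ j ∈ Finset.range ((Phi k a).natDegree + 1),
      (D ((Phi k a).coeff j) + j * u * (Phi k a).coeff j) * (if i = j then 1 else 0) =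
      D ((Phi k a).coeff i) + i * u * (Phi k a).coeff i := by
    simp only [mul_ite, mul_one, mul_zero]
    rw [Finset.sum_ite_eq]
    split_ifs with h
    · rfl
    · rw [Polynomial.coeff_eq_zero_of_natDegree_lt (by simpa [Nat.lt_succ_iff] using h)]; simp
  have e3 : ∑ j ∈ Finset.range ((Phi k a).natDegree + 1),
      (j * v * (Phi k a).coeff j) * (if i = j - 1 then 1 else 0) =
      (i + 1) * v * (Phi k a).coeff (i + 1) := by
    by_cases h : i + 1 ∈ Finset.range ((Phi k a).natDegree + 1)
    · rw [Finset.sum_eq_single_of_mem _ h]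
      · simp
      · intro j _ hj
        rcases j with _ | j
        · simp
        · rw [if_neg (by omega), mul_zero]
    · rw [Finset.sum_eq_zero, Polynomial.coeff_eq_zero_of_natDegree_lt (by simpa using h), mul_zero]
      intro j hj
      rcases j with _ | j
      · simp
      · rw [if_neg, mul_zero]
        rintro rfl
        exact h (by simpa using hj)
  rw [e2, e3]

theorem Hom.coeff {chi : Fin N → Fin r → ℤ} [CharZero K] {S : Set (Fin N)} {k : Fin N} (hk : k ∉ S)
    {a : MvPolynomial (Fin N) K} (ha : a ∈ supported K (insert k S)) {w : Fin r → ℤ} (hw : Hom chi w a) (i : ℕ) :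
    Hom chi (w - (i : ℤ) • chi k) ((Phi k a).coeff i) := by
  intro g
  have h1 := Phi_der_coeff hk (sg chi g)
    (fun a ha => sup_der _ (fun m hm => by rw [sg_X]; exact Subalgebra.smul_mem _ (X_mem_sup hm) _) ha)
    (u := MvPolynomial.C (dot g (chi k))) (v := 0) (Subalgebra.algebraMap_mem _ _) (zero_mem _)
    (by rw [sg_X, smul_eq_C_mul, add_zero]) ha i
  rw [hw g, map_smul, Polynomial.coeff_smul, smul_eq_C_mul] at h1
  rw [dot_sub, dot_smul, smul_eq_C_mul, map_sub, map_mul]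
  have : (MvPolynomial.C ((i : ℤ) : K) : MvPolynomial (Fin N) K) = (i : MvPolynomial (Fin N) K) := by
    simp
  rw [this]
  linear_combination -h1

theorem dvd_der_of_gen {S : Set (Fin N)} (D : Derivation K (MvPolynomial (Fin N) K) (MvPolynomial (Fin N) K))
    {p : MvPolynomial (Fin N) K} (h : ∀ m ∈ S, p ∣ D (X m)) {a : MvPolynomial (Fin N) K}
    (ha : a ∈ supported K S) : p ∣ D a := by
  rw [supported_eq_adjoin_X] at ha
  induction ha using Algebra.adjoin_induction with
  | mem x hx => obtain ⟨m, hm, rfl⟩ := hx; exact h m hm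
  | algebraMap c => simp
  | add x y _ _ h1 h2 => rw [map_add]; exact dvd_add h1 h2
  | mul x y hx hy h1 h2 =>
    rw [D.leibniz, smul_eq_mul, smul_eq_mul]; exact dvd_add (h2.mul_left _) (h1.mul_left _)

variable (A : PA K N r)

/-- homogeneous Poisson-prime elements of `R_S` -/
structure PA.HP (S : Set (Fin N)) (q : MvPolynomial (Fin N) K) : Prop where
  irr : Irreducible q
  mem : q ∈ supported K S
  hom : ∃ w, Hom A.chi w q
  nrm : ∀ a ∈ supported K S, q ∣ A.br q a

variable {A}

theorem PA.HP.ne_zero {S : Set (Fin N)} {q : MvPolynomial (Fin N) K} (h : A.HP S q) : q ≠ 0 := h.irr.ne_zero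

theorem PA.HP.prime {S : Set (Fin N)} {q : MvPolynomial (Fin N) K} (h : A.HP S q) : Prime q := h.irr.prime

theorem PA.HP.assoc {S : Set (Fin N)} {q q' : MvPolynomial (Fin N) K} (h : A.HP S q) (ha : Associated q q') :
    A.HP S q' := by
  obtain ⟨c, hc, rfl⟩ := assoc_iff.1 ha
  refine ⟨ha.irreducible h.irr, ?_, ?_, ?_⟩
  · rw [← smul_eq_C_mul]; exact Subalgebra.smul_mem _ h.mem _
  · obtain ⟨w, hw⟩ := h.hom; exact ⟨w, hw.Cmul c⟩
  · intro a ha'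
    rw [← smul_eq_C_mul, map_smul, LinearMap.smul_apply, smul_eq_C_mul, smul_eq_C_mul]
    exact mul_dvd_mul_left _ (h.nrm a ha')

theorem PA.br_C (a : MvPolynomial (Fin N) K) (c : K) : A.br a (C c) = 0 := by
  have h2 := (A.ham a).map_algebraMap c
  rwa [algebraMap_eq] at h2

theorem PA.br_self [CharZero K] (a : MvPolynomial (Fin N) K) : A.br a a = 0 := by
  have h1 := A.skew a a
  have e3 : (2 : MvPolynomial (Fin N) K) * A.br a a = 0 := by linear_combination h1
  exact (mul_eq_zero.1 e3).resolve_left two_ne_zero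

theorem PA.leibl (a b c : MvPolynomial (Fin N) K) : A.br (a * b) c = A.br a c * b + a * A.br b c := by
  rw [A.skew, A.leibniz, A.skew a c, A.skew b c]; ring

/-- derivation `·↦{·,a}` -/
def PA.rham (A : PA K N r) (a : MvPolynomial (Fin N) K) : Derivation K (MvPolynomial (Fin N) K) (MvPolynomial (Fin N) K) :=
  - A.ham a

theorem PA.rham_apply (a b : MvPolynomial (Fin N) K) : A.rham a b = A.br b a := by
  rw [PA.rham, Derivation.neg_apply, PA.ham_apply, A.skew b a]

theorem PA.br_mem {S : Set (Fin N)} (h : ∀ l ∈ S, ∀ m ∈ S, A.br (X l) (X m) ∈ supported K S)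
    {a b : MvPolynomial (Fin N) K} (ha : a ∈ supported K S) (hb : b ∈ supported K S) :
    A.br a b ∈ supported K S := by
  refine sup_der (A.ham a) (fun m hm => ?_) hb
  rw [PA.ham_apply, ← PA.rham_apply]
  exact sup_der _ (fun l hl => by rw [PA.rham_apply]; exact h l hl m hm) ha

theorem sg_mem {chi : Fin N → Fin r → ℤ} {S : Set (Fin N)} (g : Fin r → K)
    {a : MvPolynomial (Fin N) K} (ha : a ∈ supported K S) : sg chi g a ∈ supported K S :=
  sup_der _ (fun m hm => by rw [sg_X]; exact Subalgebra.smul_mem _ (X_mem_sup hm) _) ha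

/-- Factors of a normal homogeneous element. -/
theorem dvd_der_of_factor [CharZero K] (D : Derivation K (MvPolynomial (Fin N) K) (MvPolynomial (Fin N) K))
    {u v : MvPolynomial (Fin N) K} (hu : u ≠ 0) (hv : Prime v) (hvu : v ∣ u) (h : u ∣ D u) : v ∣ D v := by
  obtain ⟨n, w, hw, rfl⟩ := WfDvdMonoid.max_power_factor hu hv.irreducible
  have hn : n ≠ 0 := by
    rintro rfl; rw [pow_zero, one_mul] at hvu; exact hw hvu
  obtain ⟨n, rfl⟩ := Nat.exists_eq_succ_of_ne_zero hn
  have h1 : v ^ (n+1) ∣ D (v ^ (n+1) * w) := (dvd_mul_right _ _).trans h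
  rw [Derivation.leibniz, Derivation.leibniz_pow] at h1
  simp only [smul_eq_mul, nsmul_eq_mul, Nat.succ_eq_add_one, Nat.add_sub_cancel] at h1
  rw [dvd_add_right (dvd_mul_right _ _), pow_succ] at h1
  have h2 : v ^ n * v ∣ v ^ n * (w * (((n + 1 : ℕ) : MvPolynomial (Fin N) K) * D v)) := by
    convert h1 using 1; ring
  have h3 := (mul_dvd_mul_iff_left (pow_ne_zero n hv.ne_zero)).1 h2
  rcases hv.dvd_or_dvd h3 with h4 | h4
  · exact absurd h4 hw
  · rcases hv.dvd_or_dvd h4 with h5 | h5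
    · exfalso
      have h6 : (((n+1 : ℕ) : MvPolynomial (Fin N) K)) = C ((n+1 : ℕ) : K) := by simp
      rw [h6] at h5
      exact hv.not_unit (isUnit_of_dvd_unit h5 (isUnit_iff_C.2 ⟨_, by exact_mod_cast Nat.succ_ne_zero n, rfl⟩))
    · exact h5

theorem PA.HP_of_factor [CharZero K] {S : Set (Fin N)} {u v : MvPolynomial (Fin N) K} (hu : u ≠ 0)
    (hv : Irreducible v) (hvu : v ∣ u) (hmem : u ∈ supported K S) (hhom : ∃ w, Hom A.chi w u)
    (hnrm : ∀ a ∈ supported K S, u ∣ A.br u a) : A.HP S v := by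
  refine ⟨hv, sup_of_dvd hmem hu hvu, ?_, ?_⟩
  · apply Hom_of_scalar hv.ne_zero
    intro g
    apply sg_scalar_of_dvd hv.ne_zero
    refine dvd_der_of_factor _ hu hv.prime hvu ?_
    obtain ⟨w, hw⟩ := hhom
    rw [hw g, smul_eq_C_mul]; exact dvd_mul_left _ _
  · intro a ha
    rw [← PA.rham_apply]
    refine dvd_der_of_factor _ hu hv.prime hvu ?_
    rw [PA.rham_apply]; exact hnrm a ha

end HPsec

end PN

end Mod6

section Mod7
open MvPolynomial


namespace PN

section StepSec

variable {K : Type u} [Field K] [CharZero K] {N r : ℕ} {A : PA K N r}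

/-- step data -/
structure PA.SD (A : PA K N r) (S : Set (Fin N)) (k : Fin N) (h : Fin r → K) (p c : MvPolynomial (Fin N) K) : Prop where
  st : A.Stp S k h
  hp : p ∈ supported K S
  hc : c ∈ supported K S
  hp0 : p ≠ 0
  rel : IsRelPrime p c
  E : ∀ a ∈ supported K S, p ^ 2 * A.del k h a = p * A.br c a - c * A.br p a - sg A.chi h a * c * p
  wt : ∃ w, Hom A.chi w p ∧ Hom A.chi (w + A.chi k) c
  delc : A.del k h c = 0
  delp : A.del k h p = dot h (A.chi k) • c
  alt : (p = 1 ∧ c = 0) ∨ (c ≠ 0 ∧ A.HP S p)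

variable {S : Set (Fin N)} {k : Fin N} {h : Fin r → K} {p c : MvPolynomial (Fin N) K}

theorem PA.Stp.delmem (st : A.Stp S k h) {a : MvPolynomial (Fin N) K} (ha : a ∈ supported K S) :
    A.del k h a ∈ supported K S := sup_der _ st.del ha

theorem relPrime_dvd {p c a : MvPolynomial (Fin N) K} (h : IsRelPrime p c) (h2 : p ∣ c * a) : p ∣ a :=
  h.dvd_of_dvd_mul_left h2

theorem PA.Stp.mkSD (st : A.Stp S k h) (hp : p ∈ supported K S) (hc : c ∈ supported K S) (hp0 : p ≠ 0)
    (rel : IsRelPrime p c)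
    (E : ∀ a ∈ supported K S, p ^ 2 * A.del k h a = p * A.br c a - c * A.br p a - sg A.chi h a * c * p)
    (W : ∀ g, p * sg A.chi g c - c * sg A.chi g p = dot g (A.chi k) • (c * p)) :
    ∃ p c, A.SD S k h p c := by
  by_cases hc0 : c = 0
  · subst hc0
    refine ⟨1, 0, st, one_mem _, zero_mem _, one_ne_zero, isRelPrime_one_left, ?_, ⟨0, Hom.one, ?_⟩, by simp, by simp, Or.inl ⟨rfl, rfl⟩⟩
    · intro a ha
      have := E a ha
      simp only [map_zero, LinearMap.zero_apply, mul_zero, zero_mul, sub_zero] at this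
      have h2 : A.del k h a = 0 := (mul_eq_zero.1 this).resolve_left (pow_ne_zero 2 hp0)
      rw [h2]; simp
    · intro g; simp
  have e1 : p * A.del k h p = A.br c p - sg A.chi h p * c := by
    have h1 := E p hp
    rw [A.br_self] at h1
    apply mul_left_cancel₀ hp0
    linear_combination h1
  have e2 : p * A.del k h c = c * A.del k h p - C (dot h (A.chi k)) * c ^ 2 := by
    have h1 := E c hc
    have h2 := W h
    rw [smul_eq_C_mul] at h2
    rw [A.br_self, A.skew p c] at h1
    apply mul_left_cancel₀ hp0
    linear_combination h1 - c * e1 - c * h2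
  have e3 : c ∣ A.del k h c := by
    refine relPrime_dvd rel.symm (a := A.del k h c) ?_
    rw [e2]; exact dvd_sub (dvd_mul_right _ _) ((dvd_pow_self _ two_ne_zero).mul_left _)
  have delc : A.del k h c = 0 := by
    obtain ⟨q, hq⟩ := e3
    refine der_eq_zero_of_dvd (A.del k h) (st.nil c hc) (st.nil q ?_) hq
    exact sup_quot (hq ▸ st.delmem hc) hc hc0
  have delp : A.del k h p = dot h (A.chi k) • c := by
    rw [delc, mul_zero] at e2
    rw [smul_eq_C_mul]
    apply mul_left_cancel₀ hc0
    linear_combination -e2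
  have pnu : ¬ IsUnit p := by
    intro hu
    obtain ⟨x, hx, rfl⟩ := isUnit_iff_C.1 hu
    have := (A.del k h).map_algebraMap x
    rw [algebraMap_eq, delp] at this
    exact (smul_ne_zero st.lam hc0) this
  have pirr : Irreducible p := by
    refine ⟨pnu, ?_⟩
    intro a b hab
    have key : ∀ a b, p = a * b → A.del k h a = 0 → IsUnit a := by
      intro a b hab ha
      have h1 := delp
      rw [hab, Derivation.leibniz, ha, smul_zero, add_zero, smul_eq_mul] at h1
      refine rel (hab ▸ dvd_mul_right _ _) ?_
      refine ⟨C (dot h (A.chi k))⁻¹ * A.del k h b, ?_⟩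
      rw [smul_eq_C_mul] at h1
      have h3 : (C (dot h (A.chi k))⁻¹ * C (dot h (A.chi k)) : MvPolynomial (Fin N) K) = 1 := by
        rw [← C_mul, inv_mul_cancel₀ st.lam, C_1]
      linear_combination (-c) * h3 - C (dot h (A.chi k))⁻¹ * h1
    have ha0 : a ≠ 0 := by rintro rfl; exact hp0 (by rw [hab, zero_mul])
    have hb0 : b ≠ 0 := by rintro rfl; exact hp0 (by rw [hab, mul_zero])
    have ha := sup_of_dvd hp hp0 (hab ▸ dvd_mul_right a b)
    have hb := sup_of_dvd hp hp0 (hab ▸ dvd_mul_left b a)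
    rcases (der_mul_deg (A.del k h) (st.nil a ha) (st.nil b hb) ha0 hb0).2 (by
      rw [← hab, delp, Derivation.map_smul, delc, smul_zero]) with h1 | h1
    · exact Or.inl (key a b hab h1)
    · exact Or.inr (key b a (by rw [hab, mul_comm]) h1)
  have hnrm : ∀ a ∈ supported K S, p ∣ A.br p a := by
    intro a ha
    refine relPrime_dvd rel ⟨A.br c a - sg A.chi h a * c - p * A.del k h a, ?_⟩
    linear_combination E a ha
  have hhom : ∃ w, Hom A.chi w p := by
    apply Hom_of_scalar hp0
    intro g
    apply sg_scalar_of_dvd hp0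
    have := W g
    rw [smul_eq_C_mul] at this
    refine relPrime_dvd rel ⟨sg A.chi g c - C (dot g (A.chi k)) * c, ?_⟩
    linear_combination -this
  obtain ⟨w, hw⟩ := hhom
  refine ⟨p, c, st, hp, hc, hp0, rel, E, ⟨w, hw, ?_⟩, delc, delp, Or.inr ⟨hc0, pirr, hp, ⟨w, hw⟩, hnrm⟩⟩
  intro g
  have := W g
  rw [hw g, smul_eq_C_mul, smul_eq_C_mul] at this
  apply mul_left_cancel₀ hp0
  rw [dot_add, smul_eq_C_mul, map_add]
  linear_combination this


/-- the new prime -/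
def yy (k : Fin N) (p c : MvPolynomial (Fin N) K) : MvPolynomial (Fin N) K := p * X k - c

theorem PA.SD.brX (d : A.SD S k h p c) (a : MvPolynomial (Fin N) K) :
    A.br (X k) a = sg A.chi h a * X k + A.del k h a := by
  rw [PA.del_apply]; ring

theorem PA.SD.ybr (d : A.SD S k h p c) {a : MvPolynomial (Fin N) K} (ha : a ∈ supported K S) :
    p * A.br (yy k p c) a = (A.br p a + sg A.chi h a * p) * yy k p c := by
  have h1 := d.E a ha
  rw [yy, map_sub, LinearMap.sub_apply, PA.leibl, d.brX]
  linear_combination h1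

theorem PA.SD.ybrX (d : A.SD S k h p c) {w : Fin r → ℤ} (hw : Hom A.chi w p) :
    A.br (yy k p c) (X k) = - C (dot h w) * X k * yy k p c := by
  have hc : Hom A.chi (w + A.chi k) c := by
    obtain ⟨v, hv, hv'⟩ := d.wt
    rwa [Hom.unique d.hp0 hw hv]
  rw [A.skew, d.brX, yy, map_sub, map_sub, Derivation.leibniz, Derivation.leibniz, d.delc, d.delp, hw h, hc h, sg_X]
  have : A.del k h (X k) = - (C (dot h (A.chi k)) * X k * X k) := by
    rw [PA.del_apply, A.br_self, sg_X, smul_eq_C_mul]; ring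
  rw [this]
  simp only [smul_eq_C_mul, smul_eq_mul, dot_add, map_add]
  ring

theorem PA.SD.ymem (d : A.SD S k h p c) : yy k p c ∈ supported K (insert k S) :=
  sub_mem (mul_mem (supported_mono (Set.subset_insert _ _) d.hp) (X_mem_sup (Set.mem_insert _ _)))
    (supported_mono (Set.subset_insert _ _) d.hc)

theorem PA.SD.Phiy (d : A.SD S k h p c) : Phi k (yy k p c) = Polynomial.C p * Polynomial.X - Polynomial.C c :=
  Phi_lin d.st.hkS d.hp d.hc

theorem PA.SD.degy (d : A.SD S k h p c) : (Phi k (yy k p c)).natDegree = 1 := by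
  rw [d.Phiy, sub_eq_add_neg, ← Polynomial.C_neg, Polynomial.natDegree_linear d.hp0]

theorem PA.SD.ynot (d : A.SD S k h p c) : yy k p c ∉ supported K S := by
  intro hh
  have := d.degy
  rw [Phi_supp d.st.hkS hh] at this
  simp at this

theorem PA.SD.yirr (d : A.SD S k h p c) : Irreducible (yy k p c) := by
  have y0 : yy k p c ≠ 0 := by
    intro hh; exact d.ynot (hh ▸ zero_mem _)
  refine ⟨?_, ?_⟩
  · intro hu
    obtain ⟨x, hx, hx'⟩ := isUnit_iff_C.1 hu
    exact d.ynot (hx' ▸ Subalgebra.algebraMap_mem _ x)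
  · intro a b hab
    have key : ∀ a b, yy k p c = a * b → (Phi k a).natDegree = 0 → IsUnit a := by
      intro a b hab hd
      have ha : Phi k a = Polynomial.C ((Phi k a).coeff 0) := Polynomial.eq_C_of_natDegree_eq_zero hd
      have ha2 : a = (Phi k a).coeff 0 := by
        conv_lhs => rw [← Phi_eval k a, ha, Polynomial.eval_C]
      rw [← ha2] at ha
      have h1 := congrArg (Phi k) hab
      rw [d.Phiy, map_mul, ha] at h1
      have h2 := congrArg (fun q => Polynomial.coeff q 1) h1
      have h3 := congrArg (fun q => Polynomial.coeff q 0) h1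
      simp at h2 h3
      refine d.rel ⟨_, h2⟩ ⟨-(Phi k b).coeff 0, ?_⟩
      rw [mul_neg, ← h3, neg_neg]
    have ha0 : a ≠ 0 := by rintro rfl; exact y0 (by rw [hab, zero_mul])
    have hb0 : b ≠ 0 := by rintro rfl; exact y0 (by rw [hab, mul_zero])
    have h1 := d.degy
    rw [hab, map_mul, Polynomial.natDegree_mul (by simpa using (Phi_inj k).ne ha0) (by simpa using (Phi_inj k).ne hb0)] at h1
    rcases Nat.eq_zero_or_pos (Phi k a).natDegree with h2 | h2
    · exact Or.inl (key a b hab h2)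
    · exact Or.inr (key b a (by rw [hab, mul_comm]) (by omega))

theorem PA.SD.yndvd (d : A.SD S k h p c) : ¬ yy k p c ∣ p := by
  intro hh
  exact d.ynot (sup_of_dvd d.hp d.hp0 hh)

theorem PA.SD.yhom (d : A.SD S k h p c) {w : Fin r → ℤ} (hw : Hom A.chi w p) :
    Hom A.chi (w + A.chi k) (yy k p c) := by
  obtain ⟨v, hv, hv'⟩ := d.wt
  rw [Hom.unique d.hp0 hw hv]
  exact (hv.mul (Hom.X k)).sub hv'

theorem PA.SD.yHP (d : A.SD S k h p c) : A.HP (insert k S) (yy k p c) := by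
  obtain ⟨w, hw, hw'⟩ := d.wt
  refine ⟨d.yirr, d.ymem, ⟨_, d.yhom hw⟩, ?_⟩
  intro a ha
  rw [← PA.ham_apply]
  refine dvd_der_of_gen _ ?_ ha
  rintro m (rfl | hm)
  · rw [PA.ham_apply, d.ybrX hw]; exact dvd_mul_left _ _
  · rw [PA.ham_apply]
    have h1 := d.ybr (X_mem_sup (K := K) hm)
    exact (d.yirr.prime.dvd_or_dvd (a := p) ⟨_, h1.trans (mul_comm _ _)⟩).resolve_left d.yndvd

theorem PA.SD.del_dvd (d : A.SD S k h p c) {q : MvPolynomial (Fin N) K} (hq : A.HP S q)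
    (hqp : ¬ Associated q p) : q ∣ A.del k h q := by
  have h1 : q ∣ p ^ 2 * A.del k h q := by
    rw [d.E q hq.mem, A.skew c, A.skew p]
    obtain ⟨w, hw⟩ := hq.hom
    rw [hw h, smul_eq_C_mul]
    refine dvd_sub (dvd_sub ?_ ?_) ?_
    · exact ((hq.nrm c d.hc).neg_right).mul_left _
    · exact ((hq.nrm p d.hp).neg_right).mul_left _
    · exact ((dvd_mul_left _ _).mul_right _).mul_right _
  rcases hq.prime.dvd_or_dvd h1 with h2 | h2
  · exfalso
    have h3 := hq.prime.dvd_of_dvd_pow h2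
    rcases d.alt with ⟨rfl, -⟩ | ⟨-, hp⟩
    · exact hq.prime.not_unit (isUnit_of_dvd_one h3)
    · exact hqp (hq.irr.associated_of_dvd hp.irr h3)
  · exact h2

theorem PA.SD.del_zero (d : A.SD S k h p c) {q : MvPolynomial (Fin N) K} (hq : A.HP S q)
    (hqp : ¬ Associated q p) : A.del k h q = 0 := by
  obtain ⟨b, hb⟩ := d.del_dvd hq hqp
  exact der_eq_zero_of_dvd (A.del k h) (d.st.nil q hq.mem)
    (d.st.nil b (sup_quot (hb ▸ d.st.delmem hq.mem) hq.mem hq.ne_zero)) hb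

theorem PA.SD.assoc_of_del (d : A.SD S k h p c) {q : MvPolynomial (Fin N) K} (hq : A.HP S q)
    (hqp : A.del k h q ≠ 0) : Associated q p := by
  by_contra hh; exact hqp (d.del_zero hq hh)

theorem PA.HP.of_mem {T : Set (Fin N)} {q : MvPolynomial (Fin N) K} (hq : A.HP T q) (hST : S ⊆ T)
    (hm : q ∈ supported K S) : A.HP S q :=
  ⟨hq.irr, hm, hq.hom, fun a ha => hq.nrm a (supported_mono hST ha)⟩

theorem PA.SD.HP_up (d : A.SD S k h p c) {q : MvPolynomial (Fin N) K} (hq : A.HP S q)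
    (hqp : ¬ Associated q p) : A.HP (insert k S) q := by
  refine ⟨hq.irr, supported_mono (Set.subset_insert _ _) hq.mem, hq.hom, ?_⟩
  intro a ha
  rw [← PA.ham_apply]
  refine dvd_der_of_gen _ ?_ ha
  rintro m (rfl | hm)
  · rw [PA.ham_apply, A.skew, d.brX, d.del_zero hq hqp]
    obtain ⟨w, hw⟩ := hq.hom
    rw [hw h, smul_eq_C_mul, add_zero]
    exact ((dvd_mul_left _ _).mul_right _).neg_right
  · exact hq.nrm _ (X_mem_sup hm)

theorem PA.SD.HP_down (d : A.SD S k h p c) {q : MvPolynomial (Fin N) K} (hq : A.HP (insert k S) q)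
    (hm : q ∈ supported K S) : A.HP S q ∧ ¬ Associated q p := by
  have hS := hq.of_mem (Set.subset_insert _ _) hm
  refine ⟨hS, ?_⟩
  intro hh
  rcases d.alt with ⟨rfl, -⟩ | ⟨hc0, hp⟩
  · exact hq.irr.not_isUnit (hh.isUnit_iff.2 isUnit_one)
  · have h1 := (hq.assoc hh).nrm (X k) (X_mem_sup (Set.mem_insert _ _))
    obtain ⟨w, hw, hw'⟩ := d.wt
    rw [A.skew, d.brX, d.delp, hw h, dvd_neg, smul_eq_C_mul, smul_eq_C_mul] at h1
    rw [dvd_add_right ((dvd_mul_left _ _).mul_right _)] at h1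
    have h2 : p ∣ c := by
      rcases hp.prime.dvd_or_dvd h1 with h3 | h3
      · exact absurd (isUnit_of_dvd_unit h3 (isUnit_iff_C.2 ⟨_, d.st.lam, rfl⟩)) hp.irr.not_isUnit
      · exact h3
    exact hp.irr.not_isUnit (d.rel dvd_rfl h2)

end StepSec

end PN

end Mod7

section Mod8
open MvPolynomial


namespace PN

section StepSec

variable {K : Type u} [Field K] [CharZero K] {N r : ℕ} {A : PA K N r}
variable {S : Set (Fin N)} {k : Fin N} {h : Fin r → K} {p c : MvPolynomial (Fin N) K}

theorem PA.SD.kp (d : A.SD S k h p c) {a : MvPolynomial (Fin N) K} (ha : a ∈ supported K S) :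
    ∃ x, A.br p a = x * p ∧ A.br c a = p * A.del k h a + c * (x + sg A.chi h a) := by
  have h1 : p ∣ A.br p a := by
    rcases d.alt with ⟨rfl, -⟩ | ⟨-, hp⟩
    · exact one_dvd _
    · exact hp.nrm a ha
  obtain ⟨x, hx⟩ := h1
  refine ⟨x, by rw [hx, mul_comm], ?_⟩
  have := d.E a ha
  apply mul_left_cancel₀ d.hp0
  rw [hx] at this
  linear_combination -this

theorem PA.SD.hstar (d : A.SD S k h p c) {q : MvPolynomial (Fin N) K} (hq : A.HP (insert k S) q)
    {n : ℕ} (hn : n = (Phi k q).natDegree)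
    {rr : MvPolynomial (Fin N) K} (hr : rr = ∑ i ∈ Finset.range (n+1), (Phi k q).coeff i * p ^ (n - i) * c ^ i)
    {a : MvPolynomial (Fin N) K} (ha : a ∈ supported K S) :
    ∃ κ, A.br rr a = κ * rr ∧ A.br ((Phi k q).coeff n * p ^ n) a = (κ - n * sg A.chi h a) * ((Phi k q).coeff n * p ^ n) := by
  obtain ⟨κ, hκ⟩ := hq.nrm a (supported_mono (Set.subset_insert _ _) ha)
  obtain ⟨x, hx, hcx⟩ := d.kp ha
  set u := sg A.chi h a with hu
  set v := A.del k h a with hv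
  have hco := Phi_der_coeff d.st.hkS (A.rham a) (fun b hb => by rw [PA.rham_apply]; exact PA.br_mem d.st.pois hb ha)
    (u := u) (v := v) (sg_mem h ha) (d.st.delmem ha) (by rw [PA.rham_apply, d.brX]) hq.mem
  simp only [PA.rham_apply] at hco
  have q0 := hq.ne_zero
  have Pq0 : Phi k q ≠ 0 := by simpa using (Phi_inj k).ne q0
  have hκd : (Phi k κ).natDegree = 0 := by
    by_cases hκ0 : κ = 0
    · rw [hκ0]; simp
    have h1 : (Phi k (A.br q a)).natDegree ≤ n := by
      rw [Polynomial.natDegree_le_iff_coeff_eq_zero]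
      intro i hi
      rw [hco, Polynomial.coeff_eq_zero_of_natDegree_lt (by omega), Polynomial.coeff_eq_zero_of_natDegree_lt (by omega)]
      simp
    rw [hκ, map_mul, Polynomial.natDegree_mul Pq0 (by simpa using (Phi_inj k).ne hκ0), ← hn] at h1
    omega
  have hκC : Phi k κ = Polynomial.C κ := by
    have ha : Phi k κ = Polynomial.C ((Phi k κ).coeff 0) := Polynomial.eq_C_of_natDegree_eq_zero hκd
    have ha2 : κ = (Phi k κ).coeff 0 := by
      conv_lhs => rw [← Phi_eval k κ, ha, Polynomial.eval_C]
    rwa [← ha2] at ha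
  have hcoef : ∀ i : ℕ, A.br ((Phi k q).coeff i) a = κ * (Phi k q).coeff i - i * u * (Phi k q).coeff i -
      (i+1) * v * (Phi k q).coeff (i+1) := by
    intro i
    have h1 := hco i
    rw [hκ, map_mul, hκC, mul_comm, Polynomial.coeff_C_mul] at h1
    rw [h1]; ring
  have hpow : ∀ (b z : MvPolynomial (Fin N) K) (m : ℕ), A.br (z ^ (m+1)) b = (m+1) * z ^ m * A.br z b := by
    intro b z m
    rw [← PA.rham_apply, Derivation.leibniz_pow, PA.rham_apply]
    simp [mul_assoc]
  have hpp : ∀ m : ℕ, A.br (p ^ m) a = m * x * p ^ m := by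
    intro m
    rcases m with _ | m
    · have := A.br_C a 1; rw [C_1] at this; rw [pow_zero, A.skew, this]; simp
    · rw [hpow, hx]; push_cast; ring
  refine ⟨n * x + κ, ?_, ?_⟩
  · set G : ℕ → MvPolynomial (Fin N) K := fun i => i * (Phi k q).coeff i * p ^ (n + 1 - i) * c ^ (i - 1) * v with hG
    have key : ∀ i ∈ Finset.range (n+1), A.br ((Phi k q).coeff i * p ^ (n - i) * c ^ i) a =
        (n * x + κ) * ((Phi k q).coeff i * p ^ (n - i) * c ^ i) - (G (i+1) - G i) := by
      intro i hi
      have hi' : i ≤ n := Nat.lt_succ_iff.1 (Finset.mem_range.1 hi)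
      obtain ⟨m, rfl⟩ := Nat.exists_eq_add_of_le hi'
      rw [PA.leibl, PA.leibl, hcoef, hpp]
      have e1 : i + m - i = m := by omega
      have e2 : i + m + 1 - (i + 1) = m := by omega
      have e3 : i + m + 1 - i = m + 1 := by omega
      simp only [hG, e1, e2, e3, Nat.add_sub_cancel]
      rcases i with _ | i
      · have := A.br_C a 1; rw [C_1] at this; rw [pow_zero, A.skew 1, this]; push_cast; simp; ring
      · rw [hpow, hcx]; simp only [Nat.add_sub_cancel]; push_cast; ring
    rw [hr, map_sum, LinearMap.sum_apply, Finset.sum_congr rfl key, Finset.sum_sub_distrib, Finset.sum_range_sub,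
      Finset.mul_sum]
    have : G (n+1) = 0 := by
      simp only [hG]; rw [Polynomial.coeff_eq_zero_of_natDegree_lt (by omega)]; simp
    rw [this]; simp [hG]
  · rw [PA.leibl, hcoef, hpp, Polynomial.coeff_eq_zero_of_natDegree_lt (n := n+1) (by omega)]
    ring

theorem Hom.sum {chi : Fin N → Fin r → ℤ} {ι : Type*} (s : Finset ι) (f : ι → MvPolynomial (Fin N) K)
    {w : Fin r → ℤ} (hf : ∀ i ∈ s, Hom chi w (f i)) : Hom chi w (∑ i ∈ s, f i) := by
  classical
  induction s using Finset.induction_on with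
  | empty => intro g; simp
  | insert a s ha ih =>
    rw [Finset.sum_insert ha]
    exact (hf a (Finset.mem_insert_self _ _)).add (ih fun i hi => hf i (Finset.mem_insert_of_mem hi))

theorem PA.SD.HP_new (d : A.SD S k h p c) {q : MvPolynomial (Fin N) K} (hq : A.HP (insert k S) q)
    (hm : q ∉ supported K S) : Associated q (yy k p c) := by
  obtain ⟨w, hw, hw'⟩ := d.wt
  obtain ⟨wq, hwq⟩ := hq.hom
  set n := (Phi k q).natDegree with hn
  have hn0 : n ≠ 0 := by
    intro h0
    have ha : Phi k q = Polynomial.C ((Phi k q).coeff 0) := Polynomial.eq_C_of_natDegree_eq_zero (hn ▸ h0)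
    have ha2 : q = (Phi k q).coeff 0 := by
      conv_lhs => rw [← Phi_eval k q, ha, Polynomial.eval_C]
    exact hm (ha2 ▸ Phi_coeff' hq.mem 0)
  set rr := ∑ i ∈ Finset.range (n+1), (Phi k q).coeff i * p ^ (n - i) * c ^ i with hr
  have hyd : yy k p c ∣ p ^ n * q - rr := by
    have e1 : p ^ n * q = ∑ i ∈ Finset.range (n+1), (Phi k q).coeff i * p ^ (n - i) * (p * X k) ^ i := by
      conv_lhs => rw [← Phi_eval k q, Polynomial.eval_eq_sum_range, Finset.mul_sum]
      refine Finset.sum_congr rfl fun i hi => ?_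
      have hi' : i ≤ n := Nat.lt_succ_iff.1 (Finset.mem_range.1 hi)
      rw [mul_pow, ← Nat.sub_add_cancel hi', pow_add]
      simp; ring
    rw [e1, hr, ← Finset.sum_sub_distrib]
    refine Finset.dvd_sum fun i _ => ?_
    rw [← mul_sub]
    exact (sub_dvd_pow_sub_pow _ _ i).mul_left _
  have hrr0 : rr = 0 := by
    by_contra hr0
    have Pq0 : Phi k q ≠ 0 := by simpa using (Phi_inj k).ne hq.ne_zero
    set t := (Phi k q).coeff n with ht
    have ht0 : t ≠ 0 := by rw [ht, hn]; exact Polynomial.leadingCoeff_ne_zero.2 Pq0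
    set B := t * p ^ n with hB
    have hB0 : B ≠ 0 := mul_ne_zero ht0 (pow_ne_zero _ d.hp0)
    have hco := fun i => Hom.coeff d.st.hkS hq.mem hwq i
    have hBw : Hom A.chi (wq - (n : ℤ) • A.chi k + n • w) B := (hco n).mul (hw.pow n)
    have hrw : Hom A.chi (wq + n • w) rr := by
      refine Hom.sum _ _ fun i hi => ?_
      have hi' : i ≤ n := Nat.lt_succ_iff.1 (Finset.mem_range.1 hi)
      have := ((hco i).mul (hw.pow (n - i))).mul (hw'.pow i)
      convert this using 1
      conv_lhs => rw [← Nat.sub_add_cancel hi', add_smul]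
      funext j; simp; ring
    have hmemB : B ∈ supported K S := mul_mem (Phi_coeff' hq.mem n) (pow_mem d.hp n)
    have hmemr : rr ∈ supported K S := sum_mem fun i _ =>
      mul_mem (mul_mem (Phi_coeff' hq.mem i) (pow_mem d.hp _)) (pow_mem d.hc _)
    obtain ⟨κ1, h1, h2⟩ := d.hstar hq hn hr hmemr
    obtain ⟨κ2, h3, h4⟩ := d.hstar hq hn hr hmemB
    rw [← ht, ← hB] at h2 h4
    rw [A.br_self] at h1 h4
    have e1 : κ1 = 0 := (mul_eq_zero.1 h1.symm).resolve_right hr0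
    have e2 : κ2 - n * sg A.chi h B = 0 := (mul_eq_zero.1 h4.symm).resolve_right hB0
    rw [hBw h, smul_eq_C_mul] at e2
    rw [hrw h, e1, smul_eq_C_mul] at h2
    have h5 := A.skew B rr
    rw [h2, h3] at h5
    have h6 : ((n : MvPolynomial (Fin N) K) * C (dot h (A.chi k)) * (n : MvPolynomial (Fin N) K)) * (B * rr) = 0 := by
      have e3 : (C (dot h (wq - (n : ℤ) • A.chi k + n • w)) : MvPolynomial (Fin N) K) =
          C (dot h (wq + n • w)) - (n : MvPolynomial (Fin N) K) * C (dot h (A.chi k)) := by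
        have : (wq - (n : ℤ) • A.chi k + n • w) = (wq + n • w) - (n : ℤ) • A.chi k := by abel
        rw [this, dot_sub, dot_smul]; simp
      rw [e3] at e2
      linear_combination rr * e2 - h5
    have h7 : ((n : MvPolynomial (Fin N) K) * C (dot h (A.chi k)) * (n : MvPolynomial (Fin N) K)) ≠ 0 := by
      refine mul_ne_zero (mul_ne_zero ?_ ?_) ?_
      · exact_mod_cast hn0
      · simpa using d.st.lam
      · exact_mod_cast hn0
    exact (mul_ne_zero h7 (mul_ne_zero hB0 hr0)) h6
  rw [hrr0, sub_zero] at hyd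
  rcases d.yirr.prime.dvd_or_dvd hyd with h1 | h1
  · exact absurd (d.yirr.prime.dvd_of_dvd_pow h1) d.yndvd
  · exact (d.yirr.associated_of_dvd hq.irr h1).symm

theorem PA.SD.HP_iff (d : A.SD S k h p c) {q : MvPolynomial (Fin N) K} : A.HP (insert k S) q ↔
    Associated q (yy k p c) ∨ (A.HP S q ∧ ¬ Associated q p) := by
  constructor
  · intro hq
    by_cases hm : q ∈ supported K S
    · exact Or.inr (d.HP_down hq hm)
    · exact Or.inl (d.HP_new hq hm)
  · rintro (hh | ⟨h1, h2⟩)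
    · exact d.yHP.assoc hh.symm
    · exact d.HP_up h1 h2

end StepSec

end PN

end Mod8

section Mod9
open MvPolynomial


namespace PN

section IntSec

variable {K : Type u} [Field K] [CharZero K] {N r : ℕ} (A : PA K N r)

/-- interval -/
def I (a b : ℕ) : Set (Fin N) := {l | a ≤ l.val ∧ l.val < b}

theorem mem_I {a b : ℕ} {l : Fin N} : l ∈ (I a b : Set (Fin N)) ↔ a ≤ l.val ∧ l.val < b := Iff.rfl

theorem I_mono {a b a' b' : ℕ} (h1 : a' ≤ a) (h2 : b ≤ b') : (I a b : Set (Fin N)) ⊆ I a' b' :=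
  fun l hl => ⟨h1.trans hl.1, lt_of_lt_of_le hl.2 h2⟩

theorem I_insr {a : ℕ} {k : Fin N} (h : a ≤ k.val) : (I a (k.val+1) : Set (Fin N)) = insert k (I a k.val) := by
  ext l
  simp only [mem_I, Set.mem_insert_iff, Fin.ext_iff]; omega

theorem I_insl {b : ℕ} {i : Fin N} (h : i.val < b) : (I i.val b : Set (Fin N)) = insert i (I (i.val+1) b) := by
  ext l
  simp only [mem_I, Set.mem_insert_iff, Fin.ext_iff]; omega

theorem I_empty {a b : ℕ} (h : b ≤ a) : (I a b : Set (Fin N)) = ∅ := by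
  ext l
  simp only [mem_I, Set.mem_empty_iff_false, iff_false]; omega

theorem I_inter {a b a' b' : ℕ} : (I a b ∩ I a' b' : Set (Fin N)) = I (max a a') (min b b') := by
  ext l
  simp only [mem_I, Set.mem_inter_iff]; omega

theorem I_univ : (I 0 N : Set (Fin N)) = Set.univ := by
  ext l; simp [mem_I]

theorem PA.brXX_mem {a b : ℕ} {l m : Fin N} (hl : l ∈ (I a b : Set (Fin N))) (hm : m ∈ (I a b : Set (Fin N))) :
    A.br (X l) (X m) ∈ supported K (I a b : Set (Fin N)) := by
  have key : ∀ l m : Fin N, l ∈ (I a b : Set (Fin N)) → m ∈ (I a b : Set (Fin N)) → l < m →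
      A.br (X m) (X l) ∈ supported K (I a b : Set (Fin N)) := by
    intro l m hl hm hlm
    have h1 := A.stab l m hlm
    have h2 : A.br (X m) (X l) = (A.br (X m) (X l) - dot (A.hk m) (A.chi l) • (X l * X m)) + dot (A.hk m) (A.chi l) • (X l * X m) := by
      ring
    rw [h2]
    refine add_mem (supported_mono ?_ h1) (Subalgebra.smul_mem _ (mul_mem (X_mem_sup hl) (X_mem_sup hm)) _)
    rintro t ⟨ht1, ht2⟩
    simp only [mem_I, Fin.lt_def] at *; omega
  rcases lt_trichotomy l m with h | h | h
  · rw [A.skew]; exact neg_mem (key l m hl hm h)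
  · rw [h, A.br_self]; exact zero_mem _
  · exact key m l hm hl h

theorem nilp_of {k : Fin N} {h : Fin r → K} {S T : Set (Fin N)} (hST : S ⊆ T)
    (hh : ∀ a ∈ supported K T, ∃ n, (fun a => A.br (X k) a - X k * sg A.chi h a)^[n] a = 0) :
    ∀ a ∈ supported K S, Nilp (A.del k h) a := by
  intro a ha
  obtain ⟨n, hn⟩ := hh a (supported_mono hST ha)
  exact ⟨n, hn⟩

theorem PA.del_X_mem {l m : Fin N} (hlm : l < m) : A.del m (A.hk m) (X l) ∈ supported K (Set.Ioo l m) := by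
  have := A.stab l m hlm
  rw [PA.del_apply, sg_X]
  convert this using 2
  rw [mul_smul_comm, mul_comm]

theorem PA.delr_X {l m : Fin N} (hlm : l < m) : A.del l (A.hr l) (X m) = - A.del m (A.hk m) (X l) := by
  rw [PA.del_apply, PA.del_apply, sg_X, sg_X, A.cross l m hlm, A.skew (X l)]
  simp only [smul_eq_C_mul, map_neg]; ring

theorem PA.stpR {a : ℕ} (k : Fin N) : A.Stp (I a k.val) k (A.hk k) where
  hkS := by simp [mem_I]
  pois := fun l hl m hm => A.brXX_mem hl hm
  del := by
    intro m hm
    refine supported_mono ?_ (A.del_X_mem (l := m) (m := k) hm.2)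
    rintro t ⟨ht1, ht2⟩
    simp only [mem_I, Fin.lt_def] at *; omega
  nil := nilp_of A (fun l hl => hl.2) (A.nil k)
  lam := A.lam_ne k

theorem PA.stpL {b : ℕ} (i : Fin N) : A.Stp (I (i.val+1) b) i (A.hr i) where
  hkS := by simp [mem_I]
  pois := fun l hl m hm => A.brXX_mem hl hm
  del := by
    intro m hm
    rw [A.delr_X (l := i) (m := m) hm.1]
    refine neg_mem (supported_mono ?_ (A.del_X_mem (l := i) (m := m) hm.1))
    rintro t ⟨ht1, ht2⟩
    simp only [mem_I, Fin.lt_def] at *; omega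
  nil := nilp_of A (fun l hl => hl.1) (A.nilr i)
  lam := A.lamr_ne i

theorem PA.exTor (a b : ℕ) (hb : b ≤ N) : ∃ Y θ q, Tor (FractionRing (MvPolynomial (Fin N) K)) A (I a b) Y θ q := by
  induction b with
  | zero => rw [I_empty (Nat.zero_le a)]; exact ⟨_, _, _, tor_empty⟩
  | succ b ih =>
    rcases Nat.lt_or_ge b a with h | h
    · rw [I_empty h]; exact ⟨_, _, _, tor_empty⟩
    · obtain ⟨Y, θ, q, T⟩ := ih (by omega)
      rw [I_insr (k := ⟨b, by omega⟩) h]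
      exact T.insert (A.stpR ⟨b, by omega⟩)

theorem PA.exSDR (a : ℕ) (k : Fin N) : ∃ p c, A.SD (I a k.val) k (A.hk k) p c := by
  obtain ⟨Y, θ, q, T⟩ := A.exTor a k.val k.2.le
  obtain ⟨p, hp, c, hc, hp0, hrel, hE, hW⟩ := T.interface (A.stpR k)
  exact (A.stpR k).mkSD hp hc hp0 hrel hE hW

theorem PA.exSDL (i : Fin N) (b : ℕ) (hb : b ≤ N) : ∃ p c, A.SD (I (i.val+1) b) i (A.hr i) p c := by
  obtain ⟨Y, θ, q, T⟩ := A.exTor (i.val+1) b hb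
  obtain ⟨p, hp, c, hc, hp0, hrel, hE, hW⟩ := T.interface (A.stpL i)
  exact (A.stpL i).mkSD hp hc hp0 hrel hE hW

/-- `pred j + 1`, or `0` -/
def PA.pd (j : Fin N) : ℕ := by
  classical exact (Finset.univ.filter fun l : Fin N => l < j ∧ A.del j (A.hk j) (X l) ≠ 0).sup fun l => l.val + 1

theorem PA.pd_le (j : Fin N) : A.pd j ≤ j.val := by
  classical
  unfold PA.pd
  refine Finset.sup_le fun l hl => ?_
  have := (Finset.mem_filter.1 hl).2.1
  exact this

theorem PA.pd_zero {j l : Fin N} (h1 : A.pd j ≤ l.val) (h2 : l < j) : A.del j (A.hk j) (X l) = 0 := by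
  classical
  by_contra hh
  have : l.val + 1 ≤ A.pd j := by
    unfold PA.pd
    exact Finset.le_sup (f := fun l : Fin N => l.val + 1) (Finset.mem_filter.2 ⟨Finset.mem_univ _, h2, hh⟩)
  omega

theorem PA.pd_ne {j l : Fin N} (h : A.pd j = l.val + 1) : l < j ∧ A.del j (A.hk j) (X l) ≠ 0 := by
  classical
  unfold PA.pd at h
  rcases Finset.eq_empty_or_nonempty (Finset.univ.filter fun l : Fin N => l < j ∧ A.del j (A.hk j) (X l) ≠ 0) with h0 | h0
  · rw [h0] at h; simp at h
  · obtain ⟨m, hm, hm'⟩ := Finset.exists_mem_eq_sup _ h0 (fun l : Fin N => l.val + 1)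
    rw [hm'] at h
    have : m = l := Fin.ext (by omega)
    rw [← this]; exact (Finset.mem_filter.1 hm).2

theorem PA.del_zero_of_pd {j : Fin N} {b : ℕ} (h : A.pd j ≤ b) {a : MvPolynomial (Fin N) K}
    (ha : a ∈ supported K (I b j.val : Set (Fin N))) : A.del j (A.hk j) a = 0 := by
  have := dvd_der_of_gen (A.del j (A.hk j)) (p := 0) (S := I b j.val) (fun m hm => by
    rw [A.pd_zero (h.trans hm.1) hm.2]) ha
  exact zero_dvd_iff.1 this

variable (γ : Fin N → K)

/-- the interval variables -/
def PA.T (b n : ℕ) : MvPolynomial (Fin N) K :=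
  if h : n ≤ b ∨ N < n then 1 else
    have h2 : n - 1 < N := by omega
    have : A.pd ⟨n - 1, h2⟩ < n := by have := A.pd_le ⟨n - 1, h2⟩; simp only at this; omega
    (PA.T b (A.pd ⟨n - 1, h2⟩)) * (C (γ ⟨n - 1, h2⟩) * X ⟨n - 1, h2⟩) -
      C ((dot (A.hk ⟨n - 1, h2⟩) (A.chi ⟨n - 1, h2⟩))⁻¹ * γ ⟨n - 1, h2⟩) * A.del ⟨n - 1, h2⟩ (A.hk ⟨n - 1, h2⟩) (PA.T b (A.pd ⟨n - 1, h2⟩))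
termination_by n

theorem PA.T_le {b n : ℕ} (h : n ≤ b) : A.T γ b n = 1 := by
  rw [PA.T, dif_pos (Or.inl h)]

/-- the `c` of the step -/
def PA.cT (b : ℕ) (j : Fin N) : MvPolynomial (Fin N) K :=
  (dot (A.hk j) (A.chi j))⁻¹ • A.del j (A.hk j) (A.T γ b (A.pd j))

theorem PA.T_succ {b : ℕ} {j : Fin N} (h : b ≤ j.val) :
    A.T γ b (j.val + 1) = C (γ j) * yy j (A.T γ b (A.pd j)) (A.cT γ b j) := by
  rw [PA.T, dif_neg (by omega)]
  simp only [Nat.add_sub_cancel, PA.cT, yy, smul_eq_C_mul, map_mul]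
  ring

theorem PA.T_mem (b n : ℕ) : A.T γ b n ∈ supported K (I b n : Set (Fin N)) := by
  induction n using Nat.strong_induction_on with
  | _ n ih =>
    by_cases h : n ≤ b ∨ N < n
    · rw [PA.T, dif_pos h]; exact one_mem _
    · obtain ⟨j, rfl⟩ : ∃ j : Fin N, n = j.val + 1 := ⟨⟨n - 1, by omega⟩, by simp only; omega⟩
      have hb : b ≤ j.val := by omega
      have hp := ih (A.pd j) (by have := A.pd_le j; omega)
      have hp' := supported_mono (I_mono (le_refl b) (A.pd_le j)) hp
      rw [A.T_succ γ hb]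
      refine mul_mem (Subalgebra.algebraMap_mem _ _) (sub_mem (mul_mem (supported_mono (I_mono le_rfl (Nat.le_succ _)) hp') (X_mem_sup ⟨hb, Nat.lt_succ_self _⟩)) ?_)
      exact Subalgebra.smul_mem _ (supported_mono (I_mono le_rfl (Nat.le_succ _)) ((A.stpR j).delmem hp')) _

end IntSec

end PN

end Mod9

section Mod10
open MvPolynomial


namespace PN

section PredSec

variable {K : Type u} [Field K] [CharZero K] {N r : ℕ} {A : PA K N r}

theorem sup_assoc {S : Set (Fin N)} {a b : MvPolynomial (Fin N) K} (h : b ∈ supported K S)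
    (hab : Associated a b) : a ∈ supported K S := by
  obtain ⟨c, hc, rfl⟩ := assoc_iff.1 hab.symm
  exact mul_mem (Subalgebra.algebraMap_mem _ _) h

theorem PA.SD.scale {S : Set (Fin N)} {k : Fin N} {h : Fin r → K} {p c p' : MvPolynomial (Fin N) K}
    (d : A.SD S k h p c) (hp : Associated p p') (hone : p = 1 → p' = 1) :
    A.SD S k h p' ((dot h (A.chi k))⁻¹ • A.del k h p') := by
  obtain ⟨μ, hμ, rfl⟩ := assoc_iff.1 hp
  have e : (dot h (A.chi k))⁻¹ • A.del k h (C μ * p) = C μ * c := by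
    rw [← smul_eq_C_mul, Derivation.map_smul, d.delp, smul_smul, smul_smul, ← smul_eq_C_mul]
    congr 1; field_simp [d.st.lam]
  rw [e]
  have hu : IsUnit (C μ : MvPolynomial (Fin N) K) := isUnit_iff_C.2 ⟨μ, hμ, rfl⟩
  have hd : A.del k h (C μ * c) = 0 := by rw [← smul_eq_C_mul, Derivation.map_smul, d.delc, smul_zero]
  refine ⟨d.st, mul_mem (Subalgebra.algebraMap_mem _ _) d.hp, mul_mem (Subalgebra.algebraMap_mem _ _) d.hc,
    mul_ne_zero hu.ne_zero d.hp0, ?_, ?_, ?_, hd, ?_, ?_⟩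
  · exact (isRelPrime_mul_unit_left hu).2 d.rel
  · intro a ha
    have := d.E a ha
    rw [← smul_eq_C_mul, ← smul_eq_C_mul, map_smul, map_smul, LinearMap.smul_apply, LinearMap.smul_apply]
    simp only [smul_eq_C_mul]
    linear_combination (C μ)^2 * this
  · obtain ⟨w, hw, hw'⟩ := d.wt
    exact ⟨w, hw.Cmul μ, hw'.Cmul μ⟩
  · rw [← smul_eq_C_mul, Derivation.map_smul, d.delp, ← smul_eq_C_mul, smul_comm]
  · rcases d.alt with ⟨h1, h2⟩ | ⟨h1, h2⟩
    · left; exact ⟨hone h1, by rw [h2, mul_zero]⟩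
    · right; exact ⟨mul_ne_zero hu.ne_zero h1, h2.assoc hp⟩

theorem PA.SD.p_irr_or {S : Set (Fin N)} {k : Fin N} {h : Fin r → K} {p c : MvPolynomial (Fin N) K}
    (d : A.SD S k h p c) (hp : p ≠ 1) : c ≠ 0 ∧ A.HP S p := by
  rcases d.alt with ⟨h1, h2⟩ | h1
  · exact absurd h1 hp
  · exact h1

/-- coefficients of linear polynomials in a variable -/
theorem coeff_of_yy {k : Fin N} {S : Set (Fin N)} (hk : k ∉ S) {p c : MvPolynomial (Fin N) K}
    (hp : p ∈ supported K S) (hc : c ∈ supported K S) {T : Set (Fin N)} (h : yy k p c ∈ supported K T) :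
    p ∈ supported K T ∧ c ∈ supported K T := by
  have h1 := Phi_coeff k h
  rw [yy, Phi_lin hk hp hc] at h1
  constructor
  · have := h1 1; simp at this
    exact supported_mono Set.diff_subset this
  · have := h1 0; simp at this
    exact supported_mono Set.diff_subset this

variable (A) (γ : Fin N → K)

theorem one_not_sd {S : Set (Fin N)} {q : MvPolynomial (Fin N) K} (h : A.HP S q) : ¬ Associated q 1 :=
  fun hh => h.irr.not_isUnit (hh.isUnit_iff.2 isUnit_one)

theorem C_assoc {μ : K} (hμ : μ ≠ 0) (a : MvPolynomial (Fin N) K) : Associated (C μ * a) a :=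
  (assoc_iff.2 ⟨μ, hμ, rfl⟩).symm

theorem PA.pred (hγ : ∀ j, γ j ≠ 0) (b : ℕ) :
    ∀ j : Fin N, b ≤ j.val → A.SD (I b j.val) j (A.hk j) (A.T γ b (A.pd j)) (A.cT γ b j) := by
  rcases Nat.lt_or_ge N b with hN | hN
  · intro j hj; omega
  induction hN using Nat.decreasingInduction with
  | self => intro j hj; omega
  | of_succ b hbN IHb =>
    intro j
    obtain ⟨n, hn⟩ : ∃ n, n = j.val := ⟨_, rfl⟩
    induction n using Nat.strong_induction_on generalizing j with
    | _ n IHj =>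
    subst hn
    intro hbj
    have IHj' : ∀ l : Fin N, b ≤ l.val → l < j → A.SD (I b l.val) l (A.hk l) (A.T γ b (A.pd l)) (A.cT γ b l) :=
      fun l h1 h2 => IHj l.val h2 l rfl h1
    obtain ⟨p, c, d⟩ := A.exSDR b j
    -- elements with top variable `l`
    have top : ∀ l : Fin N, b ≤ l.val → l < j → ∀ q, A.HP (I b j.val) q → q ∈ supported K (I b (l.val+1) : Set (Fin N)) →
        q ∉ supported K (I b l.val : Set (Fin N)) → Associated q (A.T γ b (l.val + 1)) := by
      intro l h1 h2 q hq hm hnm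
      have h3 := hq.of_mem (S := I b (l.val+1)) (I_mono le_rfl h2) hm
      rw [I_insr h1] at h3
      have h4 := (IHj' l h1 h2).HP_new h3 hnm
      rw [A.T_succ γ h1]
      exact h4.trans (C_assoc (hγ l) _).symm
    unfold PA.cT
    rcases Nat.lt_or_ge b (A.pd j) with hpd | hpd
    swap
    · -- trivial case
      have h1 : A.T γ b (A.pd j) = 1 := A.T_le γ hpd
      have h2 : p = 1 := by
        by_contra hp
        obtain ⟨hc, hp'⟩ := d.p_irr_or hp
        have := d.delp
        rw [A.del_zero_of_pd hpd d.hp] at this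
        exact (smul_ne_zero d.st.lam hc) this.symm
      rw [h1]
      exact d.scale (by rw [h2]) (fun _ => rfl)
    obtain ⟨l, hl⟩ : ∃ l : Fin N, A.pd j = l.val + 1 :=
      ⟨⟨A.pd j - 1, by have := A.pd_le j; omega⟩, by simp only; omega⟩
    have hbl : b ≤ l.val := by omega
    obtain ⟨hlj, hdl⟩ := A.pd_ne hl
    have hp1 : p ≠ 1 := by
      rintro rfl
      have hc : c = 0 := by
        rcases d.alt with ⟨_, h1⟩ | ⟨_, h1⟩
        · exact h1
        · exact absurd (Associated.refl _) (one_not_sd A h1)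
      have := d.E (X l) (X_mem_sup ⟨hbl, hlj⟩)
      rw [hc] at this
      simp at this
      exact hdl this
    obtain ⟨hc0, hHP⟩ := d.p_irr_or hp1
    refine d.scale ?_ (fun h => absurd h hp1)
    rw [hl]
    have hbj' : b < j.val := lt_of_le_of_lt hbl hlj
    have e1 := IHb j hbj'
    by_cases hpb : p ∈ supported K (I (b+1) j.val : Set (Fin N))
    · -- p does not involve x_b
      have h1 := hHP.of_mem (I_mono (Nat.le_succ b) le_rfl) hpb
      have h2 : A.del j (A.hk j) p ≠ 0 := by
        rw [d.delp]; exact smul_ne_zero d.st.lam hc0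
      have h3 := e1.assoc_of_del h1 h2
      rw [hl] at h3
      rcases Nat.lt_or_ge l.val (b+1) with hlb | hlb
      · rw [A.T_le γ hlb] at h3; exact absurd h3 (one_not_sd A h1)
      · have h4 : p ∈ supported K (I (b+1) (l.val+1) : Set (Fin N)) := by
          exact sup_assoc (A.T_mem γ (b+1) (l.val+1)) h3
        refine top l hbl hlj p hHP (supported_mono (I_mono (Nat.le_succ _) le_rfl) h4) ?_
        intro h5
        have h6 := sup_inter h5 hpb
        rw [I_inter] at h6
        have h7 : A.T γ (b+1) (l.val+1) ∈ supported K (I (b+1) l.val : Set (Fin N)) := by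
          refine sup_assoc (supported_mono (I_mono ?_ ?_) h6) h3.symm <;> omega
        rw [A.T_succ γ hlb] at h7
        exact (IHb l hlb).ynot (sup_assoc h7 (C_assoc (hγ l) _).symm)
    · -- p involves x_b
      set bb : Fin N := ⟨b, hbN⟩ with hbb
      obtain ⟨pl, cl, dl⟩ := A.exSDL bb (j.val+1) j.2
      obtain ⟨pl', cl', dl'⟩ := A.exSDL bb j.val j.2.le
      have hbbj : bb.val < j.val := hbj'
      have y1 : A.HP (I b (j.val+1)) (yy j p c) := by rw [I_insr hbj]; exact d.yHP
      have y2 : Associated (yy j p c) (yy bb pl cl) := by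
        refine dl.HP_new (by rw [← I_insl (i := bb) (Nat.lt_succ_of_lt hbbj)]; exact y1) ?_
        intro h5
        have h6 := (coeff_of_yy d.st.hkS d.hp d.hc h5).1
        have h7 := sup_inter h6 d.hp
        rw [I_inter] at h7
        exact hpb (supported_mono (I_mono (by simp [hbb]) (by simp)) h7)
      have y3 : Associated p (yy bb pl' cl') := by
        refine dl'.HP_new (by rw [← I_insl (i := bb) hbbj]; exact hHP) ?_
        exact hpb
      obtain ⟨μ, hμ, y2⟩ := assoc_iff.1 y2.symm
      obtain ⟨ν, hν, y3'⟩ := assoc_iff.1 y3.symm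
      have hinj := dl.st.hkS
      -- compare the coefficients of `x_b`
      have hS1 : ∀ {a : MvPolynomial (Fin N) K}, a ∈ supported K (I (b+1) j.val : Set (Fin N)) →
          a ∈ supported K (I (b+1) (j.val+1) : Set (Fin N)) := fun ha => supported_mono (I_mono le_rfl (Nat.le_succ _)) ha
      have hc2 : ∀ i, (Phi bb c).coeff i ∈ supported K (I (b+1) j.val : Set (Fin N)) := by
        intro i
        have := Phi_coeff' (k := bb) (S := I (b+1) j.val) (a := c) (by rw [← I_insl (i := bb) hbbj]; exact d.hc) i
        exact this
      have hXj : Phi bb (X j : MvPolynomial (Fin N) K) = Polynomial.C (X j) :=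
        Phi_supp hinj (X_mem_sup ⟨hbj', Nat.lt_succ_self _⟩)
      have hCc : ∀ x : K, Phi bb (C x : MvPolynomial (Fin N) K) = Polynomial.C (C x) :=
        fun x => Phi_supp hinj (Subalgebra.algebraMap_mem _ x)
      have y4 : C μ * pl = yy j (C ν * pl') ((Phi bb c).coeff 1) := by
        have h1 := congrArg (fun q => Polynomial.coeff (Phi bb q) 1) y2
        have h2 := dl.Phiy
        have h3 := dl'.Phiy
        rw [map_mul, h2, hCc, yy, map_sub, map_mul, y3', map_mul, h3, hXj, hCc] at h1
        simp [Polynomial.coeff_X] at h1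
        rw [yy, ← h1]
      have hpl0 : C ν * pl' ≠ 0 := mul_ne_zero (by simpa using hν) dl'.hp0
      have hνm : C ν * pl' ∈ supported K (I (b+1) j.val : Set (Fin N)) :=
        mul_mem (Subalgebra.algebraMap_mem _ _) dl'.hp
      have hplj : pl ∉ supported K (I (b+1) j.val : Set (Fin N)) := by
        intro h5
        have h6 : yy j (C ν * pl') ((Phi bb c).coeff 1) ∈ supported K (I (b+1) j.val : Set (Fin N)) := by
          rw [← y4]; exact mul_mem (Subalgebra.algebraMap_mem _ _) h5
        have h7 := congrArg Polynomial.natDegree (Phi_supp (k := j) e1.st.hkS h6)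
        rw [yy, Phi_lin e1.st.hkS hνm (hc2 1), sub_eq_add_neg, ← Polynomial.C_neg, Polynomial.natDegree_linear hpl0] at h7
        rw [Polynomial.natDegree_C] at h7; omega
      have hpl1 : pl ≠ 1 := by
        rintro rfl; exact hplj (one_mem _)
      have h8 := (dl.p_irr_or hpl1).2
      have h9 : Associated pl (yy j (A.T γ (b+1) (A.pd j)) (A.cT γ (b+1) j)) := by
        refine e1.HP_new ?_ hplj
        rw [← I_insr hbj']; exact h8
      obtain ⟨ρ, hρ, h9⟩ := assoc_iff.1 h9
      have h10 : C (μ) * yy j (A.T γ (b+1) (A.pd j)) (A.cT γ (b+1) j) = C ρ * yy j (C ν * pl') ((Phi bb c).coeff 1) := by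
        rw [← y4, h9]; ring
      have h11 : C μ * A.T γ (b+1) (A.pd j) = C ρ * (C ν * pl') := by
        have hL : ∀ {x : K} {a}, a ∈ supported K (I (b+1) j.val : Set (Fin N)) → C x * a ∈ supported K (I (b+1) j.val : Set (Fin N)) :=
          fun ha => mul_mem (Subalgebra.algebraMap_mem _ _) ha
        refine (lin_coeff (k := j) e1.st.hkS (c := C μ * A.cT γ (b+1) j) (c' := C ρ * (Phi bb c).coeff 1) (hL e1.hp) (hL e1.hc) (hL hνm) (hL (hc2 1)) ?_).1
        simp only [yy] at h10
        linear_combination h10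
      rw [hl] at h11
      have h12 : Associated pl' (A.T γ (b+1) (l.val+1)) := by
        have a1 : Associated pl' (C ρ * (C ν * pl')) :=
          (C_assoc hν _).symm.trans (C_assoc hρ _).symm
        rw [← h11] at a1
        exact a1.trans (C_assoc hμ _)
      have h13 : pl' ∈ supported K (I (b+1) (l.val+1) : Set (Fin N)) := sup_assoc (A.T_mem γ (b+1) (l.val+1)) h12
      have h14 : cl' ∈ supported K (I (b+1) (l.val+1) : Set (Fin N)) := by
        have h1 : cl' = (dot (A.hr bb) (A.chi bb))⁻¹ • A.del bb (A.hr bb) pl' := by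
          rw [dl'.delp, smul_smul, inv_mul_cancel₀ dl'.st.lam, one_smul]
        rw [h1]
        exact Subalgebra.smul_mem _ ((A.stpL (b := l.val+1) bb).delmem h13) _
      have h15 : yy bb pl' cl' ∈ supported K (I b (l.val+1) : Set (Fin N)) := by
        rw [I_insl (i := bb) (b := l.val+1) (by simp [hbb]; omega)]
        exact sub_mem (mul_mem (supported_mono (Set.subset_insert _ _) h13) (X_mem_sup (Set.mem_insert _ _)))
          (supported_mono (Set.subset_insert _ _) h14)
      refine top l hbl hlj p hHP (sup_assoc h15 y3) ?_
      intro h16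
      have h17 := (coeff_of_yy dl'.st.hkS dl'.hp dl'.hc (sup_assoc h16 y3.symm)).1
      rcases Nat.lt_or_ge l.val (b+1) with hlb | hlb
      · rcases Nat.lt_or_ge b l.val with h18 | h18
        · omega
        · have hlb' : l.val = b := by omega
          rw [hlb', I_empty le_rfl] at h16
          have h19 : p ∈ supported K (I (b+1) j.val : Set (Fin N)) := supported_mono (Set.empty_subset _) h16
          exact hpb h19
      · have h6 := sup_inter h17 h13
        rw [I_inter] at h6
        have h7 : A.T γ (b+1) (l.val+1) ∈ supported K (I (b+1) l.val : Set (Fin N)) := by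
          refine sup_assoc (supported_mono (I_mono ?_ ?_) h6) h12.symm <;> omega
        rw [A.T_succ γ hlb] at h7
        exact (IHb l hlb).ynot (sup_assoc h7 (C_assoc (hγ l) _).symm)

end PredSec

end PN

end Mod10

section Mod11
open MvPolynomial


namespace PN

section TSec

variable {K : Type u} [Field K] [CharZero K] {N r : ℕ} (A : PA K N r) (γ : Fin N → K) (hγ : ∀ j, γ j ≠ 0)

theorem PA.T_assoc_yy (hγ : ∀ j, γ j ≠ 0) {b : ℕ} {j : Fin N} (h : b ≤ j.val) :
    Associated (A.T γ b (j.val+1)) (yy j (A.T γ b (A.pd j)) (A.cT γ b j)) := by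
  rw [A.T_succ γ h]; exact C_assoc (hγ j) _

theorem PA.T_HP (hγ : ∀ j, γ j ≠ 0) {b : ℕ} {j : Fin N} (h : b ≤ j.val) : A.HP (I b (j.val+1)) (A.T γ b (j.val+1)) := by
  rw [I_insr h]
  exact (A.pred γ hγ b j h).yHP.assoc (A.T_assoc_yy γ hγ h).symm

theorem PA.T_ne (hγ : ∀ j, γ j ≠ 0) (b n : ℕ) : A.T γ b n ≠ 0 := by
  by_cases h : n ≤ b ∨ N < n
  · rw [PA.T, dif_pos h]; exact one_ne_zero
  · obtain ⟨j, rfl⟩ : ∃ j : Fin N, n = j.val + 1 := ⟨⟨n - 1, by omega⟩, by simp only; omega⟩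
    exact (A.T_HP γ hγ (by omega)).ne_zero

theorem PA.T_top (hγ : ∀ j, γ j ≠ 0) {b : ℕ} {j : Fin N} (h : b ≤ j.val) (a : ℕ) :
    A.T γ b (j.val+1) ∉ supported K (I a j.val : Set (Fin N)) := by
  intro h1
  have h2 := sup_inter h1 (A.T_mem γ b (j.val+1))
  rw [I_inter] at h2
  exact (A.pred γ hγ b j h).ynot (sup_assoc (supported_mono (I_mono (le_max_right _ _) (by simp)) h2) (A.T_assoc_yy γ hγ h).symm)

theorem PA.T_of_top (hγ : ∀ j, γ j ≠ 0) {b n : ℕ} {l : Fin N} (hb : b ≤ l.val) (hl : l.val < n)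
    {q : MvPolynomial (Fin N) K} (hq : A.HP (I b n) q) (hm : q ∈ supported K (I b (l.val+1) : Set (Fin N)))
    (hnm : q ∉ supported K (I b l.val : Set (Fin N))) : Associated q (A.T γ b (l.val+1)) := by
  have h1 := hq.of_mem (S := I b (l.val+1)) (I_mono le_rfl hl) hm
  rw [I_insr hb] at h1
  exact ((A.pred γ hγ b l hb).HP_new h1 hnm).trans (A.T_assoc_yy γ hγ hb).symm

theorem not_HP_empty {q : MvPolynomial (Fin N) K} : ¬ A.HP ∅ q := by
  intro h
  have h1 := h.mem
  rw [supported_empty] at h1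
  obtain ⟨c, hc⟩ := h1
  refine h.irr.not_isUnit (isUnit_iff_C.2 ⟨c, ?_, hc.symm⟩)
  rintro rfl
  exact h.ne_zero (by rw [← hc]; simp)

theorem PA.HP_cases (hγ : ∀ j, γ j ≠ 0) {b n : ℕ} (hn : n ≤ N) {q : MvPolynomial (Fin N) K} (hq : A.HP (I b n) q) :
    ∃ l : Fin N, b ≤ l.val ∧ l.val < n ∧ Associated q (A.T γ b (l.val+1)) := by
  induction n with
  | zero => rw [I_empty (Nat.zero_le _)] at hq; exact absurd hq (not_HP_empty A)
  | succ n ih =>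
    rcases Nat.lt_or_ge n b with h | h
    · rw [I_empty h] at hq; exact absurd hq (not_HP_empty A)
    · by_cases hm : q ∈ supported K (I b n : Set (Fin N))
      · obtain ⟨l, h1, h2, h3⟩ := ih (by omega) (hq.of_mem (I_mono le_rfl (Nat.le_succ _)) hm)
        exact ⟨l, h1, by omega, h3⟩
      · exact ⟨⟨n, hn⟩, h, Nat.lt_succ_self n, A.T_of_top γ hγ (l := ⟨n, hn⟩) h (Nat.lt_succ_self n) hq hq.mem hm⟩

theorem PA.T_assoc_inj (hγ : ∀ j, γ j ≠ 0) {b b' : ℕ} {l l' : Fin N} (hb : b ≤ l.val) (hb' : b' ≤ l'.val)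
    (h : Associated (A.T γ b (l.val+1)) (A.T γ b' (l'.val+1))) : l = l' := by
  have key : ∀ {b b' : ℕ} {l l' : Fin N}, b ≤ l.val → b' ≤ l'.val →
      Associated (A.T γ b (l.val+1)) (A.T γ b' (l'.val+1)) → ¬ l.val < l'.val := by
    intro b b' l l' hb hb' h hlt
    refine A.T_top γ hγ hb' b (sup_assoc (supported_mono (I_mono le_rfl ?_) (A.T_mem γ b (l.val+1))) h.symm)
    omega
  have h1 := key hb hb' h
  have h2 := key hb' hb h.symm
  exact Fin.ext (by omega)

theorem PA.HP_T_iff (hγ : ∀ j, γ j ≠ 0) {b n : ℕ} (hn : n ≤ N) {l : Fin N} (hb : b ≤ l.val) (hl : l.val < n) :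
    A.HP (I b n) (A.T γ b (l.val+1)) ↔ ∀ j : Fin N, j.val < n → A.pd j ≠ l.val + 1 := by
  induction n, hl using Nat.le_induction with
  | base =>
    constructor
    · intro _ j hj h
      have := A.pd_le j
      omega
    · intro _; exact A.T_HP γ hγ hb
  | succ n hln ih =>
    have hln' : l.val < n := hln
    have e := A.pred γ hγ b ⟨n, hn⟩ (by simp only; omega)
    have hI : (I b (n+1) : Set (Fin N)) = insert ⟨n, hn⟩ (I b n) := I_insr (k := ⟨n, hn⟩) (by simp only; omega)
    constructor
    · intro h j hj hpd
      rw [hI] at h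
      obtain ⟨h1, h2⟩ := e.HP_down h (supported_mono (I_mono le_rfl hln') (A.T_mem γ b (l.val+1)))
      rcases Nat.lt_or_ge j.val n with h3 | h3
      · exact (ih (by omega)).1 h1 j h3 hpd
      · have : j = ⟨n, hn⟩ := Fin.ext (by simp only; omega)
        subst this
        rw [hpd] at h2
        exact h2 (Associated.refl _)
    · intro h
      rw [hI]
      refine e.HP_up ((ih (by omega)).2 fun j hj => h j (by omega)) ?_
      intro hass
      have h0 := h ⟨n, hn⟩ (by simp)
      rcases Nat.lt_or_ge b (A.pd ⟨n, hn⟩) with h1 | h1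
      · obtain ⟨m, hm⟩ : ∃ m : Fin N, A.pd ⟨n, hn⟩ = m.val + 1 :=
          ⟨⟨A.pd ⟨n, hn⟩ - 1, by have := A.pd_le ⟨n, hn⟩; simp only at this; omega⟩, by simp only; omega⟩
        rw [hm] at hass h0
        have := A.T_assoc_inj γ hγ hb (by omega) hass
        rw [this] at h0; exact h0 rfl
      · rw [A.T_le γ h1] at hass
        exact one_not_sd A (A.T_HP γ hγ hb) hass

theorem PA.pd_inj (hγ : ∀ j, γ j ≠ 0) {j j' l : Fin N} (h : A.pd j = l.val + 1) (h' : A.pd j' = l.val + 1) : j = j' := by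
  have key : ∀ {j j' : Fin N}, A.pd j = l.val + 1 → A.pd j' = l.val + 1 → ¬ j.val < j'.val := by
    intro j j' h h' hlt
    have e := A.pred γ hγ 0 j' (Nat.zero_le _)
    have h1 := A.pd_le j'
    have h2 : A.HP (I 0 j'.val) (A.T γ 0 (A.pd j')) := by
      refine (e.p_irr_or ?_).2
      rw [h']
      intro h3
      exact one_not_sd A (A.T_HP γ hγ (Nat.zero_le l.val)) (by rw [h3])
    rw [h', A.HP_T_iff γ hγ j'.2.le (Nat.zero_le _) (by omega)] at h2
    exact h2 j hlt h
  have h1 := key h h'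
  have h2 := key h' h
  exact Fin.ext (by omega)

/-- linked pairs -/
def PA.Lk (b : ℕ) (j : Fin N) : Prop := A.T γ b (j.val+1) ∉ supported K (I (b+1) (j.val+1) : Set (Fin N))

theorem PA.T_self (b : Fin N) : A.T γ b.val (b.val+1) = C (γ b) * X b := by
  have h : A.T γ b.val (A.pd b) = 1 := A.T_le γ (A.pd_le b)
  rw [A.T_succ γ le_rfl, PA.cT, h, yy]
  simp

theorem PA.Lk_self (hγ : ∀ j, γ j ≠ 0) (b : Fin N) : A.Lk γ b.val b := by
  unfold PA.Lk
  rw [I_empty le_rfl]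
  exact fun h => A.T_top γ hγ (b := b.val) (j := b) le_rfl 0 (supported_mono (Set.empty_subset _) h)

theorem PA.Lk_iff {b : ℕ} {j : Fin N} (hγ : ∀ j, γ j ≠ 0) (hbj : b < j.val) : A.Lk γ b j ↔
    A.T γ b (A.pd j) ∉ supported K (I (b+1) (A.pd j) : Set (Fin N)) := by
  have e := A.pred γ hγ b j hbj.le
  unfold PA.Lk
  rw [not_iff_not]
  constructor
  · intro h
    have h1 := (coeff_of_yy e.st.hkS e.hp e.hc (sup_assoc h (A.T_assoc_yy γ hγ hbj.le).symm)).1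
    have h2 := sup_inter h1 (A.T_mem γ b (A.pd j))
    rw [I_inter] at h2
    exact supported_mono (I_mono (by simp) (by simp)) h2
  · intro h
    refine sup_assoc ?_ (A.T_assoc_yy γ hγ hbj.le)
    have h1 : A.T γ b (A.pd j) ∈ supported K (I (b+1) j.val : Set (Fin N)) := supported_mono (I_mono le_rfl (A.pd_le j)) h
    have h2 : A.cT γ b j ∈ supported K (I (b+1) j.val : Set (Fin N)) :=
      Subalgebra.smul_mem _ ((A.stpR j).delmem h1) _
    exact sub_mem (mul_mem (supported_mono (I_mono le_rfl (Nat.le_succ _)) h1) (X_mem_sup ⟨hbj, Nat.lt_succ_self _⟩))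
      (supported_mono (I_mono le_rfl (Nat.le_succ _)) h2)

theorem PA.Lk_pd {b : ℕ} {j : Fin N} (hγ : ∀ j, γ j ≠ 0) (hbj : b < j.val) (h : A.Lk γ b j) :
    ∃ l : Fin N, A.pd j = l.val + 1 ∧ b ≤ l.val ∧ l < j ∧ A.Lk γ b l := by
  have h1 := (A.Lk_iff γ hγ hbj).1 h
  have h0 : b < A.pd j := by
    by_contra h2
    rw [A.T_le γ (by omega)] at h1
    exact h1 (one_mem _)
  have hpd := A.pd_le j
  refine ⟨⟨A.pd j - 1, by omega⟩, by simp only; omega, by simp only; omega, by simp only [Fin.lt_def]; omega, ?_⟩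
  unfold PA.Lk
  simp only [show A.pd j - 1 + 1 = A.pd j by omega]
  exact h1

theorem PA.Lk_of_pd {b : ℕ} {j l : Fin N} (hγ : ∀ j, γ j ≠ 0) (hb : b ≤ l.val) (hl : A.Lk γ b l) (h : A.pd j = l.val + 1) :
    A.Lk γ b j := by
  have := A.pd_le j
  rw [A.Lk_iff γ hγ (by omega), h]; exact hl

theorem PA.T_unlinked (hγ : ∀ j, γ j ≠ 0) {b : ℕ} (j : Fin N) (hbj : b < j.val) (h : ¬ A.Lk γ b j) :
    A.T γ b (j.val+1) = A.T γ (b+1) (j.val+1) := by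
  obtain ⟨n, hn⟩ : ∃ n, n = j.val := ⟨_, rfl⟩
  induction n using Nat.strong_induction_on generalizing j with
  | _ n ih =>
    subst hn
    have key : A.T γ b (A.pd j) = A.T γ (b+1) (A.pd j) := by
      rcases Nat.lt_or_ge b (A.pd j) with h0 | h0
      · have hpd := A.pd_le j
        set l : Fin N := ⟨A.pd j - 1, by omega⟩ with hl
        have e1 : A.pd j = l.val + 1 := by simp only [hl]; omega
        have h1 : ¬ A.Lk γ b l := fun hh => h (A.Lk_of_pd γ hγ (by omega) hh e1)
        have h2 : b < l.val := by
          rcases Nat.lt_or_ge b l.val with h3 | h3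
          · exact h3
          · have : b = l.val := by omega
            rw [this] at h1; exact absurd (A.Lk_self γ hγ l) h1
        rw [e1]; exact ih l.val (by omega) l h2 h1 rfl
      · rw [A.T_le γ h0, A.T_le γ (by omega)]
    rw [A.T_succ γ hbj.le, A.T_succ γ hbj, PA.cT, PA.cT, key]

theorem PA.T_linked (hγ : ∀ j, γ j ≠ 0) {b : Fin N} (j : Fin N) (hbj : b ≤ j) (h : A.Lk γ b.val j) :
    ∃ c ∈ supported K (I (b.val+1) (j.val+1) : Set (Fin N)),
      A.T γ b.val (j.val+1) = A.T γ (b.val+1) (j.val+1) * (C (γ b) * X b) - c := by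
  obtain ⟨n, hn⟩ : ∃ n, n = j.val := ⟨_, rfl⟩
  induction n using Nat.strong_induction_on generalizing j with
  | _ n ih =>
    subst hn
    rcases hbj.eq_or_lt with rfl | hbj
    · exact ⟨0, zero_mem _, by rw [A.T_self γ, A.T_le γ le_rfl]; simp⟩
    · obtain ⟨l, e1, h1, h2, h3⟩ := A.Lk_pd γ hγ (show b.val < j.val from hbj) h
      obtain ⟨c, hc, hT⟩ := ih l.val h2 l h1 h3 rfl
      have hbj' : b.val + 1 ≤ j.val := hbj
      have h2' : l.val + 1 ≤ j.val := h2
      have hTm := A.T_mem γ (b.val+1) (l.val+1)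
      have up : ∀ {a : MvPolynomial (Fin N) K} {n : ℕ}, n ≤ j.val + 1 → a ∈ supported K (I (b.val+1) n : Set (Fin N)) →
          a ∈ supported K (I (b.val+1) (j.val+1) : Set (Fin N)) := fun hn ha => supported_mono (I_mono le_rfl hn) ha
      have hdX : A.del j (A.hk j) (X b) ∈ supported K (I (b.val+1) (j.val+1) : Set (Fin N)) := by
        refine supported_mono ?_ (A.del_X_mem hbj)
        rintro t ⟨ht1, ht2⟩
        simp only [mem_I, Fin.lt_def] at *; omega
      have hdc : A.del j (A.hk j) c ∈ supported K (I (b.val+1) (j.val+1) : Set (Fin N)) :=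
        up (Nat.le_succ _) ((A.stpR j).delmem (supported_mono (I_mono le_rfl h2') hc))
      have hXj : (X j : MvPolynomial (Fin N) K) ∈ supported K (I (b.val+1) (j.val+1) : Set (Fin N)) :=
        X_mem_sup ⟨hbj', Nat.lt_succ_self _⟩
      set cc : K := (dot (A.hk j) (A.chi j))⁻¹ with hcc
      refine ⟨C (γ j) * (c * X j + C cc * (A.T γ (b.val+1) (l.val+1) * C (γ b) * A.del j (A.hk j) (X b) - A.del j (A.hk j) c)), ?_, ?_⟩
      · have hC : ∀ x : K, (C x : MvPolynomial (Fin N) K) ∈ supported K (I (b.val+1) (j.val+1) : Set (Fin N)) :=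
          fun x => Subalgebra.algebraMap_mem _ _
        exact mul_mem (hC _) (add_mem (mul_mem (up (by omega) hc) hXj) (mul_mem (hC _)
          (sub_mem (mul_mem (mul_mem (up (by omega) hTm) (hC _)) hdX) hdc)))
      · rw [A.T_succ γ (show b.val ≤ j.val by omega), A.T_succ γ hbj', PA.cT, PA.cT, e1, hT, map_sub, Derivation.leibniz, Derivation.leibniz, ← hcc]
        have : A.del j (A.hk j) (C (γ b)) = 0 := by
          have := (A.del j (A.hk j)).map_algebraMap (γ b)
          rwa [algebraMap_eq] at this
        rw [this]
        simp only [smul_eq_C_mul, smul_eq_mul, yy]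
        ring

end TSec

end PN

end Mod11

section Mod12
open MvPolynomial


namespace PN

section LSec

variable {K : Type u} [Field K] [CharZero K] {N r : ℕ} (A : PA K N r) (γ : Fin N → K) (hγ : ∀ j, γ j ≠ 0)

/-- the `c` of the left step -/
def PA.cL (b m : Fin N) : MvPolynomial (Fin N) K :=
  (dot (A.hr b) (A.chi b))⁻¹ • A.del b (A.hr b) (A.T γ (b.val+1) (m.val+1))

theorem PA.Lk_not {b : ℕ} {m : Fin N} (h : A.Lk γ b m) (n : ℕ) :
    A.T γ b (m.val+1) ∉ supported K (I (b+1) n : Set (Fin N)) := by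
  intro h1
  apply h
  have h2 := sup_inter h1 (A.T_mem γ b (m.val+1))
  rw [I_inter] at h2
  exact supported_mono (I_mono (by simp) (by simp)) h2

theorem PA.predL (hγ : ∀ j, γ j ≠ 0) {b m : Fin N} {n : ℕ} (hn : n ≤ N) (hbm : b ≤ m) (hmn : m.val < n)
    (hL : A.Lk γ b.val m) (hpd : ∀ j : Fin N, j.val < n → A.pd j ≠ m.val + 1) :
    A.SD (I (b.val+1) n) b (A.hr b) (A.T γ (b.val+1) (m.val+1)) (A.cL γ b m) := by
  obtain ⟨p, c, e⟩ := A.exSDL b n hn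
  have hbm' : b.val ≤ m.val := hbm
  have h1 := (A.HP_T_iff γ hγ hn (b := b.val) hbm' hmn).2 hpd
  rw [I_insl (show b.val < n by omega)] at h1
  have h2 := e.HP_new h1 (A.Lk_not γ hL n)
  obtain ⟨μ, hμ, h3⟩ := assoc_iff.1 h2
  obtain ⟨c', hc', h4⟩ := A.T_linked γ hγ m hbm hL
  have hC : ∀ x : K, (C x : MvPolynomial (Fin N) K) ∈ supported K (I (b.val+1) n : Set (Fin N)) :=
          fun x => Subalgebra.algebraMap_mem _ _
  have hTm : A.T γ (b.val+1) (m.val+1) ∈ supported K (I (b.val+1) n : Set (Fin N)) :=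
    supported_mono (I_mono le_rfl (by omega)) (A.T_mem γ (b.val+1) (m.val+1))
  have h5 := (lin_coeff e.st.hkS e.hp e.hc (p' := C μ * C (γ b) * A.T γ (b.val+1) (m.val+1)) (c' := C μ * c')
    (mul_mem (mul_mem (hC _) (hC _)) hTm)
    (mul_mem (hC _) (supported_mono (I_mono le_rfl (by omega)) hc')) (by
      have : p * X b - c = yy b p c := rfl
      rw [this, h3, h4]; ring)).1
  rw [← C_mul] at h5
  refine e.scale ?_ ?_
  · rw [h5]; exact C_assoc (mul_ne_zero hμ (hγ b)) _
  · intro hp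
    rcases hbm'.eq_or_lt with h6 | h6
    · exact A.T_le γ (by omega)
    · exfalso
      refine one_not_sd A (A.T_HP γ hγ (b := b.val+1) (j := m) h6) ?_
      rw [← hp, h5]; exact (C_assoc (mul_ne_zero hμ (hγ b)) _).symm

theorem PA.T_eqL (hγ : ∀ j, γ j ≠ 0) {b m : Fin N} (hbm : b ≤ m) (hL : A.Lk γ b.val m) :
    A.T γ b.val (m.val+1) = C (γ b) * yy b (A.T γ (b.val+1) (m.val+1)) (A.cL γ b m) := by
  have hbm' : b.val ≤ m.val := hbm
  have e := A.predL γ hγ (n := m.val+1) m.2 hbm (Nat.lt_succ_self _) hL (fun j hj h => by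
    have := A.pd_le j; omega)
  have h1 := A.T_HP γ hγ hbm'
  rw [I_insl (show b.val < m.val+1 by omega)] at h1
  have h2 := e.HP_new h1 (A.Lk_not γ hL _)
  obtain ⟨μ, hμ, h3⟩ := assoc_iff.1 h2.symm
  obtain ⟨c', hc', h4⟩ := A.T_linked γ hγ m hbm hL
  have hC : ∀ x : K, (C x : MvPolynomial (Fin N) K) ∈ supported K (I (b.val+1) (m.val+1) : Set (Fin N)) :=
          fun x => Subalgebra.algebraMap_mem _ _
  have h5 := (lin_coeff e.st.hkS (p := C (γ b) * A.T γ (b.val+1) (m.val+1)) (c := c')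
    (p' := C μ * A.T γ (b.val+1) (m.val+1)) (c' := C μ * A.cL γ b m) (mul_mem (hC _) e.hp) hc' (mul_mem (hC _) e.hp)
    (mul_mem (hC _) e.hc) (by
      have h6 := h3
      rw [h4, yy] at h6
      linear_combination h6)).1
  have h6 := mul_right_cancel₀ e.hp0 h5
  rw [h3, ← h6]

theorem PA.exMax (hγ : ∀ j, γ j ≠ 0) (b : Fin N) {n : ℕ} (h : b.val < n) : ∃ m : Fin N, b ≤ m ∧ m.val < n ∧ A.Lk γ b.val m ∧
    ∀ m' : Fin N, b ≤ m' → m'.val < n → A.Lk γ b.val m' → m' ≤ m := by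
  classical
  obtain ⟨m, hm, hm2⟩ := Finset.exists_max_image (Finset.univ.filter fun m : Fin N => b ≤ m ∧ m.val < n ∧ A.Lk γ b.val m) id
    ⟨b, by simp [h, A.Lk_self γ hγ b]⟩
  simp only [Finset.mem_filter, Finset.mem_univ, true_and] at hm hm2
  exact ⟨m, hm.1, hm.2.1, hm.2.2, fun m' h1 h2 h3 => hm2 m' ⟨h1, h2, h3⟩⟩

theorem PA.max_pd (hγ : ∀ j, γ j ≠ 0) {b m : Fin N} {n : ℕ} (hbm : b ≤ m) (hL : A.Lk γ b.val m)
    (hmax : ∀ m' : Fin N, b ≤ m' → m'.val < n → A.Lk γ b.val m' → m' ≤ m) (j : Fin N) (hj : j.val < n) :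
    A.pd j ≠ m.val + 1 := by
  intro h
  have h1 := A.pd_ne h
  have h2 := hmax j (hbm.trans h1.1.le) hj (A.Lk_of_pd γ hγ hbm hL h)
  exact absurd h1.1 (not_lt.2 h2)

theorem PA.Lk_consec (hγ : ∀ j, γ j ≠ 0) {b j l : Fin N} (hbj : b < j) (hL : A.Lk γ b.val j) (hpd : A.pd j = l.val + 1)
    (m : Fin N) (hbm : b ≤ m) (hmj : m < j) (hm : A.Lk γ b.val m) : m ≤ l := by
  obtain ⟨l', e1, h1, h2, h3⟩ := A.Lk_pd γ hγ (show b.val < j.val from hbj) hL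
  have : l' = l := Fin.ext (by omega)
  subst this
  obtain ⟨M, hM1, hM2, hM3, hM4⟩ := A.exMax γ hγ b (n := j.val) hbj
  have e := A.predL γ hγ j.2.le hM1 hM2 hM3 (A.max_pd γ hγ hM1 hM3 hM4)
  have a1 := (A.HP_T_iff γ hγ j.2.le (b := b.val) hM1 hM2).2 (A.max_pd γ hγ hM1 hM3 hM4)
  have a2 := (A.HP_T_iff γ hγ j.2.le (b := b.val) (l := l') h1 h2).2 (by
    intro j' hj' h
    have := A.pd_inj γ hγ h e1
    rw [this] at hj'; omega)
  rw [I_insl (show b.val < j.val from hbj)] at a1 a2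
  have := (e.HP_new a1 (A.Lk_not γ hM3 _)).trans (e.HP_new a2 (A.Lk_not γ h3 _)).symm
  have := A.T_assoc_inj γ hγ (b := b.val) (b' := b.val) hM1 h1 this
  rw [← this]
  exact hM4 m hbm hmj hm

end LSec

end PN

end Mod12

section Mod13
open MvPolynomial


namespace PN

section MonSec

variable {K : Type u} [Field K] {N : ℕ}

abbrev dg (f : MvPolynomial (Fin N) K) : Fin N →₀ ℕ := (MonomialOrder.lex (σ := Fin N)).degree f
abbrev lc (f : MvPolynomial (Fin N) K) : K := (MonomialOrder.lex (σ := Fin N)).leadingCoeff f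

def gp (γ : Fin N → K) (m : Fin N →₀ ℕ) : K := ∏ l, γ l ^ m l

theorem gp_add (γ : Fin N → K) (m n : Fin N →₀ ℕ) : gp γ (m + n) = gp γ m * gp γ n := by
  simp [gp, pow_add, Finset.prod_mul_distrib]

theorem gp_ne {γ : Fin N → K} (hγ : ∀ j, γ j ≠ 0) (m : Fin N →₀ ℕ) : gp γ m ≠ 0 :=
  Finset.prod_ne_zero_iff.2 fun l _ => pow_ne_zero _ (hγ l)

theorem gp_single (γ : Fin N → K) (b : Fin N) : gp γ (Finsupp.single b 1) = γ b := by
  rw [gp, Finset.prod_eq_single b]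
  · simp
  · intro l _ h; rw [Finsupp.single_eq_of_ne h]; simp
  · simp

def Mon (γ : Fin N → K) (f : MvPolynomial (Fin N) K) : Prop := lc f = gp γ (dg f)

theorem lc_ne {f : MvPolynomial (Fin N) K} : lc f ≠ 0 ↔ f ≠ 0 := MonomialOrder.leadingCoeff_ne_zero_iff

theorem dg_sup {S : Set (Fin N)} {f : MvPolynomial (Fin N) K} (hf : f ∈ supported K S) {l : Fin N} (hl : l ∉ S) :
    dg f l = 0 := by
  by_cases h0 : f = 0
  · rw [h0]; simp [dg]
  · by_contra h
    exact MonomialOrder.coeff_degree_ne_zero_iff.2 h0 (coeff_sup_zero hf hl h)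

theorem Mon.mul {γ : Fin N → K} {f g : MvPolynomial (Fin N) K} (hf0 : f ≠ 0) (hg0 : g ≠ 0) (hf : Mon γ f) (hg : Mon γ g) :
    Mon γ (f * g) := by
  unfold Mon lc dg at *
  rw [MonomialOrder.leadingCoeff_mul, MonomialOrder.degree_mul hf0 hg0, gp_add, hf, hg]

theorem Mon.of_mul {γ : Fin N → K} (hγ : ∀ j, γ j ≠ 0) {f g : MvPolynomial (Fin N) K} (hf0 : f ≠ 0) (hg0 : g ≠ 0) (hf : Mon γ f) (hg : Mon γ (f * g)) :
    Mon γ g := by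
  unfold Mon lc dg at *
  rw [MonomialOrder.leadingCoeff_mul, MonomialOrder.degree_mul hf0 hg0, gp_add, hf] at hg
  exact mul_left_cancel₀ (gp_ne hγ _) hg

theorem Mon.one {γ : Fin N → K} : Mon γ (1 : MvPolynomial (Fin N) K) := by
  unfold Mon lc dg
  rw [MonomialOrder.leadingCoeff_one, MonomialOrder.degree_one]; simp [gp]

theorem Mon.pow {γ : Fin N → K} {f : MvPolynomial (Fin N) K} (hf0 : f ≠ 0) (hf : Mon γ f) (n : ℕ) : Mon γ (f ^ n) := by
  induction n with
  | zero => rw [pow_zero]; exact Mon.one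
  | succ n ih => rw [pow_succ]; exact ih.mul (pow_ne_zero _ hf0) hf0 hf

theorem Mon.prod {γ : Fin N → K} {ι : Type*} (s : Finset ι) (f : ι → MvPolynomial (Fin N) K) (hf0 : ∀ i ∈ s, f i ≠ 0)
    (hf : ∀ i ∈ s, Mon γ (f i)) : Mon γ (∏ i ∈ s, f i) := by
  classical
  induction s using Finset.induction_on with
  | empty => rw [Finset.prod_empty]; exact Mon.one
  | insert a s ha ih =>
    rw [Finset.prod_insert ha]
    refine Mon.mul (hf0 a (by simp)) (Finset.prod_ne_zero_iff.2 fun i hi => hf0 i (by simp [hi])) (hf a (by simp)) ?_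
    exact ih (fun i hi => hf0 i (by simp [hi])) (fun i hi => hf i (by simp [hi]))

theorem dg_C (c : K) : dg (C c : MvPolynomial (Fin N) K) = 0 := MonomialOrder.degree_C c

theorem dg_prodpow (z : Fin N → MvPolynomial (Fin N) K) (hz : ∀ i, z i ≠ 0) (e : Fin N → ℕ) (l : Fin N) :
    dg (∏ m, z m ^ e m) l = ∑ m, e m * dg (z m) l := by
  unfold dg
  rw [MonomialOrder.degree_prod (fun i _ => pow_ne_zero _ (hz i)), Finsupp.finset_sum_apply]
  refine Finset.sum_congr rfl fun i _ => ?_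
  rw [MonomialOrder.degree_pow]; simp

theorem dg_lin {b : Fin N} {n : ℕ} {q c : MvPolynomial (Fin N) K} {g : K} (hg : g ≠ 0) (hq0 : q ≠ 0)
    (hq : q ∈ supported K (I (b.val+1) n : Set (Fin N))) (hc : c ∈ supported K (I (b.val+1) n : Set (Fin N))) :
    dg (q * (C g * X b) - c) = dg q + Finsupp.single b 1 ∧ lc (q * (C g * X b) - c) = lc q * g := by
  have hC0 : (C g : MvPolynomial (Fin N) K) ≠ 0 := by simpa using hg
  have hX0 : (X b : MvPolynomial (Fin N) K) ≠ 0 := X_ne_zero b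
  have h1 : dg (q * (C g * X b)) = dg q + Finsupp.single b 1 := by
    unfold dg
    rw [MonomialOrder.degree_mul hq0 (mul_ne_zero hC0 hX0), MonomialOrder.degree_mul hC0 hX0, MonomialOrder.degree_X,
      MonomialOrder.degree_C, zero_add]
  have h2 : lc (q * (C g * X b)) = lc q * g := by
    unfold lc
    rw [MonomialOrder.leadingCoeff_mul, MonomialOrder.leadingCoeff_mul, MonomialOrder.leadingCoeff_X, MonomialOrder.leadingCoeff_C, mul_one]
  have h3 : (MonomialOrder.lex (σ := Fin N)).toSyn (dg (-c)) < (MonomialOrder.lex (σ := Fin N)).toSyn (dg (q * (C g * X b))) := by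
    rw [MonomialOrder.lex_lt_iff, Finsupp.Lex.lt_iff]
    have hc' := neg_mem hc
    refine ⟨b, fun j hj => ?_, ?_⟩
    · have hj' : j.val < b.val := hj
      simp only [ofLex_toLex]
      rw [h1, Finsupp.add_apply, Finsupp.single_eq_of_ne (by exact hj.ne), dg_sup hc' (by simp [mem_I]; omega), dg_sup hq (by simp [mem_I]; omega), add_zero]
    · simp only [ofLex_toLex]
      rw [h1, Finsupp.add_apply, Finsupp.single_eq_same, dg_sup hc' (by simp [mem_I])]
      omega
  rw [sub_eq_add_neg]
  refine ⟨?_, ?_⟩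
  · rw [← h1]; exact MonomialOrder.degree_add_of_lt h3
  · rw [← h2]; exact MonomialOrder.leadingCoeff_add_of_lt h3

/-- if `p ∣ a - b` and `x_l` occurs in the leading monomial of `p` but not in those of `a`, `b`, the leading coefficients/monomials agree. -/
theorem lead_eq {p a b : MvPolynomial (Fin N) K} {l : Fin N} (h : p ∣ a - b) (hp : dg p l ≠ 0) (ha : dg a l = 0)
    (hb : dg b l = 0) : dg a = dg b ∧ lc a = lc b := by
  by_cases hab : a = b
  · subst hab; exact ⟨rfl, rfl⟩
  obtain ⟨q, hq⟩ := h
  have hne : p * q ≠ 0 := by rw [← hq]; exact sub_ne_zero.2 hab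
  have h1 : dg (a - b) l ≠ 0 := by
    unfold dg
    rw [hq, MonomialOrder.degree_mul (left_ne_zero_of_mul hne) (right_ne_zero_of_mul hne), Finsupp.add_apply]
    have : (MonomialOrder.lex (σ := Fin N)).degree p l ≠ 0 := hp
    omega
  have hnb : dg (-b) = dg b := by
    unfold dg; rw [MonomialOrder.degree_neg]
  have hdg : dg a = dg b := by
    by_contra h2
    rw [← hnb] at h2 hb
    have h3 : (MonomialOrder.lex (σ := Fin N)).toSyn (dg a) ≠ (MonomialOrder.lex (σ := Fin N)).toSyn (dg (-b)) := by
      intro h4; exact h2 ((MonomialOrder.lex (σ := Fin N)).toSyn.injective h4)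
    rcases lt_or_gt_of_ne h3 with h4 | h4
    · apply h1; rw [sub_eq_add_neg, dg, MonomialOrder.degree_add_eq_right_of_lt h4]; exact hb
    · apply h1; rw [sub_eq_add_neg, dg, MonomialOrder.degree_add_of_lt h4]; exact ha
  refine ⟨hdg, ?_⟩
  by_contra h2
  apply h1
  have h3 : coeff (dg a) (a - b) ≠ 0 := by
    rw [coeff_sub, sub_ne_zero]
    rw [show coeff (dg a) b = lc b by rw [hdg]; rfl]
    exact h2
  have h4 : (MonomialOrder.lex (σ := Fin N)).toSyn (dg a) ≤ (MonomialOrder.lex (σ := Fin N)).toSyn (dg (a - b)) :=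
    MonomialOrder.le_degree (mem_support_iff.2 h3)
  have h5 : (MonomialOrder.lex (σ := Fin N)).toSyn (dg (a - b)) ≤ (MonomialOrder.lex (σ := Fin N)).toSyn (dg a) := by
    refine MonomialOrder.degree_sub_le.trans ?_
    rw [show (MonomialOrder.lex (σ := Fin N)).degree b = dg a from hdg.symm]; simp [dg]
  have h6 := (MonomialOrder.lex (σ := Fin N)).toSyn.injective (le_antisymm h5 h4)
  rw [h6]; exact ha

theorem ufd_prod (z : Fin N → MvPolynomial (Fin N) K) (Q : Fin N → Prop) (u : MvPolynomial (Fin N) K) (hu : u ≠ 0)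
    (h : ∀ v, Irreducible v → v ∣ u → ∃ m, Q m ∧ Associated v (z m)) :
    ∃ (e : Fin N → ℕ) (c : K), c ≠ 0 ∧ u = C c * ∏ m, z m ^ e m ∧ ∀ m, e m ≠ 0 → Q m := by
  classical
  induction u using WfDvdMonoid.induction_on_irreducible with
  | zero => exact absurd rfl hu
  | unit u hu' =>
    obtain ⟨c, hc, rfl⟩ := isUnit_iff_C.1 hu'
    exact ⟨0, c, hc, by simp, by simp⟩
  | mul a i ha hi ih =>
    obtain ⟨e, c, hc, h1, h2⟩ := ih ha (fun v hv hva => h v hv (hva.mul_left _))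
    obtain ⟨m, hm, hm2⟩ := h i hi (dvd_mul_right _ _)
    obtain ⟨d, hd, h3⟩ := assoc_iff.1 hm2.symm
    refine ⟨e + Pi.single m 1, d * c, mul_ne_zero hd hc, ?_, ?_⟩
    · have : ∏ t, z t ^ (e + Pi.single m 1 : Fin N → ℕ) t = (∏ t, z t ^ e t) * z m := by
        simp only [Pi.add_apply, pow_add, Finset.prod_mul_distrib]
        congr 1
        rw [Finset.prod_eq_single m]
        · simp
        · intro t _ ht; simp [ht]
        · simp
      rw [this, h3, C_mul]
      conv_lhs => rw [h1]
      ring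
    · intro t ht
      by_cases h4 : t = m
      · rw [h4]; exact hm
      · apply h2; simpa [h4] using ht

end MonSec

section TMon

variable {K : Type u} [Field K] [CharZero K] {N r : ℕ} (A : PA K N r) (γ : Fin N → K)

theorem PA.T_mon (hγ : ∀ j, γ j ≠ 0) (m : Fin N) (d b : ℕ) (hb : b + d = m.val + 1) :
    Mon γ (A.T γ b (m.val+1)) ∧ ∀ l : Fin N, dg (A.T γ b (m.val+1)) l ≠ 0 ↔ (b ≤ l.val ∧ l ≤ m ∧ A.Lk γ l.val m) := by
  induction d generalizing b with
  | zero =>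
    rw [A.T_le γ (by omega)]
    refine ⟨Mon.one, fun l => ?_⟩
    have : dg (1 : MvPolynomial (Fin N) K) = 0 := MonomialOrder.degree_one
    rw [this]
    simp only [Finsupp.coe_zero, Pi.zero_apply, ne_eq, not_true_eq_false, false_iff, Fin.le_def]
    omega
  | succ d ih =>
    obtain ⟨h1, h2⟩ := ih (b+1) (by omega)
    obtain ⟨bb, rfl⟩ : ∃ bb : Fin N, b = bb.val := ⟨⟨b, by omega⟩, rfl⟩
    have hbm : bb ≤ m := by rw [Fin.le_def]; omega
    by_cases hL : A.Lk γ bb.val m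
    · obtain ⟨c, hc, h3⟩ := A.T_linked γ hγ m hbm hL
      obtain ⟨h4, h5⟩ := dg_lin (hγ bb) (A.T_ne γ hγ _ _) (A.T_mem γ _ _) hc
      rw [h3]
      refine ⟨?_, fun l => ?_⟩
      · unfold Mon; rw [h4, h5, gp_add, gp_single, h1]
      · rw [h4, Finsupp.add_apply]
        by_cases hl : l = bb
        · subst hl; simp [hL, hbm]
        · rw [Finsupp.single_eq_of_ne hl, add_zero, h2 l]
          have : l.val ≠ bb.val := fun h => hl (Fin.ext h)
          constructor
          · rintro ⟨a1, a2, a3⟩; exact ⟨by omega, a2, a3⟩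
          · rintro ⟨a1, a2, a3⟩; exact ⟨by omega, a2, a3⟩
    · have hlt : bb.val < m.val := by
        rcases (show bb.val ≤ m.val from hbm).eq_or_lt with h | h
        · exact absurd (by rw [h]; exact A.Lk_self γ hγ m) hL
        · exact h
      rw [A.T_unlinked γ hγ m hlt hL]
      refine ⟨h1, fun l => ?_⟩
      rw [h2 l]
      constructor
      · rintro ⟨a1, a2, a3⟩; exact ⟨by omega, a2, a3⟩
      · rintro ⟨a1, a2, a3⟩
        refine ⟨?_, a2, a3⟩
        rcases a1.eq_or_lt with h | h
        · rw [← h] at a3; exact absurd a3 hL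
        · exact h

theorem PA.Lk_next (hγ : ∀ j, γ j ≠ 0) {l j : Fin N} (hj : A.pd j = l.val + 1) (m : Fin N) (hlm : l < m) (h : A.Lk γ l.val m) : j ≤ m := by
  obtain ⟨n, hn⟩ : ∃ n, n = m.val := ⟨_, rfl⟩
  induction n using Nat.strong_induction_on generalizing m with
  | _ n ih =>
    subst hn
    obtain ⟨t, e1, h1, h2, h3⟩ := A.Lk_pd γ hγ (show l.val < m.val from hlm) h
    rcases (show l ≤ t from h1).eq_or_lt with h4 | h4
    · subst h4; rw [A.pd_inj γ hγ hj e1]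
    · exact (ih t.val h2 t h4 h3 rfl).trans h2.le

theorem PA.Lk_first (hγ : ∀ j, γ j ≠ 0) {i : Fin N} (l : Fin N) (hil : i < l) (h : A.Lk γ i.val l) :
    ∃ i0 : Fin N, A.pd i0 = i.val + 1 ∧ i < i0 ∧ i0 ≤ l ∧ A.Lk γ i0.val l ∧ ∀ b : Fin N, i < b → b < i0 → ¬ A.Lk γ b.val l := by
  obtain ⟨n, hn⟩ : ∃ n, n = l.val := ⟨_, rfl⟩
  induction n using Nat.strong_induction_on generalizing l with
  | _ n ih =>
    subst hn
    obtain ⟨t, e1, h1, h2, h3⟩ := A.Lk_pd γ hγ (show i.val < l.val from hil) h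
    rcases (show i ≤ t from h1).eq_or_lt with h4 | h4
    · subst h4
      refine ⟨l, e1, hil, le_rfl, A.Lk_self γ hγ l, fun b hb hbl hL => ?_⟩
      obtain ⟨t', e1', h1', h2', h3'⟩ := A.Lk_pd γ hγ (show b.val < l.val from hbl) hL
      have : i.val < b.val := hb
      omega
    · obtain ⟨i0, a1, a2, a3, a4, a5⟩ := ih t.val h2 t h4 h3 rfl
      refine ⟨i0, a1, a2, a3.trans h2.le, A.Lk_of_pd γ hγ a3 a4 e1, fun b hb hbl hL => ?_⟩
      have hbl' : b < l := hbl.trans_le (a3.trans h2.le)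
      obtain ⟨t', e1', h1', h2', h3'⟩ := A.Lk_pd γ hγ (show b.val < l.val from hbl') hL
      have : t' = t := Fin.ext (by omega)
      subst this
      exact a5 b hb hbl h3'

theorem PA.T_range (hγ : ∀ j, γ j ≠ 0) (m : Fin N) (d b b' : ℕ) (hd : b' = b + d) (hb' : b' ≤ m.val)
    (h : ∀ c : Fin N, b ≤ c.val → c.val < b' → ¬ A.Lk γ c.val m) : A.T γ b (m.val+1) = A.T γ b' (m.val+1) := by
  induction d generalizing b with
  | zero => rw [hd]; rfl
  | succ d ih =>
    rw [← ih (b+1) (by omega) (fun c h1 h2 => h c (by omega) h2)]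
    exact A.T_unlinked γ hγ m (by omega) (h ⟨b, by omega⟩ le_rfl (by simp only; omega))

theorem PA.exGamma : ∃ γ : Fin N → K, (∀ j, γ j ≠ 0) ∧ ∀ i j : Fin N, A.pd j = i.val + 1 →
    γ i * γ j * (dot (A.hk j) (A.chi j))⁻¹ * lc (A.del j (A.hk j) (X i)) = gp γ (dg (A.del j (A.hk j) (X i))) := by
  suffices h : ∀ n ≤ N, ∃ γ : Fin N → K, (∀ j, γ j ≠ 0) ∧ ∀ i j : Fin N, j.val < n → A.pd j = i.val + 1 →
    γ i * γ j * (dot (A.hk j) (A.chi j))⁻¹ * lc (A.del j (A.hk j) (X i)) = gp γ (dg (A.del j (A.hk j) (X i))) by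
    obtain ⟨γ, h1, h2⟩ := h N le_rfl
    exact ⟨γ, h1, fun i j => h2 i j j.2⟩
  intro n
  induction n with
  | zero => intro _; exact ⟨fun _ => 1, fun _ => one_ne_zero, fun i j hj => by omega⟩
  | succ n ih =>
    intro hn
    obtain ⟨γ, h1, h2⟩ := ih (by omega)
    classical
    let k : Fin N := ⟨n, hn⟩
    have hgp : ∀ (x : K) (i j : Fin N), i < j → j ≤ k → gp (Function.update γ k x) (dg (A.del j (A.hk j) (X i))) = gp γ (dg (A.del j (A.hk j) (X i))) := by
      intro x i j hij hjk
      unfold gp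
      refine Finset.prod_congr rfl fun l _ => ?_
      by_cases hl : l = k
      · subst hl
        rw [dg_sup (A.del_X_mem hij) (fun h => absurd h.2 (not_lt.2 hjk))]; simp
      · rw [Function.update_of_ne hl]
    by_cases hp : ∃ i : Fin N, A.pd k = i.val + 1
    · obtain ⟨i, hi⟩ := hp
      obtain ⟨hik, hne⟩ := A.pd_ne hi
      have hlam := A.lam_ne k
      have hlc := lc_ne.2 hne
      set x : K := gp γ (dg (A.del k (A.hk k) (X i))) * dot (A.hk k) (A.chi k) / (γ i * lc (A.del k (A.hk k) (X i))) with hx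
      have hx0 : x ≠ 0 := div_ne_zero (mul_ne_zero (gp_ne h1 _) hlam) (mul_ne_zero (h1 i) hlc)
      refine ⟨Function.update γ k x, ?_, ?_⟩
      · intro j
        by_cases hj : j = k
        · subst hj; simpa using hx0
        · rw [Function.update_of_ne hj]; exact h1 j
      · intro i' j hj hpd
        have hij := (A.pd_ne hpd).1
        have hjk : j ≤ k := by rw [Fin.le_def]; simp only [k]; omega
        rw [hgp x i' j hij hjk]
        rcases hjk.eq_or_lt with h3 | h3
        · subst h3
          have : i' = i := Fin.ext (by omega)
          subst this
          rw [Function.update_self, Function.update_of_ne hik.ne, hx]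
          have := h1 i'
          field_simp
        · rw [Function.update_of_ne h3.ne, Function.update_of_ne (hij.trans h3).ne]
          exact h2 i' j (by exact h3) hpd
    · refine ⟨γ, h1, ?_⟩
      intro i j hj hpd
      rcases Nat.lt_or_ge j.val n with h3 | h3
      · exact h2 i j h3 hpd
      · exact absurd ⟨i, by rw [← hpd]; congr 1; exact Fin.ext (by simp only [k]; omega)⟩ hp

end TMon

end PN

end Mod13

section Mod14
open MvPolynomial


namespace PN

section Ex

variable {K : Type u} [Field K] [CharZero K] {N r : ℕ} (A : PA K N r) (γ : Fin N → K)

/-- the second term of the exchange relation -/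
def PA.uu (i j : Fin N) : MvPolynomial (Fin N) K :=
  A.T γ i.val (A.pd j) * A.T γ (i.val+1) (j.val+1) - A.T γ (i.val+1) (A.pd j) * A.T γ i.val (j.val+1)

theorem PA.br_Cl (c : K) (a b : MvPolynomial (Fin N) K) : A.br (C c * a) b = C c * A.br a b := by
  rw [← smul_eq_C_mul, ← smul_eq_C_mul, map_smul, LinearMap.smul_apply]

theorem PA.ex_SDL (hγ : ∀ j, γ j ≠ 0) {i j l : Fin N} (hL : A.Lk γ i.val l) (hpd : A.pd j = l.val + 1) (hil : i ≤ l) :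
    A.SD (I (i.val+1) j.val) i (A.hr i) (A.T γ (i.val+1) (l.val+1)) (A.cL γ i l) := by
  have hlj := (A.pd_ne hpd).1
  refine A.predL γ hγ j.2.le hil hlj hL fun j' hj' h => ?_
  rw [A.pd_inj γ hγ h hpd] at hj'; omega

theorem PA.uu_eqR (hγ : ∀ j, γ j ≠ 0) {i j : Fin N} (hij : i < j) :
    A.uu γ i j = C (γ j * (dot (A.hk j) (A.chi j))⁻¹) * (A.T γ (i.val+1) (A.pd j) * A.del j (A.hk j) (A.T γ i.val (A.pd j)) -
      A.T γ i.val (A.pd j) * A.del j (A.hk j) (A.T γ (i.val+1) (A.pd j))) := by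
  have hij' : i.val + 1 ≤ j.val := hij
  unfold PA.uu
  rw [A.T_succ γ (show i.val ≤ j.val by omega), A.T_succ γ hij', PA.cT, PA.cT, yy, yy]
  simp only [smul_eq_C_mul, C_mul]
  ring

theorem PA.uu_eqL (hγ : ∀ j, γ j ≠ 0) {i j l : Fin N} (hij : i < j) (hL : A.Lk γ i.val j) (hLl : A.Lk γ i.val l)
    (hpd : A.pd j = l.val + 1) (hil : i ≤ l) :
    A.uu γ i j = C (γ i) * (A.T γ (i.val+1) (l.val+1) * A.cL γ i j - A.cL γ i l * A.T γ (i.val+1) (j.val+1)) := by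
  unfold PA.uu
  rw [hpd, A.T_eqL γ hγ hil hLl, A.T_eqL γ hγ hij.le hL, yy, yy]
  ring

theorem PA.uu_mem (hγ : ∀ j, γ j ≠ 0) {i j l : Fin N} (hij : i < j) (hL : A.Lk γ i.val j) (hLl : A.Lk γ i.val l)
    (hpd : A.pd j = l.val + 1) (hil : i ≤ l) : A.uu γ i j ∈ supported K (I (i.val+1) j.val : Set (Fin N)) := by
  have hij' : i.val + 1 ≤ j.val := hij
  have hC : ∀ (x : K) S, (C x : MvPolynomial (Fin N) K) ∈ supported K (S : Set (Fin N)) :=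
          fun x S => Subalgebra.algebraMap_mem _ _
  have hp := A.pd_le j
  have h1 : A.uu γ i j ∈ supported K (I i.val j.val : Set (Fin N)) := by
    rw [A.uu_eqR γ hγ hij]
    have a1 : A.T γ (i.val+1) (A.pd j) ∈ supported K (I i.val j.val : Set (Fin N)) :=
      supported_mono (I_mono (by omega) hp) (A.T_mem γ _ _)
    have a2 : A.T γ i.val (A.pd j) ∈ supported K (I i.val j.val : Set (Fin N)) :=
      supported_mono (I_mono (by omega) hp) (A.T_mem γ _ _)
    exact mul_mem (hC _ _) (sub_mem (mul_mem a1 ((A.stpR j).delmem a2)) (mul_mem a2 ((A.stpR j).delmem a1)))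
  have h2 : A.uu γ i j ∈ supported K (I (i.val+1) (j.val+1) : Set (Fin N)) := by
    rw [A.uu_eqL γ hγ hij hL hLl hpd hil]
    have hlj : l.val < j.val := (A.pd_ne hpd).1
    have a1 : A.T γ (i.val+1) (l.val+1) ∈ supported K (I (i.val+1) (j.val+1) : Set (Fin N)) :=
      supported_mono (I_mono le_rfl (by omega)) (A.T_mem γ _ _)
    have a2 : A.T γ (i.val+1) (j.val+1) ∈ supported K (I (i.val+1) (j.val+1) : Set (Fin N)) := A.T_mem γ _ _
    have a3 : ∀ m : Fin N, A.T γ (i.val+1) (m.val+1) ∈ supported K (I (i.val+1) (j.val+1) : Set (Fin N)) →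
      A.cL γ i m ∈ supported K (I (i.val+1) (j.val+1) : Set (Fin N)) := fun m hm =>
      Subalgebra.smul_mem _ ((A.stpL i).delmem hm) _
    exact mul_mem (hC _ _) (sub_mem (mul_mem a1 (a3 _ a2)) (mul_mem (a3 _ a1) a2))
  have := sup_inter h1 h2
  rw [I_inter] at this
  exact supported_mono (I_mono (by simp) (by simp)) this

theorem PA.uu_ne (hγ : ∀ j, γ j ≠ 0) {i j l : Fin N} (hij : i < j) (hL : A.Lk γ i.val j)
    (hpd : A.pd j = l.val + 1) : A.uu γ i j ≠ 0 := by
  intro h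
  have hij' : i.val + 1 ≤ j.val := hij
  unfold PA.uu at h
  have hM := (A.T_HP γ hγ (show i.val ≤ j.val by omega)).prime
  have h1 : A.T γ i.val (j.val+1) ∣ A.T γ i.val (A.pd j) * A.T γ (i.val+1) (j.val+1) :=
    ⟨A.T γ (i.val+1) (A.pd j), by linear_combination h⟩
  rcases hM.dvd_or_dvd h1 with h2 | h2
  · refine A.T_top γ hγ (show i.val ≤ j.val by omega) i.val (sup_of_dvd ?_ (A.T_ne γ hγ _ _) h2)
    exact supported_mono (I_mono le_rfl (A.pd_le j)) (A.T_mem γ _ _)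
  · exact hL (sup_of_dvd (A.T_mem γ _ _) (A.T_ne γ hγ _ _) h2)

theorem PA.T_one_or (hγ : ∀ j, γ j ≠ 0) {b : ℕ} {l : Fin N} (h : b ≤ l.val + 1) :
    (b = l.val + 1 ∧ A.T γ b (l.val+1) = 1) ∨ (b ≤ l.val ∧ A.HP (I b (l.val+1)) (A.T γ b (l.val+1))) := by
  rcases h.eq_or_lt with h | h
  · left; exact ⟨h, A.T_le γ h.ge⟩
  · right; exact ⟨by omega, A.T_HP γ hγ (by omega)⟩

theorem PA.SD.p_nrm {A : PA K N r} {S : Set (Fin N)} {k : Fin N} {h : Fin r → K} {p c : MvPolynomial (Fin N) K} (d : A.SD S k h p c)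
    {a : MvPolynomial (Fin N) K} (ha : a ∈ supported K S) : ∃ x, A.br p a = x * p := by
  obtain ⟨x, hx, -⟩ := d.kp ha; exact ⟨x, hx⟩

theorem PA.uu_br (hγ : ∀ j, γ j ≠ 0) {i j l : Fin N} (hij : i < j) (hL : A.Lk γ i.val j) (hLl : A.Lk γ i.val l)
    (hpd : A.pd j = l.val + 1) (hil : i ≤ l) {a : MvPolynomial (Fin N) K} (ha : a ∈ supported K (I (i.val+1) j.val : Set (Fin N))) :
    ∃ x, A.br (A.T γ (i.val+1) (l.val+1)) a = x * A.T γ (i.val+1) (l.val+1) ∧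
      A.br (A.T γ i.val (l.val+1)) a = (x + sg A.chi (A.hr i) a) * A.T γ i.val (l.val+1) ∧
      A.br (A.T γ (i.val+1) (j.val+1)) a = (x + sg A.chi (A.hk j) a) * A.T γ (i.val+1) (j.val+1) ∧
      A.br (A.T γ i.val (j.val+1)) a = (x + sg A.chi (A.hr i) a + sg A.chi (A.hk j) a) * A.T γ i.val (j.val+1) ∧
      A.br (A.uu γ i j) a = (2 * x + sg A.chi (A.hr i) a + sg A.chi (A.hk j) a) * A.uu γ i j := by
  have hij' : i.val + 1 ≤ j.val := hij
  have e1 := A.ex_SDL γ hγ hLl hpd hil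
  have e2 := A.pred γ hγ (i.val+1) j hij'
  have e3 := A.pred γ hγ i.val j (by omega)
  rw [hpd] at e2 e3
  obtain ⟨x, hx⟩ := e1.p_nrm ha
  have b1 := e1.ybr ha
  have b2 := e2.ybr ha
  have b3 := e3.ybr (supported_mono (I_mono (by omega) le_rfl) ha)
  have c1 : A.br (A.T γ i.val (l.val+1)) a = (x + sg A.chi (A.hr i) a) * A.T γ i.val (l.val+1) := by
    apply mul_left_cancel₀ e1.hp0
    rw [A.T_eqL γ hγ hil hLl, A.br_Cl]
    rw [hx] at b1
    linear_combination C (γ i) * b1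
  have c2 : A.br (A.T γ (i.val+1) (j.val+1)) a = (x + sg A.chi (A.hk j) a) * A.T γ (i.val+1) (j.val+1) := by
    apply mul_left_cancel₀ e1.hp0
    rw [A.T_succ γ hij', hpd, A.br_Cl]
    rw [hx] at b2
    linear_combination C (γ j) * b2
  have c3 : A.br (A.T γ i.val (j.val+1)) a = (x + sg A.chi (A.hr i) a + sg A.chi (A.hk j) a) * A.T γ i.val (j.val+1) := by
    apply mul_left_cancel₀ (A.T_ne γ hγ i.val (l.val+1))
    rw [A.T_succ γ (show i.val ≤ j.val by omega), hpd, A.br_Cl]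
    rw [c1] at b3
    linear_combination C (γ j) * b3
  refine ⟨x, hx, c1, c2, c3, ?_⟩
  unfold PA.uu
  rw [hpd, map_sub, LinearMap.sub_apply, PA.leibl, PA.leibl, hx, c1, c2, c3]
  ring

theorem PA.uu_hom (hγ : ∀ j, γ j ≠ 0) {i j l : Fin N} (hij : i < j) (hL : A.Lk γ i.val j) (hLl : A.Lk γ i.val l)
    (hpd : A.pd j = l.val + 1) (hil : i ≤ l) {w : Fin r → ℤ} (hw : Hom A.chi w (A.T γ (i.val+1) (l.val+1))) :
    Hom A.chi (w + A.chi i) (A.T γ i.val (l.val+1)) ∧ Hom A.chi (w + A.chi j) (A.T γ (i.val+1) (j.val+1)) ∧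
    Hom A.chi (w + A.chi i + A.chi j) (A.T γ i.val (j.val+1)) ∧ Hom A.chi (w + w + A.chi i + A.chi j) (A.uu γ i j) := by
  have hij' : i.val + 1 ≤ j.val := hij
  have e1 := A.ex_SDL γ hγ hLl hpd hil
  have e2 := A.pred γ hγ (i.val+1) j hij'
  have e3 := A.pred γ hγ i.val j (by omega)
  rw [hpd] at e2 e3
  have c1 : Hom A.chi (w + A.chi i) (A.T γ i.val (l.val+1)) := by
    rw [A.T_eqL γ hγ hil hLl]; exact (e1.yhom hw).Cmul _
  have c2 : Hom A.chi (w + A.chi j) (A.T γ (i.val+1) (j.val+1)) := by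
    rw [A.T_succ γ hij', hpd]; exact (e2.yhom hw).Cmul _
  have c3 : Hom A.chi (w + A.chi i + A.chi j) (A.T γ i.val (j.val+1)) := by
    rw [A.T_succ γ (show i.val ≤ j.val by omega), hpd]; exact (e3.yhom c1).Cmul _
  refine ⟨c1, c2, c3, ?_⟩
  unfold PA.uu
  rw [hpd]
  refine Hom.sub ?_ ?_
  · convert c1.mul c2 using 1; abel
  · convert hw.mul c3 using 1; abel

theorem PA.T_hom (hγ : ∀ j, γ j ≠ 0) (b n : ℕ) : ∃ w, Hom A.chi w (A.T γ b n) := by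
  by_cases h : n ≤ b ∨ N < n
  · rw [PA.T, dif_pos h]; exact ⟨0, Hom.one⟩
  · obtain ⟨j, rfl⟩ : ∃ j : Fin N, n = j.val + 1 := ⟨⟨n - 1, by omega⟩, by simp only; omega⟩
    exact (A.T_HP γ hγ (by omega)).hom

theorem PA.uu_ndvd (hγ : ∀ j, γ j ≠ 0) {i j l : Fin N} (hij : i < j) (hL : A.Lk γ i.val j) (hLl : A.Lk γ i.val l)
    (hpd : A.pd j = l.val + 1) (hil : i < l) : ¬ A.T γ (i.val+1) (l.val+1) ∣ A.uu γ i j := by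
  intro h
  have hij' : i.val + 1 ≤ j.val := hij
  have hil' : i.val + 1 ≤ l.val := hil
  have hlj := (A.pd_ne hpd).1
  have e1 := A.ex_SDL γ hγ hLl hpd hil.le
  have hp := (A.T_HP γ hγ hil')
  rw [A.uu_eqL γ hγ hij hL hLl hpd hil.le] at h
  have h1 : A.T γ (i.val+1) (l.val+1) ∣ A.cL γ i l * A.T γ (i.val+1) (j.val+1) := by
    have h2 : A.T γ (i.val+1) (l.val+1) ∣ A.T γ (i.val+1) (l.val+1) * A.cL γ i j - A.cL γ i l * A.T γ (i.val+1) (j.val+1) :=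
      (C_assoc (hγ i) _).dvd_iff_dvd_right.1 h
    have h3 := dvd_sub (dvd_mul_right (A.T γ (i.val+1) (l.val+1)) (A.cL γ i j)) h2
    simpa using h3
  have h2 := relPrime_dvd e1.rel h1
  have h3 := hp.irr.associated_of_dvd (A.T_HP γ hγ hij').irr h2
  exact hlj.ne (A.T_assoc_inj γ hγ hil' hij' h3)

theorem PA.uu_fac (hγ : ∀ j, γ j ≠ 0) {i j l : Fin N} (hij : i < j) (hL : A.Lk γ i.val j) (hLl : A.Lk γ i.val l)
    (hpd : A.pd j = l.val + 1) (hil : i ≤ l) : ∃ (e : Fin N → ℕ) (c : K), c ≠ 0 ∧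
      A.uu γ i j = C c * ∏ m, A.T γ (i.val+1) (m.val+1) ^ e m ∧
      ∀ m, e m ≠ 0 → i < m ∧ m < j ∧ m ≠ l := by
  refine ufd_prod (fun m => A.T γ (i.val+1) (m.val+1)) _ (A.uu γ i j) (A.uu_ne γ hγ hij hL hpd) fun v hv hvu => ?_
  obtain ⟨w, hw⟩ := A.T_hom γ hγ (i.val+1) (l.val+1)
  have h1 : A.HP (I (i.val+1) j.val) v := by
    refine A.HP_of_factor (A.uu_ne γ hγ hij hL hpd) hv hvu (A.uu_mem γ hγ hij hL hLl hpd hil)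
      ⟨_, (A.uu_hom γ hγ hij hL hLl hpd hil hw).2.2.2⟩ fun a ha => ?_
    obtain ⟨x, -, -, -, -, hx⟩ := A.uu_br γ hγ hij hL hLl hpd hil ha
    rw [hx]; exact dvd_mul_left _ _
  obtain ⟨m, hm1, hm2, hm3⟩ := A.HP_cases γ hγ j.2.le h1
  refine ⟨m, ⟨hm1, hm2, ?_⟩, hm3⟩
  rintro rfl
  exact A.uu_ndvd γ hγ hij hL hLl hpd hm1 (hm3.symm.dvd.trans hvu)

end Ex

end PN

end Mod14

section Mod15
open MvPolynomial


namespace PN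

section Ex

variable {K : Type u} [Field K] [CharZero K] {N r : ℕ} (A : PA K N r) (γ : Fin N → K)

/-- normalisation condition on `γ` -/
def PA.GN : Prop := ∀ i j : Fin N, A.pd j = i.val + 1 →
    γ i * γ j * (dot (A.hk j) (A.chi j))⁻¹ * lc (A.del j (A.hk j) (X i)) = gp γ (dg (A.del j (A.hk j) (X i)))

theorem PA.uu_dg (hγ : ∀ j, γ j ≠ 0) {i j l : Fin N} (hij : i < j) (hL : A.Lk γ i.val j) (hLl : A.Lk γ i.val l)
    (hpd : A.pd j = l.val + 1) (hil : i ≤ l) : dg (A.uu γ i j) l = 0 := by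
  obtain ⟨e, c, hc, h1, h2⟩ := A.uu_fac γ hγ hij hL hLl hpd hil
  have hne : ∀ m : Fin N, A.T γ (i.val+1) (m.val+1) ≠ 0 := fun m => A.T_ne γ hγ _ _
  rw [h1, dg, MonomialOrder.degree_mul (by simpa using hc) (Finset.prod_ne_zero_iff.2 fun m _ => pow_ne_zero _ (hne m)),
    MonomialOrder.degree_C, zero_add]
  have h3 := dg_prodpow (fun m : Fin N => A.T γ (i.val+1) (m.val+1)) hne e l
  rw [dg] at h3
  rw [h3]
  refine Finset.sum_eq_zero fun m _ => ?_
  by_cases hm : e m = 0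
  · rw [hm, zero_mul]
  · obtain ⟨a1, a2, a3⟩ := h2 m hm
    rw [mul_eq_zero]; right
    by_contra h4
    have a1' : i.val < m.val := a1
    obtain ⟨b1, b2, b3⟩ := ((A.T_mon γ hγ m (m.val - i.val) (i.val+1) (by omega)).2 l).1 h4
    have := A.Lk_next γ hγ hpd m (lt_of_le_of_ne b2 (Ne.symm a3)) b3
    exact absurd a2 (not_lt.2 this)

theorem PA.uu_mon (hγ : ∀ j, γ j ≠ 0) (hG : A.GN γ) (n : ℕ) : ∀ i j : Fin N, j.val - i.val ≤ n → i < j → A.Lk γ i.val j → Mon γ (A.uu γ i j) := by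
  induction n with
  | zero => intro i j h hij; have : i.val < j.val := hij; omega
  | succ n ih =>
    intro i j hn hij hL
    have hij' : i.val + 1 ≤ j.val := hij
    obtain ⟨l, hpd, hil, hlj, hLl⟩ := A.Lk_pd γ hγ hij' hL
    have hlj' : l.val < j.val := hlj
    rcases (show i ≤ l from hil).eq_or_lt with h | hil'
    · subst h
      have hne := (A.pd_ne hpd).2
      have hlam := A.lam_ne j
      have h1 : A.uu γ i j = C (γ i * γ j * (dot (A.hk j) (A.chi j))⁻¹) * A.del j (A.hk j) (X i) := by
        rw [A.uu_eqR γ hγ hij, hpd, A.T_self, A.T_le γ le_rfl, ← smul_eq_C_mul (X i), Derivation.map_smul,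
          Derivation.map_one_eq_zero, smul_eq_C_mul, smul_eq_C_mul]
        simp only [C_mul]; ring
      have hc0 : (C (γ i * γ j * (dot (A.hk j) (A.chi j))⁻¹) : MvPolynomial (Fin N) K) ≠ 0 := by
        rw [Ne, C_eq_zero]; exact mul_ne_zero (mul_ne_zero (hγ i) (hγ j)) (inv_ne_zero hlam)
      unfold Mon lc dg
      rw [h1, MonomialOrder.leadingCoeff_mul, MonomialOrder.leadingCoeff_C, MonomialOrder.degree_mul hc0 hne,
        MonomialOrder.degree_C, zero_add]
      exact hG i j hpd
    · obtain ⟨i0, a1, a2, a3, a4, a5⟩ := A.Lk_first γ hγ l hil' hLl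
      have a2' : i.val < i0.val := a2
      have a3' : i0.val ≤ l.val := a3
      have hi0j : i0 < j := a3.trans_lt hlj
      have hLj : A.Lk γ i0.val j := A.Lk_of_pd γ hγ a3' a4 hpd
      set p := A.T γ (i.val+1) (l.val+1) with hp
      have r1 : A.T γ i0.val (l.val+1) = p := (A.T_range γ hγ l (i0.val - (i.val+1)) (i.val+1) i0.val (by omega) a3'
        (fun c h1 h2 => a5 c h1 h2)).symm
      have r2 : A.T γ i0.val (j.val+1) = A.T γ (i.val+1) (j.val+1) :=
        (A.T_range γ hγ j (i0.val - (i.val+1)) (i.val+1) i0.val (by omega) (by omega)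
        (fun c h1 h2 h3 => by
          obtain ⟨t, e1, t1, t2, t3⟩ := A.Lk_pd γ hγ (show c.val < j.val by omega) h3
          have : t = l := Fin.ext (by omega)
          subst this
          exact a5 c h1 h2 t3)).symm
      have hil2 : i.val + 1 ≤ l.val := hil'
      obtain ⟨t, e1, t1, t2, t3⟩ := A.Lk_pd γ hγ hil2 hLl
      have t1' : i.val ≤ t.val := t1
      have t2' : t.val < l.val := t2
      have q1 : p ∣ A.uu γ i j - A.T γ i.val (l.val+1) * A.T γ (i.val+1) (j.val+1) :=
        ⟨- A.T γ i.val (j.val+1), by rw [PA.uu, hpd, ← hp]; ring⟩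
      have q2 : p ∣ A.uu γ i l + A.T γ (i.val+1) (t.val+1) * A.T γ i.val (l.val+1) :=
        ⟨A.T γ i.val (t.val+1), by rw [PA.uu, e1, ← hp]; ring⟩
      have q3 : p ∣ A.uu γ i0 j + A.T γ (i0.val+1) (l.val+1) * A.T γ (i.val+1) (j.val+1) :=
        ⟨A.T γ (i0.val+1) (j.val+1), by rw [PA.uu, hpd, r1, r2]; ring⟩
      have q4 : ∃ U, Mon γ U ∧ U ≠ 0 ∧ dg U l = 0 ∧ p ∣ U - A.T γ (i.val+1) (t.val+1) * A.T γ (i0.val+1) (l.val+1) := by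
        rcases a3.eq_or_lt with h | h
        · subst h
          have : t.val = i.val := by omega
          refine ⟨1, Mon.one, one_ne_zero, ?_, ?_⟩
          · have : dg (1 : MvPolynomial (Fin N) K) = 0 := MonomialOrder.degree_one
            rw [this]; rfl
          · rw [this, A.T_le γ le_rfl, A.T_le γ le_rfl]; simp
        · have h' : i0.val < l.val := h
          obtain ⟨s, f1, s1, s2, s3⟩ := A.Lk_pd γ hγ h' a4
          have : s = t := Fin.ext (by omega)
          subst this
          have hpdl := f1
          refine ⟨A.uu γ i0 l, ih i0 l (by omega) h a4, A.uu_ne γ hγ h a4 f1,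
            dg_sup (A.uu_mem γ hγ h a4 s3 f1 s1) (by simp [mem_I]), ?_⟩
          have r3 : A.T γ i0.val (s.val+1) = A.T γ (i.val+1) (s.val+1) :=
            (A.T_range γ hγ s (i0.val - (i.val+1)) (i.val+1) i0.val (by omega) s1
            (fun c h1 h2 h3 => a5 c h1 h2 (A.Lk_of_pd γ hγ (by omega) h3 f1))).symm
          exact ⟨- A.T γ (i0.val+1) (s.val+1), by rw [PA.uu, f1, r1, r3]; ring⟩
      obtain ⟨U, hU1, hU2, hU3, hU4⟩ := q4
      have q5 : p ∣ A.uu γ i j * U - A.uu γ i l * A.uu γ i0 j := by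
        obtain ⟨x1, q1⟩ := q1
        obtain ⟨x2, q2⟩ := q2
        obtain ⟨x3, q3⟩ := q3
        obtain ⟨x4, q4⟩ := hU4
        refine ⟨x1 * U + A.T γ i.val (l.val+1) * A.T γ (i.val+1) (j.val+1) * x4 - x2 * A.uu γ i0 j
          + A.T γ (i.val+1) (t.val+1) * A.T γ i.val (l.val+1) * x3, ?_⟩
        linear_combination U * q1 + A.T γ i.val (l.val+1) * A.T γ (i.val+1) (j.val+1) * q4 - A.uu γ i0 j * q2
          + A.T γ (i.val+1) (t.val+1) * A.T γ i.val (l.val+1) * q3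
      have n1 := A.uu_ne γ hγ hij hL hpd
      have n2 := A.uu_ne γ hγ hil' hLl e1
      have n3 := A.uu_ne γ hγ hi0j hLj hpd
      have d1 := A.uu_dg γ hγ hij hL hLl hpd hil
      have d2 : dg (A.uu γ i l) l = 0 := dg_sup (A.uu_mem γ hγ hil' hLl t3 e1 t1) (by simp [mem_I])
      have d3 := A.uu_dg γ hγ hi0j hLj a4 hpd a3
      have hlp : dg p l ≠ 0 := ((A.T_mon γ hγ l (l.val - i.val) (i.val+1) (by omega)).2 l).2
        ⟨hil2, le_rfl, A.Lk_self γ hγ l⟩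
      obtain ⟨g1, g2⟩ := lead_eq q5 hlp (by rw [dg, MonomialOrder.degree_mul n1 hU2, Finsupp.add_apply]; exact Nat.add_eq_zero_iff.2 ⟨d1, hU3⟩)
        (by rw [dg, MonomialOrder.degree_mul n2 n3, Finsupp.add_apply]; exact Nat.add_eq_zero_iff.2 ⟨d2, d3⟩)
      have m2 := ih i l (by omega) hil' hLl
      have m3 := ih i0 j (by omega) hi0j hLj
      have m4 := Mon.mul n2 n3 m2 m3
      have m5 : Mon γ (U * A.uu γ i j) := by
        unfold Mon
        rw [mul_comm U, g1, g2]; exact m4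
      exact Mon.of_mul hγ hU2 n1 hU1 m5

theorem PA.exch (hγ : ∀ j, γ j ≠ 0) (hG : A.GN γ) {i j l : Fin N} (hij : i < j) (hL : A.Lk γ i.val j) (hLl : A.Lk γ i.val l)
    (hpd : A.pd j = l.val + 1) (hil : i ≤ l) : ∃ e : Fin N → ℕ,
      A.uu γ i j = ∏ m, A.T γ (i.val+1) (m.val+1) ^ e m ∧
      ∀ m, e m ≠ 0 → i < m ∧ m < j ∧ m ≠ l := by
  obtain ⟨e, c, hc, h1, h2⟩ := A.uu_fac γ hγ hij hL hLl hpd hil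
  refine ⟨e, ?_, h2⟩
  have hne : ∀ m : Fin N, A.T γ (i.val+1) (m.val+1) ≠ 0 := fun m => A.T_ne γ hγ _ _
  have hm : ∀ m : Fin N, Mon γ (A.T γ (i.val+1) (m.val+1)) := fun m => by
    rcases Nat.lt_or_ge i.val (m.val+1) with h | h
    · exact (A.T_mon γ hγ m (m.val - i.val) (i.val+1) (by omega)).1
    · rw [A.T_le γ (by omega)]; exact Mon.one
  have hP : ∏ m, A.T γ (i.val+1) (m.val+1) ^ e m ≠ 0 := Finset.prod_ne_zero_iff.2 fun m _ => pow_ne_zero _ (hne m)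
  have h3 := A.uu_mon γ hγ hG _ i j le_rfl hij hL
  rw [h1, mul_comm] at h3
  have h4 := Mon.of_mul hγ hP (by simpa using hc) (Mon.prod _ _ (fun m _ => pow_ne_zero _ (hne m)) fun m _ => (hm m).pow (hne m) _) h3
  unfold Mon at h4
  rw [dg_C] at h4
  have : lc (C c : MvPolynomial (Fin N) K) = c := MonomialOrder.leadingCoeff_C c
  rw [this] at h4
  have : c = 1 := by rw [h4]; simp [gp]
  rw [h1, this]; simp

end Ex

end PN

end Mod15

section Mod16
open MvPolynomial


namespace PN

section ZZ

variable {K : Type u} [Field K] [CharZero K] {N r : ℕ} (A : PA K N r)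

/-- logarithmic bracket of `p M / u` with `a`, cleared of denominators -/
def PA.ZZ (p M u a : MvPolynomial (Fin N) K) : MvPolynomial (Fin N) K :=
  A.br p a * (M * u) + A.br M a * (p * u) - A.br u a * (p * M)

theorem PA.ZZ_one (p M u : MvPolynomial (Fin N) K) : A.ZZ p M u 1 = 0 := by
  have h : ∀ a, A.br a 1 = 0 := fun a => by have := A.br_C a 1; rwa [C_1] at this
  simp [PA.ZZ, h]

theorem PA.ZZ_C (p M u a : MvPolynomial (Fin N) K) (c : K) : A.ZZ p M u (C c * a) = C c * A.ZZ p M u a := by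
  simp only [PA.ZZ, A.leibniz, A.br_C]; ring

theorem PA.ZZ_yy {S : Set (Fin N)} {k : Fin N} {h : Fin r → K} {P c p M u : MvPolynomial (Fin N) K} {wp wM : Fin r → ℤ}
    (d : A.SD S k h P c) (hp : p ∈ supported K S) (hM : M ∈ supported K S) (hu : u ∈ supported K S)
    (ep : Hom A.chi wp p) (eM : Hom A.chi wM M) (eu : Hom A.chi (wp + wM) u) (h0 : A.ZZ p M u P = 0) :
    A.ZZ p M u (yy k P c) = 0 := by
  have h1 := d.ybr hp
  have h2 := d.ybr hM
  have h3 := d.ybr hu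
  rw [ep h, smul_eq_C_mul] at h1
  rw [eM h, smul_eq_C_mul] at h2
  rw [eu h, smul_eq_C_mul, dot_add, C_add] at h3
  refine (mul_eq_zero.1 (?_ : P * A.ZZ p M u (yy k P c) = 0)).resolve_left d.hp0
  unfold PA.ZZ at h0 ⊢
  rw [A.skew p, A.skew M, A.skew u] at h0 ⊢
  linear_combination (-M * u) * h1 + (-p * u) * h2 + (p * M) * h3 + (yy k P c) * h0

end ZZ

section Ex

variable {K : Type u} [Field K] [CharZero K] {N r : ℕ} (A : PA K N r) (γ : Fin N → K)

theorem PA.Lk_next' (hγ : ∀ j, γ j ≠ 0) {i m : Fin N} (him : i ≤ m) (hm : A.Lk γ i.val m) (j : Fin N) (hmj : m < j)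
    (hj : A.Lk γ i.val j) : ∃ j', j' ≤ j ∧ A.pd j' = m.val + 1 := by
  obtain ⟨n, hn⟩ : ∃ n, n = j.val := ⟨_, rfl⟩
  induction n using Nat.strong_induction_on generalizing j with
  | _ n ih =>
    subst hn
    have hij : i < j := lt_of_le_of_lt him hmj
    obtain ⟨l, e1, h1, h2, h3⟩ := A.Lk_pd γ hγ (show i.val < j.val from hij) hj
    have h4 := A.Lk_consec γ hγ hij hj e1 m him hmj hm
    rcases h4.eq_or_lt with h | h
    · subst h; exact ⟨j, le_rfl, e1⟩
    · obtain ⟨j', h5, h6⟩ := ih l.val h2 l h h3 rfl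
      exact ⟨j', h5.trans h2.le, h6⟩

variable {i j l : Fin N} 

/-- basic Poisson facts about an exchange relation -/
theorem PA.exch_br (hγ : ∀ j, γ j ≠ 0) (hij : i < j) (hL : A.Lk γ i.val j) (hLl : A.Lk γ i.val l)
    (hpd : A.pd j = l.val + 1) (hil : i ≤ l) :
    (∀ a ∈ supported K (I (i.val+1) j.val : Set (Fin N)),
      A.ZZ (A.T γ (i.val+1) (l.val+1)) (A.T γ i.val (j.val+1)) (A.uu γ i j) a = 0) ∧
    A.ZZ (A.T γ (i.val+1) (l.val+1)) (A.T γ i.val (j.val+1)) (A.uu γ i j) (A.T γ i.val (j.val+1)) = 0 ∧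
    A.ZZ (A.T γ (i.val+1) (l.val+1)) (A.T γ i.val (j.val+1)) (A.uu γ i j) (A.T γ i.val (l.val+1)) =
      C (dot (A.hr i) (A.chi i)) * A.T γ i.val (l.val+1) *
        (A.T γ (i.val+1) (l.val+1) * A.T γ i.val (j.val+1) * A.uu γ i j) := by
  have hlj := (A.pd_ne hpd).1
  have hij' : i.val + 1 ≤ j.val := hij
  have hu := A.uu_mem γ hγ hij hL hLl hpd hil
  have hu0 := A.uu_ne γ hγ hij hL hpd
  have hp : A.T γ (i.val+1) (l.val+1) ∈ supported K (I (i.val+1) j.val : Set (Fin N)) :=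
    supported_mono (I_mono le_rfl hlj) (A.T_mem γ _ _)
  have hp0 := A.T_ne γ hγ (i.val+1) (l.val+1)
  have hL0 := A.T_ne γ hγ i.val (l.val+1)
  obtain ⟨w, hw⟩ := A.T_hom γ hγ (i.val+1) (l.val+1)
  obtain ⟨wL, wR, wM, wu⟩ := A.uu_hom γ hγ hij hL hLl hpd hil hw
  obtain ⟨x, x1, x2, x3, x4, x5⟩ := A.uu_br γ hγ hij hL hLl hpd hil hp
  obtain ⟨y, y1, y2, y3, y4, y5⟩ := A.uu_br γ hγ hij hL hLl hpd hil hu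
  have hML : A.br (A.T γ i.val (j.val+1)) (A.T γ i.val (l.val+1)) = C (dot (A.hk j) (w + A.chi i)) *
      (A.T γ i.val (j.val+1) * A.T γ i.val (l.val+1)) := by
    have e := A.pred γ hγ i.val j hij.le
    rw [hpd] at e
    have h1 := e.ybr e.hp
    rw [A.br_self, wL, smul_eq_C_mul] at h1
    rw [A.T_succ γ hij.le, A.br_Cl, hpd]
    have h2 := mul_left_cancel₀ hL0 (h1.trans (by ring : _ = A.T γ i.val (l.val+1) * (C (dot (A.hk j) (w + A.chi i)) *
      A.T γ i.val (l.val+1) * yy j (A.T γ i.val (l.val+1)) (A.cT γ i.val j))))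
    rw [h2]; ring
  have hfirst : ∀ a ∈ supported K (I (i.val+1) j.val : Set (Fin N)),
      A.ZZ (A.T γ (i.val+1) (l.val+1)) (A.T γ i.val (j.val+1)) (A.uu γ i j) a = 0 := fun a ha => by
    obtain ⟨x, x1, x2, x3, x4, x5⟩ := A.uu_br γ hγ hij hL hLl hpd hil ha
    unfold PA.ZZ
    rw [x1, x4, x5]; ring
  refine ⟨hfirst, ?_⟩
  clear hfirst
  generalize A.T γ (i.val+1) (l.val+1) = p at *
  generalize A.T γ i.val (l.val+1) = L at *
  generalize A.T γ i.val (j.val+1) = M at *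
  generalize hU : A.uu γ i j = U at *
  have hx : x = 0 := by
    rw [A.br_self] at x1
    exact (mul_eq_zero.1 x1.symm).resolve_right hp0
  subst hx
  rw [hw, hw, smul_eq_C_mul, smul_eq_C_mul] at x5 x4
  rw [hw, smul_eq_C_mul] at x2
  rw [A.br_self, eq_comm] at y5
  have hy := (mul_eq_zero.1 y5).resolve_right hu0
  rw [wu, wu, smul_eq_C_mul, smul_eq_C_mul] at hy y4
  rw [wu, smul_eq_C_mul] at y2
  set a := dot (A.hr i) w
  set b := dot (A.hk j) w
  have hci := A.cross i j hij
  simp only [dot_add, C_add] at *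
  rw [hci, C_neg] at *
  -- y = - (a+b) U
  have hy1 : y = - (C a + C b) * U := by
    have := A.skew p U
    rw [x5, y1] at this
    refine mul_right_cancel₀ hp0 ?_
    linear_combination this
  have hs : C (dot (A.hr i) (A.chi i)) + C (dot (A.hk j) (A.chi j)) = (0 : MvPolynomial (Fin N) K) := by
    refine mul_right_cancel₀ hu0 ?_
    linear_combination hy - 2 * hy1
  refine ⟨?_, ?_⟩
  · unfold PA.ZZ
    rw [A.br_self, A.skew p, A.skew U, x4, y4]
    subst hy1
    linear_combination (p * M * U * M) * hs
  · unfold PA.ZZ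
    rw [A.skew p, A.skew U, x2, y2, hML]
    subst hy1
    ring

/-- `p M / u` commutes with `T i (n+1)`, `n ≥ j` -/
theorem PA.exch_brR (hγ : ∀ j, γ j ≠ 0) (hij : i < j) (hL : A.Lk γ i.val j) (hLl : A.Lk γ i.val l)
    (hpd : A.pd j = l.val + 1) (hil : i ≤ l) (n : Fin N) (hn : j ≤ n) :
    A.ZZ (A.T γ (i.val+1) (l.val+1)) (A.T γ i.val (j.val+1)) (A.uu γ i j) (A.T γ i.val (n.val+1)) = 0 := by
  obtain ⟨h1, h2, h3⟩ := A.exch_br γ hγ hij hL hLl hpd hil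
  have hlj := (A.pd_ne hpd).1
  obtain ⟨w, hw⟩ := A.T_hom γ hγ (i.val+1) (l.val+1)
  obtain ⟨wL, wR, wM, wu⟩ := A.uu_hom γ hγ hij hL hLl hpd hil hw
  obtain ⟨v, hv⟩ : ∃ v, v = n.val := ⟨_, rfl⟩
  induction v using Nat.strong_induction_on generalizing n with
  | _ v ih =>
    subst hv
    rcases hn.eq_or_lt with h | h
    · subst h; exact h2
    · have hin : i < n := hij.trans h
      have hjn : j.val < n.val := h
      have hlj' : l.val < j.val := hlj
      have hij'' : i.val < j.val := hij
      rw [A.T_succ γ hin.le, A.ZZ_C]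
      have e := A.pred γ hγ i.val n hin.le
      rw [A.ZZ_yy e (wp := w) (wM := w + A.chi i + A.chi j) (supported_mono (I_mono (by omega) (by omega)) (A.T_mem γ _ _))
        (supported_mono (I_mono (by omega) (by omega)) (A.T_mem γ _ _))
        (supported_mono (I_mono (by omega) (by omega)) (A.uu_mem γ hγ hij hL hLl hpd hil)) hw wM
        (by convert wu using 1; abel), mul_zero]
      have hpn := A.pd_le n
      rcases Nat.lt_or_ge i.val (A.pd n) with h4 | h4
      · obtain ⟨m, hm⟩ : ∃ m : Fin N, A.pd n = m.val + 1 := ⟨⟨A.pd n - 1, by omega⟩, by simp only; omega⟩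
        rw [hm]
        rcases le_or_gt j m with h5 | h5
        · exact ih m.val (by omega) m h5 rfl
        · by_cases hLm : A.Lk γ i.val m
          · have h6 := A.Lk_of_pd γ hγ (by omega) hLm hm
            have h7 : j.val ≤ m.val := A.Lk_consec γ hγ hin h6 hm j hij.le h hL
            have : m.val < j.val := h5
            omega
          · have him : i.val < m.val := by
              rcases (show i.val ≤ m.val by omega).eq_or_lt with h7 | h7
              · have : i = m := Fin.ext h7
                subst this; exact absurd (A.Lk_self γ hγ i) hLm
              · exact h7
            rw [A.T_unlinked γ hγ m him hLm]
            exact h1 _ (supported_mono (I_mono le_rfl h5) (A.T_mem γ _ _))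
      · rw [A.T_le γ h4, A.ZZ_one]

/-- `p M / u` commutes with `T b (m+1)`, `b ≤ i`, if `m` is not a predecessor -/
theorem PA.exch_brL (hγ : ∀ j, γ j ≠ 0) (hij : i < j) (hL : A.Lk γ i.val j) (hLl : A.Lk γ i.val l)
    (hpd : A.pd j = l.val + 1) (hil : i ≤ l) (b : ℕ) (hb : b ≤ i.val) (m : Fin N) (hbm : b ≤ m.val)
    (hm : ∀ j, A.pd j ≠ m.val + 1) :
    A.ZZ (A.T γ (i.val+1) (l.val+1)) (A.T γ i.val (j.val+1)) (A.uu γ i j) (A.T γ b (m.val+1)) = 0 := by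
  obtain ⟨h1, h2, h3⟩ := A.exch_br γ hγ hij hL hLl hpd hil
  have hlj := (A.pd_ne hpd).1
  obtain ⟨w, hw⟩ := A.T_hom γ hγ (i.val+1) (l.val+1)
  obtain ⟨wL, wR, wM, wu⟩ := A.uu_hom γ hγ hij hL hLl hpd hil hw
  have hlj' : l.val < j.val := hlj
  have hij'' : i.val < j.val := hij
  induction hb using Nat.decreasingInduction with
  | self =>
    rcases le_or_gt j m with h5 | h5
    · exact A.exch_brR γ hγ hij hL hLl hpd hil m h5
    · by_cases hLm : A.Lk γ i.val m
      · obtain ⟨j', _, h6⟩ := A.Lk_next' γ hγ hbm hLm j h5 hL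
        exact absurd h6 (hm j')
      · have him : i.val < m.val := by
          rcases hbm.eq_or_lt with h7 | h7
          · have : i = m := Fin.ext h7
            subst this; exact absurd (A.Lk_self γ hγ i) hLm
          · exact h7
        rw [A.T_unlinked γ hγ m him hLm]
        exact h1 _ (supported_mono (I_mono le_rfl h5) (A.T_mem γ _ _))
  | of_succ b hb ih =>
    obtain ⟨b, rfl⟩ : ∃ b' : Fin N, b = b'.val := ⟨⟨b, by omega⟩, rfl⟩
    have ih' : A.ZZ (A.T γ (i.val+1) (l.val+1)) (A.T γ i.val (j.val+1)) (A.uu γ i j) (A.T γ (b.val+1) (m.val+1)) = 0 := by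
      rcases hbm.eq_or_lt with h | h
      · rw [A.T_le γ (show m.val + 1 ≤ b.val + 1 by omega), A.ZZ_one]
      · exact ih h
    by_cases hLm : A.Lk γ b.val m
    · rw [A.T_eqL γ hγ hbm hLm, A.ZZ_C]
      have e := A.predL γ hγ le_rfl hbm m.2 hLm (fun j _ => hm j)
      rw [A.ZZ_yy e (wp := w) (wM := w + A.chi i + A.chi j) (supported_mono (I_mono (by omega) (by omega)) (A.T_mem γ _ _))
        (supported_mono (I_mono (by omega) (by omega)) (A.T_mem γ _ _))
        (supported_mono (I_mono (by omega) (by omega)) (A.uu_mem γ hγ hij hL hLl hpd hil)) hw wM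
        (by convert wu using 1; abel) ih', mul_zero]
    · have him : b.val < m.val := by
        rcases hbm.eq_or_lt with h7 | h7
        · have : b = m := Fin.ext h7
          subst this; exact absurd (A.Lk_self γ hγ b) hLm
        · exact h7
      rw [A.T_unlinked γ hγ m him hLm]; exact ih'

end Ex

section T0

variable {K : Type u} [Field K] [CharZero K] {N r : ℕ} (A : PA K N r) (γ : Fin N → K)

/-- the initial cluster is log-canonical -/
theorem PA.T0_lc (hγ : ∀ j, γ j ≠ 0) (k : Fin N) : ∀ l : Fin N, l < k → ∃ ω : K,
    A.br (A.T γ 0 (k.val+1)) (A.T γ 0 (l.val+1)) = C ω * (A.T γ 0 (k.val+1) * A.T γ 0 (l.val+1)) := by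
  obtain ⟨n, hn⟩ : ∃ n, n = k.val := ⟨_, rfl⟩
  induction n using Nat.strong_induction_on generalizing k with
  | _ n ih =>
    subst hn
    intro l hl
    have e := A.pred γ hγ 0 k (Nat.zero_le _)
    have h1 := e.ybr (a := A.T γ 0 (l.val+1)) (supported_mono (I_mono le_rfl hl) (A.T_mem γ _ _))
    obtain ⟨w, hw⟩ := A.T_hom γ hγ 0 (l.val+1)
    have hp := A.pd_le k
    have hl' : l.val < k.val := hl
    obtain ⟨ω, hω⟩ : ∃ ω, A.br (A.T γ 0 (A.pd k)) (A.T γ 0 (l.val+1)) = C ω * (A.T γ 0 (A.pd k) * A.T γ 0 (l.val+1)) := by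
      rcases Nat.eq_zero_or_pos (A.pd k) with h | h
      · refine ⟨0, ?_⟩
        have := A.br_C (A.T γ 0 (l.val+1)) 1
        rw [h, A.T_le γ le_rfl, A.skew, ← C_1, this]; simp
      · obtain ⟨m, hm⟩ : ∃ m : Fin N, A.pd k = m.val + 1 := ⟨⟨A.pd k - 1, by omega⟩, by simp only; omega⟩
        rw [hm]
        rcases lt_trichotomy m l with h5 | h5 | h5
        · obtain ⟨ω, h⟩ := ih l.val hl' l rfl m h5
          exact ⟨-ω, by rw [A.skew, h, C_neg]; ring⟩
        · subst h5; exact ⟨0, by rw [A.br_self]; simp⟩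
        · exact ih m.val (by omega) m rfl l h5
    refine ⟨ω + dot (A.hk k) w, mul_left_cancel₀ e.hp0 ?_⟩
    rw [A.T_succ γ (Nat.zero_le _), A.br_Cl]
    rw [hω, hw, smul_eq_C_mul] at h1
    rw [C_add]
    linear_combination C (γ k) * h1

/-- recursion for the log-canonical coefficients of the initial cluster -/
theorem PA.T0_rec (hγ : ∀ j, γ j ≠ 0) (k l : Fin N) (hl : l < k) {w : Fin r → ℤ} (hw : Hom A.chi w (A.T γ 0 (l.val+1))) {ω ω' : K}
    (h : A.br (A.T γ 0 (k.val+1)) (A.T γ 0 (l.val+1)) = C ω * (A.T γ 0 (k.val+1) * A.T γ 0 (l.val+1)))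
    (h' : A.br (A.T γ 0 (A.pd k)) (A.T γ 0 (l.val+1)) = C ω' * (A.T γ 0 (A.pd k) * A.T γ 0 (l.val+1))) :
    ω = ω' + dot (A.hk k) w := by
  have e := A.pred γ hγ 0 k (Nat.zero_le _)
  have h1 := e.ybr (a := A.T γ 0 (l.val+1)) (supported_mono (I_mono le_rfl hl) (A.T_mem γ _ _))
  rw [h', hw, smul_eq_C_mul] at h1
  have n1 := A.T_ne γ hγ 0 (k.val+1)
  have n2 := A.T_ne γ hγ 0 (l.val+1)
  have n3 := e.hp0
  have h2 : (C ω : MvPolynomial (Fin N) K) = C (ω' + dot (A.hk k) w) := by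
    refine mul_right_cancel₀ (mul_ne_zero (mul_ne_zero n1 n2) n3) ?_
    rw [C_add]
    rw [A.T_succ γ (Nat.zero_le _), A.br_Cl] at h
    rw [A.T_succ γ (Nat.zero_le _)]
    linear_combination C (γ k) * h1 - A.T γ 0 (A.pd k) * h
  exact C_injective _ _ h2

theorem PA.T0_wt (hγ : ∀ j, γ j ≠ 0) (k : Fin N) {w v : Fin r → ℤ} (hw : Hom A.chi w (A.T γ 0 (k.val+1)))
    (hv : Hom A.chi v (A.T γ 0 (A.pd k))) : w = v + A.chi k := by
  have e := A.pred γ hγ 0 k (Nat.zero_le _)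
  obtain ⟨v', h1, h2⟩ := e.wt
  have h3 := Hom.unique e.hp0 hv h1
  subst h3
  refine Hom.unique (A.T_ne γ hγ 0 (k.val+1)) hw ?_
  rw [A.T_succ γ (Nat.zero_le _), yy]
  exact ((h1.mul (Hom.X k)).sub h2).Cmul _

end T0

end PN

end Mod16

section Mod17
namespace PN

section Lin

variable {N : ℕ} {G : Type*} [AddCommGroup G]

/-- exponent transformation of a mutation -/
def Ev (k : Fin N) (b v : Fin N → ℤ) : Fin N → ℤ :=
  fun a => if a = k then - v k else v a + v k * max (- b a) 0

/-- dual transformation of a mutation -/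
def prE (k : Fin N) (b : Fin N → ℤ) (g : Fin N → G) (n : Fin N) : G :=
  if n = k then - g k + ∑ c, max (- b c) 0 • g c else g n

theorem sum_prE {k : Fin N} {b : Fin N → ℤ} (hb : b k = 0) (v : Fin N → ℤ) (g : Fin N → G) :
    ∑ l, v l • prE k b g l = ∑ a, Ev k b v a • g a := by
  have h1 : ∀ l, v l • prE k b g l = v l • g l +
      if l = k then v k • (- g k - g k + ∑ c, max (- b c) 0 • g c) else 0 := by
    intro l
    unfold prE
    split_ifs with h
    · subst h; rw [← smul_add]; congr 1; abel
    · rw [add_zero]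
  have h2 : ∀ a, Ev k b v a • g a = v a • g a + v k • (max (- b a) 0 • g a) +
      if a = k then v k • (- g k - g k) else 0 := by
    intro a
    unfold Ev
    split_ifs with h
    · subst h; rw [hb]; simp only [neg_zero, max_self, zero_smul, smul_zero, add_zero]
      rw [← smul_add, neg_smul, ← smul_neg]; congr 1; abel
    · rw [add_zero, add_smul, mul_smul]
  simp only [h1, h2, Finset.sum_add_distrib, Finset.sum_ite_eq', Finset.mem_univ, if_true]
  rw [smul_add, ← Finset.smul_sum]; abel

theorem prE_sum {ι : Type*} (s : Finset ι) (k : Fin N) (b : Fin N → ℤ) (v : ι → ℤ) (g : ι → Fin N → G) (n : Fin N) :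
    ∑ l ∈ s, v l • prE k b (g l) n = prE k b (fun c => ∑ l ∈ s, v l • g l c) n := by
  unfold prE
  split_ifs with h
  · simp only [smul_add, Finset.sum_add_distrib, smul_neg, Finset.sum_neg_distrib, Finset.smul_sum]
    rw [Finset.sum_comm]
    congr 1
    refine Finset.sum_congr rfl fun c _ => Finset.sum_congr rfl fun l _ => ?_
    rw [smul_smul, smul_smul, mul_comm]
  · rfl

theorem Ev_invol {k : Fin N} {b : Fin N → ℤ} (hb : b k = 0) (v : Fin N → ℤ) : Ev k b (Ev k b v) = v := by
  funext a
  unfold Ev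
  by_cases h : a = k
  · subst h; simp
  · simp [h]

theorem prE_ne {k : Fin N} {b : Fin N → ℤ} (g : Fin N → G) {n : Fin N} (h : n ≠ k) : prE k b g n = g n := if_neg h

theorem prE_self {k : Fin N} {b : Fin N → ℤ} (g : Fin N → G) : prE k b g k = - g k + ∑ c, max (- b c) 0 • g c := if_pos rfl

theorem prE_zero_iff {k : Fin N} {b : Fin N → ℤ} (hb : b k = 0) {g : Fin N → G} (h : ∀ n, prE k b g n = 0) (n : Fin N) : g n = 0 := by
  have h1 : ∀ n, n ≠ k → g n = 0 := fun n hn => by rw [← prE_ne (b := b) g hn, h]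
  by_cases hn : n = k
  · subst hn
    have h2 := h n
    rw [prE_self, Finset.sum_eq_zero, add_zero, neg_eq_zero] at h2
    · exact h2
    · intro c _
      by_cases hc : c = n
      · subst hc; rw [hb]; simp
      · rw [h1 c hc, smul_zero]
  · exact h1 n hn

theorem prE_delta {K : Type*} [Field K] {k : Fin N} {b : Fin N → ℤ} (j : Fin N) (x y : K) (hjk : j ≠ k) (hb : b k = 0) (n : Fin N) :
    prE k b (fun c => (if c = j then x else 0) + if c = k then y else 0) n =
      (if n = j then x else 0) + if n = k then (max (- b j) 0) • x - y else 0 := by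
  by_cases h : n = k
  · subst h
    rw [prE_self]
    simp only [smul_add, smul_ite, smul_zero, Finset.sum_add_distrib, Finset.sum_ite_eq', Finset.mem_univ, if_true, hb, if_neg hjk.symm]
    simp; ring
  · rw [prE_ne _ h]; simp [h]

end Lin

section Log

variable {K : Type u} [Field K] {F : Type u} [Field F] [Algebra K F] {N r : ℕ}

/-- Laurent monomial -/
def lm (z : Fin N → F) (v : Fin N → ℤ) : F := ∏ l, z l ^ v l

theorem lm_ne {z : Fin N → F} (hz : ∀ k, z k ≠ 0) (v : Fin N → ℤ) : lm z v ≠ 0 :=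
  Finset.prod_ne_zero_iff.2 fun l _ => zpow_ne_zero _ (hz l)

theorem lm_add {z : Fin N → F} (hz : ∀ k, z k ≠ 0) (v v' : Fin N → ℤ) : lm z (v + v') = lm z v * lm z v' := by
  unfold lm
  rw [← Finset.prod_mul_distrib]
  exact Finset.prod_congr rfl fun l _ => zpow_add₀ (hz l) _ _

theorem eg_mul (D : Derivation K F F) {a b : F} {x y : K} (ha : D a = x • a) (hb : D b = y • b) : D (a * b) = (x + y) • (a * b) := by
  rw [D.leibniz, ha, hb, smul_eq_mul, smul_eq_mul]
  simp only [Algebra.smul_def, map_add]; ring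

theorem eg_inv (D : Derivation K F F) {a : F} {x : K} (h0 : a ≠ 0) (ha : D a = x • a) : D a⁻¹ = (-x) • a⁻¹ := by
  have h1 : D (a * a⁻¹) = 0 := by rw [mul_inv_cancel₀ h0]; exact D.map_one_eq_zero
  rw [D.leibniz, ha, smul_eq_mul, smul_eq_mul] at h1
  refine mul_left_cancel₀ h0 ?_
  simp only [Algebra.smul_def, map_neg] at *
  linear_combination h1

theorem eg_pow (D : Derivation K F F) {a : F} {x : K} (ha : D a = x • a) (n : ℕ) : D (a ^ n) = (n • x) • a ^ n := by
  induction n with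
  | zero => simp
  | succ n ih => rw [pow_succ, eg_mul D ih ha, succ_nsmul]

theorem eg_zpow (D : Derivation K F F) {a : F} {x : K} (h0 : a ≠ 0) (ha : D a = x • a) (n : ℤ) : D (a ^ n) = (n • x) • a ^ n := by
  rcases n with n | n
  · simpa using eg_pow D ha n
  · rw [zpow_negSucc, eg_inv D (pow_ne_zero _ h0) (eg_pow D ha _), negSucc_zsmul]

theorem eg_prod (D : Derivation K F F) {ι : Type*} (s : Finset ι) (f : ι → F) (x : ι → K) (h : ∀ i ∈ s, D (f i) = x i • f i) :
    D (∏ i ∈ s, f i) = (∑ i ∈ s, x i) • ∏ i ∈ s, f i := by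
  classical
  induction s using Finset.induction_on with
  | empty => simp
  | insert a s ha ih =>
    rw [Finset.prod_insert ha, Finset.sum_insert ha]
    exact eg_mul D (h a (Finset.mem_insert_self _ _)) (ih fun i hi => h i (Finset.mem_insert_of_mem hi))

theorem eg_lm (D : Derivation K F F) {z : Fin N → F} (hz : ∀ k, z k ≠ 0) {x : Fin N → K} (h : ∀ k, D (z k) = x k • z k)
    (v : Fin N → ℤ) : D (lm z v) = (∑ l, v l • x l) • lm z v :=
  eg_prod D _ _ _ fun l _ => eg_zpow D (hz l) (h l) (v l)

theorem smul_inj {x y : K} {a : F} (h : a ≠ 0) (e : x • a = y • a) : x = y := by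
  rw [Algebra.smul_def, Algebra.smul_def] at e
  exact (algebraMap K F).injective (mul_right_cancel₀ h e)

theorem dot_prE (h : Fin r → K) (k : Fin N) (b : Fin N → ℤ) (w : Fin N → Fin r → ℤ) (n : Fin N) :
    dot h (prE k b w n) = prE k b (fun c => dot h (w c)) n := by
  unfold prE
  split_ifs
  · rw [dot_add, dot_neg, dot_sum]
    congr 1
    refine Finset.sum_congr rfl fun c _ => ?_
    rw [dot_smul, zsmul_eq_mul]
  · rfl

/-- exchange polynomial -/
def exP (z : Fin N → F) (b : Fin N → ℤ) : F :=
  (∏ l, z l ^ (max (b l) 0).toNat) + ∏ l, z l ^ (max (- b l) 0).toNat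

theorem exP_eq {z : Fin N → F} (hz : ∀ k, z k ≠ 0) (b : Fin N → ℤ) :
    exP z b = lm z (fun l => max (- b l) 0) * (1 + lm z b) := by
  have h1 : ∏ l, z l ^ (max (- b l) 0).toNat = lm z (fun l => max (- b l) 0) := by
    refine Finset.prod_congr rfl fun l _ => ?_
    rw [← zpow_natCast, Int.toNat_of_nonneg (le_max_right _ _)]
  have h2 : ∏ l, z l ^ (max (b l) 0).toNat = lm z (fun l => max (- b l) 0) * lm z b := by
    rw [← lm_add hz]
    refine Finset.prod_congr rfl fun l _ => ?_
    rw [← zpow_natCast, Int.toNat_of_nonneg (le_max_right _ _)]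
    congr 1
    simp only [Pi.add_apply]
    rcases le_total (b l) 0 with h | h
    · rw [max_eq_right h, max_eq_left (by omega)]; ring
    · rw [max_eq_left h, max_eq_right (by omega)]; ring
  rw [exP, h1, h2]; ring

end Log

end PN

end Mod17

section Mod18
namespace PN

/-- data for compatible cluster structures -/
structure CD (K : Type u) [Field K] (F : Type u) [Field F] [Algebra K F] (N r : ℕ) where
  ham : F → Derivation K F F
  skew : ∀ f g, ham f g = - ham g f
  D : (Fin r → K) → Derivation K F F
  lam : Fin N → K
  ex : Finset (Fin N)
  dd : Fin N → ℕ
  lam_ne : ∀ k ∈ ex, lam k ≠ 0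
  dd_pos : ∀ k, 0 < dd k
  hdl : ∀ k ∈ ex, ∀ l ∈ ex, (dd l : K) * lam k = (dd k : K) * lam l

variable {K : Type u} [Field K] [CharZero K] {F : Type u} [Field F] [Algebra K F] {N r : ℕ} (Q : CD K F N r)

/-- log-canonical homogeneous generating cluster -/
structure CD.LCW (z : Fin N → F) (L : Fin N → Fin N → K) (w : Fin N → Fin r → ℤ) : Prop where
  nz : ∀ k, z k ≠ 0
  lc : ∀ k l, Q.ham (z k) (z l) = L k l • (z k * z l)
  wt : ∀ h k, Q.D h (z k) = dot h (w k) • z k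
  nd : ∀ v : Fin N → ℤ, (∀ n, ∑ l, v l • L l n = 0) → ∑ l, v l • w l = 0 → v = 0
  gen : IntermediateField.adjoin K (Set.range z) = ⊤

/-- compatible column -/
def CD.Col (L : Fin N → Fin N → K) (w : Fin N → Fin r → ℤ) (k : Fin N) (b : Fin N → ℤ) : Prop :=
  (∀ n, ∑ l, b l • L l n = if n = k then Q.lam k else 0) ∧ ∑ l, b l • w l = 0

/-- logarithmic hamiltonian derivation -/
def CD.lg (z : Fin N → F) (n : Fin N) : Derivation K F F := - ((z n)⁻¹ • Q.ham (z n))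

variable {Q}

theorem CD.LCW.sk {z : Fin N → F} {L : Fin N → Fin N → K} {w : Fin N → Fin r → ℤ} (H : Q.LCW z L w) (k l : Fin N) : L k l = - L l k := by
  refine smul_inj (mul_ne_zero (H.nz k) (H.nz l)) ?_
  rw [← H.lc, Q.skew, H.lc, neg_smul, mul_comm]

theorem CD.LCW.sk0 {z : Fin N → F} {L : Fin N → Fin N → K} {w : Fin N → Fin r → ℤ} (H : Q.LCW z L w) (k : Fin N) : L k k = 0 :=
  self_eq_neg.1 (H.sk k k)

theorem CD.LCW.lg_z {z : Fin N → F} {L : Fin N → Fin N → K} {w : Fin N → Fin r → ℤ} (H : Q.LCW z L w) (n l : Fin N) :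
    Q.lg z n (z l) = L l n • z l := by
  have h := H.nz n
  unfold CD.lg
  rw [Derivation.neg_apply, Derivation.smul_apply, H.lc, H.sk l n, neg_smul, smul_eq_mul, mul_smul_comm, inv_mul_cancel_left₀ h]

theorem CD.LCW.lg_lm {z : Fin N → F} {L : Fin N → Fin N → K} {w : Fin N → Fin r → ℤ} (H : Q.LCW z L w) (n : Fin N) (v : Fin N → ℤ) :
    Q.lg z n (lm z v) = (∑ l, v l • L l n) • lm z v := eg_lm _ H.nz (H.lg_z n) v

theorem CD.LCW.D_lm {z : Fin N → F} {L : Fin N → Fin N → K} {w : Fin N → Fin r → ℤ} (H : Q.LCW z L w) (h : Fin r → K) (v : Fin N → ℤ) :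
    Q.D h (lm z v) = (dot h (∑ l, v l • w l)) • lm z v := by
  rw [eg_lm _ H.nz (H.wt h) v, dot_sum]
  congr 1
  exact Finset.sum_congr rfl fun l _ => by rw [dot_smul, zsmul_eq_mul]

/-- pairing of two columns -/
theorem CD.LCW.pair {z : Fin N → F} {L : Fin N → Fin N → K} {w : Fin N → Fin r → ℤ} (H : Q.LCW z L w) {k j : Fin N}
    {b c : Fin N → ℤ} (hb : Q.Col L w k b) (hc : Q.Col L w j c) : (c k : K) * Q.lam k = - ((b j : K) * Q.lam j) := by
  have h1 : ∑ n, c n • ∑ l, b l • L l n = (c k : K) * Q.lam k := by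
    simp only [hb.1, smul_ite, smul_zero, Finset.sum_ite_eq', Finset.mem_univ, if_true]
    rw [zsmul_eq_mul]
  have h2 : ∑ l, b l • ∑ n, c n • L n l = (b j : K) * Q.lam j := by
    simp only [hc.1, smul_ite, smul_zero, Finset.sum_ite_eq', Finset.mem_univ, if_true]
    rw [zsmul_eq_mul]
  rw [← h1, ← h2]
  simp only [Finset.smul_sum]
  rw [Finset.sum_comm, ← Finset.sum_neg_distrib]
  refine Finset.sum_congr rfl fun l _ => ?_
  rw [← Finset.sum_neg_distrib]
  refine Finset.sum_congr rfl fun n _ => ?_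
  rw [H.sk l n, smul_neg, smul_neg, smul_smul, smul_smul, mul_comm]

theorem CD.LCW.diag {z : Fin N → F} {L : Fin N → Fin N → K} {w : Fin N → Fin r → ℤ} (H : Q.LCW z L w) {k : Fin N}
    {b : Fin N → ℤ} (hk : k ∈ Q.ex) (hb : Q.Col L w k b) : b k = 0 := by
  have h := self_eq_neg.1 (H.pair hb hb)
  exact_mod_cast (mul_eq_zero.1 h).resolve_right (Q.lam_ne k hk)

/-- scaled version of the pairing -/
theorem CD.LCW.pairZ {z : Fin N → F} {L : Fin N → Fin N → K} {w : Fin N → Fin r → ℤ} (H : Q.LCW z L w) {k j : Fin N}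
    {b c : Fin N → ℤ} (hk : k ∈ Q.ex) (hj : j ∈ Q.ex) (hb : Q.Col L w k b) (hc : Q.Col L w j c) :
    (Q.dd k : ℤ) * c k = - ((Q.dd j : ℤ) * b j) := by
  have h1 := H.pair hb hc
  have h2 := Q.hdl k hk j hj
  have h3 := Q.lam_ne k hk
  have : (Q.lam k) * ((Q.dd k : K) * c k + (Q.dd j : K) * b j) = 0 := by
    linear_combination (Q.dd k : K) * h1 + (b j : K) * h2
  have h4 := (mul_eq_zero.1 this).resolve_left h3
  have h5 : (((Q.dd k : ℤ) * c k + (Q.dd j : ℤ) * b j : ℤ) : K) = 0 := by push_cast; exact h4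
  have h6 : (Q.dd k : ℤ) * c k + (Q.dd j : ℤ) * b j = 0 := by exact_mod_cast h5
  linarith

theorem CD.LCW.col_uniq {z : Fin N → F} {L : Fin N → Fin N → K} {w : Fin N → Fin r → ℤ} (H : Q.LCW z L w) {k : Fin N}
    {b c : Fin N → ℤ} (hb : Q.Col L w k b) (hc : Q.Col L w k c) : b = c := by
  have := H.nd (b - c) (fun n => ?_) ?_
  · exact sub_eq_zero.1 this
  · simp only [Pi.sub_apply, sub_smul, Finset.sum_sub_distrib, hb.1, hc.1, sub_self]
  · simp only [Pi.sub_apply, sub_smul, Finset.sum_sub_distrib, hb.2, hc.2, sub_self]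

theorem CD.LCW.one_add_ne {z : Fin N → F} {L : Fin N → Fin N → K} {w : Fin N → Fin r → ℤ} (H : Q.LCW z L w) {k : Fin N}
    {b : Fin N → ℤ} (hk : k ∈ Q.ex) (hb : Q.Col L w k b) : 1 + lm z b ≠ 0 := by
  intro h
  have h1 := H.lg_lm k b
  rw [hb.1, if_pos rfl] at h1
  rw [show lm z b = -1 by linear_combination h] at h1
  rw [map_neg, Derivation.map_one_eq_zero, neg_zero] at h1
  exact smul_ne_zero (Q.lam_ne k hk) (neg_ne_zero.2 one_ne_zero) h1.symm

theorem exP_congr {z z' : Fin N → F} {k : Fin N} {b : Fin N → ℤ} (hb : b k = 0) (hz : ∀ l, l ≠ k → z' l = z l) : exP z' b = exP z b := by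
  unfold exP
  congr 1
  all_goals
    refine Finset.prod_congr rfl fun l _ => ?_
    by_cases h : l = k
    · subst h; simp [hb]
    · rw [hz l h]

/-- mutation of clusters -/
theorem CD.LCW.mut {z z' : Fin N → F} {L : Fin N → Fin N → K} {w : Fin N → Fin r → ℤ} (H : Q.LCW z L w) {k : Fin N}
    {b : Fin N → ℤ} (hk : k ∈ Q.ex) (hb : Q.Col L w k b) (hz : ∀ l, l ≠ k → z' l = z l) (he : z' k * z k = exP z b) :
    Q.LCW z' (fun l n => prE k b (fun c => prE k b (fun a => L a c) l) n) (prE k b w) := by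
  have hbk := H.diag hk hb
  have hzk := H.nz k
  have he' : z' k = (z k)⁻¹ * (lm z (fun l => max (- b l) 0) * (1 + lm z b)) := by
    rw [← exP_eq H.nz, ← he]; field_simp
  have h1 := H.one_add_ne hk hb
  have hnz : ∀ l, z' l ≠ 0 := by
    intro l
    by_cases h : l = k
    · subst h; rw [he']
      exact mul_ne_zero (inv_ne_zero hzk) (mul_ne_zero (lm_ne H.nz _) h1)
    · rw [hz l h]; exact H.nz l
  have key : ∀ (E : Derivation K F F) (x : Fin N → K), (∀ l, E (z l) = x l • z l) → E (lm z b) = 0 →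
      ∀ l, E (z' l) = prE k b x l • z' l := by
    intro E x hx h0 l
    by_cases h : l = k
    · subst h
      rw [prE_self, he']
      refine eg_mul E (eg_inv E hzk (hx l)) ?_
      have : E (1 + lm z b) = (0 : K) • (1 + lm z b) := by rw [map_add, h0, Derivation.map_one_eq_zero]; simp
      simpa using eg_mul E (eg_lm E H.nz hx _) this
    · rw [prE_ne _ h, hz l h, hx]
  have key2 : ∀ n, n ≠ k → ∀ l, Q.lg z n (z' l) = prE k b (fun a => L a n) l • z' l := by
    intro n hn
    refine key _ _ (H.lg_z n) ?_
    rw [H.lg_lm, hb.1, if_neg hn, zero_smul]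
  have key3 : ∀ n, n ≠ k → ∀ l, Q.ham (z' n) (z' l) = (- prE k b (fun a => L a n) l) • (z' n * z' l) := by
    intro n hn l
    have := key2 n hn l
    unfold CD.lg at this
    rw [hz n hn]
    have hn0 := H.nz n
    rw [Derivation.neg_apply, Derivation.smul_apply, smul_eq_mul] at this
    have h2 : Q.ham (z n) (z' l) = - (z n * (-((z n)⁻¹ * Q.ham (z n) (z' l)))) := by field_simp
    rw [h2, this, neg_smul, mul_smul_comm]
  have hsk : ∀ l n, prE k b (fun c => prE k b (fun a => L a c) l) n = - prE k b (fun c => prE k b (fun a => L a c) n) l := by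
    have ex : ∀ l n, prE k b (fun c => prE k b (fun a => L a c) l) n = ∑ x, ∑ y, Ev k b (Pi.single l 1) x • Ev k b (Pi.single n 1) y • L x y := by
      intro l n
      have := sum_prE hbk (Pi.single n 1) (fun c => prE k b (fun a => L a c) l)
      have e1 : ∀ g : Fin N → K, ∀ n : Fin N, ∑ l, (Pi.single n (1:ℤ) : Fin N → ℤ) l • g l = g n := by
        intro g n
        rw [Finset.sum_eq_single n]
        · simp
        · intro l _ h; rw [Pi.single_eq_of_ne h]; simp
        · simp
      rw [e1] at this
      rw [this, Finset.sum_comm]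
      refine Finset.sum_congr rfl fun y _ => ?_
      have := sum_prE hbk (Pi.single l 1) (fun a => L a y)
      rw [e1] at this
      rw [this, Finset.smul_sum]
      refine Finset.sum_congr rfl fun x _ => ?_
      rw [smul_smul, smul_smul, mul_comm]
    intro l n
    rw [ex, ex, Finset.sum_comm, ← Finset.sum_neg_distrib]
    refine Finset.sum_congr rfl fun y _ => ?_
    rw [← Finset.sum_neg_distrib]
    refine Finset.sum_congr rfl fun x _ => ?_
    rw [H.sk x y, smul_neg, smul_neg, smul_smul, smul_smul, mul_comm]
  have lc1 : ∀ n, n ≠ k → ∀ l, Q.ham (z' n) (z' l) = prE k b (fun c => prE k b (fun a => L a c) n) l • (z' n * z' l) := by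
    intro n hn l
    rw [key3 n hn, hsk n l, prE_ne _ hn]
  refine ⟨hnz, ?_, ?_, ?_, ?_⟩
  · intro n l
    by_cases hn : n = k
    · by_cases hl : l = k
      · subst hn; subst hl
        haveI : CharZero F := charZero_of_injective_algebraMap (algebraMap K F).injective
        rw [self_eq_neg.1 (Q.skew (z' l) (z' l)), self_eq_neg.1 (hsk l l), zero_smul]
      · rw [Q.skew, lc1 l hl, hsk n l, neg_smul, mul_comm]
    · exact lc1 n hn l
  · intro h l
    rw [dot_prE]
    refine key _ _ (H.wt h) ?_ l
    rw [H.D_lm, hb.2, dot_zero, zero_smul]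
  · intro v h2 h3
    have h4 : Ev k b v = 0 := by
      refine H.nd _ (fun n => ?_) ?_
      · refine prE_zero_iff (k := k) (b := b) hbk (g := fun n => ∑ l, Ev k b v l • L l n) (fun n => ?_) n
        rw [← h2 n, prE_sum]
        congr 1
        funext c
        exact (sum_prE hbk v (fun a => L a c)).symm
      · rw [← h3]; exact (sum_prE hbk v w).symm
    rw [← Ev_invol hbk v, h4]
    funext a
    unfold Ev
    simp
  · rw [← top_le_iff, ← H.gen, IntermediateField.adjoin_le_iff]
    rintro _ ⟨l, rfl⟩
    have hm : ∀ l, z' l ∈ IntermediateField.adjoin K (Set.range z') := fun l => IntermediateField.subset_adjoin _ _ ⟨l, rfl⟩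
    by_cases h : l = k
    · subst h
      have : z l = exP z' b / z' l := by
        rw [exP_congr hbk hz, ← he]
        have := hnz l
        field_simp
      rw [this]
      refine div_mem (add_mem (prod_mem fun l _ => pow_mem (hm l) _) (prod_mem fun l _ => pow_mem (hm l) _)) (hm l)
    · simp only [SetLike.mem_coe]; rw [← hz l h]; exact hm l

end PN

end Mod18

section Mod19
namespace PN

variable {K : Type u} [Field K] [CharZero K] {F : Type u} [Field F] [Algebra K F] {N r : ℕ} {Q : CD K F N r}

/-- mutated bracket matrix -/
def mL (k : Fin N) (b : Fin N → ℤ) (L : Fin N → Fin N → K) : Fin N → Fin N → K :=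
  fun l n => prE k b (fun c => prE k b (fun a => L a c) l) n

theorem sum_mL {k : Fin N} {b : Fin N → ℤ} (hb : b k = 0) (L : Fin N → Fin N → K) (v : Fin N → ℤ) (n : Fin N) :
    ∑ l, v l • mL k b L l n = prE k b (fun c => ∑ a, Ev k b v a • L a c) n := by
  unfold mL
  rw [prE_sum]
  congr 1
  funext c
  exact sum_prE hb v (fun a => L a c)

theorem CD.LCW.uniq {z : Fin N → F} {L L' : Fin N → Fin N → K} {w w' : Fin N → Fin r → ℤ} (H : Q.LCW z L w) (H' : Q.LCW z L' w') :
    L' = L ∧ w' = w := by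
  constructor
  · funext k l
    refine smul_inj (mul_ne_zero (H.nz k) (H.nz l)) ?_
    rw [← H.lc, ← H'.lc]
  · funext k
    refine dot_inj (K := K) fun h => ?_
    refine smul_inj (H.nz k) ?_
    rw [← H.wt, ← H'.wt]

theorem CD.LCW.col_self {z : Fin N → F} {L : Fin N → Fin N → K} {w : Fin N → Fin r → ℤ} (H : Q.LCW z L w) {k : Fin N}
    {b : Fin N → ℤ} (hk : k ∈ Q.ex) (hb : Q.Col L w k b) : Q.Col (mL k b L) (prE k b w) k (-b) := by
  have hbk := H.diag hk hb
  have hE : Ev k b (-b) = -b := by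
    funext a
    unfold Ev
    by_cases h : a = k
    · subst h; simp [hbk]
    · simp [h, hbk]
  refine ⟨fun n => ?_, ?_⟩
  · rw [sum_mL hbk, hE]
    simp only [Pi.neg_apply, neg_smul, Finset.sum_neg_distrib, hb.1]
    by_cases h : n = k
    · subst h
      rw [prE_self]
      simp only [if_true]
      rw [neg_neg, Finset.sum_eq_zero, add_zero]
      intro c _
      by_cases hc : c = n
      · subst hc; simp [hbk]
      · simp [hc]
    · rw [prE_ne _ h]; simp [h]
  · rw [sum_prE hbk, hE]
    simp only [Pi.neg_apply, neg_smul, Finset.sum_neg_distrib, hb.2, neg_zero]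

/-- new column -/
def mC (k : Fin N) (b c : Fin N → ℤ) : Fin N → ℤ :=
  fun a => if a = k then - c a else c a + max (b a) 0 * max (c k) 0 - max (- b a) 0 * max (- c k) 0

theorem mC_Ev {k : Fin N} {b : Fin N → ℤ} (hb : b k = 0) (c : Fin N → ℤ) : Ev k b (mC k b c) = c + (max (c k) 0) • b := by
  funext a
  unfold Ev mC
  by_cases h : a = k
  · subst h; simp [hb]
  · simp only [h, if_false, if_true, Pi.add_apply, Pi.smul_apply, smul_eq_mul]
    have h1 : b a = max (b a) 0 - max (- b a) 0 := by
      rcases le_total (b a) 0 with h | h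
      · rw [max_eq_right h, max_eq_left (by omega)]; ring
      · rw [max_eq_left h, max_eq_right (by omega)]; ring
    have h2 : c k = max (c k) 0 - max (- c k) 0 := by
      rcases le_total (c k) 0 with h | h
      · rw [max_eq_right h, max_eq_left (by omega)]; ring
      · rw [max_eq_left h, max_eq_right (by omega)]; ring
    linear_combination (- max (c k) 0) * h1 - (max (- b a) 0) * h2

theorem CD.LCW.pair_max {z : Fin N → F} {L : Fin N → Fin N → K} {w : Fin N → Fin r → ℤ} (H : Q.LCW z L w) {k j : Fin N}
    {b c : Fin N → ℤ} (hk : k ∈ Q.ex) (hj : j ∈ Q.ex) (hb : Q.Col L w k b) (hc : Q.Col L w j c) :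
    ((max (c k) 0 : ℤ) : K) * Q.lam k = ((max (- b j) 0 : ℤ) : K) * Q.lam j := by
  have h1 := H.pairZ hk hj hb hc
  have h2 := H.pair hb hc
  have hk0 : (0:ℤ) < Q.dd k := by exact_mod_cast Q.dd_pos k
  have hj0 : (0:ℤ) < Q.dd j := by exact_mod_cast Q.dd_pos j
  rcases le_total (c k) 0 with h | h
  · have : 0 ≤ b j := by
      by_contra h'
      push Not at h'
      nlinarith
    rw [max_eq_right h, max_eq_right (by omega)]; simp
  · have : b j ≤ 0 := by
      by_contra h'
      push Not at h'
      nlinarith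
    rw [max_eq_left h, max_eq_left (by omega), h2]; push_cast; ring

theorem CD.LCW.col_mut {z : Fin N → F} {L : Fin N → Fin N → K} {w : Fin N → Fin r → ℤ} (H : Q.LCW z L w) {k j : Fin N} (hjk : j ≠ k)
    {b c : Fin N → ℤ} (hk : k ∈ Q.ex) (hj : j ∈ Q.ex) (hb : Q.Col L w k b) (hc : Q.Col L w j c) :
    Q.Col (mL k b L) (prE k b w) j (mC k b c) := by
  have hbk := H.diag hk hb
  refine ⟨fun n => ?_, ?_⟩
  · rw [sum_mL hbk, mC_Ev hbk]
    have : (fun m => ∑ a, (c + (max (c k) 0) • b) a • L a m) =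
        fun m => (if m = j then Q.lam j else 0) + if m = k then (max (- b j) 0) • Q.lam j else 0 := by
      funext m
      simp only [Pi.add_apply, Pi.smul_apply, add_smul, Finset.sum_add_distrib, hc.1, smul_assoc, ← Finset.smul_sum, hb.1]
      congr 1
      rw [smul_ite, smul_zero, zsmul_eq_mul, zsmul_eq_mul, H.pair_max hk hj hb hc]
    rw [this, prE_delta _ _ _ hjk hbk]
    simp
  · rw [sum_prE hbk, mC_Ev hbk]
    simp only [Pi.add_apply, Pi.smul_apply, add_smul, Finset.sum_add_distrib, hc.2, smul_assoc, ← Finset.smul_sum, hb.2, smul_zero, add_zero]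

theorem exP_neg (z : Fin N → F) (b : Fin N → ℤ) : exP z (-b) = exP z b := by
  unfold exP
  simp only [Pi.neg_apply, neg_neg]
  rw [add_comm]

/-- backward transport of columns -/
theorem CD.LCW.col_back {z z' : Fin N → F} {L L' : Fin N → Fin N → K} {w w' : Fin N → Fin r → ℤ} (H : Q.LCW z L w) {k j : Fin N} (hjk : j ≠ k)
    {b c : Fin N → ℤ} (hk : k ∈ Q.ex) (hj : j ∈ Q.ex) (hb : Q.Col L w k b)
    (hz : ∀ l, l ≠ k → z' l = z l) (he : z' k * z k = exP z b) (H' : Q.LCW z' L' w')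
    (hc : Q.Col L' w' j c) : ∃ c', Q.Col L w j c' := by
  have hm : Q.LCW z' (mL k b L) (prE k b w) := H.mut hk hb hz he
  obtain ⟨rfl, rfl⟩ := hm.uniq H'
  have hs := H.col_self hk hb
  have hbk := H.diag hk hb
  have h2 := hm.mut (z' := z) hk hs (fun l hl => (hz l hl).symm)
    (by rw [mul_comm, he, exP_neg, exP_congr hbk hz])
  obtain ⟨h3, h4⟩ := H.uniq h2
  have h5 := hm.col_mut hjk hk hj hs hc
  refine ⟨mC k (-b) c, ?_⟩
  rw [h4] at h5
  have h6 : mL k (-b) (mL k b L) = L := h3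
  rw [h6] at h5
  exact h5

variable (Q) in
/-- good seed -/
def CD.Good (S : CSeed F N) : Prop :=
  (∀ k, k ∉ Q.ex → ∀ l, S.B l k = 0) ∧ ∃ L w, Q.LCW S.z L w ∧ ∀ k ∈ Q.ex, Q.Col L w k (fun l => S.B l k)

theorem cMutB_col (B : Fin N → Fin N → ℤ) {k j : Fin N} (h : j ≠ k) : (fun l => cMutB B k l j) = mC k (fun l => B l k) (fun l => B l j) := by
  funext l
  unfold cMutB mC
  by_cases h1 : l = k <;> simp [h1, h]

theorem cMutB_self (B : Fin N → Fin N → ℤ) (k : Fin N) : (fun l => cMutB B k l k) = - (fun l => B l k) := by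
  funext l; simp [cMutB]

theorem cMutB_invol (B : Fin N → Fin N → ℤ) (k : Fin N) : cMutB (cMutB B k) k = B := by
  funext i j
  unfold cMutB
  by_cases h1 : i = k <;> by_cases h2 : j = k <;> simp [h1, h2]

theorem CD.Good.mut {S S' : CSeed F N} {k : Fin N} (G : Q.Good S) (h : CSeedMutRel F Q.ex S S' k) : Q.Good S' := by
  obtain ⟨h0, L, w, H, hC⟩ := G
  obtain ⟨hk, hB, hz, he⟩ := h
  refine ⟨fun j hj l => ?_, _, _, H.mut hk (hC k hk) hz he, fun j hj => ?_⟩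
  · have hjk : j ≠ k := fun h => hj (h ▸ hk)
    have := congrFun (cMutB_col S.B hjk) l
    rw [hB, this]
    unfold mC
    simp [h0 j hj]
  · rw [hB]
    by_cases hjk : j = k
    · subst hjk
      rw [cMutB_self]
      exact H.col_self hk (hC j hk)
    · rw [cMutB_col _ hjk]
      exact H.col_mut hjk hk hj (hC k hk) (hC j hj)

theorem mutRel_symm {ex : Finset (Fin N)} {S S' : CSeed F N} {k : Fin N} (h : CSeedMutRel F ex S S' k) (h0 : S.B k k = 0) : CSeedMutRel F ex S' S k := by
  obtain ⟨hk, hB, hz, he⟩ := h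
  refine ⟨hk, by rw [hB, cMutB_invol], fun l hl => (hz l hl).symm, ?_⟩
  change _ = exP S'.z (fun l => S'.B l k)
  rw [hB, cMutB_self, exP_neg, exP_congr (b := fun l => S.B l k) h0 hz, mul_comm]
  exact he

theorem CD.Good.diag {S : CSeed F N} (G : Q.Good S) (k : Fin N) : S.B k k = 0 := by
  obtain ⟨h0, L, w, H, hC⟩ := G
  by_cases hk : k ∈ Q.ex
  · exact H.diag (b := fun l => S.B l k) hk (hC k hk)
  · exact h0 k hk k

theorem CD.Good.mut' {S S' : CSeed F N} {k : Fin N} (G : Q.Good S') (h : CSeedMutRel F Q.ex S S' k) : Q.Good S := by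
  refine G.mut (mutRel_symm h ?_)
  have := G.diag k
  rw [h.2.1] at this
  simpa [cMutB] using this

theorem CD.LCW.indep {z : Fin N → F} {L : Fin N → Fin N → K} {w : Fin N → Fin r → ℤ} (H : Q.LCW z L w) :
    LinearIndependent K (lm z) := by
  classical
  rw [linearIndependent_iff']
  intro s
  induction s using Finset.induction_on with
  | empty => simp
  | insert v0 s hv0 ih =>
    intro g hg
    have key : ∀ (E : Derivation K F F) (x : (Fin N → ℤ) → K), (∀ v, E (lm z v) = x v • lm z v) → ∀ v ∈ s, g v * (x v - x v0) = 0 := by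
      intro E x hx
      refine ih (fun v => g v * (x v - x v0)) ?_
      have h1 := congrArg E hg
      rw [map_zero, map_sum] at h1
      have h2 : ∑ v ∈ insert v0 s, (g v * (x v - x v0)) • lm z v = 0 := by
        have h3 := congrArg (fun f => x v0 • f) hg
        simp only [smul_zero, Finset.smul_sum] at h3
        rw [← sub_zero (0 : F)]
        nth_rewrite 2 [← h3]
        rw [← h1, ← Finset.sum_sub_distrib]
        refine Finset.sum_congr rfl fun v _ => ?_
        rw [Derivation.map_smul, hx, smul_smul, smul_smul, ← sub_smul]
        congr 1; ring
      rw [Finset.sum_insert hv0] at h2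
      simpa using h2
    have hs : ∀ v ∈ s, g v = 0 := by
      intro v hv
      by_contra hne
      have hvv : v - v0 = 0 := by
        refine H.nd _ (fun n => ?_) ?_
        · have := (mul_eq_zero.1 (key _ _ (H.lg_lm n) v hv)).resolve_left hne
          simpa only [Pi.sub_apply, sub_smul, Finset.sum_sub_distrib] using this
        · refine dot_inj (K := K) fun h => ?_
          have := (mul_eq_zero.1 (key _ _ (H.D_lm h) v hv)).resolve_left hne
          simp only [Pi.sub_apply, sub_smul, Finset.sum_sub_distrib]
          rw [dot_sub, this, dot_zero]
      rw [sub_eq_zero] at hvv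
      exact hv0 (hvv ▸ hv)
    intro v hv
    rcases Finset.mem_insert.1 hv with rfl | hv
    · rw [Finset.sum_insert hv0, Finset.sum_eq_zero (fun v hv => by rw [hs v hv, zero_smul]), add_zero] at hg
      exact (smul_eq_zero.1 hg).resolve_right (lm_ne H.nz _)
    · exact hs v hv

theorem CD.Good.valid {S : CSeed F N} (G : Q.Good S) : CSeedIsValid K F Q.ex S := by
  obtain ⟨h0, L, w, H, hC⟩ := G
  refine ⟨H.indep, h0, Q.dd, Q.dd_pos, fun k hk l hl => ?_⟩
  exact H.pairZ hk hl (hC k hk) (hC l hl)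

theorem CD.Good.equiv {S S' : CSeed F N} (G : Q.Good S) (h : CMutEquiv K F Q.ex S S') : Q.Good S' := by
  induction h with
  | refl => exact G
  | tail _ h ih =>
    obtain ⟨_, _, k, h | h⟩ := h
    · exact ih.mut h
    · exact ih.mut' h

theorem CD.Good.logcan {S : CSeed F N} (G : Q.Good S) (k l : Fin N) : ∃ ω : K, Q.ham (S.z k) (S.z l) = ω • (S.z k * S.z l) := by
  obtain ⟨h0, L, w, H, hC⟩ := G
  exact ⟨_, H.lc k l⟩

theorem CD.Good.step {S S' : CSeed F N} {k : Fin N} (G : Q.Good S) (h : CSeedMutRel F Q.ex S S' k) : CMutEquiv K F Q.ex S S' :=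
  Relation.ReflTransGen.single ⟨G.valid, (G.mut h).valid, k, Or.inl h⟩

/-- all mutations exist, and mutation equivalence reduces to forward mutations -/
theorem CD.Good.exMut {S : CSeed F N} (G : Q.Good S) {k : Fin N} (hk : k ∈ Q.ex) : ∃ S', CSeedMutRel F Q.ex S S' k := by
  classical
  refine ⟨⟨fun l => if l = k then exP S.z (fun l => S.B l k) / S.z k else S.z l, cMutB S.B k⟩, hk, rfl, fun l hl => by simp [hl], ?_⟩
  obtain ⟨h0, L, w, H, hC⟩ := G
  have := H.nz k
  simp only [if_true]
  rw [div_mul_cancel₀ _ this]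
  rfl

theorem CD.Good.fwd {S S' : CSeed F N} (G : Q.Good S) (h : CMutEquiv K F Q.ex S S') :
    Relation.ReflTransGen (fun A B => Q.Good A ∧ ∃ k, CSeedMutRel F Q.ex A B k) S S' := by
  induction h with
  | refl => exact Relation.ReflTransGen.refl
  | tail h1 h ih =>
    refine ih.tail ⟨G.equiv h1, ?_⟩
    obtain ⟨_, _, k, h | h⟩ := h
    · exact ⟨k, h⟩
    · have := (G.equiv h1).mut' h
      exact ⟨k, mutRel_symm h (this.diag k)⟩

/-- symmetric closure -/
theorem CD.Good.symm {S S' : CSeed F N} (G : Q.Good S) (h : CMutEquiv K F Q.ex S S') : CMutEquiv K F Q.ex S' S := by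
  induction h with
  | refl => exact Relation.ReflTransGen.refl
  | tail h1 h ih =>
    obtain ⟨a, b, k, h⟩ := h
    exact Relation.ReflTransGen.head ⟨b, a, k, h.symm⟩ ih

end PN

end Mod19

section Mod20
namespace PN

variable {K : Type u} [Field K] [CharZero K] {F : Type u} [Field F] [Algebra K F] {N r : ℕ} {Q : CD K F N r}

variable (Q) in
/-- exchange step in a chain of clusters -/
def CD.XStep (z z' : Fin N → F) : Prop :=
  ∃ k b L w, k ∈ Q.ex ∧ Q.LCW z L w ∧ Q.Col L w k b ∧ (∀ l, l ≠ k → z' l = z l) ∧ z' k * z k = exP z b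

theorem CD.XStep.lcw {z z' : Fin N → F} (h : Q.XStep z z') : ∃ L w, Q.LCW z' L w := by
  obtain ⟨k, b, L, w, hk, H, hb, hz, he⟩ := h
  exact ⟨_, _, H.mut hk hb hz he⟩

theorem chain_lcw {z z' : Fin N → F} (h : Relation.ReflTransGen Q.XStep z z') (H : ∃ L w, Q.LCW z L w) : ∃ L w, Q.LCW z' L w := by
  induction h with
  | refl => exact H
  | tail _ h _ => exact h.lcw

theorem chain_fix {z z' : Fin N → F} (h : Relation.ReflTransGen Q.XStep z z') (k : Fin N) (hk : k ∉ Q.ex) : z' k = z k := by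
  induction h with
  | refl => rfl
  | tail _ h ih =>
    obtain ⟨i, b, L, w, hi, H, hb, hz, he⟩ := h
    rw [hz k (fun h => hk (h ▸ hi)), ih]

theorem chain_col {z z' : Fin N → F} (h : Relation.ReflTransGen Q.XStep z z') (k : Fin N) (hk : k ∈ Q.ex) :
    (∃ L w b, Q.LCW z L w ∧ Q.Col L w k b) ∨ z' k = z k := by
  induction h using Relation.ReflTransGen.head_induction_on with
  | refl => exact Or.inr rfl
  | head h _ ih =>
    obtain ⟨i, b, L, w, hi, H, hb, hz, he⟩ := h
    by_cases hki : k = i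
    · subst hki; exact Or.inl ⟨L, w, b, H, hb⟩
    · rcases ih with ⟨L', w', c, H', hc⟩ | ih
      · obtain ⟨c', hc'⟩ := H.col_back hki hi hk hb hz he H' hc
        exact Or.inl ⟨L, w, c', H, hc'⟩
      · exact Or.inr (by rw [ih, hz k hki])

theorem chain_seed {z z' : Fin N → F} (h : Relation.ReflTransGen Q.XStep z z') (H : ∃ L w, Q.LCW z L w)
    (hne : ∀ k ∈ Q.ex, z' k ≠ z k) : ∃ S : CSeed F N, S.z = z ∧ Q.Good S := by
  classical
  obtain ⟨L, w, H⟩ := H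
  have h1 : ∀ k, ∃ b, (k ∈ Q.ex → Q.Col L w k b) ∧ (k ∉ Q.ex → b = 0) := by
    intro k
    by_cases hk : k ∈ Q.ex
    · obtain ⟨L', w', b, H', hb⟩ := (chain_col h k hk).resolve_right (hne k hk)
      obtain ⟨rfl, rfl⟩ := H.uniq H'
      exact ⟨b, fun _ => hb, fun h => absurd hk h⟩
    · exact ⟨0, fun h => absurd h hk, fun _ => rfl⟩
  choose b hb hb0 using h1
  refine ⟨⟨z, fun l k => b k l⟩, rfl, fun k hk l => ?_, L, w, H, fun k hk => hb k hk⟩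
  simp [hb0 k hk]

theorem chain_equiv {S : CSeed F N} (G : Q.Good S) {z' : Fin N → F} (h : Relation.ReflTransGen Q.XStep S.z z') :
    ∃ S' : CSeed F N, CMutEquiv K F Q.ex S S' ∧ S'.z = z' := by
  induction h with
  | refl => exact ⟨S, Relation.ReflTransGen.refl, rfl⟩
  | tail _ h ih =>
    obtain ⟨S1, h1, rfl⟩ := ih
    obtain ⟨k, b, L, w, hk, H, hb, hz, he⟩ := h
    have G1 := G.equiv h1
    obtain ⟨h0, L', w', H', hC⟩ := id G1
    obtain ⟨rfl, rfl⟩ := H.uniq H'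
    have hbb := H.col_uniq hb (hC k hk)
    subst hbb
    rename_i z2 _
    exact ⟨⟨_, cMutB S1.B k⟩, h1.trans (G1.step (k := k) ⟨hk, rfl, hz, he⟩), rfl⟩

end PN

end Mod20

section Mod21
namespace PN

/-- abstract place with first order information -/
structure Pl (F : Type*) [Field F] (κ : Type*) [Field κ] (V : Type*) [AddCommGroup V] [Module κ V] where
  J : F → κ → V → Prop
  nul : J 0 0 0
  one : J 1 1 0
  add : ∀ {f g x y v w}, J f x v → J g y w → J (f + g) (x + y) (v + w)
  mul : ∀ {f g x y v w}, J f x v → J g y w → J (f * g) (x * y) (x • w + y • v)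
  inv : ∀ {f x v}, J f x v → x ≠ 0 → J f⁻¹ x⁻¹ (- ((x⁻¹ * x⁻¹) • v))
  uniq : ∀ {f x y v w}, J f x v → J f y w → x = y ∧ v = w
  zero : ∀ {f v}, J f 0 v → v = 0

variable {F : Type*} [Field F] {κ : Type*} [Field κ] [CharZero κ] {V : Type*} [AddCommGroup V] [Module κ V] (P : Pl F κ V) {N : ℕ}

/-- logarithmic form -/
def Pl.U (f : F) (x : κ) (l : V) : Prop := P.J f x (x • l)

variable {P}

theorem Pl.U.mul {f g : F} {x y : κ} {l m : V} (h1 : P.U f x l) (h2 : P.U g y m) : P.U (f * g) (x * y) (l + m) := by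
  have := P.mul h1 h2
  unfold Pl.U
  convert this using 1
  rw [smul_add, smul_smul, smul_smul, mul_comm y x, add_comm]

theorem Pl.U.one : P.U 1 1 0 := by
  unfold Pl.U; rw [smul_zero]; exact P.one

theorem Pl.U.inv {f : F} {x : κ} {l : V} (h1 : P.U f x l) (hx : x ≠ 0) : P.U f⁻¹ x⁻¹ (-l) := by
  have := P.inv h1 hx
  unfold Pl.U
  convert this using 1
  rw [smul_smul, mul_assoc, inv_mul_cancel₀ hx, mul_one, smul_neg]

theorem Pl.U.pow {f : F} {x : κ} {l : V} (h1 : P.U f x l) (n : ℕ) : P.U (f ^ n) (x ^ n) (n • l) := by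
  induction n with
  | zero => simpa using Pl.U.one
  | succ n ih => rw [pow_succ, pow_succ, succ_nsmul]; exact ih.mul h1

theorem Pl.U.zpow {f : F} {x : κ} {l : V} (h1 : P.U f x l) (hx : x ≠ 0) (n : ℤ) : P.U (f ^ n) (x ^ n) (n • l) := by
  rcases n with n | n
  · simpa using h1.pow n
  · rw [zpow_negSucc, zpow_negSucc, negSucc_zsmul]; exact (h1.pow _).inv (pow_ne_zero _ hx)

theorem Pl.U.prod {ι : Type*} (s : Finset ι) {f : ι → F} {x : ι → κ} {l : ι → V} (h : ∀ i ∈ s, P.U (f i) (x i) (l i)) :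
    P.U (∏ i ∈ s, f i) (∏ i ∈ s, x i) (∑ i ∈ s, l i) := by
  classical
  induction s using Finset.induction_on with
  | empty => simpa using Pl.U.one
  | insert a s ha ih =>
    rw [Finset.prod_insert ha, Finset.prod_insert ha, Finset.sum_insert ha]
    exact (h a (Finset.mem_insert_self _ _)).mul (ih fun i hi => h i (Finset.mem_insert_of_mem hi))

theorem Pl.U.lm {z : Fin N → F} {x : Fin N → κ} {l : Fin N → V} (h : ∀ i, P.U (z i) (x i) (l i)) (hx : ∀ i, x i ≠ 0) (v : Fin N → ℤ) :
    P.U (PN.lm z v) (PN.lm x v) (∑ i, v i • l i) :=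
  Pl.U.prod _ fun i _ => (h i).zpow (hx i) _

variable (κ) in
/-- corank at most one -/
def Rk (l : Fin N → V) : Prop := ∀ c d : Fin N → κ, ∑ i, c i • l i = 0 → ∑ i, d i • l i = 0 →
  ∃ s t : κ, (s ≠ 0 ∨ t ≠ 0) ∧ ∀ i, s * c i + t * d i = 0

theorem Rk.upd {l l' : Fin N → V} (h : Rk κ l) {k : Fin N} {α : κ} {β : Fin N → κ} (hα : α ≠ 0) (hβ : β k = 0)
    (h1 : ∀ i, i ≠ k → l' i = l i) (h2 : l' k = α • l k + ∑ i, β i • l i) : Rk κ l' := by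
  classical
  have key : ∀ c : Fin N → κ, ∑ i, c i • l' i = 0 → ∑ i, (if i = k then α * c k else c i + c k * β i) • l i = 0 := by
    intro c hc
    rw [← hc]
    have e1 : ∀ i, (if i = k then α * c k else c i + c k * β i) • l i = c i • l i + c k • (β i • l i) +
        if i = k then (c k • (α • l k) - c k • l k) else 0 := by
      intro i
      split_ifs with hi
      · subst hi; rw [hβ, zero_smul, smul_zero, smul_smul, mul_comm]; abel
      · rw [add_smul, mul_smul, add_zero]
    have e2 : ∀ i, c i • l' i = c i • l i + if i = k then (c k • (α • l k + ∑ i, β i • l i) - c k • l k) else 0 := by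
      intro i
      split_ifs with hi
      · subst hi; rw [h2]; abel
      · rw [h1 i hi, add_zero]
    simp only [e1, e2, Finset.sum_add_distrib, Finset.sum_ite_eq', Finset.mem_univ, if_true, ← Finset.smul_sum]
    rw [smul_add]; abel
  intro c d hc hd
  obtain ⟨s, t, hst, hh⟩ := h _ _ (key c hc) (key d hd)
  refine ⟨s, t, hst, ?_⟩
  have hk : s * c k + t * d k = 0 := by
    have := hh k
    simp only [if_true] at this
    refine (mul_eq_zero.1 (?_ : α * (s * c k + t * d k) = 0)).resolve_left hα
    linear_combination this
  intro i
  by_cases hi : i = k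
  · rw [hi, hk]
  · have := hh i
    simp only [if_neg hi] at this
    linear_combination this - β i * hk

end PN

end Mod21

section Mod22
namespace PN

variable {F : Type*} [Field F] {κ : Type*} [Field κ] [CharZero κ] {V : Type*} [AddCommGroup V] [Module κ V] {P : Pl F κ V} {N : ℕ}

variable (P) in
/-- regular state -/
def Pl.St (ex : Finset (Fin N)) (z : Fin N → F) (x : Fin N → κ) (l : Fin N → V) : Prop :=
  (∀ i, P.U (z i) (x i) (l i)) ∧ (∀ i ∈ ex, x i ≠ 0) ∧ (∀ i, x i = 0 → l i = 0) ∧ Rk κ l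

theorem U_npow {z : Fin N → F} {x : Fin N → κ} {l : Fin N → V} (h : ∀ i, P.U (z i) (x i) (l i)) (v : Fin N → ℕ) :
    P.U (∏ i, z i ^ v i) (∏ i, x i ^ v i) (∑ i, v i • l i) :=
  Pl.U.prod _ fun i _ => (h i).pow _

theorem exP_J {z : Fin N → F} {x : Fin N → κ} {l : Fin N → V} (h : ∀ i, P.U (z i) (x i) (l i)) (b : Fin N → ℤ) :
    P.J (exP z b) (exP x b) ((∏ i, x i ^ (max (b i) 0).toNat) • (∑ i, (max (b i) 0).toNat • l i) +
      (∏ i, x i ^ (max (- b i) 0).toNat) • (∑ i, (max (- b i) 0).toNat • l i)) :=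
  P.add (U_npow h _) (U_npow h _)

theorem exP_zero {ex : Finset (Fin N)} {z : Fin N → F} {x : Fin N → κ} {l : Fin N → V} (h : P.St ex z x l) {b : Fin N → ℤ} (hb : b ≠ 0)
    (h0 : exP x b = 0) : (∀ i, x i ≠ 0) ∧ ∑ i, (b i : κ) • l i = 0 ∧ PN.lm x b = -1 := by
  classical
  obtain ⟨hU, hex, hx0, hR⟩ := h
  have hJ := exP_J hU b
  rw [h0] at hJ
  have hv := P.zero hJ
  have hsing : ∀ a, x a = 0 → ∑ i, (Pi.single a (1:κ) : Fin N → κ) i • l i = 0 := by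
    intro a ha
    refine Finset.sum_eq_zero fun i _ => ?_
    by_cases hi : i = a
    · subst hi; rw [hx0 i ha, smul_zero]
    · rw [Pi.single_eq_of_ne hi, zero_smul]
  set m1 := ∏ i, x i ^ (max (b i) 0).toNat with hm1
  set m2 := ∏ i, x i ^ (max (- b i) 0).toNat with hm2
  have hsum : m1 + m2 = 0 := h0
  have hne : m1 ≠ 0 := by
    intro h1
    have h2 : m2 = 0 := by rw [h1, zero_add] at hsum; exact hsum
    obtain ⟨a, -, ha⟩ := Finset.prod_eq_zero_iff.1 h1
    obtain ⟨a', -, ha'⟩ := Finset.prod_eq_zero_iff.1 h2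
    have e1 : x a = 0 ∧ (max (b a) 0).toNat ≠ 0 := by
      constructor
      · exact eq_zero_of_pow_eq_zero ha
      · intro h; rw [h, pow_zero] at ha; exact one_ne_zero ha
    have e2 : x a' = 0 ∧ (max (- b a') 0).toNat ≠ 0 := by
      constructor
      · exact eq_zero_of_pow_eq_zero ha'
      · intro h; rw [h, pow_zero] at ha'; exact one_ne_zero ha'
    have haa : a ≠ a' := by
      rintro rfl
      have := e1.2; have := e2.2
      omega
    obtain ⟨s, t, hst, hh⟩ := hR _ _ (hsing a e1.1) (hsing a' e2.1)
    have h3 := hh a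
    have h4 := hh a'
    rw [Pi.single_eq_same, Pi.single_eq_of_ne haa] at h3
    rw [Pi.single_eq_same, Pi.single_eq_of_ne haa.symm] at h4
    rcases hst with h | h
    · apply h; linear_combination h3
    · apply h; linear_combination h4
  have hm2' : m2 = - m1 := by linear_combination hsum
  have hne2 : m2 ≠ 0 := by rw [hm2']; exact neg_ne_zero.2 hne
  have hrel : ∑ i, (b i : κ) • l i = 0 := by
    rw [hm2', neg_smul, ← sub_eq_add_neg, ← smul_sub, smul_eq_zero] at hv
    have := hv.resolve_left hne
    rw [← Finset.sum_sub_distrib] at this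
    rw [← this]
    refine Finset.sum_congr rfl fun i _ => ?_
    rw [Int.cast_smul_eq_zsmul, ← natCast_zsmul, ← natCast_zsmul, ← sub_smul]
    congr 1
    omega
  have hba : ∀ a, x a = 0 → b a = 0 := by
    intro a ha
    have h1 := Finset.prod_ne_zero_iff.1 hne a (Finset.mem_univ _)
    have h2 := Finset.prod_ne_zero_iff.1 hne2 a (Finset.mem_univ _)
    rw [ha] at h1 h2
    have h3 : (max (b a) 0).toNat = 0 := by by_contra h; exact h1 (zero_pow h)
    have h4 : (max (- b a) 0).toNat = 0 := by by_contra h; exact h2 (zero_pow h)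
    omega
  have hall : ∀ i, x i ≠ 0 := by
    intro a ha
    obtain ⟨s, t, hst, hh⟩ := hR _ _ (hsing a ha) hrel
    obtain ⟨i, hi⟩ := Function.ne_iff.1 hb
    have hia : i ≠ a := fun h => hi (by rw [h]; exact hba a ha)
    have h3 := hh a
    have h4 := hh i
    rw [Pi.single_eq_same, hba a ha] at h3
    rw [Pi.single_eq_of_ne hia] at h4
    rcases hst with h | h
    · apply h; simpa using h3
    · apply h
      rw [mul_zero, zero_add] at h4
      refine (mul_eq_zero.1 h4).resolve_right ?_
      exact_mod_cast hi
  refine ⟨hall, hrel, ?_⟩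
  rw [exP_eq hall] at h0
  have := (mul_eq_zero.1 h0).resolve_left (lm_ne hall _)
  linear_combination this

theorem St_unit {ex : Finset (Fin N)} {z z' : Fin N → F} {x : Fin N → κ} {l : Fin N → V} (h : P.St ex z x l) {k : Fin N} (hk : k ∈ ex)
    {b : Fin N → ℤ} (hbk : b k = 0) (hz0 : z k ≠ 0) (hz : ∀ i, i ≠ k → z' i = z i) (he : z' k * z k = exP z b) (h0 : exP x b ≠ 0) :
    ∃ x' l', P.St ex z' x' l' := by
  classical
  obtain ⟨hU, hex, hx0, hR⟩ := h
  set m1 := ∏ i, x i ^ (max (b i) 0).toNat with hm1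
  set m2 := ∏ i, x i ^ (max (- b i) 0).toNat with hm2
  set y := exP x b with hy
  have hUe : P.U (exP z b) y (∑ i, (y⁻¹ * (m1 * ((max (b i) 0).toNat : κ) + m2 * ((max (- b i) 0).toNat : κ))) • l i) := by
    unfold Pl.U
    have := exP_J hU b
    convert this using 1
    rw [Finset.smul_sum, Finset.smul_sum, Finset.smul_sum, ← Finset.sum_add_distrib]
    refine Finset.sum_congr rfl fun i _ => ?_
    rw [smul_smul, mul_inv_cancel_left₀ h0, add_smul, mul_smul, mul_smul, Nat.cast_smul_eq_nsmul, Nat.cast_smul_eq_nsmul]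
  have hxk := hex k hk
  refine ⟨Function.update x k (y * (x k)⁻¹), Function.update l k ((∑ i, (y⁻¹ * (m1 * ((max (b i) 0).toNat : κ) + m2 * ((max (- b i) 0).toNat : κ))) • l i) + - l k), fun i => ?_, fun i hi => ?_, fun i hi => ?_, ?_⟩
  rotate_left
  · by_cases hik : i = k
    · subst hik; rw [Function.update_self]; exact mul_ne_zero h0 (inv_ne_zero hxk)
    · rw [Function.update_of_ne hik]; exact hex i hi
  · by_cases hik : i = k
    · subst hik; rw [Function.update_self] at hi; exact absurd hi (mul_ne_zero h0 (inv_ne_zero hxk))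
    · rw [Function.update_of_ne hik] at hi ⊢; exact hx0 i hi
  rotate_left
  · by_cases hik : i = k
    · subst hik
      rw [Function.update_self, Function.update_self, show z' i = exP z b * (z i)⁻¹ by rw [← he]; field_simp]
      exact hUe.mul ((hU i).inv hxk)
    · rw [Function.update_of_ne hik, Function.update_of_ne hik, hz i hik]; exact hU i
  · refine hR.upd (k := k) (α := -1) (β := fun i => y⁻¹ * (m1 * ((max (b i) 0).toNat : κ) + m2 * ((max (- b i) 0).toNat : κ))) (neg_ne_zero.2 one_ne_zero) ?_ (fun i hi => Function.update_of_ne hi _ _) ?_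
    · simp [hbk]
    · rw [Function.update_self, neg_smul, one_smul, add_comm]

theorem St_zero {ex : Finset (Fin N)} {z z' : Fin N → F} {x : Fin N → κ} {l : Fin N → V} (h : P.St ex z x l) {k : Fin N} (hk : k ∈ ex)
    {b : Fin N → ℤ} (hz0 : z k ≠ 0) (he : z' k * z k = exP z b) (h0 : exP x b = 0) : P.J (z' k) 0 0 := by
  obtain ⟨hU, hex, hx0, hR⟩ := h
  have hJ := exP_J hU b
  rw [h0] at hJ
  have hv := P.zero hJ
  rw [hv] at hJ
  have := P.mul hJ ((hU k).inv (hex k hk))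
  rw [← he, mul_assoc, mul_inv_cancel₀ hz0, mul_one] at this
  simpa using this

theorem lm_smul (z : Fin N → F) (n : ℤ) (v : Fin N → ℤ) : PN.lm z (n • v) = PN.lm z v ^ n := by
  unfold lm
  rw [← Finset.prod_zpow]
  refine Finset.prod_congr rfl fun i _ => ?_
  rw [Pi.smul_apply, smul_eq_mul, mul_comm, zpow_mul]

theorem lm_single [DecidableEq (Fin N)] (z : Fin N → F) (j : Fin N) (n : ℤ) : PN.lm z (Pi.single j n) = z j ^ n := by
  unfold lm
  rw [Finset.prod_eq_single j]
  · rw [Pi.single_eq_same]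
  · intro i _ hi; rw [Pi.single_eq_of_ne hi, zpow_zero]
  · simp

theorem lm_mut {z z' : Fin N → F} {j : Fin N} {c : Fin N → ℤ} (hcj : c j = 0) (hnz : ∀ i, z i ≠ 0)
    (hz' : ∀ i, i ≠ j → z' i = z i) (he' : z' j * z j = exP z c) (v : Fin N → ℤ) :
    PN.lm z' v = PN.lm z (Ev j c v) * (1 + PN.lm z c) ^ v j := by
  classical
  have h1 : z' j = PN.lm z (fun i => max (- c i) 0) * (1 + PN.lm z c) * (z j)⁻¹ := by
    rw [← exP_eq hnz, ← he', mul_assoc, mul_inv_cancel₀ (hnz j), mul_one]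
  have h2 : PN.lm z' v = PN.lm z v * (z' j * (z j)⁻¹) ^ v j := by
    unfold lm
    rw [← Finset.mul_prod_erase _ _ (Finset.mem_univ j), ← Finset.mul_prod_erase (a := j) (s := Finset.univ) _ (Finset.mem_univ j)]
    rw [Finset.prod_congr rfl (g := fun i => z i ^ v i) (fun i hi => by rw [hz' i (Finset.ne_of_mem_erase hi)])]
    have := zpow_ne_zero (v j) (hnz j)
    rw [mul_zpow, inv_zpow]
    field_simp
  have h3 : Ev j c v = v + (v j • (fun i => max (- c i) 0) + Pi.single j (-2 * v j)) := by
    funext i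
    unfold Ev
    by_cases hi : i = j
    · subst hi; simp [hcj]; ring
    · simp [hi]
  rw [h2, h3, lm_add hnz, lm_add hnz, lm_smul, lm_single, h1]
  have h4 : z j ^ (-2 * v j) = ((z j)⁻¹ * (z j)⁻¹) ^ v j := by
    rw [zpow_mul]; congr 1; rw [zpow_neg, ← mul_inv]; congr 1; exact zpow_two _
  rw [h4, mul_assoc, mul_assoc (PN.lm z v), ← mul_zpow, ← mul_zpow]
  congr 2; ring

/-- the main local computation -/
theorem St_core {ex : Finset (Fin N)} {z z1 z' z3 : Fin N → F} {x : Fin N → κ} {l : Fin N → V} (h : P.St ex z1 x l) {k j : Fin N}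
    (hk : k ∈ ex) (hj : j ∈ ex) (hjk : j ≠ k) {b c : Fin N → ℤ} (hb0 : b ≠ 0) (hbk : b k = 0) (hcj : c j = 0) (hck : 0 < c k) (hbj : b j < 0)
    (hnz : ∀ i, z i ≠ 0) (hzk : P.J (z k) 0 0) (hz1 : ∀ i, i ≠ k → z1 i = z i) (he1 : z1 k * z k = exP z b)
    (hz' : ∀ i, i ≠ j → z' i = z i) (he' : z' j * z j = exP z c)
    (hnz' : ∀ i, z' i ≠ 0)
    (hz3 : ∀ i, i ≠ k → z3 i = z' i) (he3 : z3 k * z' k = exP z' (mC j c b)) :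
    ∃ x' l', P.St ex z3 x' l' := by
  classical
  obtain ⟨hU, hex, hx0, hR⟩ := id h
  -- first the vanishing of the exchange polynomial
  have hex1 : exP x b = 0 := by
    have h1 := exP_J hU b
    rw [exP_congr hbk hz1, ← he1] at h1
    have h2 := P.mul (hU k) hzk
    have := (P.uniq h1 h2).1
    rw [this, mul_zero]
  obtain ⟨hxa, hrel, hlm⟩ := exP_zero h hb0 hex1
  have hnz1 : ∀ i, z1 i ≠ 0 := by
    intro i hi
    have h1 := hU i
    have h2 : P.U (z1 i * (z1 i)⁻¹) _ _ := h1.mul (h1.inv (hxa i))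
    rw [hi, zero_mul] at h2
    rw [mul_inv_cancel₀ (hxa i)] at h2
    have h3 := P.add h2 h2
    rw [add_zero] at h3
    have := (P.uniq h2 h3).1
    norm_num at this
  have hlmb : PN.lm z1 b = PN.lm z b := by
    refine Finset.prod_congr rfl fun i _ => ?_
    by_cases hi : i = k
    · subst hi; rw [hbk]; simp
    · rw [hz1 i hi]
  have hw : P.J (PN.lm z b) (-1) 0 := by
    have h1 : P.J _ _ _ := Pl.U.lm hU hxa b
    rw [hlm, hlmb] at h1
    have : ∑ i, b i • l i = 0 := by
      rw [← hrel]; exact Finset.sum_congr rfl fun i _ => (Int.cast_smul_eq_zsmul _ _ _).symm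
    rw [this, smul_zero] at h1
    exact h1
  set e : ℕ := (- b j).toNat with hee
  have hej : b j = - (e : ℤ) := by omega
  have hepos : 0 < e := by omega
  set n : ℕ := (c k - 1).toNat with hn
  have hcn : c k = n + 1 := by omega
  set cc : Fin N → ℤ := Function.update c k 0 with hcc
  set bm : Fin N → ℤ := fun i => max (- b i) 0 with hbm
  -- eta and xi
  have hlmc : PN.lm z c = z k * (z k ^ n * PN.lm z1 cc) := by
    have hA : PN.lm z c = z k ^ c k * ∏ i ∈ Finset.univ.erase k, z i ^ c i :=
      (Finset.mul_prod_erase Finset.univ (fun i => z i ^ c i) (Finset.mem_univ k)).symm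
    have hB : PN.lm z1 cc = z1 k ^ cc k * ∏ i ∈ Finset.univ.erase k, z1 i ^ cc i :=
      (Finset.mul_prod_erase Finset.univ (fun i => z1 i ^ cc i) (Finset.mem_univ k)).symm
    have hC : ∏ i ∈ Finset.univ.erase k, z1 i ^ cc i = ∏ i ∈ Finset.univ.erase k, z i ^ c i := by
      refine Finset.prod_congr rfl fun i hi => ?_
      have hi := Finset.ne_of_mem_erase hi
      rw [hcc, Function.update_of_ne hi, hz1 i hi]
    have hD : cc k = 0 := by rw [hcc, Function.update_self]
    rw [hA, hB, hC, hD, hcn, zpow_add₀ (hnz k), zpow_one, zpow_natCast, zpow_zero]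
    ring
  set δ : κ := 0 ^ n with hδ
  have hzkn : P.U (z k ^ n) δ 0 := by
    have h1 : P.U (z k) 0 0 := by unfold Pl.U; rw [smul_zero]; exact hzk
    simpa using h1.pow n
  set y := PN.lm x cc with hy
  have heta : P.U (z k ^ n * PN.lm z1 cc) (δ * y) (∑ i, cc i • l i) := by
    have := hzkn.mul (Pl.U.lm hU hxa cc)
    rw [zero_add] at this
    exact this
  set η := z k ^ n * PN.lm z1 cc with hη
  have hxi : P.J (PN.lm z c) 0 0 := by
    rw [hlmc]
    have := P.mul hzk heta
    simpa using this
  set ξ := PN.lm z c with hξ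
  have hone : P.J (1 + ξ) 1 0 := by
    have := P.add P.one hxi
    simpa using this
  have hgeo : ∀ m : ℕ, P.J (∑ i ∈ Finset.range m, (1 + ξ) ^ i) (m : κ) 0 := by
    intro m
    induction m with
    | zero => simpa using P.nul
    | succ m ih =>
      rw [Finset.sum_range_succ, Nat.cast_succ]
      have h1 : P.U (1 + ξ) 1 0 := by unfold Pl.U; rw [smul_zero]; exact hone
      have h2 : P.J _ _ _ := h1.pow m
      have := P.add ih h2
      simpa using this
  -- the new variable, up to a monomial
  set u := x k * (PN.lm x bm)⁻¹ with hu
  have hu0 : u ≠ 0 := mul_ne_zero (hxa k) (inv_ne_zero (lm_ne hxa bm))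
  set ζ := z1 k * (PN.lm z1 bm)⁻¹ + PN.lm z b * (η * ∑ i ∈ Finset.range e, (1 + ξ) ^ i) with hζ
  set ζ0 := u - e * (δ * y) with hζ0
  set q : V := u • (l k - ∑ i, bm i • l i) - (e * (δ * y)) • ∑ i, cc i • l i with hq
  have hJζ : P.J ζ ζ0 q := by
    have h1 : P.J _ _ _ := (hU k).mul ((Pl.U.lm hU hxa bm).inv (lm_ne hxa bm))
    have h2 := P.add h1 (P.mul hw (P.mul heta (hgeo e)))
    convert h2 using 1
    · rw [hζ0]; ring
    · rw [hq, sub_eq_add_neg, sub_eq_add_neg]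
      congr 1
      rw [smul_zero, smul_zero, zero_add, add_zero, smul_smul, smul_smul, ← neg_smul]
      congr 1; ring
  have hbmk : bm k = 0 := by rw [hbm]; simp [hbk]
  have hcck : cc k = 0 := by rw [hcc, Function.update_self]
  have hζne : ζ0 ≠ 0 := by
    intro h0
    rw [h0] at hJζ
    have hq0 := P.zero hJζ
    have hue : e * (δ * y) = u := by rw [hζ0] at h0; linear_combination - h0
    rw [hq, hue, ← smul_sub, smul_eq_zero] at hq0
    have h1 := hq0.resolve_left hu0
    have h2 : ∑ i, ((Pi.single k (1:κ) : Fin N → κ) i - ((bm i : ℤ) : κ) - ((cc i : ℤ) : κ)) • l i = 0 := by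
      rw [← h1]
      simp only [sub_smul, Finset.sum_sub_distrib, Int.cast_smul_eq_zsmul]
      congr 2
      rw [Finset.sum_eq_single k]
      · rw [Pi.single_eq_same, one_smul]
      · intro i _ hi; rw [Pi.single_eq_of_ne hi, zero_smul]
      · simp
    obtain ⟨s, t, hst, hh⟩ := hR _ _ hrel h2
    have h3 := hh k
    rw [hbk, hbmk, hcck, Pi.single_eq_same] at h3
    have ht : t = 0 := by simpa using h3
    obtain ⟨i, hi⟩ := Function.ne_iff.1 hb0
    have h4 := hh i
    rw [ht, zero_mul, add_zero] at h4
    have hs : s = 0 := (mul_eq_zero.1 h4).resolve_right (by exact_mod_cast hi)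
    rcases hst with h | h
    · exact h hs
    · exact h ht
  -- identities in the field
  have hlmbm : PN.lm z1 bm = PN.lm z bm := by
    refine Finset.prod_congr rfl fun i _ => ?_
    by_cases hi : i = k
    · subst hi; rw [hbmk]; simp
    · rw [hz1 i hi]
  have hEv : PN.lm z' (mC j c b) = PN.lm z b * (1 + ξ) ^ e := by
    rw [lm_mut hcj hnz hz' he', mC_Ev hcj, max_eq_right hbj.le, zero_smul, add_zero]
    congr 1
    rw [← zpow_natCast]
    congr 1
    unfold mC
    simp only [if_true]
    omega
  have hζz : ζ * z k = 1 + PN.lm z' (mC j c b) := by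
    have h1 : z1 k * z k = PN.lm z bm * (1 + PN.lm z b) := by rw [he1, exP_eq hnz]
    have h2 : (∑ i ∈ Finset.range e, (1 + ξ) ^ i) * ξ = (1 + ξ) ^ e - 1 := by
      have := geom_sum_mul (1 + ξ) e
      rwa [add_sub_cancel_left] at this
    have h3 : ξ = z k * η := hlmc
    have h4 : PN.lm z bm ≠ 0 := lm_ne hnz bm
    rw [hEv, hζ, hlmbm]
    have h5 : z1 k * (PN.lm z bm)⁻¹ * z k = 1 + PN.lm z b := by
      field_simp
      linear_combination h1
    linear_combination h5 + PN.lm z b * h2 - PN.lm z b * (∑ i ∈ Finset.range e, (1 + ξ) ^ i) * h3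
  set bn : Fin N → ℤ := fun i => max (- mC j c b i) 0 with hbn
  have hbnk : bn k = 0 := by
    rw [hbn]
    simp only [mC, if_neg hjk.symm, hbk]
    rw [max_eq_right hbj.le, max_eq_right (by omega : - c k ≤ 0)]
    simp
  have hz3k : z3 k = PN.lm z' bn * ζ := by
    have h1 : z3 k * z k = PN.lm z' bn * (1 + PN.lm z' (mC j c b)) := by
      rw [← exP_eq hnz', ← he3, hz' k hjk.symm]
    rw [← hζz] at h1
    refine mul_right_cancel₀ (hnz k) ?_
    rw [h1]; ring
  -- the variable number j
  set cm : Fin N → ℤ := fun i => max (- c i) 0 with hcm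
  have hcmk : cm k = 0 := by rw [hcm]; simp only; omega
  have hcmj : cm j = 0 := by rw [hcm]; simp only; omega
  have hlmcm : PN.lm z1 cm = PN.lm z cm := by
    refine Finset.prod_congr rfl fun i _ => ?_
    by_cases hi : i = k
    · subst hi; rw [hcmk]; simp
    · rw [hz1 i hi]
  set xj := PN.lm x cm * 1 * (x j)⁻¹ with hxj
  have hUj : P.U (z' j) xj (∑ i, cm i • l i + 0 + - l j) := by
    have h1 : P.U (1 + ξ) 1 0 := by unfold Pl.U; rw [smul_zero]; exact hone
    have h2 := ((Pl.U.lm hU hxa cm).mul h1).mul ((hU j).inv (hxa j))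
    rw [hlmcm, ← exP_eq hnz, ← he', hz1 j hjk, mul_assoc, mul_inv_cancel₀ (hnz j), mul_one] at h2
    exact h2
  have hxj0 : xj ≠ 0 := mul_ne_zero (mul_ne_zero (lm_ne hxa cm) one_ne_zero) (inv_ne_zero (hxa j))
  set la : Fin N → V := Function.update l k (ζ0⁻¹ • q) with hla
  have hRa : Rk κ la := by
    refine hR.upd (k := k) (α := ζ0⁻¹ * u) (β := fun i => - (ζ0⁻¹ * u * ((bm i : ℤ) : κ)) - ζ0⁻¹ * (e * (δ * y)) * ((cc i : ℤ) : κ))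
      (mul_ne_zero (inv_ne_zero hζne) hu0) ?_ (fun i hi => Function.update_of_ne hi _ _) ?_
    · simp [hbmk, hcck]
    · rw [hla, Function.update_self, hq]
      simp only [sub_smul, neg_smul, mul_smul, Finset.sum_sub_distrib, Finset.sum_neg_distrib, Int.cast_smul_eq_zsmul, ← Finset.smul_sum, smul_sub]
      abel
  set lb : Fin N → V := Function.update la j (∑ i, cm i • l i + 0 + - l j) with hlb
  have hRb : Rk κ lb := by
    refine hRa.upd (k := j) (α := -1) (β := fun i => ((cm i : ℤ) : κ)) (neg_ne_zero.2 one_ne_zero) ?_ (fun i hi => Function.update_of_ne hi _ _) ?_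
    · simp [hcmj]
    · rw [hlb, Function.update_self, hla, Function.update_of_ne hjk, neg_smul, one_smul, add_zero, add_comm]
      congr 1
      refine Finset.sum_congr rfl fun i _ => ?_
      by_cases hi : i = k
      · subst hi; rw [hcmk]; simp
      · rw [Function.update_of_ne hi, Int.cast_smul_eq_zsmul]
  set zb : Fin N → F := Function.update z' k ζ with hzb
  set xb : Fin N → κ := Function.update (Function.update x k ζ0) j xj with hxb
  have hUb : ∀ i, P.U (zb i) (xb i) (lb i) := by
    intro i
    by_cases hij : i = j
    · subst hij
      rw [hzb, hxb, hlb, Function.update_of_ne hjk, Function.update_self, Function.update_self]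
      exact hUj
    · by_cases hik : i = k
      · subst hik
        rw [hzb, hxb, hlb, hla, Function.update_self, Function.update_of_ne hij, Function.update_of_ne hij, Function.update_self, Function.update_self]
        unfold Pl.U
        rw [smul_smul, mul_inv_cancel₀ hζne, one_smul]
        exact hJζ
      · rw [hzb, hxb, hlb, hla, Function.update_of_ne hik, Function.update_of_ne hij, Function.update_of_ne hij, Function.update_of_ne hik, Function.update_of_ne hik, hz' i hij, ← hz1 i hik]
        exact hU i
  have hxb0 : ∀ i, xb i ≠ 0 := by
    intro i
    by_cases hij : i = j
    · subst hij; rw [hxb, Function.update_self]; exact hxj0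
    · by_cases hik : i = k
      · subst hik; rw [hxb, Function.update_of_ne hij, Function.update_self]; exact hζne
      · rw [hxb, Function.update_of_ne hij, Function.update_of_ne hik]; exact hxa i
  have hlmbn : PN.lm zb bn = PN.lm z' bn := by
    refine Finset.prod_congr rfl fun i _ => ?_
    by_cases hi : i = k
    · subst hi; rw [hbnk]; simp
    · rw [hzb, Function.update_of_ne hi]
  have hUk := (Pl.U.lm hUb hxb0 bn).mul (hUb k)
  rw [hlmbn, show zb k = ζ by rw [hzb, Function.update_self], ← hz3k] at hUk
  have hne3 : ∀ i, Function.update xb k (PN.lm xb bn * xb k) i ≠ 0 := by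
    intro i
    by_cases hik : i = k
    · subst hik; rw [Function.update_self]; exact mul_ne_zero (lm_ne hxb0 bn) (hxb0 _)
    · rw [Function.update_of_ne hik]; exact hxb0 i
  refine ⟨Function.update xb k (PN.lm xb bn * xb k), Function.update lb k (∑ i, bn i • lb i + lb k), fun i => ?_, fun i _ => hne3 i,
    fun i hi => absurd hi (hne3 i), ?_⟩
  · by_cases hik : i = k
    · subst hik; rw [Function.update_self, Function.update_self]; exact hUk
    · rw [Function.update_of_ne hik, Function.update_of_ne hik, hz3 i hik]
      have := hUb i
      rwa [hzb, Function.update_of_ne hik] at this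
  · refine hRb.upd (k := k) (α := 1) (β := fun i => ((bn i : ℤ) : κ)) one_ne_zero ?_ (fun i hi => Function.update_of_ne hi _ _) ?_
    · simp [hbnk]
    · rw [Function.update_self, one_smul, add_comm]
      congr 1
      exact Finset.sum_congr rfl fun i _ => (Int.cast_smul_eq_zsmul _ _ _).symm

end PN

end Mod22

section Mod23
namespace PN

variable {K : Type u} [Field K] [CharZero K] {F : Type u} [Field F] [Algebra K F] {N r : ℕ} {Q : CD K F N r}
  {κ : Type*} [Field κ] [CharZero κ] {V : Type*} [AddCommGroup V] [Module κ V] {P : Pl F κ V}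

theorem mC_neg (k : Fin N) (b c : Fin N → ℤ) : mC k (-b) (-c) = - mC k b c := by
  funext l
  unfold mC
  by_cases h : l = k
  · simp [h]
  · simp [h]; ring

variable (P Q) in
def InvA (S : CSeed F N) : Prop := ∃ x l, P.St Q.ex S.z x l

variable (P Q) in
def InvT (S : CSeed F N) (k : Fin N) : Prop := ∃ S1, CSeedMutRel F Q.ex S S1 k ∧ InvA Q P S1 ∧ P.J (S.z k) 0 0

variable (P Q) in
def Inv (S : CSeed F N) : Prop := InvA Q P S ∨ ∃ k, InvT Q P S k

theorem CD.Col.ne_zero {L : Fin N → Fin N → K} {w : Fin N → Fin r → ℤ} {k : Fin N} {b : Fin N → ℤ} (h : Q.Col L w k b) (hk : k ∈ Q.ex) :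
    b ≠ 0 := by
  rintro rfl
  have := h.1 k
  simp at this
  exact Q.lam_ne k hk this.symm

theorem CD.Col.indep {L : Fin N → Fin N → K} {w : Fin N → Fin r → ℤ} {k j : Fin N} {b c : Fin N → ℤ} (hb : Q.Col L w k b) (hc : Q.Col L w j c)
    (hk : k ∈ Q.ex) (hj : j ∈ Q.ex) (hjk : j ≠ k) (h : ∀ i l, b i * c l = b l * c i) : False := by
  refine hc.ne_zero hj (funext fun l => ?_)
  have h1 : (c l : K) * Q.lam k = 0 := by
    have e1 := hb.1 k
    have e2 := hc.1 k
    rw [if_pos rfl] at e1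
    rw [if_neg hjk.symm] at e2
    have : c l • ∑ i, b i • L i k = b l • ∑ i, c i • L i k := by
      rw [Finset.smul_sum, Finset.smul_sum]
      refine Finset.sum_congr rfl fun i _ => ?_
      rw [smul_smul, smul_smul, ← h i l, mul_comm]
    rw [e1, e2, smul_zero, zsmul_eq_mul] at this
    exact this
  exact_mod_cast (mul_eq_zero.1 h1).resolve_right (Q.lam_ne k hk)

theorem Inv.step {S S' : CSeed F N} {j : Fin N} (G : Q.Good S) (h : Inv Q P S) (hm : CSeedMutRel F Q.ex S S' j) : Inv Q P S' := by
  classical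
  have G' := G.mut hm
  obtain ⟨_, L, w, H, hC⟩ := id G
  have hd := G.diag j
  obtain ⟨hj, hB, hz, he⟩ := id hm
  replace he : S'.z j * S.z j = exP S.z (fun l => S.B l j) := he
  rcases h with ⟨x, l, hs⟩ | ⟨k, S1, hm1, ⟨x, l, hs⟩, hJ⟩
  · by_cases h0 : exP x (fun l => S.B l j) = 0
    · exact Or.inr ⟨j, S, mutRel_symm hm hd, ⟨x, l, hs⟩, St_zero hs hj (H.nz j) he h0⟩
    · exact Or.inl (St_unit hs hj (b := fun l => S.B l j) hd (H.nz j) hz he h0)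
  · obtain ⟨hk, hB1, hz1, he1⟩ := id hm1
    replace he1 : S1.z k * S.z k = exP S.z (fun l => S.B l k) := he1
    by_cases hjk : j = k
    · subst hjk
      refine Or.inl ⟨x, l, ?_⟩
      have : S'.z = S1.z := by
        funext i
        by_cases hi : i = j
        · subst hi; exact mul_right_cancel₀ (H.nz i) (he.trans he1.symm)
        · rw [hz i hi, hz1 i hi]
      rw [this]; exact hs
    · obtain ⟨S3, hm3⟩ := G'.exMut hk
      obtain ⟨_, hB3, hz3, he3⟩ := id hm3
      replace he3 : S3.z k * S'.z k = exP S'.z (fun l => S'.B l k) := he3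
      refine Or.inr ⟨k, S3, hm3, ?_, by rw [hz k (Ne.symm hjk)]; exact hJ⟩
      rw [hB, cMutB_col _ (Ne.symm hjk)] at he3
      have G1 := G.mut hm1
      obtain ⟨_, L', w', H', _⟩ := id G'
      obtain ⟨_, L1, w1, H1, _⟩ := id G1
      have hdk := G.diag k
      have hp := H.pairZ hk hj (hC k hk) (hC j hj)
      have dk := Q.dd_pos k
      have dj := Q.dd_pos j
      have hb0 := (hC k hk).ne_zero hk
      have hc0 := (hC j hj).ne_zero hj
      rcases lt_trichotomy (S.B k j) 0 with h0 | h0 | h0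
      · have hbj : 0 < S.B j k := by
          by_contra hn
          push Not at hn
          have t1 : (Q.dd k : ℤ) * S.B k j < 0 := mul_neg_of_pos_of_neg (by exact_mod_cast dk) h0
          have t2 : (Q.dd j : ℤ) * S.B j k ≤ 0 := mul_nonpos_of_nonneg_of_nonpos (by positivity) hn
          linarith
        refine St_core hs hk hj hjk (b := - fun l => S.B l k) (c := - fun l => S.B l j) (neg_ne_zero.2 hb0) (by simp [hdk]) (by simp [hd]) (by simpa using h0) (by simpa using hbj)
          H.nz hJ hz1 (by rw [exP_neg]; exact he1) hz (by rw [exP_neg]; exact he) H'.nz hz3 ?_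
        rw [mC_neg, exP_neg]; exact he3
      · have hbj : S.B j k = 0 := by
          rw [h0, mul_zero] at hp
          have := neg_eq_zero.1 hp.symm
          exact (mul_eq_zero.1 this).resolve_left (by exact_mod_cast dj.ne')
        have hmc : mC j (fun l => S.B l j) (fun l => S.B l k) = fun l => S.B l k := by
          funext i
          unfold mC
          by_cases hi : i = j
          · subst hi; simp [hbj]
          · simp [hi, hbj]
        rw [hmc, exP_congr (b := fun l => S.B l k) hbj hz, hz k (Ne.symm hjk)] at he3
        have e3 : S3.z k = S1.z k := mul_right_cancel₀ (H.nz k) (he3.trans he1.symm)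
        have hexb : exP x (fun l => S.B l k) = 0 := by
          have h1 := exP_J hs.1 (fun l => S.B l k)
          rw [exP_congr (b := fun l => S.B l k) hdk hz1, ← he1] at h1
          have h2 := P.mul (hs.1 k) hJ
          have := (P.uniq h1 h2).1
          rw [this, mul_zero]
        refine St_unit hs hj (b := fun l => S.B l j) hd (H1.nz j) (fun i hi => ?_) ?_ ?_
        · by_cases hik : i = k
          · rw [hik, e3]
          · rw [hz3 i hik, hz i hi, hz1 i hik]
        · rw [hz3 j hjk, hz1 j hjk, exP_congr (b := fun l => S.B l j) h0 hz1]; exact he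
        · intro hexc
          obtain ⟨_, r1, _⟩ := exP_zero hs hb0 hexb
          obtain ⟨_, r2, _⟩ := exP_zero hs hc0 hexc
          obtain ⟨s, t, hst, hh⟩ := hs.2.2.2 _ _ r1 r2
          refine (hC k hk).indep (hC j hj) hk hj hjk fun i l => ?_
          have q1 := hh i
          have q2 := hh l
          have : ((S.B i k * S.B l j : ℤ) : κ) = ((S.B l k * S.B i j : ℤ) : κ) := by
            push_cast
            rcases hst with hs0 | ht0
            · refine mul_left_cancel₀ hs0 ?_
              linear_combination (S.B l j : κ) * q1 - (S.B i j : κ) * q2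
            · refine mul_left_cancel₀ ht0 ?_
              linear_combination -(S.B l k : κ) * q1 + (S.B i k : κ) * q2
          exact_mod_cast this
      · have hbj : S.B j k < 0 := by
          by_contra hn
          push Not at hn
          have t1 : 0 < (Q.dd k : ℤ) * S.B k j := mul_pos (by exact_mod_cast dk) h0
          have t2 : 0 ≤ (Q.dd j : ℤ) * S.B j k := mul_nonneg (by positivity) hn
          linarith
        exact St_core hs hk hj hjk (b := fun l => S.B l k) (c := fun l => S.B l j) hb0 hdk hd h0 hbj
          H.nz hJ hz1 he1 hz he H'.nz hz3 he3

theorem Inv.regular {S : CSeed F N} (h : Inv Q P S) (i : Fin N) : ∃ y v, P.J (S.z i) y v := by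
  rcases h with ⟨x, l, hs⟩ | ⟨k, S1, hm1, ⟨x, l, hs⟩, hJ⟩
  · exact ⟨_, _, hs.1 i⟩
  · by_cases hi : i = k
    · subst hi; exact ⟨_, _, hJ⟩
    · rw [← hm1.2.2.1 i hi]; exact ⟨_, _, hs.1 i⟩

theorem Inv.equiv {S S' : CSeed F N} (G : Q.Good S) (h : Inv Q P S) (hm : CMutEquiv K F Q.ex S S') : Inv Q P S' := by
  have hf := G.fwd hm
  clear hm
  induction hf with
  | refl => exact h
  | tail _ h2 ih =>
    obtain ⟨g, k, hk⟩ := h2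
    exact ih.step g hk

end PN

end Mod23

section Mod24
namespace PN

section place

variable {F : Type*} [Field F] {κ : Type*} [Field κ] {V : Type*} [AddCommGroup V] [Module κ V] {A : Type*} [CommRing A]

/-- the place attached to a prime with a derivation -/
def mkPl (φ : A →+* F) (hφ : Function.Injective φ) (res : A →+* κ) (D : A →+ V) (hD : ∀ a b, D (a * b) = res a • D b + res b • D a)
    (h0 : ∀ a, res a = 0 → D a = 0) : Pl F κ V where
  J f x v := ∃ a b, res b ≠ 0 ∧ f * φ b = φ a ∧ x * res b = res a ∧ x • D b + res b • v = D a
  nul := ⟨0, 1, by simp, by simp, by simp, by simp⟩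
  one := ⟨1, 1, by simp, by simp, by simp, by simp⟩
  add := by
    rintro f g x y v w ⟨a, b, hb, h1, h2, h3⟩ ⟨a', b', hb', h1', h2', h3'⟩
    refine ⟨a * b' + a' * b, b * b', by rw [map_mul]; exact mul_ne_zero hb hb', ?_, ?_, ?_⟩
    · simp only [map_mul, map_add, ← h1, ← h1']; ring
    · simp only [map_mul, map_add, ← h2, ← h2']; ring
    · simp only [map_mul, map_add, hD, ← h2, ← h2', ← h3, ← h3']
      module
  mul := by
    rintro f g x y v w ⟨a, b, hb, h1, h2, h3⟩ ⟨a', b', hb', h1', h2', h3'⟩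
    refine ⟨a * a', b * b', by rw [map_mul]; exact mul_ne_zero hb hb', ?_, ?_, ?_⟩
    · simp only [map_mul, ← h1, ← h1']; ring
    · simp only [map_mul, ← h2, ← h2']; ring
    · simp only [map_mul, hD, ← h2, ← h2', ← h3, ← h3']
      module
  inv := by
    rintro f x v ⟨a, b, hb, h1, h2, h3⟩ hx
    have hra : res a ≠ 0 := by rw [← h2]; exact mul_ne_zero hx hb
    have hb0 : φ b ≠ 0 := by
      intro h; apply hb; rw [hφ (h.trans (map_zero φ).symm), map_zero]
    have hf : f ≠ 0 := by
      rintro rfl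
      rw [zero_mul] at h1
      apply hra; rw [hφ (h1.symm.trans (map_zero φ).symm), map_zero]
    refine ⟨b, a, hra, ?_, ?_, ?_⟩
    · rw [← h1, inv_mul_cancel_left₀ hf]
    · rw [← h2, inv_mul_cancel_left₀ hx]
    · rw [← h3, ← h2, smul_add, smul_smul, inv_mul_cancel₀ hx, one_smul, smul_neg, smul_smul, smul_smul]
      rw [show x * res b * (x⁻¹ * x⁻¹) = x⁻¹ * res b by field_simp]
      abel
  uniq := by
    rintro f x y v w ⟨a, b, hb, h1, h2, h3⟩ ⟨a', b', hb', h1', h2', h3'⟩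
    have he : a * b' = a' * b := by
      apply hφ; simp only [map_mul, ← h1, ← h1']; ring
    have hxy : x = y := by
      have := congrArg res he
      simp only [map_mul, ← h2, ← h2'] at this
      refine mul_right_cancel₀ (mul_ne_zero hb hb') ?_
      linear_combination this
    subst hxy
    refine ⟨rfl, ?_⟩
    have := congrArg D he
    simp only [hD, ← h2, ← h2', ← h3, ← h3'] at this
    have h4 : (res b * res b') • v = (res b * res b') • w := by
      have h5 := sub_eq_zero.2 this
      rw [← sub_eq_zero, ← h5]
      module
    have h6 : (res b * res b') • (v - w) = 0 := by rw [smul_sub, h4, sub_self]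
    exact sub_eq_zero.1 ((smul_eq_zero.1 h6).resolve_left (mul_ne_zero hb hb'))
  zero := by
    rintro f v ⟨a, b, hb, h1, h2, h3⟩
    rw [zero_mul] at h2
    rw [h0 a h2.symm, zero_smul, zero_add] at h3
    exact (smul_eq_zero.1 h3).resolve_left hb

end place

open MvPolynomial

section poly

variable {K : Type u} [Field K] [CharZero K] {N : ℕ}

theorem exists_pderiv_not_dvd {p : MvPolynomial (Fin N) K} (hp : Prime p) : ∃ a, ¬ p ∣ pderiv a p := by
  by_contra hcon
  push Not at hcon
  have h0 : ∀ a, pderiv a p = 0 := by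
    intro a
    by_contra hne
    have h1 := totalDegree_le_of_dvd_of_isDomain (hcon a) hne
    have hle : ∀ n ∈ (pderiv a p).support, (n.sum fun _ e => e) + 1 ≤ p.totalDegree := by
      intro n hn
      rw [mem_support_iff, coeff_pderiv] at hn
      have := le_totalDegree (mem_support_iff.2 (left_ne_zero_of_mul hn))
      rwa [Finsupp.sum_add_index' (by simp) (by simp), Finsupp.sum_single_index rfl] at this
    have hpos : 0 < p.totalDegree := by
      obtain ⟨n, hn⟩ := Finset.nonempty_iff_ne_empty.2 (fun h => hne (support_eq_empty.1 h))
      have := hle n hn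
      omega
    have h2 : (pderiv a p).totalDegree < p.totalDegree := by
      exact (Finset.sup_lt_iff hpos).2 fun n hn => hle n hn
    omega
  apply hp.not_unit
  rw [isUnit_iff_C]
  have hsup : ∀ m, m ≠ 0 → coeff m p = 0 := by
    intro m hm
    obtain ⟨a, ha⟩ := Finsupp.ne_iff.1 hm
    have hle : Finsupp.single a 1 ≤ m := by
      rw [Finsupp.single_le_iff]; exact Nat.one_le_iff_ne_zero.2 ha
    have h1 := congrArg (coeff (m - Finsupp.single a 1)) (h0 a)
    rw [coeff_pderiv, coeff_zero, tsub_add_cancel_of_le hle] at h1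
    refine (mul_eq_zero.1 h1).resolve_right ?_
    exact Nat.cast_add_one_ne_zero _
  have hC : p = C (coeff 0 p) := by
    ext m
    rw [coeff_C]
    split_ifs with h
    · rw [h]
    · exact hsup m (Ne.symm h)
  refine ⟨_, fun h => hp.ne_zero ?_, hC⟩
  rw [hC, h, C_0]

end poly

section apply

variable {K : Type u} [Field K] [CharZero K] {F : Type u} [Field F] [Algebra K F] {N r : ℕ} {Q : CD K F N r}

theorem CD.LCW.aeval_inj {z : Fin N → F} {L : Fin N → Fin N → K} {w : Fin N → Fin r → ℤ} (H : Q.LCW z L w) :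
    Function.Injective (MvPolynomial.aeval z : MvPolynomial (Fin N) K →ₐ[K] F) := by
  rw [injective_iff_map_eq_zero]
  intro p hp
  have h1 := H.indep
  have h2 : Function.Injective (fun (m : Fin N →₀ ℕ) (i : Fin N) => (m i : ℤ)) := by
    intro m n h
    ext i
    have := congrFun h i
    simp only at this
    exact_mod_cast this
  have h3 := h1.comp _ h2
  rw [linearIndependent_iff'] at h3
  rw [MvPolynomial.aeval_def, MvPolynomial.eval₂_eq'] at hp
  ext m
  rw [MvPolynomial.coeff_zero]
  by_cases hm : m ∈ p.support
  · refine h3 p.support (fun m => MvPolynomial.coeff m p) ?_ m hm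
    rw [← hp]
    refine Finset.sum_congr rfl fun n _ => ?_
    rw [Algebra.smul_def]
    congr 1
    simp [lm]
  · exact MvPolynomial.notMem_support_iff.1 hm

set_option maxHeartbeats 1000000 in
theorem place_reg {S S' : CSeed F N} (G : Q.Good S) (hm : CMutEquiv K F Q.ex S S') {p : MvPolynomial (Fin N) K} (hp : Prime p)
    (hpx : ∀ k ∈ Q.ex, ¬ p ∣ X k) (i : Fin N) : ∃ a b : MvPolynomial (Fin N) K, ¬ p ∣ b ∧ S'.z i * aeval S.z b = aeval S.z a := by
  classical
  obtain ⟨_, L, w, H, hC⟩ := id G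
  obtain ⟨a, ha⟩ := exists_pderiv_not_dvd hp
  haveI hprime : (Ideal.span {p}).IsPrime := (Ideal.span_singleton_prime hp.ne_zero).2 hp
  let A := MvPolynomial (Fin N) K
  let κ := FractionRing (A ⧸ (Ideal.span {p} : Ideal A))
  let res : A →+* κ := (algebraMap (A ⧸ (Ideal.span {p} : Ideal A)) κ).comp (Ideal.Quotient.mk _)
  have hres : ∀ f : A, res f = 0 ↔ p ∣ f := by
    intro f
    change algebraMap (A ⧸ (Ideal.span {p} : Ideal A)) κ (Ideal.Quotient.mk _ f) = 0 ↔ _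
    rw [map_eq_zero_iff _ (IsFractionRing.injective _ _), Ideal.Quotient.eq_zero_iff_mem, Ideal.mem_span_singleton]
  haveI : CharZero κ := (RingHom.charZero_iff (res.comp (C : K →+* A)).injective).1 inferInstance
  let E : A →+ (Fin N → κ) :=
    { toFun := fun f b => res (pderiv a p * pderiv b f - pderiv b p * pderiv a f)
      map_zero' := by funext b; simp
      map_add' := by intro f g; funext b; rw [Pi.add_apply, ← map_add]; congr 1; rw [map_add, map_add]; ring }
  have hE : ∀ f b, E f b = res (pderiv a p * pderiv b f - pderiv b p * pderiv a f) := fun _ _ => rfl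
  have hmul : ∀ f g, E (f * g) = res f • E g + res g • E f := by
    intro f g
    funext b
    rw [Pi.add_apply, Pi.smul_apply, Pi.smul_apply, hE, hE, hE, smul_eq_mul, smul_eq_mul, ← map_mul, ← map_mul, ← map_add]
    congr 1
    simp only [Derivation.leibniz, smul_eq_mul]
    ring
  have hEp : E p = 0 := by
    funext b; rw [hE, mul_comm, sub_self, map_zero]; rfl
  have h0 : ∀ f, res f = 0 → E f = 0 := by
    intro f hf
    obtain ⟨g, rfl⟩ := (hres f).1 hf
    rw [hmul, hEp, (hres p).2 dvd_rfl, zero_smul, smul_zero, add_zero]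
  let P : Pl F κ (Fin N → κ) := mkPl (aeval S.z : A →ₐ[K] F).toRingHom H.aeval_inj res E hmul h0
  have hxa : ∀ l, res (X l) = 0 → l = a := by
    intro l hl
    obtain ⟨u, hu⟩ := (hres _).1 hl
    have hir : Irreducible (X l : A) := MvPolynomial.X_prime.irreducible
    have huu := (hir.isUnit_or_isUnit hu).resolve_left hp.not_unit
    obtain ⟨c, hc, rfl⟩ := isUnit_iff_C.1 huu
    by_contra hne
    have := congrArg (pderiv a) hu
    rw [pderiv_X_of_ne hne, Derivation.leibniz, pderiv_C, smul_zero, zero_add, smul_eq_mul] at this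
    apply ha
    have h2 := (mul_eq_zero.1 this.symm).resolve_left (fun h => hc (C_eq_zero.1 h))
    rw [h2]; exact dvd_zero _
  have hpa : res (pderiv a p) ≠ 0 := fun h => ha ((hres _).1 h)
  have hE1 : E 1 = 0 := by
    funext b; rw [hE]; simp
  have hSt : P.St Q.ex S.z (fun l => res (X l)) (fun l => (res (X l))⁻¹ • E (X l)) := by
    refine ⟨fun l => ?_, fun l hl h => hpx l hl ((hres _).1 h), fun l hl => ?_, ?_⟩
    · refine ⟨X l, 1, by rw [map_one]; exact one_ne_zero, ?_, ?_, ?_⟩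
      · rw [map_one, mul_one]; exact (aeval_X S.z l).symm
      · rw [map_one, mul_one]
      · rw [hE1, smul_zero, zero_add, map_one, one_smul]
        change res (X l) • (res (X l))⁻¹ • E (X l) = _
        by_cases hl : res (X l) = 0
        · rw [h0 _ hl, smul_zero, smul_zero]
        · rw [smul_smul, mul_inv_cancel₀ hl, one_smul]
    · simp only at hl ⊢; rw [h0 _ hl, smul_zero]
    · have key : ∀ c : Fin N → κ, ∑ l, c l • (res (X l))⁻¹ • E (X l) = 0 →
          ∀ b, b ≠ a → c b = (res (X b) * (res (pderiv a p))⁻¹ * res (pderiv b p) * (res (X a))⁻¹) * c a := by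
        intro c hc b hb
        have h1 := congrFun hc b
        rw [Finset.sum_apply] at h1
        have h2 : ∀ l, (c l • (res (X l))⁻¹ • E (X l)) b = (if l = b then c b * (res (X b))⁻¹ * res (pderiv a p) else 0) -
            (if l = a then c a * (res (X a))⁻¹ * res (pderiv b p) else 0) := by
          intro l
          rw [Pi.smul_apply, Pi.smul_apply, hE, smul_eq_mul, smul_eq_mul, pderiv_X, pderiv_X]
          by_cases hlb : l = b
          · subst hlb
            rw [if_pos rfl, if_neg hb, Pi.single_eq_same, Pi.single_eq_of_ne hb]
            simp; ring
          · by_cases hla : l = a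
            · subst hla
              rw [if_neg hlb, if_pos rfl, Pi.single_eq_same, Pi.single_eq_of_ne hlb]
              simp; ring
            · rw [if_neg hlb, if_neg hla, Pi.single_eq_of_ne hla, Pi.single_eq_of_ne hlb]
              simp
        simp only [h2, Finset.sum_sub_distrib, Finset.sum_ite_eq', Finset.mem_univ, if_true, Pi.zero_apply] at h1
        have hb0 : res (X b) ≠ 0 := fun h => hb (hxa b h)
        have h3 : c b * (res (X b))⁻¹ * res (pderiv a p) = c a * (res (X a))⁻¹ * res (pderiv b p) := sub_eq_zero.1 h1
        calc c b = (c b * (res (X b))⁻¹ * res (pderiv a p)) * (res (X b) * (res (pderiv a p))⁻¹) := by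
                rw [mul_assoc, mul_assoc, mul_left_comm (res (pderiv a p)), ← mul_assoc (res (X b))⁻¹, inv_mul_cancel₀ hb0, mul_inv_cancel₀ hpa, mul_one, mul_one]
          _ = _ := by rw [h3]; ring
      intro c d hc hd
      have k1 := key c hc
      have k2 := key d hd
      by_cases h : c a = 0 ∧ d a = 0
      · refine ⟨1, 0, Or.inl one_ne_zero, fun b => ?_⟩
        by_cases hb : b = a
        · rw [hb, h.1]; simp
        · rw [k1 b hb, h.1]; simp
      · refine ⟨d a, - c a, ?_, fun b => ?_⟩
        · by_contra hn
          push Not at hn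
          exact h ⟨neg_eq_zero.1 hn.2, hn.1⟩
        · by_cases hb : b = a
          · rw [hb]; ring
          · rw [k1 b hb, k2 b hb]; ring
  have hInv : Inv Q P S' := Inv.equiv G (Or.inl ⟨_, _, hSt⟩) hm
  obtain ⟨y, v, f, g, hg, h1, -, -⟩ := hInv.regular i
  exact ⟨f, g, fun h => hg ((hres _).2 h), h1⟩

end apply
end PN

end Mod24

section Mod25
namespace PN

open MvPolynomial

variable {K : Type u} [Field K] [CharZero K] {F : Type u} [Field F] [Algebra K F] {N r : ℕ} {Q : CD K F N r}

/-- denominators all of whose prime factors are among the exchangeable variables -/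
theorem mono_of_primes (ex : Finset (Fin N)) (b : MvPolynomial (Fin N) K) (hb : b ≠ 0) (h : ∀ p, Prime p → p ∣ b → ∃ k ∈ ex, p ∣ X k) :
    ∃ (c : K) (n : Fin N → ℕ), c ≠ 0 ∧ (∀ k, k ∉ ex → n k = 0) ∧ b = C c * ∏ k, X k ^ n k := by
  classical
  induction b using UniqueFactorizationMonoid.induction_on_prime with
  | h₁ => exact absurd rfl hb
  | h₂ b hu =>
    obtain ⟨c, hc, rfl⟩ := isUnit_iff_C.1 hu
    exact ⟨c, 0, hc, fun _ _ => rfl, by simp⟩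
  | h₃ a p ha hp ih =>
    obtain ⟨c, n, hc, hn, he⟩ := ih ha (fun q hq hqa => h q hq (hqa.mul_left p))
    obtain ⟨k, hk, hpk⟩ := h p hp (dvd_mul_right _ _)
    have has : Associated (X k : MvPolynomial (Fin N) K) p := (hp.associated_of_dvd MvPolynomial.X_prime hpk).symm
    obtain ⟨d, hd, rfl⟩ := assoc_iff.1 has
    refine ⟨d * c, n + Pi.single k 1, mul_ne_zero hd hc, fun l hl => ?_, ?_⟩
    · have : l ≠ k := fun h => hl (h ▸ hk)
      rw [Pi.add_apply, hn l hl, Pi.single_eq_of_ne this, zero_add]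
    · rw [he]
      simp only [Pi.add_apply, pow_add, Finset.prod_mul_distrib]
      have : ∏ l, (X l : MvPolynomial (Fin N) K) ^ (Pi.single k 1 : Fin N → ℕ) l = X k := by
        rw [Finset.prod_eq_single k]
        · rw [Pi.single_eq_same, pow_one]
        · intro l _ hl; rw [Pi.single_eq_of_ne hl, pow_zero]
        · simp
      rw [this, C_mul]; ring

theorem mixed_aeval (ex : Finset (Fin N)) (S : CSeed F N) (hz : ∀ k, S.z k ≠ 0) (a : MvPolynomial (Fin N) K) : aeval S.z a ∈ cMixed K F ex S := by
  classical
  have hX : ∀ k, S.z k ∈ cMixed K F ex S := by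
    intro k
    refine Algebra.subset_adjoin ⟨Pi.single k 1, fun l _ => ?_, ?_⟩
    · by_cases h : l = k
      · subst h; simp
      · rw [Pi.single_eq_of_ne h]
    · exact (by simpa using (lm_single S.z k 1).symm : S.z k = lm S.z (Pi.single k 1))
  induction a using MvPolynomial.induction_on with
  | C c => rw [aeval_C]; exact Subalgebra.algebraMap_mem _ _
  | add p q hp hq => rw [map_add]; exact Subalgebra.add_mem _ hp hq
  | mul_X p i hp => rw [map_mul, aeval_X]; exact Subalgebra.mul_mem _ hp (hX i)

/-- the Laurent phenomenon -/
theorem laurent {S S' : CSeed F N} (G : Q.Good S) (hm : CMutEquiv K F Q.ex S S') (i : Fin N) : S'.z i ∈ cMixed K F Q.ex S := by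
  classical
  obtain ⟨_, L, w, H, hC⟩ := id G
  have hinj := H.aeval_inj
  obtain ⟨a, b, hab⟩ := (IntermediateField.mem_adjoin_range_iff K S.z (S'.z i)).1 (by rw [H.gen]; trivial)
  have hz' : S'.z i ≠ 0 := by
    obtain ⟨_, L', w', H', _⟩ := G.equiv hm
    exact H'.nz i
  have hb0 : aeval S.z b ≠ 0 := by
    intro h; apply hz'; rw [hab, h, div_zero]
  have ha0 : aeval S.z a ≠ 0 := by
    intro h; apply hz'; rw [hab, h, zero_div]
  have ha1 : a ≠ 0 := by rintro rfl; simp at ha0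
  obtain ⟨a', b', g, hrel, rfl, rfl⟩ := UniqueFactorizationMonoid.exists_reduced_factors a ha1 b
  rw [map_mul] at ha0 hb0 
  rw [map_mul, map_mul, mul_div_mul_left _ _ (left_ne_zero_of_mul ha0)] at hab
  have hb1 := right_ne_zero_of_mul hb0
  have hb2 : b' ≠ 0 := by rintro rfl; simp at hb1
  obtain ⟨c, n, hc, hn, he⟩ := mono_of_primes Q.ex b' hb2 (by
    intro p hp hpb
    by_contra hno
    push Not at hno
    obtain ⟨f, g, hg, hfg⟩ := place_reg G hm hp hno i
    have h1 : a' * g = f * b' := by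
      apply hinj
      rw [map_mul, map_mul, ← hfg, hab]
      field_simp
    have h2 : p ∣ a' * g := h1 ▸ hpb.mul_left f
    exact hp.not_unit (hrel ((hp.dvd_or_dvd h2).resolve_right hg) hpb))
  have h1 : S'.z i = c⁻¹ • (aeval S.z a' * lm S.z (fun k => - (n k : ℤ))) := by
    rw [hab, he, map_mul, aeval_C, map_prod, Algebra.smul_def, map_inv₀]
    have : lm S.z (fun k => - (n k : ℤ)) = (∏ k, (aeval S.z (X k ^ n k : MvPolynomial (Fin N) K)))⁻¹ := by
      unfold lm
      rw [← Finset.prod_inv_distrib]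
      refine Finset.prod_congr rfl fun k _ => ?_
      rw [map_pow, aeval_X, zpow_neg, zpow_natCast]
    rw [this, div_eq_mul_inv, mul_inv]; ring
  rw [h1]
  refine Subalgebra.smul_mem _ (Subalgebra.mul_mem _ (mixed_aeval _ _ H.nz _) (Algebra.subset_adjoin ⟨_, fun l hl => ?_, rfl⟩)) _
  simp only [hn l hl]; simp

theorem mixed_den {ex : Finset (Fin N)} {S : CSeed F N} (hz : ∀ k, S.z k ≠ 0) {f : F} (hf : f ∈ cMixed K F ex S) :
    ∃ n : Fin N → ℕ, (∀ k, k ∉ ex → n k = 0) ∧ ∃ a : MvPolynomial (Fin N) K, f * ∏ k, S.z k ^ n k = aeval S.z a := by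
  classical
  have hP : ∀ n : Fin N → ℕ, ∏ k, S.z k ^ n k = aeval S.z (∏ k, X k ^ n k : MvPolynomial (Fin N) K) := by
    intro n; rw [map_prod]; exact Finset.prod_congr rfl fun k _ => by rw [map_pow, aeval_X]
  refine Algebra.adjoin_induction (s := {v | ∃ f : Fin N → ℤ, (∀ l : Fin N, l ∉ ex → 0 ≤ f l) ∧ v = cLaurent F S f})
    (p := fun f _ => ∃ n : Fin N → ℕ, (∀ k, k ∉ ex → n k = 0) ∧ ∃ a : MvPolynomial (Fin N) K, f * ∏ k, S.z k ^ n k = aeval S.z a)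
    ?_ ?_ ?_ ?_ hf
  · rintro _ ⟨v, hv, rfl⟩
    refine ⟨fun k => (- v k).toNat, fun k hk => by have := hv k hk; simp only; omega, ∏ k, X k ^ (v k).toNat, ?_⟩
    rw [map_prod]
    unfold cLaurent
    rw [← Finset.prod_mul_distrib]
    refine Finset.prod_congr rfl fun k _ => ?_
    rw [map_pow, aeval_X, ← zpow_natCast, ← zpow_natCast, ← zpow_add₀ (hz k)]
    congr 1; simp only; omega
  · intro c
    exact ⟨0, fun _ _ => rfl, C c, by simp⟩
  · rintro f g _ _ ⟨n, hn, a, ha⟩ ⟨m, hm, b, hb⟩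
    refine ⟨n + m, fun k hk => by rw [Pi.add_apply, hn k hk, hm k hk], a * (∏ k, X k ^ m k) + b * (∏ k, X k ^ n k), ?_⟩
    rw [map_add, map_mul, map_mul, ← ha, ← hb, ← hP, ← hP]
    simp only [Pi.add_apply, pow_add, Finset.prod_mul_distrib]; ring
  · rintro f g _ _ ⟨n, hn, a, ha⟩ ⟨m, hm, b, hb⟩
    refine ⟨n + m, fun k hk => by rw [Pi.add_apply, hn k hk, hm k hk], a * b, ?_⟩
    rw [map_mul, ← ha, ← hb]
    simp only [Pi.add_apply, pow_add, Finset.prod_mul_distrib]; ring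

end PN

end Mod25

section Mod26
open MvPolynomial


namespace PN

section Step

variable {K : Type u} [Field K] [CharZero K] {N r : ℕ} {F : Type u} [Field F] [Algebra K F]
  [Algebra (MvPolynomial (Fin N) K) F] [IsFractionRing (MvPolynomial (Fin N) K) F]
  [IsScalarTower K (MvPolynomial (Fin N) K) F] (A : PA K N r) {Q : CD K F N r}

theorem prod_perm {M : Type*} [CommMonoid M] (π : Equiv.Perm (Fin N)) (f : Fin N → M) : ∏ k, f (π.symm k) = ∏ k, f k :=
  Equiv.prod_comp π.symm f

theorem xstep_of (hQ : Q.ham = hamF A) (hD : Q.D = sgF F A) {z : Fin N → F} {L : Fin N → Fin N → K} {w : Fin N → Fin r → ℤ}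
    (H : Q.LCW z L w) (π : Equiv.Perm (Fin N)) {Z : Fin N → MvPolynomial (Fin N) K}
    (hz : ∀ k, z (π k) = algebraMap _ F (Z k)) (i : Fin N) (hi : π i ∈ Q.ex) (f g : Fin N → ℕ)
    (hfg : ∀ k, f k = 0 ∨ g k = 0) {P u R : MvPolynomial (Fin N) K}
    (hP : P = ∏ k, Z k ^ f k) (hu : u = ∏ k, Z k ^ g k) (hR : R * Z i = P + u) {v : Fin r → ℤ}
    (eP : Hom A.chi v P) (eu : Hom A.chi v u)
    (hb : ∀ k, A.br P (Z k) * u - A.br u (Z k) * P = if k = i then C (Q.lam (π i)) * Z i * (P * u) else 0) :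
    Q.XStep z (Function.update z (π i) (algebraMap _ F R)) := by
  classical
  set b : Fin N → ℤ := fun l => (f (π.symm l) : ℤ) - g (π.symm l) with hbd
  have hz' : ∀ k, z k = algebraMap _ F (Z (π.symm k)) := fun k => by rw [← hz, Equiv.apply_symm_apply]
  have iu : algebraMap _ F u = lm z (fun l => (g (π.symm l) : ℤ)) := by
    rw [hu, map_prod, ← prod_perm π]
    exact Finset.prod_congr rfl fun k _ => by rw [map_pow, ← hz', zpow_natCast]
  have iP : algebraMap _ F P = lm z (fun l => (f (π.symm l) : ℤ)) := by
    rw [hP, map_prod, ← prod_perm π]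
    exact Finset.prod_congr rfl fun k _ => by rw [map_pow, ← hz', zpow_natCast]
  have ib : lm z b * algebraMap _ F u = algebraMap _ F P := by
    rw [iu, iP, ← lm_add H.nz]; congr 1; funext l; simp [hbd]
  have hneg : (fun l => max (- b l) 0) = fun l => (g (π.symm l) : ℤ) := by
    funext l
    rcases hfg (π.symm l) with h | h <;> simp [hbd, h]
  have ub : algebraMap _ F u ≠ 0 := by rw [iu]; exact lm_ne H.nz _
  have bb := lm_ne H.nz b
  have Pb : algebraMap _ F P ≠ 0 := by rw [iP]; exact lm_ne H.nz _
  have hP0 : P ≠ 0 := fun h => Pb (by rw [h, map_zero])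
  have hlg : ∀ n a, Q.lg z n (algebraMap _ F a) = (z n)⁻¹ * algebraMap _ F (A.br a (Z (π.symm n))) := by
    intro n a
    unfold CD.lg
    rw [Derivation.neg_apply, Derivation.smul_apply, hQ, hz' n, ← brF_ham, brF_io, A.skew, map_neg, smul_neg, neg_neg, smul_eq_mul]
  refine ⟨π i, b, L, w, hi, H, ⟨fun n => ?_, ?_⟩, fun l hl => Function.update_of_ne hl _ _, ?_⟩
  · have h1 := hlg n P
    rw [← ib, Derivation.leibniz, H.lg_lm, hlg, smul_eq_mul, smul_eq_mul] at h1
    have hn := H.nz n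
    have h2 := congrArg (algebraMap _ F) (hb (π.symm n))
    rw [map_sub, map_mul, map_mul] at h2
    refine smul_inj (mul_ne_zero ub (mul_ne_zero hn Pb)) ?_
    have h3 : (∑ l, b l • L l n) • (algebraMap _ F u * (z n * algebraMap _ F P)) =
        algebraMap _ F (A.br P (Z (π.symm n))) * algebraMap _ F u - algebraMap _ F (A.br u (Z (π.symm n))) * algebraMap _ F P := by
      rw [← ib]
      have h4 : algebraMap _ F (A.br P (Z (π.symm n))) = z n * (lm z b * ((z n)⁻¹ * algebraMap _ F (A.br u (Z (π.symm n)))) + algebraMap _ F u * (∑ l, b l • L l n) • lm z b) := by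
        rw [h1, mul_inv_cancel_left₀ hn]
      rw [h4]
      simp only [Algebra.smul_def]
      field_simp
      ring
    rw [h3, h2]
    have e1 : (π.symm n = i) ↔ n = π i := by rw [Equiv.symm_apply_eq]
    by_cases hc : n = π i
    · rw [if_pos hc, if_pos (e1.2 hc), hc, hz]
      rw [map_mul, map_mul, map_mul, ← algebraMap_eq, ← IsScalarTower.algebraMap_apply, Algebra.smul_def]; ring
    · rw [if_neg hc, if_neg (fun h => hc (e1.1 h)), map_zero, zero_smul]
  · apply dot_inj (K := K)
    intro h
    have hw : ∀ a, Hom A.chi v a → Q.D h (algebraMap _ F a) = dot h v • algebraMap _ F a := fun a ha => by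
      rw [hD, sgF_io, ha, io_smul]
    have h1 := hw P eP
    rw [← ib, Derivation.leibniz, H.D_lm, hw u eu, smul_eq_mul, smul_eq_mul] at h1
    have h2 : dot h (∑ l, b l • w l) • (lm z b * algebraMap _ F u) = (0 : K) • (lm z b * algebraMap _ F u) := by
      simp only [Algebra.smul_def, map_zero] at h1 ⊢
      linear_combination h1
    rw [smul_inj (mul_ne_zero bb ub) h2]; simp [dot]
  · rw [Function.update_self, hz, ← map_mul, hR, map_add, ← ib, exP_eq H.nz, hneg, ← iu]; ring

end Step

end PN

end Mod26

section Mod27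
open MvPolynomial


namespace PN

section Walk

variable {K : Type u} [Field K] [CharZero K] {N r : ℕ} {F : Type u} [Field F] [Algebra K F]
  [Algebra (MvPolynomial (Fin N) K) F] [IsFractionRing (MvPolynomial (Fin N) K) F]
  [IsScalarTower K (MvPolynomial (Fin N) K) F] (A : PA K N r) (γ : Fin N → K) (Q : CD K F N r) (e : Fin N → ℤ)

/-- compatibility of all the data -/
structure CX : Prop where
  hγ : ∀ j, γ j ≠ 0
  hG : A.GN γ
  ham : Q.ham = hamF A
  D : Q.D = sgF F A
  ex : ∀ k : Fin N, k ∈ Q.ex ↔ ∃ j, A.pd j = k.val + 1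
  epd : ∀ j l : Fin N, A.pd j = l.val + 1 → e j = e l
  lam : ∀ i ∈ Q.ex, ∀ k ∈ Q.ex, e i = e k → Q.lam k = dot (A.hr i) (A.chi i)

/-- the clusters of the walk -/
structure IsW (i j : Fin N) (Z : Fin N → MvPolynomial (Fin N) K) : Prop where
  lt : ∀ k, k < i → ∃ m, k ≤ m ∧ A.Lk γ k.val m ∧ (∀ j', A.pd j' ≠ m.val + 1) ∧ Z k = A.T γ k.val (m.val+1)
  eq : ∃ m, i ≤ m ∧ m ≤ j ∧ A.Lk γ i.val m ∧ (∀ m', i ≤ m' → m' ≤ j → A.Lk γ i.val m' → m' ≤ m) ∧ Z i = A.T γ i.val (m.val+1)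
  mid : ∀ k, i < k → k ≤ j → Z k = A.T γ (i.val+1) (k.val+1)
  gt : ∀ k, j < k → Z k = A.T γ i.val (k.val+1)

variable (F) in
/-- the initial cluster -/
def z0 (k : Fin N) : F := algebraMap _ F (A.T γ 0 (k.val+1))

/-- reachability of a state of the walk -/
def WS (i j : Fin N) : Prop :=
  ∃ (z : Fin N → F) (π : Equiv.Perm (Fin N)) (Z : Fin N → MvPolynomial (Fin N) K),
    Relation.ReflTransGen Q.XStep (z0 F A γ) z ∧ (∀ k, z (π k) = algebraMap _ F (Z k)) ∧ IsW A γ i j Z ∧ ∀ l, e (π l) = e l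

variable {A γ Q e}

theorem CX.lk (X : CX A γ Q e) (i j : Fin N) (hij : i ≤ j) (h : A.Lk γ i.val j) : e j = e i := by
  obtain ⟨n, hn⟩ : ∃ n, n = j.val := ⟨_, rfl⟩
  induction n using Nat.strong_induction_on generalizing j with
  | _ n ih =>
    subst hn
    rcases hij.eq_or_lt with rfl | hij
    · rfl
    · obtain ⟨l, h1, h2, h3, h4⟩ := A.Lk_pd γ X.hγ (show i.val < j.val from hij) h
      rw [X.epd _ _ h1]
      exact ih l.val h3 l h2 h4 rfl

theorem WS.step (X : CX A γ Q e) (H0 : ∃ L w, Q.LCW (z0 F A γ) L w) {i j0 j : Fin N} (hij0 : i ≤ j0) (hj : j.val = j0.val + 1) (h : WS A γ Q e i j0) :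
    WS A γ Q e i j := by
  classical
  obtain ⟨z, π, Z, hc, hz, W, he⟩ := h
  have hlt : j0 < j := by rw [Fin.lt_def]; omega
  have hij : i < j := lt_of_le_of_lt hij0 hlt
  have hj' : ∀ k : Fin N, k ≤ j → k ≠ j → k ≤ j0 := fun k h1 h2 => by
    rw [Fin.le_def] at *; have := Fin.val_ne_of_ne h2; omega
  have hj'' : ∀ k : Fin N, k < j → k ≤ j0 := fun k h1 => hj' k h1.le h1.ne
  by_cases hL : A.Lk γ i.val j
  · obtain ⟨l, hpd, hil, hlj, hLl⟩ := A.Lk_pd γ X.hγ (show i.val < j.val from hij) hL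
    have hil : i ≤ l := hil
    obtain ⟨m, hm1, hm2, hm3, hm4, hZi⟩ := W.eq
    have hml : m = l := le_antisymm (A.Lk_consec γ X.hγ hij hL hpd m hm1 (lt_of_le_of_lt hm2 hlt) hm3) (hm4 l hil (hj'' _ hlj) hLl)
    subst hml
    obtain ⟨g, hu, hg⟩ := A.exch γ X.hγ X.hG hij hL hLl hpd hil
    obtain ⟨w, hw⟩ := A.T_hom γ X.hγ (i.val+1) (m.val+1)
    obtain ⟨wL, wR, wM, wu⟩ := A.uu_hom γ X.hγ hij hL hLl hpd hil hw
    obtain ⟨b1, b2, b3⟩ := A.exch_br γ X.hγ hij hL hLl hpd hil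
    have hZj : Z j = A.T γ i.val (j.val+1) := W.gt j hlt
    have hmj := hlj.ne
    have i_ex : i ∈ Q.ex := by
      obtain ⟨i0, h1, _⟩ := A.Lk_first γ X.hγ j hij hL
      exact (X.ex i).2 ⟨i0, h1⟩
    have p_ex : π i ∈ Q.ex := by
      by_contra hn
      have h1 := chain_fix hc _ hn
      rw [hz, hZi, z0] at h1
      have h1 := io_inj h1
      have h2 : A.HP (I 0 N) (A.T γ 0 ((π i).val+1)) :=
        (A.HP_T_iff γ X.hγ le_rfl (Nat.zero_le _) (π i).2).2 fun j _ hj => hn ((X.ex _).2 ⟨j, hj⟩)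
      rw [← h1] at h2
      have h3 := h2.of_mem (S := I i.val (j.val+1)) (I_mono (Nat.zero_le _) j.2)
        (supported_mono (I_mono le_rfl (by have : m.val < j.val := hlj; omega)) (A.T_mem γ _ _))
      exact (A.HP_T_iff γ X.hγ j.2 hil (Nat.lt_succ_of_lt hlj)).1 h3 j (Nat.lt_succ_self _) hpd
    obtain ⟨L, w', H⟩ := chain_lcw hc H0
    set f : Fin N → ℕ := fun k => (if k = j then 1 else 0) + (if k = m ∧ m ≠ i then 1 else 0) with hf
    have hP : A.T γ (i.val+1) (m.val+1) * A.T γ i.val (j.val+1) = ∏ k, Z k ^ f k := by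
      simp only [hf, pow_add, Finset.prod_mul_distrib, pow_ite, pow_one, pow_zero]
      rw [Finset.prod_ite_eq' _ _ _, if_pos (Finset.mem_univ _), hZj, mul_comm]
      congr 1
      by_cases hmi : m = i
      · rw [hmi, A.T_le γ le_rfl]; simp
      · simp only [hmi, ne_eq, not_false_eq_true, and_true]
        rw [Finset.prod_ite_eq' _ _ _, if_pos (Finset.mem_univ _), W.mid m (lt_of_le_of_ne hil (Ne.symm hmi)) (hj'' _ hlj)]
    have hu' : A.uu γ i j = ∏ k, Z k ^ g k := by
      rw [hu]
      refine Finset.prod_congr rfl fun k _ => ?_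
      by_cases hk : g k = 0
      · rw [hk, pow_zero, pow_zero]
      · obtain ⟨h1, h2, h3⟩ := hg k hk
        rw [W.mid k h1 (hj'' _ h2)]
    have hfg : ∀ k, f k = 0 ∨ g k = 0 := by
      intro k
      by_cases hk : g k = 0
      · exact Or.inr hk
      · obtain ⟨h1, h2, h3⟩ := hg k hk
        left; simp [hf, h2.ne, h3]
    have key := xstep_of A X.ham X.D H π hz i p_ex f g hfg hP hu' (R := A.T γ (i.val+1) (j.val+1))
      (by rw [hZi, PA.uu, hpd]; ring) (by have := hw.mul wM; rwa [show w + (w + A.chi i + A.chi j) = w + w + A.chi i + A.chi j by abel] at this)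
      wu (fun k => by
        have hZZ : A.br (A.T γ (i.val+1) (m.val+1) * A.T γ i.val (j.val+1)) (Z k) * A.uu γ i j -
            A.br (A.uu γ i j) (Z k) * (A.T γ (i.val+1) (m.val+1) * A.T γ i.val (j.val+1)) =
            A.ZZ (A.T γ (i.val+1) (m.val+1)) (A.T γ i.val (j.val+1)) (A.uu γ i j) (Z k) := by
          rw [A.leibl, PA.ZZ]; ring
        rw [hZZ]
        rcases lt_trichotomy k i with hk | hk | hk
        · obtain ⟨m', h1, h2, h3, h4⟩ := W.lt k hk
          rw [if_neg hk.ne, h4]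
          exact A.exch_brL γ X.hγ hij hL hLl hpd hil k.val hk.le m' h1 h3
        · subst hk
          rw [if_pos rfl, hZi, b3, X.lam k i_ex (π k) p_ex (he k).symm]
        · rw [if_neg hk.ne']
          by_cases hkj : k < j
          · rw [W.mid k hk (hj'' _ hkj)]
            exact b1 _ (supported_mono (I_mono le_rfl hkj) (A.T_mem γ _ _))
          · have hkj : j ≤ k := not_lt.1 hkj
            rw [W.gt k (lt_of_lt_of_le hlt hkj)]
            exact A.exch_brR γ X.hγ hij hL hLl hpd hil k hkj)
    refine ⟨_, (Equiv.swap i j).trans π, Function.update (Function.update Z i (Z j)) j (A.T γ (i.val+1) (j.val+1)), hc.tail key, ?_, ?_, ?_⟩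
    · intro k
      rw [Equiv.trans_apply]
      by_cases hkj : k = j
      · subst hkj
        rw [Equiv.swap_apply_right, Function.update_self, Function.update_self]
      · rw [Function.update_of_ne hkj]
        by_cases hki : k = i
        · subst hki
          rw [Equiv.swap_apply_left, Function.update_self, Function.update_of_ne (fun h => hij.ne' (π.injective h)), hz]
        · rw [Equiv.swap_apply_of_ne_of_ne hki hkj, Function.update_of_ne hki, Function.update_of_ne (fun h => hki (π.injective h)), hz]
    · refine ⟨fun k hk => ?_, ⟨j, hij.le, le_rfl, hL, fun m' _ h _ => h, ?_⟩, fun k h1 h2 => ?_, fun k hk => ?_⟩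
      · rw [Function.update_of_ne (hk.trans hij).ne, Function.update_of_ne hk.ne]
        exact W.lt k hk
      · rw [Function.update_of_ne hij.ne, Function.update_self, hZj]
      · by_cases hkj : k = j
        · subst hkj; rw [Function.update_self]
        · rw [Function.update_of_ne hkj, Function.update_of_ne h1.ne']
          exact W.mid k h1 (hj' _ h2 hkj)
      · rw [Function.update_of_ne hk.ne', Function.update_of_ne (hij.trans hk).ne']
        exact W.gt k (hlt.trans hk)
    · intro l
      rw [Equiv.trans_apply, he]
      have hji := X.lk i j hij.le hL
      by_cases h1 : l = i
      · subst h1; rw [Equiv.swap_apply_left, hji]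
      · by_cases h2 : l = j
        · subst h2; rw [Equiv.swap_apply_right, hji]
        · rw [Equiv.swap_apply_of_ne_of_ne h1 h2]
  · refine ⟨z, π, Z, hc, hz, ⟨W.lt, ?_, fun k h1 h2 => ?_, fun k hk => W.gt k (hlt.trans hk)⟩, he⟩
    · obtain ⟨m, hm1, hm2, hm3, hm4, hZi⟩ := W.eq
      exact ⟨m, hm1, hm2.trans hlt.le, hm3, fun m' h1 h2 h3 => hm4 m' h1 (hj' _ h2 (by rintro rfl; exact hL h3)) h3, hZi⟩
    · by_cases hkj : k = j
      · subst hkj; rw [W.gt k hlt, A.T_unlinked γ X.hγ k h1 hL]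
      · exact W.mid k h1 (hj' _ h2 hkj)

theorem WS.row (X : CX A γ Q e) (H0 : ∃ L w, Q.LCW (z0 F A γ) L w) {i : Fin N} (h : WS A γ Q e i i) (n : ℕ) (j : Fin N) (hj : j.val = i.val + n) :
    WS A γ Q e i j := by
  induction n generalizing j with
  | zero => rwa [Fin.ext (show j.val = i.val by omega)]
  | succ n ih =>
    exact WS.step X H0 (j0 := ⟨i.val + n, by omega⟩) (by rw [Fin.le_def]; simp) (by simp; omega) (ih _ rfl)

theorem IsW.last (hγ : ∀ j, γ j ≠ 0) {i j : Fin N} (hj : ∀ k : Fin N, k ≤ j) {Z : Fin N → MvPolynomial (Fin N) K} (W : IsW A γ i j Z) :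
    ∃ m, i ≤ m ∧ A.Lk γ i.val m ∧ (∀ j', A.pd j' ≠ m.val + 1) ∧ Z i = A.T γ i.val (m.val+1) := by
  obtain ⟨m, hm1, hm2, hm3, hm4, hZi⟩ := W.eq
  exact ⟨m, hm1, hm3, fun j' => A.max_pd γ hγ (n := N) hm1 hm3 (fun m' h1 _ h3 => hm4 m' h1 (hj m') h3) j' j'.2, hZi⟩

theorem WS.diag (X : CX A γ Q e) (H0 : ∃ L w, Q.LCW (z0 F A γ) L w) (n : ℕ) (i : Fin N) (hi : i.val = n) : WS A γ Q e i i := by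
  induction n generalizing i with
  | zero =>
    refine ⟨z0 F A γ, 1, fun k => A.T γ 0 (k.val+1), Relation.ReflTransGen.refl, fun k => rfl,
      ⟨fun k hk => ?_, ⟨i, le_rfl, le_rfl, A.Lk_self γ X.hγ i, fun m' _ h _ => h, by simp only [hi]⟩, fun k h1 h2 => absurd h1 (not_lt.2 h2), fun k hk => by rw [hi]⟩, fun l => rfl⟩
    rw [Fin.lt_def] at hk; omega
  | succ n ih =>
    have hN : 0 < N := by have := i.2; omega
    obtain ⟨z, π, Z, hc, hz, W, he⟩ := WS.row X H0 (ih ⟨n, by omega⟩ rfl) (N - 1 - n) ⟨N - 1, by omega⟩ (by have := i.2; simp only; omega)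
    have hmax : ∀ k : Fin N, k ≤ ⟨N - 1, by omega⟩ := fun k => by have := k.2; rw [Fin.le_def]; simp only; omega
    refine ⟨z, π, Z, hc, hz, ⟨fun k hk => ?_, ⟨i, le_rfl, le_rfl, A.Lk_self γ X.hγ i, fun m' _ h _ => h, ?_⟩, fun k h1 h2 => absurd h1 (not_lt.2 h2), fun k hk => ?_⟩, he⟩
    · by_cases hkn : k.val = n
      · have := W.last X.hγ hmax
        rwa [show (⟨n, by omega⟩ : Fin N) = k from Fin.ext hkn.symm] at this
      · exact W.lt k (by rw [Fin.lt_def] at *; simp only; omega)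
    · rw [W.mid i (by rw [Fin.lt_def]; simp only; omega) (hmax i), hi]
    · rw [W.mid k (by rw [Fin.lt_def] at *; simp only; omega) (hmax k), hi]

theorem walk_gen (X : CX A γ Q e) (H0 : ∃ L w, Q.LCW (z0 F A γ) L w) (i : Fin N) :
    ∃ (z : Fin N → F) (k : Fin N), Relation.ReflTransGen Q.XStep (z0 F A γ) z ∧ z k = algebraMap _ F (C (γ i) * MvPolynomial.X i) := by
  obtain ⟨z, π, Z, hc, hz, W, he⟩ := WS.diag X H0 _ i rfl
  obtain ⟨m, hm1, hm2, hm3, hm4, hZi⟩ := W.eq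
  obtain rfl := le_antisymm hm1 hm2
  exact ⟨z, π i, hc, by rw [hz, hZi, A.T_self]⟩

theorem walk_end (X : CX A γ Q e) (H0 : ∃ L w, Q.LCW (z0 F A γ) L w) :
    ∃ (z : Fin N → F) (π : Equiv.Perm (Fin N)) (m : Fin N → Fin N), Relation.ReflTransGen Q.XStep (z0 F A γ) z ∧
      ∀ k, k ≤ m k ∧ (∀ j', A.pd j' ≠ (m k).val + 1) ∧ z (π k) = algebraMap _ F (A.T γ k.val ((m k).val+1)) := by
  rcases Nat.eq_zero_or_pos N with h | hN
  · subst h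
    exact ⟨_, 1, id, Relation.ReflTransGen.refl, fun k => k.elim0⟩
  · obtain ⟨z, π, Z, hc, hz, W, he⟩ := WS.diag X H0 _ ⟨N - 1, by omega⟩ rfl
    have hmax : ∀ k : Fin N, k ≤ ⟨N - 1, by omega⟩ := fun k => by have := k.2; rw [Fin.le_def]; simp only; omega
    have h : ∀ k, ∃ m, k ≤ m ∧ A.Lk γ k.val m ∧ (∀ j', A.pd j' ≠ m.val + 1) ∧ Z k = A.T γ k.val (m.val+1) := by
      intro k
      rcases (hmax k).lt_or_eq with h | h
      · exact W.lt k h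
      · have := W.last X.hγ hmax
        rwa [← h] at this
    choose m h1 h2 h3 h4 using h
    exact ⟨z, π, m, hc, fun k => ⟨h1 k, h3 k, by rw [hz, h4]⟩⟩

end Walk

end PN

end Mod27

section Mod28
open MvPolynomial


namespace PN

section Init

variable {K : Type u} [Field K] [CharZero K] {N r : ℕ} {F : Type u} [Field F] [Algebra K F]
  [Algebra (MvPolynomial (Fin N) K) F] [IsFractionRing (MvPolynomial (Fin N) K) F]
  [IsScalarTower K (MvPolynomial (Fin N) K) F] (A : PA K N r) (γ : Fin N → K)

theorem FS_le_of {S : Set (Fin N)} {E : IntermediateField K F} (h : ∀ m ∈ S, algebraMap (MvPolynomial (Fin N) K) F (X m) ∈ E) : FS K F S ≤ E := by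
  refine IntermediateField.adjoin_le_iff.2 ?_
  rintro _ ⟨m, hm, rfl⟩
  exact h m hm

theorem z0_gen (hγ : ∀ j, γ j ≠ 0) : IntermediateField.adjoin K (Set.range (z0 F A γ)) = ⊤ := by
  set E := IntermediateField.adjoin K (Set.range (z0 F A γ)) with hE
  have key : ∀ n : ℕ, ∀ k : Fin N, k.val = n → algebraMap (MvPolynomial (Fin N) K) F (X k) ∈ E := by
    intro n
    induction n using Nat.strong_induction_on with
    | _ n ih =>
      rintro k rfl
      have hFS : FS K F (I 0 k.val) ≤ E := FS_le_of fun m hm => ih m.val hm.2 m rfl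
      have e := A.pred γ hγ 0 k (Nat.zero_le _)
      have hp := hFS (io_mem_FS (F := F) e.hp)
      have hc := hFS (io_mem_FS (F := F) e.hc)
      have hz : algebraMap _ F (A.T γ 0 (k.val+1)) ∈ E := IntermediateField.subset_adjoin _ _ ⟨k, rfl⟩
      have h1 := A.T_succ γ (Nat.zero_le k.val)
      rw [yy] at h1
      have h2 := congrArg (algebraMap _ F) h1
      rw [map_mul, map_sub, map_mul, ← algebraMap_eq, ← IsScalarTower.algebraMap_apply] at h2
      have hp0 : algebraMap _ F (A.T γ 0 (A.pd k)) ≠ 0 := io_ne e.hp0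
      have hg0 : algebraMap K F (γ k) ≠ 0 := by simpa using hγ k
      have h3 : algebraMap (MvPolynomial (Fin N) K) F (X k) =
          ((algebraMap K F (γ k))⁻¹ * algebraMap _ F (A.T γ 0 (k.val+1)) + algebraMap _ F (A.cT γ 0 k)) * (algebraMap _ F (A.T γ 0 (A.pd k)))⁻¹ := by
        rw [h2]; field_simp; ring
      rw [h3]
      exact E.mul_mem (E.add_mem (E.mul_mem (E.inv_mem (E.algebraMap_mem _)) hz) hc) (E.inv_mem hp)
  rw [eq_top_iff]
  intro f _
  obtain ⟨a, b, hb, rfl⟩ := IsFractionRing.div_surjective (A := MvPolynomial (Fin N) K) f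
  have h : ∀ a : MvPolynomial (Fin N) K, algebraMap _ F a ∈ E := fun a =>
    FS_le_of (S := Set.univ) (fun m _ => key _ m rfl) (io_mem_FS (by rw [supported_univ]; trivial))
  exact E.div_mem (h a) (h b)

theorem z0_lcw {Q : CD K F N r} (hγ : ∀ j, γ j ≠ 0) (ham : Q.ham = hamF A) (hD : Q.D = sgF F A) : ∃ L w, Q.LCW (z0 F A γ) L w := by
  have hlc : ∀ k l : Fin N, ∃ ω : K, A.br (A.T γ 0 (k.val+1)) (A.T γ 0 (l.val+1)) = C ω * (A.T γ 0 (k.val+1) * A.T γ 0 (l.val+1)) := by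
    intro k l
    rcases lt_trichotomy k l with h | rfl | h
    · obtain ⟨ω, hω⟩ := A.T0_lc γ hγ l k h
      exact ⟨-ω, by rw [A.skew, hω, map_neg]; ring⟩
    · exact ⟨0, by rw [A.br_self]; simp⟩
    · exact A.T0_lc γ hγ k l h
  choose L hL using hlc
  have hT : ∀ k : Fin N, A.T γ 0 (k.val+1) ≠ 0 := fun k => A.T_ne γ hγ _ _
  have hw : ∀ k : Fin N, ∃ w, Hom A.chi w (A.T γ 0 (k.val+1)) := fun k => A.T_hom γ hγ _ _
  choose w hw using hw
  have hsk : ∀ k l, L k l = - L l k := by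
    intro k l
    have h := A.skew (A.T γ 0 (k.val+1)) (A.T γ 0 (l.val+1))
    rw [hL, hL, mul_comm (A.T γ 0 (l.val+1)), ← neg_mul, ← map_neg] at h
    exact C_injective _ _ (mul_right_cancel₀ (mul_ne_zero (hT k) (hT l)) h)
  refine ⟨L, w, fun k => io_ne (hT k), fun k l => ?_, fun h k => ?_, fun v h1 h2 => ?_, z0_gen A γ hγ⟩
  · rw [ham, ← brF_ham, z0, z0, brF_io, hL, ← smul_eq_C_mul, io_smul, map_mul]
  · rw [hD, z0, sgF_io, hw k, io_smul]
  · by_contra hv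
    obtain ⟨k, hk, hmax⟩ : ∃ k, v k ≠ 0 ∧ ∀ l, k < l → v l = 0 := by
      classical
      have hne : (Finset.univ.filter fun k => v k ≠ 0).Nonempty := by
        by_contra hne
        rw [Finset.not_nonempty_iff_eq_empty, Finset.filter_eq_empty_iff] at hne
        exact hv (funext fun k => not_not.1 (hne (Finset.mem_univ k)))
      refine ⟨_, (Finset.mem_filter.1 (Finset.max'_mem _ hne)).2, fun l hl => ?_⟩
      by_contra hl'
      exact absurd (Finset.le_max' _ l (Finset.mem_filter.2 ⟨Finset.mem_univ _, hl'⟩)) (not_le.2 hl)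
    have h1' : ∀ n, ∑ l, v l • L n l = 0 := fun n => by
      have := h1 n
      rw [← neg_eq_zero, ← Finset.sum_neg_distrib, ← this]
      exact Finset.sum_congr rfl fun l _ => by rw [hsk n l, smul_neg, neg_neg]
    obtain ⟨M, hM1, hM2⟩ : ∃ M : Fin N → K, ∑ l, v l • M l = 0 ∧ ∀ l, l ≤ k →
        L k l - M l = dot (A.hk k) (w l) - if l = k then dot (A.hk k) (A.chi k) else 0 := by
      rcases Nat.eq_zero_or_eq_succ_pred (A.pd k) with hp | hp
      · refine ⟨0, by simp, fun l hl => ?_⟩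
        have hT0 : A.T γ 0 0 = 1 := A.T_le γ le_rfl
        rcases hl.lt_or_eq with hl | rfl
        · rw [if_neg hl.ne, A.T0_rec γ hγ k l hl (hw l) (hL k l) (ω' := 0)
            (by rw [hp, hT0, A.skew]; have := A.br_C (A.T γ 0 (l.val+1)) 1; rw [C_1] at this; rw [this]; simp)]
          simp
        · have hh : Hom A.chi 0 (A.T γ 0 (A.pd l)) := by rw [hp, hT0]; exact Hom.one
          have e1 := A.T0_wt γ hγ l (hw l) hh
          have e2 : L l l = 0 := self_eq_neg.1 (hsk l l)
          rw [if_pos rfl, e1, e2, zero_add]; simp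
      · have hlt : (A.pd k).pred < N := by have := A.pd_le k; have := k.2; omega
        obtain ⟨p, hp'⟩ : ∃ p : Fin N, A.pd k = p.val + 1 := ⟨⟨_, hlt⟩, hp⟩
        have hpk := (A.pd_ne hp').1
        refine ⟨L p, h1' p, fun l hl => ?_⟩
        rcases hl.lt_or_eq with hl | rfl
        · rw [if_neg hl.ne, A.T0_rec γ hγ k l hl (hw l) (hL k l) (ω' := L p l) (by rw [hp', hL])]
          ring
        · have e1 := A.T0_wt γ hγ l (hw l) (by rw [hp']; exact hw p)
          have e2 : L l l = 0 := self_eq_neg.1 (hsk l l)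
          have e3 := A.T0_rec γ hγ l p hpk (hw p) (hL l p) (ω' := L p p) (by rw [hp', hL])
          have e4 : L p p = 0 := self_eq_neg.1 (hsk p p)
          rw [if_pos rfl, e1, e2, hsk p l, e3, e4, dot_add]; ring
    have h3 : ∑ l, v l • (L k l - M l) = 0 := by
      simp only [smul_sub, Finset.sum_sub_distrib, h1', hM1, sub_zero]
    have h4 : ∑ l, v l • (L k l - M l) = ∑ l, (v l • dot (A.hk k) (w l) - if l = k then v k • dot (A.hk k) (A.chi k) else 0) := by
      refine Finset.sum_congr rfl fun l _ => ?_
      by_cases hl : l ≤ k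
      · rw [hM2 l hl, smul_sub]
        congr 1
        split_ifs with h
        · rw [h]
        · rw [smul_zero]
      · have hl := not_le.1 hl
        rw [hmax l hl, if_neg hl.ne']; simp
    rw [h3, Finset.sum_sub_distrib, Finset.sum_ite_eq' _ _ _, if_pos (Finset.mem_univ _)] at h4
    have h5 : ∑ l, v l • dot (A.hk k) (w l) = 0 := by
      rw [← dot_zero (A.hk k), ← h2, dot_sum]
      exact Finset.sum_congr rfl fun l _ => by rw [dot_smul, zsmul_eq_mul]
    rw [h5, zero_sub, eq_comm, neg_eq_zero, zsmul_eq_mul] at h4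
    rcases mul_eq_zero.1 h4 with h | h
    · exact hk (by exact_mod_cast h)
    · exact A.lam_ne k h

end Init

end PN

end Mod28

section Mod29
open MvPolynomial


namespace PN

section Main

variable {K : Type u} [Field K] [CharZero K] {N r : ℕ} {F : Type u} [Field F] [Algebra K F]
  [Algebra (MvPolynomial (Fin N) K) F] [IsFractionRing (MvPolynomial (Fin N) K) F]
  [IsScalarTower K (MvPolynomial (Fin N) K) F] {A : PA K N r} {γ : Fin N → K} {Q : CD K F N r} {e : Fin N → ℤ}

theorem rel_pow {a b : MvPolynomial (Fin N) K} (h : IsRelPrime a b) (m n : ℕ) : IsRelPrime (a ^ m) (b ^ n) := by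
  rw [← Finset.card_range m, ← Finset.prod_const, ← Finset.card_range n, ← Finset.prod_const]
  exact IsRelPrime.prod_left fun i _ => IsRelPrime.prod_right fun j _ => h

theorem io_aeval (z : Fin N → F) (Z : Fin N → MvPolynomial (Fin N) K) (hz : ∀ k, z k = algebraMap _ F (Z k)) (a : MvPolynomial (Fin N) K) :
    aeval z a = algebraMap _ F (aeval Z a) := by
  have : (aeval z : MvPolynomial (Fin N) K →ₐ[K] F) = (IsScalarTower.toAlgHom K (MvPolynomial (Fin N) K) F).comp (aeval Z) := by
    apply MvPolynomial.algHom_ext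
    intro k
    rw [AlgHom.comp_apply, aeval_X, aeval_X, hz]; rfl
  rw [this]; rfl

theorem cx_main (X : CX A γ Q e) : ∃ S0 : CSeed F N, Q.Good S0 ∧ S0.z = z0 F A γ ∧
    cClusterAlg K F Q.ex S0 = (IsScalarTower.toAlgHom K (MvPolynomial (Fin N) K) F).range ∧
    cUpper K F Q.ex S0 = (IsScalarTower.toAlgHom K (MvPolynomial (Fin N) K) F).range ∧
    ∀ k, algebraMap _ F (C (γ k) * MvPolynomial.X k) ∈ cClusterVars K F Q.ex S0 := by
  have H0 := z0_lcw (Q := Q) A γ X.hγ X.ham X.D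
  obtain ⟨zE, π, m, hc, hE⟩ := walk_end X H0
  have hE' : ∀ k, zE k = algebraMap _ F (A.T γ (π.symm k).val ((m (π.symm k)).val+1)) := fun k => by
    rw [← (hE _).2.2, Equiv.apply_symm_apply]
  have hna : ∀ k ∈ Q.ex, ∀ l, ¬ Associated (A.T γ 0 (k.val+1)) (A.T γ (π.symm l).val ((m (π.symm l)).val+1)) := by
    intro k hk l h
    have h1 := A.T_assoc_inj γ X.hγ (Nat.zero_le _) (hE (π.symm l)).1 h
    obtain ⟨j, hj⟩ := (X.ex k).1 hk
    rw [h1] at hj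
    exact (hE (π.symm l)).2.1 j hj
  obtain ⟨S0, hS0, G0⟩ := chain_seed hc H0 (fun k hk h => by
    rw [hE', z0] at h
    refine hna k hk k ?_
    rw [io_inj h])
  rw [← hS0] at hc
  obtain ⟨SE, hSE, hSEz⟩ := chain_equiv G0 hc
  have GE := G0.equiv hSE
  have nz : ∀ {S : CSeed F N}, Q.Good S → ∀ k, S.z k ≠ 0 := by
    intro S G
    obtain ⟨_, L, w, H, _⟩ := G
    exact H.nz
  have hinter : ∀ f, f ∈ cMixed K F Q.ex S0 → f ∈ cMixed K F Q.ex SE → f ∈ (IsScalarTower.toAlgHom K (MvPolynomial (Fin N) K) F).range := by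
    intro f h1 h2
    obtain ⟨n, hn, a, ha⟩ := mixed_den (nz G0) h1
    obtain ⟨n', hn', a', ha'⟩ := mixed_den (nz GE) h2
    rw [io_aeval _ (fun k => A.T γ 0 (k.val+1)) (fun k => by rw [hS0]; rfl)] at ha
    rw [io_aeval _ (fun k => A.T γ (π.symm k).val ((m (π.symm k)).val+1)) (fun k => by rw [hSEz]; exact hE' k)] at ha'
    generalize aeval (fun k => A.T γ 0 (k.val+1)) a = b at ha
    generalize aeval (fun k => A.T γ (π.symm k).val ((m (π.symm k)).val+1)) a' = b' at ha'
    have hD : ∏ k, S0.z k ^ n k = algebraMap _ F (∏ k : Fin N, A.T γ 0 (k.val+1) ^ n k) := by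
      rw [map_prod]; exact Finset.prod_congr rfl fun k _ => by rw [hS0, z0, map_pow]
    have hDE : ∏ k, SE.z k ^ n' k = algebraMap _ F (∏ k : Fin N, A.T γ (π.symm k).val ((m (π.symm k)).val+1) ^ n' k) := by
      rw [map_prod]; exact Finset.prod_congr rfl fun k _ => by rw [hSEz, hE', map_pow]
    have hrel : IsRelPrime (∏ k : Fin N, A.T γ 0 (k.val+1) ^ n k) (∏ k : Fin N, A.T γ (π.symm k).val ((m (π.symm k)).val+1) ^ n' k) := by
      refine IsRelPrime.prod_left fun k _ => IsRelPrime.prod_right fun l _ => ?_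
      by_cases hk : k ∈ Q.ex
      · refine rel_pow ?_ _ _
        have i1 := (A.T_HP γ X.hγ (Nat.zero_le k.val)).irr
        have i2 := (A.T_HP γ X.hγ (hE (π.symm l)).1).irr
        exact i1.isRelPrime_iff_not_dvd.2 fun h => hna k hk l (i1.associated_of_dvd i2 h)
      · rw [hn k hk, pow_zero]; exact isRelPrime_one_left
    rw [hD] at ha
    rw [hDE] at ha'
    have hD0 : algebraMap _ F (∏ k : Fin N, A.T γ 0 (k.val+1) ^ n k) ≠ 0 := by
      rw [← hD]; exact Finset.prod_ne_zero_iff.2 fun k _ => pow_ne_zero _ (nz G0 k)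
    generalize (∏ k : Fin N, A.T γ 0 (k.val+1) ^ n k) = D at *
    generalize (∏ k : Fin N, A.T γ (π.symm k).val ((m (π.symm k)).val+1) ^ n' k) = D' at *
    have h3 : b * D' = D * b' := by
      apply io_inj (F := F)
      rw [map_mul, map_mul, ← ha, ← ha']; ring
    obtain ⟨c, rfl⟩ := hrel.dvd_of_dvd_mul_right ⟨b', h3⟩
    refine ⟨c, ?_⟩
    show algebraMap _ F c = f
    apply mul_right_cancel₀ hD0
    rw [ha, map_mul, mul_comm]
  have hvar : ∀ k, algebraMap _ F (C (γ k) * MvPolynomial.X k) ∈ cClusterVars K F Q.ex S0 := by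
    intro i
    obtain ⟨z, k, h1, h2⟩ := walk_gen X H0 i
    rw [← hS0] at h1
    obtain ⟨S', h3, h4⟩ := chain_equiv G0 h1
    exact ⟨S', h3, k, by rw [h4, h2]⟩
  have hadj : ∀ B : Subalgebra K F, (∀ k, algebraMap (MvPolynomial (Fin N) K) F (C (γ k) * MvPolynomial.X k) ∈ B) →
      (IsScalarTower.toAlgHom K (MvPolynomial (Fin N) K) F).range ≤ B := by
    intro B hB
    rintro _ ⟨a, rfl⟩
    show algebraMap _ F a ∈ B
    have h : ∀ k, algebraMap (MvPolynomial (Fin N) K) F (MvPolynomial.X k) ∈ B := by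
      intro k
      have h1 := B.smul_mem (hB k) (γ k)⁻¹
      rwa [← smul_eq_C_mul, io_smul, inv_smul_smul₀ (X.hγ k)] at h1
    induction a using MvPolynomial.induction_on with
    | C c => rw [← algebraMap_eq, ← IsScalarTower.algebraMap_apply]; exact B.algebraMap_mem c
    | add p q hp hq => rw [map_add]; exact B.add_mem hp hq
    | mul_X p n hp => rw [map_mul]; exact B.mul_mem hp (h n)
  refine ⟨S0, G0, hS0, le_antisymm ?_ ?_, le_antisymm ?_ ?_, hvar⟩
  · refine Algebra.adjoin_le ?_
    rintro _ ⟨S', h1, l, rfl⟩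
    exact hinter _ (laurent G0 h1 l) (laurent GE ((G0.symm hSE).trans h1) l)
  · exact hadj _ fun k => Algebra.subset_adjoin (hvar k)
  · intro f hf
    simp only [cUpper, Algebra.mem_iInf] at hf
    exact hinter f (hf S0 Relation.ReflTransGen.refl) (hf SE hSE)
  · refine hadj _ fun k => ?_
    simp only [cUpper, Algebra.mem_iInf]
    intro S' hS'
    obtain ⟨S'', h1, l, h2⟩ := hvar k
    rw [h2]
    exact laurent (G0.equiv hS') ((G0.symm hS').trans h1) l

end Main

end PN

end Mod29

section Mod30
open MvPolynomial


namespace PN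

section Link

variable {K : Type u} [Field K] [CharZero K] {N r : ℕ} (P : SymPoissonNilpotent K N r)

theorem PRsub_I (k : Fin N) : PRsub K N ((k : ℕ) + 1) = supported K (I 0 (k.val + 1)) := by
  rw [PRsub_succ_eq]
  congr 1
  ext l
  rw [mem_I, Set.mem_Iic, Fin.le_def]
  omega

theorem HP_link (k : Fin N) (q : MvPolynomial (Fin N) K) :
    (IsPoissonPrimeIn K P.br (PRsub K N ((k : ℕ) + 1)) q ∧ ∃ f : Fin r → ℤ, IsEigenWith K P.act f q) ↔
      (ofP P).HP (I 0 (k.val + 1)) q := by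
  rw [PRsub_I]
  constructor
  · rintro ⟨⟨hm, h0, hu, hp, hb⟩, f, hf⟩
    refine ⟨⟨?_, ?_⟩, hm, ⟨f, (eigen_iff P).1 hf⟩, ?_⟩
    · intro h
      obtain ⟨c, hc, e⟩ := isUnit_iff_C.1 h
      refine hu ⟨C c⁻¹, (supported K (I 0 (k.val + 1))).algebraMap_mem c⁻¹, ?_⟩
      rw [e, ← C_mul, mul_inv_cancel₀ hc, C_1]
    · intro a b hab
      have ha : a ∈ supported K (I 0 (k.val + 1)) := sup_of_dvd hm h0 ⟨b, hab⟩
      have hb' : b ∈ supported K (I 0 (k.val + 1)) := sup_of_dvd hm h0 ⟨a, by rw [hab, mul_comm]⟩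
      rcases hp a ha b hb' ⟨1, one_mem _, by rw [mul_one, hab]⟩ with ⟨e, _, he⟩ | ⟨e, _, he⟩
      · right
        refine isUnit_iff_exists_inv.2 ⟨e, ?_⟩
        apply mul_left_cancel₀ h0
        calc q * (b * e) = (q * e) * b := by ring
          _ = a * b := by rw [← he]
          _ = q * 1 := by rw [mul_one, hab]
      · left
        refine isUnit_iff_exists_inv.2 ⟨e, ?_⟩
        apply mul_left_cancel₀ h0
        calc q * (a * e) = a * (q * e) := by ring
          _ = a * b := by rw [← he]
          _ = q * 1 := by rw [mul_one, hab]
    · intro a ha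
      obtain ⟨e, _, he⟩ := hb a ha
      refine ⟨-e, ?_⟩
      rw [(ofP P).skew]
      change - P.br a q = _
      rw [he]; ring
  · intro h
    have h0 := h.ne_zero
    refine ⟨⟨h.mem, h0, ?_, ?_, ?_⟩, ?_⟩
    · rintro ⟨v, _, hv⟩
      exact h.irr.not_isUnit (isUnit_iff_exists_inv.2 ⟨v, hv⟩)
    · rintro a ha b hb ⟨e, _, he⟩
      rcases h.prime.dvd_or_dvd ⟨e, he⟩ with ⟨d, hd⟩ | ⟨d, hd⟩
      · exact Or.inl ⟨d, sup_quot (by rw [← hd]; exact ha) h.mem h0, hd⟩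
      · exact Or.inr ⟨d, sup_quot (by rw [← hd]; exact hb) h.mem h0, hd⟩
    · intro a ha
      obtain ⟨e, he⟩ := h.nrm a ha
      have hs : P.br a q = q * (-e) := by
        rw [P.skew]
        change - (ofP P).br q a = _
        rw [he]; ring
      refine ⟨-e, ?_, by rw [hs, mul_comm]⟩
      refine sup_quot (a := q) ?_ h.mem h0
      rw [← hs]
      exact PA.br_mem (A := ofP P) (fun l hl m hm => (ofP P).brXX_mem hl hm) ha h.mem
    · obtain ⟨w, hw⟩ := h.hom
      exact ⟨w, (eigen_iff P).2 hw⟩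

variable {P} {η : Fin N → ℤ} {y : Fin N → MvPolynomial (Fin N) K} (hs : IsPoissonPrimeSeq K P η y)
  {γ : Fin N → K} (hγ : ∀ j, γ j ≠ 0)

theorem seq_T (hs : IsPoissonPrimeSeq K P η y) (hγ : ∀ j, γ j ≠ 0) (k : Fin N) :
    ∃ t : Kˣ, (ofP P).T γ 0 (k.val + 1) = (t : K) • y k := by
  have h1 := (ofP P).T_HP γ hγ (Nat.zero_le k.val)
  rw [← HP_link, hs.prime_iff] at h1
  obtain ⟨l, hl, -, t, ht⟩ := h1
  rcases hl.lt_or_eq with h | h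
  · exfalso
    refine (ofP P).T_top γ hγ (Nat.zero_le k.val) 0 ?_
    rw [ht]
    have h2 := (hs.prime l).1
    rw [PRsub_I] at h2
    have hlk : l.val < k.val := h
    exact Subalgebra.smul_mem _ (supported_mono (I_mono (le_refl 0) (by omega)) h2) _
  · exact ⟨t, by rw [ht, h]⟩

theorem seq_iff (hs : IsPoissonPrimeSeq K P η y) (hγ : ∀ j, γ j ≠ 0) {l k : Fin N} (hlk : l ≤ k) :
    (∀ l' : Fin N, l < l' → l' ≤ k → η l' ≠ η l) ↔ ∀ j : Fin N, j ≤ k → (ofP P).pd j ≠ l.val + 1 := by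
  have hlk' : l.val ≤ k.val := hlk
  have h1 := (ofP P).HP_T_iff γ hγ (b := 0) (n := k.val + 1) (by omega) (l := l) (Nat.zero_le _) (by omega)
  rw [← HP_link, hs.prime_iff] at h1
  have h2 : (∀ j : Fin N, j ≤ k → (ofP P).pd j ≠ l.val + 1) ↔ ∀ j : Fin N, j.val < k.val + 1 → (ofP P).pd j ≠ l.val + 1 :=
    forall_congr' fun j => by rw [Fin.le_def, Nat.lt_succ_iff]
  rw [h2, ← h1]
  obtain ⟨t, ht⟩ := seq_T hs hγ l
  constructor
  · intro h
    exact ⟨l, hlk, h, t, ht⟩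
  · rintro ⟨l', hl', h, t', ht'⟩
    obtain ⟨s, hs'⟩ := seq_T hs hγ l'
    have : l = l' := by
      refine (ofP P).T_assoc_inj γ hγ (Nat.zero_le _) (Nat.zero_le _) (assoc_iff.2 ⟨(s : K) * (t' : K)⁻¹, ?_, ?_⟩)
      · exact mul_ne_zero s.ne_zero (inv_ne_zero t'.ne_zero)
      · rw [hs', ht', ← smul_eq_C_mul, smul_smul, mul_assoc, inv_mul_cancel₀ t'.ne_zero, mul_one]
    rw [this]; exact h

theorem seq_ex (hs : IsPoissonPrimeSeq K P η y) (hγ : ∀ j, γ j ≠ 0) (k : Fin N) :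
    k ∈ exSet η ↔ ∃ j, (ofP P).pd j = k.val + 1 := by
  have hN : 0 < N := by have := k.isLt; omega
  set m : Fin N := ⟨N - 1, by omega⟩ with hm
  have hle : ∀ l : Fin N, l ≤ m := fun l => by
    rw [Fin.le_def, hm]; have := l.isLt; simp only; omega
  have h1 := seq_iff hs hγ (hle k)
  rw [← not_iff_not, exSet, Finset.mem_filter]
  push Not
  constructor
  · intro h j
    exact h1.1 (fun l' h3 _ => h (Finset.mem_univ _) l' h3) j (hle j)
  · intro h _ l' h3
    exact h1.2 (fun j _ => h j) l' h3 (hle l')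

theorem seq_epd (hs : IsPoissonPrimeSeq K P η y) (hγ : ∀ j, γ j ≠ 0) (j l : Fin N)
    (h : (ofP P).pd j = l.val + 1) : η j = η l := by
  have hlj := ((ofP P).pd_ne h).1
  by_contra hne
  refine (seq_iff hs hγ hlj.le).1 ?_ j le_rfl h
  intro l' h1 h2
  rcases h2.lt_or_eq with h3 | h3
  · refine (seq_iff hs hγ h1.le).2 ?_ l' h1 le_rfl
    intro j' hj' h4
    have := (ofP P).pd_inj γ hγ h h4
    rw [← this] at hj'
    exact absurd hj' (not_le.2 h3)
  · rw [h3]; exact hne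

end Link

theorem main_thm
    {K : Type u} [Field K] [CharZero K] {N r : ℕ}
    (P : SymPoissonNilpotent K N r)
    (η : Fin N → ℤ) (y : Fin N → MvPolynomial (Fin N) K)
    (hseq : IsPoissonPrimeSeq K P η y)
    (hB : PoissonCondB K P η) :
    ∃ (F : Type u) (_ : Field F) (_ : Algebra K F)
      (ι : MvPolynomial (Fin N) K →ₐ[K] F),
      (Function.Injective ι ∧ ∀ d : F, ∃ a b : MvPolynomial (Fin N) K,
        b ≠ 0 ∧ d * ι b = ι a) ∧
      ∃ brF : F →ₗ[K] F →ₗ[K] F,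
        (∀ a b : F, brF a b = - brF b a) ∧
        (∀ a b c : F, brF a (b * c) = brF a b * c + b * brF a c) ∧
        (∀ a b : MvPolynomial (Fin N) K, brF (ι a) (ι b) = ι (P.br a b)) ∧
        ∃ (t : Fin N → Kˣ) (S0 : CSeed F N),
          CSeedIsValid K F (exSet η) S0 ∧
          (∀ k : Fin N, S0.z k = ι ((t k : K) • y k)) ∧
          cClusterAlg K F (exSet η) S0 = ι.range ∧
          cUpper K F (exSet η) S0 = ι.range ∧
          (∀ k : Fin N, ∃ s : Kˣ,
            ι ((s : K) • MvPolynomial.X k) ∈ cClusterVars K F (exSet η) S0) ∧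
          (∀ S' : CSeed F N, CMutEquiv K F (exSet η) S0 S' →
            ∀ k l : Fin N, ∃ ω : K, brF (S'.z k) (S'.z l) = ω • (S'.z k * S'.z l)) := by
  obtain ⟨γ, hγ, hG⟩ := (ofP P).exGamma
  obtain ⟨d, hd, hdB⟩ := hB
  let F := FractionRing (MvPolynomial (Fin N) K)
  let Q : CD K F N r :=
    { ham := hamF (ofP P)
      skew := fun f g => brF_skew (ofP P) f g
      D := sgF F (ofP P)
      lam := SymPoissonNilpotent.lamstar K P
      ex := exSet η
      dd := fun k => d (η k)
      lam_ne := fun k _ => P.eig_ne_rev k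
      dd_pos := fun k => hd _ ⟨k, rfl⟩
      hdl := hdB }
  have X : CX (ofP P) γ Q η :=
    { hγ := hγ
      hG := hG
      ham := rfl
      D := rfl
      ex := seq_ex hseq hγ
      epd := seq_epd hseq hγ
      lam := fun i hi k hk he => by
        have h1 := hdB i hi k hk
        rw [he] at h1
        have h2 : (d (η k) : K) ≠ 0 := Nat.cast_ne_zero.2 (hd _ ⟨k, rfl⟩).ne'
        exact (mul_left_cancel₀ h2 h1).symm }
  obtain ⟨S0, G, hz, hA, hU, hV⟩ := cx_main X
  choose t ht using seq_T hseq hγ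
  refine ⟨F, inferInstance, inferInstance, IsScalarTower.toAlgHom K (MvPolynomial (Fin N) K) F, ⟨?_, ?_⟩,
    brF (ofP P), brF_skew (ofP P), brF_lr (ofP P), brF_io (ofP P), t, S0, G.valid, ?_, hA, hU, ?_, ?_⟩
  · exact IsFractionRing.injective (MvPolynomial (Fin N) K) F
  · intro f
    obtain ⟨a, b, hb, rfl⟩ := IsFractionRing.div_surjective (A := MvPolynomial (Fin N) K) f
    have hb0 : b ≠ 0 := nonZeroDivisors.ne_zero hb
    refine ⟨a, b, hb0, ?_⟩
    change algebraMap _ F a / algebraMap _ F b * algebraMap _ F b = algebraMap _ F a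
    exact div_mul_cancel₀ _ (fun h => hb0 (IsFractionRing.injective (MvPolynomial (Fin N) K) F (by rw [h, map_zero])))
  · intro k
    rw [hz, ← ht]; rfl
  · intro k
    refine ⟨Units.mk0 (γ k) (hγ k), ?_⟩
    rw [Units.val_mk0, smul_eq_C_mul]
    exact hV k
  · intro S' h k l
    exact (G.equiv h).logcan k l

end PN

end Mod30

/-- **Cluster algebra structures on symmetric Poisson nilpotent algebras.**
Let `K` be a field of characteristic `0` and `R = K[x_1, …, x_N]` a symmetric nilpotent
semi-quadratic Poisson algebra satisfying the Poisson analog of condition (B).  Then `R`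
has a canonical structure of cluster algebra for which no frozen variables are inverted
and for which the Poisson bracket is compatible in the sense of
Gekhtman–Shapiro–Vainshtein (log-canonical on every cluster).  Its initial cluster
consists, up to scalar multiples, of the `H`-eigenvector Poisson prime elements `y_k` of
the chain of Poisson subalgebras `K[x_1] ⊂ K[x_1,x_2] ⊂ ⋯ ⊂ K[x_1, …, x_N]`; each
generator `x_k` is, up to rescaling, a cluster variable; and this cluster algebra
coincides with the corresponding upper cluster algebra. -/
theorem symmetric_Poisson_nilpotent_cluster_structure
    {K : Type u} [Field K] [CharZero K] {N r : ℕ}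
    (P : SymPoissonNilpotent K N r)
    (η : Fin N → ℤ) (y : Fin N → MvPolynomial (Fin N) K)
    (hseq : IsPoissonPrimeSeq K P η y)
    (hB : PoissonCondB K P η) :
    ∃ (F : Type u) (_ : Field F) (_ : Algebra K F)
      (ι : MvPolynomial (Fin N) K →ₐ[K] F),
      (Function.Injective ι ∧ ∀ d : F, ∃ a b : MvPolynomial (Fin N) K,
        b ≠ 0 ∧ d * ι b = ι a) ∧
      ∃ brF : F →ₗ[K] F →ₗ[K] F,
        (∀ a b : F, brF a b = - brF b a) ∧
        (∀ a b c : F, brF a (b * c) = brF a b * c + b * brF a c) ∧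
        (∀ a b : MvPolynomial (Fin N) K, brF (ι a) (ι b) = ι (P.br a b)) ∧
        ∃ (t : Fin N → Kˣ) (S0 : CSeed F N),
          CSeedIsValid K F (exSet η) S0 ∧
          (∀ k : Fin N, S0.z k = ι ((t k : K) • y k)) ∧
          cClusterAlg K F (exSet η) S0 = ι.range ∧
          cUpper K F (exSet η) S0 = ι.range ∧
          (∀ k : Fin N, ∃ s : Kˣ,
            ι ((s : K) • MvPolynomial.X k) ∈ cClusterVars K F (exSet η) S0) ∧
          (∀ S' : CSeed F N, CMutEquiv K F (exSet η) S0 S' →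
            ∀ k l : Fin N, ∃ ω : K, brF (S'.z k) (S'.z l) = ω • (S'.z k * S'.z l)) := by
  exact PN.main_thm P η y hseq hB
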